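/- Let p be a prime and q = p^a a prime power with q ≥ 4. Then for every positive integer n, the bilinear complexity of multiplication in F_{q^n} over F_q satisfies μ_q(n) ≤ 3(1 + p/(q − 3)) · n; that is, there exist an integer r with r ≤ 3(1 + p/(q−3))n, F_q-linear forms a₁, …, a_r, b₁, …, b_r on F_{q^n}, and elements c₁, …, c_r ∈ F_{q^n} such that x·y = ∑_{l=1}^{r} a_l(x) b_l(y) c_l for all x, y ∈ F_{q^n}. -/

import Mathlib

set_option linter.unusedSectionVars false

open scoped WithZero
open IsDedekindDomain

/-- The multiplication of the commutative `K`-algebra `L` has bilinear rank at most `r`. -/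
def HasRank (K L : Type*) [Field K] [CommRing L] [Algebra K L] (r : ℕ) : Prop :=
  ∃ (A B : Fin r → (L →ₗ[K] K)) (c : Fin r → L), ∀ x y : L, x * y = ∑ l, (A l x * B l y) • c l

section HasRank

variable {K L : Type*} [Field K] [CommRing L] [Algebra K L]

theorem HasRank.of_fintype {ι : Type*} [Fintype ι] (A B : ι → (L →ₗ[K] K)) (c : ι → L)
    (h : ∀ x y : L, x * y = ∑ l, (A l x * B l y) • c l) : HasRank K L (Fintype.card ι) := by
  let e := Fintype.equivFin ι
  refine ⟨fun l => A (e.symm l), fun l => B (e.symm l), fun l => c (e.symm l), fun x y => ?_⟩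
  rw [h, ← e.symm.sum_comp]

theorem HasRank.karatsuba [Module.Finite K L] :
    HasRank K L (Module.finrank K L * (Module.finrank K L + 1) / 2) := by
  classical
  set n := Module.finrank K L
  let b := Module.finBasis K L
  let S := {x : Fin n × Fin n // x.1 < x.2}
  have hS : Fintype.card S + n + Fintype.card S = n * n := by
    have h1 : Fintype.card {x : Fin n × Fin n // x.2 < x.1} = Fintype.card S :=
      Fintype.card_congr ((Equiv.prodComm _ _).subtypeEquiv (by simp))
    have h2 : Fintype.card {x : Fin n × Fin n // x.1 = x.2} = n := by
      rw [Fintype.card_congr (β := Fin n) ⟨fun x => x.1.1, fun i => ⟨(i, i), rfl⟩, ?_, ?_⟩]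
      · simp
      · rintro ⟨⟨i, j⟩, h⟩; simpa using h
      · intro i; rfl
    have h3 : Fintype.card (Fin n × Fin n) = n * n := by simp
    rw [← h3]
    suffices H : Fintype.card S + Fintype.card {x : Fin n × Fin n // x.1 = x.2} +
        Fintype.card {x : Fin n × Fin n // x.2 < x.1} = Fintype.card (Fin n × Fin n) by
      rw [h1, h2] at H
      exact H
    simp only [Fintype.card_subtype, S]
    rw [← Finset.card_union_of_disjoint, ← Finset.card_union_of_disjoint, ← Finset.card_univ]
    · congr 1; ext ⟨i, j⟩
      simp only [Finset.mem_union, Finset.mem_filter, Finset.mem_univ, true_and, iff_true]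
      rcases lt_trichotomy i j with h | h | h <;> simp [h]
    · rw [Finset.disjoint_left]; rintro ⟨i, j⟩; simp; grind
    · rw [Finset.disjoint_left]; rintro ⟨i, j⟩; simp; grind
  have hcard : Fintype.card (Fin n ⊕ S) = n * (n + 1) / 2 := by
    rw [Fintype.card_sum, Fintype.card_fin]
    have : n * (n + 1) = n * n + n := by ring
    omega
  rw [← hcard]
  let A : Fin n ⊕ S → (L →ₗ[K] K) :=
    Sum.elim (fun i => b.coord i) (fun s => b.coord s.1.1 + b.coord s.1.2)
  let c : Fin n ⊕ S → L := Sum.elim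
    (fun i => b i * b i - ∑ s : S, if s.1.1 = i ∨ s.1.2 = i then b s.1.1 * b s.1.2 else 0)
    (fun s => b s.1.1 * b s.1.2)
  refine HasRank.of_fintype A A c fun x y => ?_
  have hx : x = ∑ i, b.repr x i • b i := (b.sum_repr x).symm
  have hy : y = ∑ i, b.repr y i • b i := (b.sum_repr y).symm
  set X := b.repr x
  set Y := b.repr y
  have hA : ∀ i, A (Sum.inl i) x = X i ∧ A (Sum.inl i) y = Y i := fun i => ⟨rfl, rfl⟩
  rw [Fintype.sum_sum_type]
  have e1 : ∑ s : S, (A (Sum.inr s) x * A (Sum.inr s) y) • c (Sum.inr s) =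
      ∑ s : S, (X s.1.1 * Y s.1.2 + X s.1.2 * Y s.1.1) • (b s.1.1 * b s.1.2) +
      ∑ s : S, (X s.1.1 * Y s.1.1 + X s.1.2 * Y s.1.2) • (b s.1.1 * b s.1.2) := by
    rw [← Finset.sum_add_distrib]
    refine Finset.sum_congr rfl fun s _ => ?_
    rw [← add_smul]; congr 1
    change (X s.1.1 + X s.1.2) * (Y s.1.1 + Y s.1.2) = _
    ring
  have e2 : ∑ i, (A (Sum.inl i) x * A (Sum.inl i) y) • c (Sum.inl i) =
      ∑ i, (X i * Y i) • (b i * b i) -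
      ∑ s : S, (X s.1.1 * Y s.1.1 + X s.1.2 * Y s.1.2) • (b s.1.1 * b s.1.2) := by
    have : ∀ i, (A (Sum.inl i) x * A (Sum.inl i) y) • c (Sum.inl i) = (X i * Y i) • (b i * b i) -
        ∑ s : S, if s.1.1 = i ∨ s.1.2 = i then (X i * Y i) • (b s.1.1 * b s.1.2) else 0 := by
      intro i
      change (X i * Y i) • (_ - _) = _
      rw [smul_sub, Finset.smul_sum]
      congr 1
      refine Finset.sum_congr rfl fun s _ => ?_
      split_ifs <;> simp
    simp_rw [this]
    rw [Finset.sum_sub_distrib, Finset.sum_comm]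
    congr 1
    refine Finset.sum_congr rfl fun s _ => ?_
    have hne : s.1.1 ≠ s.1.2 := s.2.ne
    rw [← Finset.sum_filter]
    have : Finset.univ.filter (fun i => s.1.1 = i ∨ s.1.2 = i) = {s.1.1, s.1.2} := by
      ext i; simp [eq_comm]
    rw [this, Finset.sum_pair hne, ← add_smul]
  rw [e1, e2]
  have e3 : x * y = ∑ i, (X i * Y i) • (b i * b i) +
      ∑ s : S, (X s.1.1 * Y s.1.2 + X s.1.2 * Y s.1.1) • (b s.1.1 * b s.1.2) := by
    have key : x * y = ∑ z : Fin n × Fin n, (X z.1 * Y z.2) • (b z.1 * b z.2) := by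
      rw [Fintype.sum_prod_type, hx, hy, Finset.sum_mul_sum]
      simp only [smul_mul_smul_comm]
      rfl
    rw [key]
    have g1 : ∑ s : S, (X s.1.1 * Y s.1.2 + X s.1.2 * Y s.1.1) • (b s.1.1 * b s.1.2) =
      ∑ z : Fin n × Fin n with z.1 < z.2, (X z.1 * Y z.2) • (b z.1 * b z.2) +
      ∑ z : Fin n × Fin n with z.2 < z.1, (X z.1 * Y z.2) • (b z.1 * b z.2) := by
      have : ∑ z : Fin n × Fin n with z.2 < z.1, (X z.1 * Y z.2) • (b z.1 * b z.2) =
        ∑ z : Fin n × Fin n with z.1 < z.2, (X z.2 * Y z.1) • (b z.1 * b z.2) := by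
        refine Finset.sum_bij (fun z _ => (z.2, z.1)) ?_ ?_ ?_ ?_
        · simp
        · rintro ⟨a, b⟩ _ ⟨c, d⟩ _ h; simp at h; simp [h]
        · rintro ⟨a, b⟩ h; exact ⟨(b, a), by simpa using h, rfl⟩
        · intro z _; simp [mul_comm]
      rw [this, ← Finset.sum_add_distrib]
      simp_rw [← add_smul]
      rw [Finset.sum_subtype (p := fun z : Fin n × Fin n => z.1 < z.2)]
      simp
    have g2 : ∑ i, (X i * Y i) • (b i * b i) =
        ∑ z : Fin n × Fin n with z.1 = z.2, (X z.1 * Y z.2) • (b z.1 * b z.2) := by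
      refine Finset.sum_bij (fun i _ => (i, i)) ?_ ?_ ?_ ?_
      · simp
      · intro a _ b _ h; simpa using h
      · rintro ⟨a, b⟩ h; exact ⟨a, by simp, by simpa using h⟩
      · intro _ _; rfl
    rw [g1, g2, ← Finset.sum_filter_add_sum_filter_not Finset.univ
      (fun z : Fin n × Fin n => z.1 = z.2)]
    congr 1
    rw [← Finset.sum_filter_add_sum_filter_not (Finset.univ.filter _)
      (fun z : Fin n × Fin n => z.1 < z.2), Finset.filter_filter, Finset.filter_filter]
    congr 2
    · ext z; simp; intro h; exact h.ne
    · ext z; simp; omega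
  rw [e3]; abel

theorem HasRank.of_evaluation {R : Type*} [CommRing R] [Algebra K R] {E : Type*} [CommRing E]
    [Algebra K E] {r s : ℕ} (hE : HasRank K E r) (φ : Fin s → (R →ₐ[K] E))
    (f h : L →ₗ[K] R) (Θ : (Fin s → E) →ₗ[K] L)
    (H : ∀ x y, x * y = Θ fun i => φ i (f x * h y)) : HasRank K L (r * s) := by
  obtain ⟨A, B, c, hc⟩ := hE
  have := HasRank.of_fintype (K := K) (L := L) (ι := Fin r × Fin s)
    (fun l => A l.1 ∘ₗ (φ l.2).toLinearMap ∘ₗ f) (fun l => B l.1 ∘ₗ (φ l.2).toLinearMap ∘ₗ h)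
    (fun l => Θ (Pi.single l.2 (c l.1))) (fun x y => by
      rw [H, Fintype.sum_prod_type, Finset.sum_comm]
      have : (fun i => φ i (f x * h y)) = ∑ i, ∑ l,
          (A l (φ i (f x)) * B l (φ i (h y))) • (Pi.single i (c l) : Fin s → E) := by
        funext j
        simp only [Finset.sum_apply, Pi.smul_apply, map_mul, hc]
        rw [Finset.sum_eq_single j]
        · simp
        · intro i _ hij
          simp [hij.symm]
        · simp
      rw [this]
      simp [map_sum])
  simpa using this

end HasRank

section RelIndex

theorem AddSubgroup.relIndex_eq_inf_mul_sup {G : Type*} [AddCommGroup G] {A A' : AddSubgroup G}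
    (h : A ≤ A') (B : AddSubgroup G) :
    A.relIndex A' = (A ⊓ B).relIndex (A' ⊓ B) * (A ⊔ B).relIndex (A' ⊔ B) := by
  have h1 : A ≤ A' ⊓ (A ⊔ B) := le_inf h le_sup_left
  rw [← AddSubgroup.relIndex_mul_relIndex A _ A' h1 inf_le_left]
  congr 1
  · have : A' ⊓ (A ⊔ B) = (A' ⊓ B) ⊔ A := by
      rw [inf_comm, sup_comm (A' ⊓ B), inf_comm A' B, sup_inf_assoc_of_le B h]
    rw [this, AddSubgroup.relIndex_sup_right, ← AddSubgroup.inf_relIndex_right, ← inf_assoc,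
      inf_eq_left.2 h]
  · rw [AddSubgroup.inf_relIndex_left]
    have : A' ⊔ B = A' ⊔ (A ⊔ B) := by rw [← sup_assoc, sup_eq_left.2 h]
    rw [this, AddSubgroup.relIndex_sup_right]

/-- `A ⊓ B` is finite and `A ⊔ B` has finite index. -/
def AddSubgroup.Fredholm {G : Type*} [AddCommGroup G] (A B : AddSubgroup G) : Prop :=
  Nat.card ↥(A ⊓ B) ≠ 0 ∧ (A ⊔ B).index ≠ 0

/-- The multiplicative Euler characteristic of the pair `A, B`. -/
noncomputable def AddSubgroup.eulerChar {G : Type*} [AddCommGroup G] (A B : AddSubgroup G) : ℚ :=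
  Nat.card ↥(A ⊓ B) / (A ⊔ B).index

namespace AddSubgroup

variable {G : Type*} [AddCommGroup G] {A A' B : AddSubgroup G}

theorem Fredholm.symm (h : Fredholm A B) : Fredholm B A := by
  rwa [Fredholm, inf_comm, sup_comm]

theorem eulerChar_comm : eulerChar A B = eulerChar B A := by
  rw [eulerChar, eulerChar, inf_comm, sup_comm]

theorem card_inf_eq (h : A ≤ A') :
    Nat.card ↥(A' ⊓ B) = Nat.card ↥(A ⊓ B) * (A ⊓ B).relIndex (A' ⊓ B) := by
  rw [← relIndex_bot_left, ← relIndex_bot_left,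
    relIndex_mul_relIndex _ _ _ bot_le (inf_le_inf_right B h)]

theorem index_sup_eq (h : A ≤ A') :
    (A ⊔ B).index = (A ⊔ B).relIndex (A' ⊔ B) * (A' ⊔ B).index :=
  (relIndex_mul_index (sup_le_sup_right h B)).symm

theorem Fredholm.mono (h : Fredholm A B) (hA : A ≤ A') (hi : A.relIndex A' ≠ 0) :
    Fredholm A' B := by
  rw [relIndex_eq_inf_mul_sup hA B] at hi
  rw [Fredholm, card_inf_eq hA]
  have := h.2
  rw [index_sup_eq hA] at this
  exact ⟨mul_ne_zero h.1 (left_ne_zero_of_mul hi), right_ne_zero_of_mul this⟩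

theorem Fredholm.anti (h : Fredholm A' B) (hA : A ≤ A') (hi : A.relIndex A' ≠ 0) :
    Fredholm A B := by
  rw [relIndex_eq_inf_mul_sup hA B] at hi
  rw [Fredholm, index_sup_eq hA]
  have := h.1
  rw [card_inf_eq hA] at this
  exact ⟨left_ne_zero_of_mul this, mul_ne_zero (right_ne_zero_of_mul hi) h.2⟩

theorem Fredholm.relIndex_ne_zero (h : Fredholm A B) (h' : Fredholm A' B) (hA : A ≤ A') :
    A.relIndex A' ≠ 0 := by
  rw [relIndex_eq_inf_mul_sup hA B]
  have h1 := h'.1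
  rw [card_inf_eq hA] at h1
  have h2 := h.2
  rw [index_sup_eq hA] at h2
  exact mul_ne_zero (right_ne_zero_of_mul h1) (left_ne_zero_of_mul h2)

theorem Fredholm.eulerChar_eq (h : Fredholm A B) (h' : Fredholm A' B) (hA : A ≤ A') :
    eulerChar A' B = A.relIndex A' * eulerChar A B := by
  rw [relIndex_eq_inf_mul_sup hA B, eulerChar, eulerChar, card_inf_eq hA, index_sup_eq hA]
  have h1 := h'.2
  have h2 := h.2
  rw [index_sup_eq hA] at h2
  have h3 := left_ne_zero_of_mul h2
  push_cast
  field_simp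

end AddSubgroup

end RelIndex

/-- An affine curve with a single place at infinity, rational over the constant field `K`. The
ring `O` is the coordinate ring, `F` the function field, and `v` measures the pole order at
infinity. -/
structure Crv (K O F : Type) [Field K] [CommRing O] [Field F] [Algebra K O] [Algebra O F]
    [Algebra K F] where
  v : Valuation F ℤᵐ⁰
  v_const : ∀ c : K, c ≠ 0 → v (algebraMap K F c) = 1
  residue : ∀ f, v f ≤ 1 → ∃ c : K, v (f - algebraMap K F c) < 1
  exists_exp_one : ∃ f, v f = WithZero.exp (1 : ℤ)
  one_le : ∀ b : O, b ≠ 0 → 1 ≤ v (algebraMap O F b)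
  exists_add : ∃ k : ℤ, ∀ f, ∃ b : O, v (f - algebraMap O F b) ≤ WithZero.exp k

namespace Crv

variable {K O F : Type} [Field K] [CommRing O] [Field F] [Algebra K O] [Algebra O F]
    [Algebra K F]

theorem v_algebraMap_le (C : Crv K O F) (c : K) : C.v (algebraMap K F c) ≤ 1 := by
  by_cases h : c = 0
  · simp [h]
  · exact (C.v_const c h).le

/-- Functions with pole of order at most `k` at infinity. -/
def L (C : Crv K O F) (k : ℤ) : Submodule K F where
  carrier := {f | C.v f ≤ WithZero.exp k}
  add_mem' ha hb := (C.v.map_add _ _).trans (max_le ha hb)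
  zero_mem' := by simp
  smul_mem' c f hf := by
    rw [Set.mem_ofPred_eq, Algebra.smul_def, map_mul]
    exact (mul_le_of_le_one_left' (C.v_algebraMap_le c)).trans hf

theorem mem_L {C : Crv K O F} {k : ℤ} {f : F} : f ∈ C.L k ↔ C.v f ≤ WithZero.exp k := Iff.rfl

/-- The degree at infinity. -/
noncomputable def deg (C : Crv K O F) (f : F) : ℤ := WithZero.log (C.v f)

theorem v_eq (C : Crv K O F) {f : F} (hf : f ≠ 0) : C.v f = WithZero.exp (C.deg f) :=
  (WithZero.exp_log ((C.v.ne_zero_iff).2 hf)).symm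

theorem mem_L_iff {C : Crv K O F} {k : ℤ} {f : F} (hf : f ≠ 0) : f ∈ C.L k ↔ C.deg f ≤ k := by
  rw [mem_L, C.v_eq hf, WithZero.exp_le_exp]

theorem mem_L_deg (C : Crv K O F) (f : F) : f ∈ C.L (C.deg f) := by
  by_cases hf : f = 0
  · simp [hf]
  · rw [mem_L_iff hf]

theorem deg_inv (C : Crv K O F) {f : F} : C.deg f⁻¹ = - C.deg f := by
  rw [deg, map_inv₀, WithZero.log_inv]; rfl

theorem L_mono (C : Crv K O F) {k m : ℤ} (h : k ≤ m) : C.L k ≤ C.L m := fun _ hf =>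
  le_trans (mem_L.1 hf) (WithZero.exp_le_exp.2 h)

theorem mul_mem_L {C : Crv K O F} {k m : ℤ} {f g : F} (hf : f ∈ C.L k) (hg : g ∈ C.L m) :
    f * g ∈ C.L (k + m) := by
  rw [mem_L, map_mul, WithZero.exp_add]
  exact mul_le_mul' hf hg

theorem exists_deg (C : Crv K O F) (k : ℤ) : ∃ f, f ≠ 0 ∧ C.deg f = k := by
  obtain ⟨t, ht⟩ := C.exists_exp_one
  have : C.v (t ^ k) = WithZero.exp k := by
    rw [map_zpow₀, ht, ← WithZero.exp_zsmul]; simp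
  have h0 : t ^ k ≠ 0 := fun h => by rw [h, map_zero] at this; exact WithZero.exp_ne_zero this.symm
  exact ⟨t ^ k, h0, by rw [deg, this, WithZero.log_exp]⟩

theorem exists_smul_sub_mem (C : Crv K O F) {k : ℤ} {t f : F} (ht0 : t ≠ 0) (ht : C.deg t = k)
    (hf : f ∈ C.L k) : ∃ c : K, f - c • t ∈ C.L (k - 1) := by
  have h1 : C.v (f / t) ≤ 1 := by
    rw [map_div₀, C.v_eq ht0, ht]
    exact div_le_one_of_le₀ hf zero_le
  obtain ⟨c, hc⟩ := C.residue _ h1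
  refine ⟨c, ?_⟩
  have h2 : f - c • t = (f / t - algebraMap K F c) * t := by
    rw [sub_mul, div_mul_cancel₀ _ ht0, Algebra.smul_def]
  have h3 : f / t - algebraMap K F c ∈ C.L (-1) := by
    by_cases h0 : f / t - algebraMap K F c = 0
    · simp [h0]
    · rw [mem_L_iff h0]
      rw [C.v_eq h0, ← WithZero.exp_zero, WithZero.exp_lt_exp] at hc
      omega
  rw [h2, show k - 1 = -1 + k by ring]
  exact mul_mem_L h3 (ht ▸ C.mem_L_deg t)

theorem relIndex_L_succ [Finite K] (C : Crv K O F) (k : ℤ) :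
    (C.L (k - 1)).toAddSubgroup.relIndex (C.L k).toAddSubgroup = Nat.card K := by
  obtain ⟨t, ht0, ht⟩ := C.exists_deg k
  have htL : t ∈ C.L k := ht ▸ C.mem_L_deg t
  let e : K →+ (C.L k).toAddSubgroup ⧸
      ((C.L (k - 1)).toAddSubgroup.addSubgroupOf (C.L k).toAddSubgroup) :=
    (QuotientAddGroup.mk' _).comp
      { toFun := fun c => ⟨c • t, (C.L k).smul_mem c htL⟩
        map_zero' := by simp
        map_add' := fun a b => by ext; simp [add_smul] }
  refine (Nat.card_congr (Equiv.ofBijective e ⟨?_, ?_⟩)).symm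
  · rw [injective_iff_map_eq_zero]
    intro c hc
    by_contra h0
    have : c • t ∈ C.L (k - 1) := by
      have := (QuotientAddGroup.eq_zero_iff _).1 hc
      exact this
    rw [mem_L, Algebra.smul_def, map_mul, C.v_const c h0, one_mul, C.v_eq ht0, ht,
      WithZero.exp_le_exp] at this
    omega
  · rintro ⟨f⟩
    obtain ⟨c, hc⟩ := C.exists_smul_sub_mem ht0 ht f.2
    refine ⟨c, QuotientAddGroup.eq.2 ?_⟩
    change -(c • t) + (f : F) ∈ C.L (k - 1)
    rwa [neg_add_eq_sub]

theorem relIndex_L [Finite K] (C : Crv K O F) (k : ℤ) (m : ℕ) :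
    (C.L k).toAddSubgroup.relIndex (C.L (k + m)).toAddSubgroup = Nat.card K ^ m := by
  induction m with
  | zero => simp
  | succ m ih =>
    rw [← AddSubgroup.relIndex_mul_relIndex _ (C.L (k + m)).toAddSubgroup _, ih, pow_succ]
    · congr 1
      have := C.relIndex_L_succ (k + (m + 1 : ℕ))
      rwa [show k + ((m + 1 : ℕ) : ℤ) - 1 = k + m by push_cast; ring] at this
    · exact C.L_mono (by omega)
    · exact C.L_mono (by push_cast; omega)

variable [IsScalarTower K O F]

variable (K F) in
/-- An ideal of `O` seen inside `F`. -/
def emb (I : Ideal O) : Submodule K F :=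
  (I.restrictScalars K).map (IsScalarTower.toAlgHom K O F).toLinearMap

theorem algebraMap_mem_emb [IsDomain O] [IsFractionRing O F] {I : Ideal O} {b : O} :
    algebraMap O F b ∈ emb K F I ↔ b ∈ I :=
  ⟨fun ⟨_, hc, h⟩ => IsFractionRing.injective O F h ▸ hc, fun h => ⟨b, h, rfl⟩⟩

theorem emb_mono {I J : Ideal O} (h : I ≤ J) : emb K F I ≤ emb K F J :=
  Submodule.map_mono h

variable [IsDomain O] [IsFractionRing O F]

theorem emb_top_inf_L_neg (C : Crv K O F) {k : ℤ} (hk : k < 0) (I : Ideal O) :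
    emb K F I ⊓ C.L k = ⊥ := by
  rw [eq_bot_iff]
  rintro f ⟨⟨b, -, rfl⟩, hb⟩
  by_contra h
  have hb0 : b ≠ 0 := fun h0 => h (by simp [h0])
  have h1 := C.one_le b hb0
  have h2 : C.v (algebraMap O F b) ≤ WithZero.exp k := hb
  rw [← WithZero.exp_zero] at h1
  have := WithZero.exp_le_exp.1 (h1.trans h2)
  omega

theorem emb_inf_L_zero (C : Crv K O F) {b : O} (hb : C.v (algebraMap O F b) ≤ 1) :
    ∃ c : K, algebraMap K O c = b := by
  obtain ⟨c, hc⟩ := C.residue _ hb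
  refine ⟨c, ?_⟩
  by_contra h
  have := C.one_le (b - algebraMap K O c) (sub_ne_zero.2 (Ne.symm h))
  rw [map_sub, ← IsScalarTower.algebraMap_apply K O F] at this
  exact absurd hc this.not_gt

variable [Finite K]

theorem fredholm_top (C : Crv K O F) (k : ℤ) :
    AddSubgroup.Fredholm (emb K F (⊤ : Ideal O)).toAddSubgroup (C.L k).toAddSubgroup := by
  have hq : Nat.card K ≠ 0 := Nat.card_pos.ne'
  obtain ⟨k0, h0⟩ := C.exists_add
  have key : ∀ k m : ℤ, k ≤ m → (C.L k).toAddSubgroup.relIndex (C.L m).toAddSubgroup ≠ 0 := by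
    intro k m h
    obtain ⟨d, rfl⟩ := Int.le.dest h
    rw [C.relIndex_L]
    exact pow_ne_zero _ hq
  set A := (emb K F (⊤ : Ideal O)).toAddSubgroup
  have h1 : A ⊔ (C.L k0).toAddSubgroup = ⊤ := by
    rw [eq_top_iff]
    intro f _
    obtain ⟨b, hb⟩ := h0 f
    rw [← add_sub_cancel (algebraMap O F b) f]
    exact AddSubgroup.add_mem_sup ⟨b, trivial, rfl⟩ hb
  have h2 : ∀ k < 0, A ⊓ (C.L k).toAddSubgroup = ⊥ := by
    intro k hk
    exact congrArg Submodule.toAddSubgroup (C.emb_top_inf_L_neg hk (⊤ : Ideal O))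
  have h3 : AddSubgroup.Fredholm A (C.L (min k0 (-1))).toAddSubgroup := by
    constructor
    · rw [h2 _ (by omega)]; simp
    · rw [sup_comm, AddSubgroup.index_sup_eq (A := (C.L (min k0 (-1))).toAddSubgroup) (B := A)
        (A' := (C.L k0).toAddSubgroup) (C.L_mono (by omega)), sup_comm _ A, sup_comm _ A, h1]
      have := key (min k0 (-1)) k0 (by omega)
      rw [AddSubgroup.relIndex_eq_inf_mul_sup (C.L_mono (by omega)) A, sup_comm _ A, sup_comm _ A,
        h1] at this
      simpa using right_ne_zero_of_mul this
  have h4 : AddSubgroup.Fredholm A (C.L (min (min k0 (-1)) k)).toAddSubgroup :=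
    (h3.symm.anti (C.L_mono (by omega)) (key _ _ (by omega))).symm
  exact (h4.symm.mono (C.L_mono (by omega)) (key _ _ (by omega))).symm

theorem L_map_mul (C : Crv K O F) {f : F} (hf : f ≠ 0) (k : ℤ) :
    (C.L k).toAddSubgroup.map (AddMonoidHom.mulLeft f) = (C.L (C.deg f + k)).toAddSubgroup := by
  ext g
  constructor
  · rintro ⟨h, hh, rfl⟩
    exact mul_mem_L (C.mem_L_deg f) hh
  · intro hg
    refine ⟨f⁻¹ * g, ?_, by simp [hf]⟩
    have := mul_mem_L (C.mem_L_deg f⁻¹) (show g ∈ C.L _ from hg)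
    rwa [deg_inv, neg_add_cancel_left] at this

theorem map_mul_emb (I : Ideal O) (b : O) :
    (emb K F I).toAddSubgroup.map (AddMonoidHom.mulLeft (algebraMap O F b)) =
      (emb K F (Ideal.span {b} * I)).toAddSubgroup := by
  ext g
  constructor
  · rintro ⟨h, ⟨c, hc, rfl⟩, rfl⟩
    exact ⟨b * c, Ideal.mul_mem_mul (Ideal.mem_span_singleton_self b) hc,
      map_mul (algebraMap O F) _ _⟩
  · rintro ⟨x, hx, rfl⟩
    obtain ⟨c, hc, rfl⟩ := Ideal.mem_span_singleton_mul.1 hx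
    exact ⟨_, ⟨c, hc, rfl⟩, (map_mul (algebraMap O F) _ _).symm⟩

end Crv

namespace AddSubgroup

variable {G : Type*} [AddCommGroup G]

theorem card_map_bijective {e : G →+ G} (he : Function.Bijective e) (A B : AddSubgroup G) :
    Nat.card ↥(A.map e ⊓ B.map e) = Nat.card ↥(A ⊓ B) ∧
      (A.map e ⊔ B.map e).index = (A ⊔ B).index := by
  rw [← map_inf _ _ _ he.1, ← map_sup]
  refine ⟨Nat.card_congr ((A ⊓ B).equivMapOfInjective e he.1).toEquiv.symm, ?_⟩
  rw [index_map_of_bijective he]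

end AddSubgroup

namespace Crv

variable {K O F : Type} [Field K] [CommRing O] [Field F] [Algebra K O] [Algebra O F]
    [Algebra K F] [IsScalarTower K O F] [IsDomain O] [IsFractionRing O F] [Finite K]

theorem fredholm (C : Crv K O F) {I : Ideal O} (hI : I ≠ ⊥) (k : ℤ) :
    AddSubgroup.Fredholm (emb K F I).toAddSubgroup (C.L k).toAddSubgroup := by
  obtain ⟨b, hb, hb0⟩ := Submodule.exists_mem_ne_zero_of_ne_bot hI
  have hf : algebraMap O F b ≠ 0 := by simpa using hb0
  have h1 : AddSubgroup.Fredholm (emb K F (Ideal.span {b})).toAddSubgroup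
      (C.L k).toAddSubgroup := by
    have := AddSubgroup.card_map_bijective (e := AddMonoidHom.mulLeft (algebraMap O F b))
      (mulLeft_bijective₀ _ hf) (emb K F (⊤ : Ideal O)).toAddSubgroup
      (C.L (k - C.deg (algebraMap O F b))).toAddSubgroup
    rw [C.L_map_mul hf, map_mul_emb, Ideal.mul_top, add_sub_cancel] at this
    rw [AddSubgroup.Fredholm, this.1, this.2]
    exact C.fredholm_top _
  have hle : Ideal.span {b} ≤ I := (Ideal.span_singleton_le_iff_mem _).2 hb
  have h2 := h1.relIndex_ne_zero (C.fredholm_top k) (emb_mono le_top)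
  rw [← AddSubgroup.relIndex_mul_relIndex _ (emb K F I).toAddSubgroup _ (emb_mono hle)
    (emb_mono le_top)] at h2
  exact h1.mono (emb_mono hle) (left_ne_zero_of_mul h2)

theorem relIndex_emb (I : Ideal O) :
    (emb K F I).toAddSubgroup.relIndex (emb K F (⊤ : Ideal O)).toAddSubgroup =
      Nat.card (O ⧸ I) := by
  have : ∀ J : Ideal O, (emb K F J).toAddSubgroup =
      J.toAddSubgroup.map (algebraMap O F).toAddMonoidHom := fun J => rfl
  rw [this, this, AddSubgroup.relIndex_map_map_of_injective _ _ (IsFractionRing.injective O F)]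
  exact AddSubgroup.relIndex_top_right _

theorem finite_quotient (C : Crv K O F) {I : Ideal O} (hI : I ≠ ⊥) : Finite (O ⧸ I) := by
  refine Nat.finite_of_card_ne_zero ?_
  rw [← relIndex_emb (K := K) (F := F)]
  exact (C.fredholm hI 0).relIndex_ne_zero (C.fredholm_top 0) (emb_mono le_top)

theorem finite_inf (C : Crv K O F) {I : Ideal O} (hI : I ≠ ⊥) (k : ℤ) :
    Finite ↥(emb K F I ⊓ C.L k) :=
  Nat.finite_of_card_ne_zero (C.fredholm hI k).1

theorem finite_sup (C : Crv K O F) {I : Ideal O} (hI : I ≠ ⊥) (k : ℤ) :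
    Finite (F ⧸ (emb K F I ⊔ C.L k)) := by
  have := (C.fredholm hI k).2
  rw [← Submodule.sup_toAddSubgroup] at this
  exact Nat.finite_of_card_ne_zero this

variable (K) in
/-- The codimension of an ideal. -/
noncomputable def codim (I : Ideal O) : ℕ := Module.finrank K (O ⧸ I)

noncomputable def l (C : Crv K O F) (I : Ideal O) (k : ℤ) : ℕ :=
  Module.finrank K ↥(emb K F I ⊓ C.L k)

noncomputable def i (C : Crv K O F) (I : Ideal O) (k : ℤ) : ℕ :=
  Module.finrank K (F ⧸ (emb K F I ⊔ C.L k))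

/-- The genus. -/
noncomputable def genus (C : Crv K O F) : ℕ := C.i ⊤ 0

theorem card_inf (C : Crv K O F) {I : Ideal O} (hI : I ≠ ⊥) (k : ℤ) :
    Nat.card ↥(emb K F I ⊓ C.L k) = Nat.card K ^ C.l I k := by
  have := C.finite_inf hI k
  exact Module.natCard_eq_pow_finrank

theorem index_sup (C : Crv K O F) {I : Ideal O} (hI : I ≠ ⊥) (k : ℤ) :
    (emb K F I ⊔ C.L k).toAddSubgroup.index = Nat.card K ^ C.i I k := by
  have := C.finite_sup hI k
  exact Module.natCard_eq_pow_finrank (K := K) (V := F ⧸ (emb K F I ⊔ C.L k))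

theorem card_quotient (C : Crv K O F) {I : Ideal O} (hI : I ≠ ⊥) :
    Nat.card (O ⧸ I) = Nat.card K ^ codim K I := by
  have := C.finite_quotient hI
  exact Module.natCard_eq_pow_finrank

theorem eulerChar_eq_zpow (C : Crv K O F) {I : Ideal O} (hI : I ≠ ⊥) (k : ℤ) :
    AddSubgroup.eulerChar (emb K F I).toAddSubgroup (C.L k).toAddSubgroup =
      (Nat.card K : ℚ) ^ ((C.l I k : ℤ) - C.i I k) := by
  have hq : (Nat.card K : ℚ) ≠ 0 := Nat.cast_ne_zero.2 Nat.card_pos.ne'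
  rw [AddSubgroup.eulerChar, ← Submodule.sup_toAddSubgroup, C.index_sup hI, zpow_sub₀ hq]
  have : Nat.card ↥((emb K F I).toAddSubgroup ⊓ (C.L k).toAddSubgroup) = _ := C.card_inf hI k
  rw [this]
  simp

theorem eulerChar_mul_of_le (C : Crv K O F) {I J : Ideal O} (hI : I ≠ ⊥) (hJ : J ≠ ⊥) {k m : ℤ} {e : ℕ}
    (h : AddSubgroup.eulerChar (emb K F J).toAddSubgroup (C.L m).toAddSubgroup =
      (Nat.card K ^ e : ℕ) * AddSubgroup.eulerChar (emb K F I).toAddSubgroup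
        (C.L k).toAddSubgroup) :
    (C.l J m : ℤ) - C.i J m = C.l I k - C.i I k + e := by
  have hq : (1 : ℚ) < Nat.card K := Nat.one_lt_cast.2 Finite.one_lt_card
  rw [C.eulerChar_eq_zpow hI, C.eulerChar_eq_zpow hJ, Nat.cast_pow, ← zpow_natCast,
    ← zpow_add₀ (by positivity)] at h
  have := zpow_right_injective₀ (by positivity) hq.ne' h
  omega

theorem rr_top (C : Crv K O F) (k : ℤ) :
    (C.l ⊤ k : ℤ) - C.i ⊤ k = k + 1 - C.genus := by
  have key : ∀ (k : ℤ) (m : ℕ), (C.l ⊤ (k + m) : ℤ) - C.i ⊤ (k + m) = C.l ⊤ k - C.i ⊤ k + m := by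
    intro k m
    apply C.eulerChar_mul_of_le top_ne_bot top_ne_bot
    rw [AddSubgroup.eulerChar_comm, AddSubgroup.eulerChar_comm (B := (C.L k).toAddSubgroup),
      (C.fredholm_top k).symm.eulerChar_eq (C.fredholm_top (k + m)).symm (C.L_mono (by omega)),
      C.relIndex_L]
  have h1 : C.l ⊤ (-1) = 0 := by
    rw [l, C.emb_top_inf_L_neg (by norm_num)]; simp
  have h0 : C.l ⊤ 0 = 1 := by
    have : emb K F (⊤ : Ideal O) ⊓ C.L 0 = Submodule.span K {1} := by
      ext f
      rw [Submodule.mem_span_singleton]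
      constructor
      · rintro ⟨⟨b, -, rfl⟩, hb⟩
        obtain ⟨c, rfl⟩ := C.emb_inf_L_zero hb
        exact ⟨c, by
          rw [Algebra.smul_def, mul_one]
          exact IsScalarTower.algebraMap_apply K O F c⟩
      · rintro ⟨c, rfl⟩
        rw [Algebra.smul_def, mul_one]
        refine ⟨⟨algebraMap K O c, trivial, (IsScalarTower.algebraMap_apply K O F c).symm⟩, ?_⟩
        simp [mem_L, C.v_algebraMap_le c]
    rw [l, this, finrank_span_singleton one_ne_zero]
  have e0 : (C.l ⊤ 0 : ℤ) - C.i ⊤ 0 = 1 - C.genus := by rw [h0, genus]; norm_num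
  rcases le_total 0 k with h | h
  · obtain ⟨m, rfl⟩ := Int.le.dest h
    have := key 0 m
    omega
  · obtain ⟨m, hm⟩ := Int.le.dest h
    have := key k m
    rw [hm] at this
    omega

/-- The weak form of the Riemann-Roch theorem. -/
theorem rr (C : Crv K O F) {I : Ideal O} (hI : I ≠ ⊥) (k : ℤ) :
    (C.l I k : ℤ) - C.i I k = k + 1 - C.genus - codim K I := by
  have := C.eulerChar_mul_of_le (k := k) (m := k) (e := codim K I) hI (top_ne_bot (α := Ideal O)) (by
    rw [(C.fredholm hI k).eulerChar_eq (C.fredholm_top k) (emb_mono le_top), relIndex_emb,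
      C.card_quotient hI])
  have := C.rr_top k
  omega

theorem codim_span (C : Crv K O F) {b : O} (hb : b ≠ 0) :
    (codim K (Ideal.span {b}) : ℤ) = C.deg (algebraMap O F b) := by
  have hf : algebraMap O F b ≠ 0 := by simpa using hb
  have hI : Ideal.span {b} ≠ ⊥ := by simpa using hb
  have h := AddSubgroup.card_map_bijective (e := AddMonoidHom.mulLeft (algebraMap O F b))
      (mulLeft_bijective₀ _ hf) (emb K F (⊤ : Ideal O)).toAddSubgroup (C.L 0).toAddSubgroup
  rw [C.L_map_mul hf, map_mul_emb, Ideal.mul_top, add_zero] at h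
  have := C.eulerChar_mul_of_le (e := 0) (k := C.deg (algebraMap O F b)) (m := 0) hI
    (top_ne_bot (α := Ideal O)) (by
    rw [AddSubgroup.eulerChar, AddSubgroup.eulerChar, h.1, h.2]; simp)
  have h1 := C.rr hI (C.deg (algebraMap O F b))
  have h2 := C.rr_top 0
  omega

theorem l_eq_zero (C : Crv K O F) {I : Ideal O} (hI : I ≠ ⊥) {k : ℤ} (hk : C.l I k = 0) {b : O}
    (hb : b ∈ I) (hb' : algebraMap O F b ∈ C.L k) : b = 0 := by
  have := C.finite_inf hI k
  rw [l, Submodule.finrank_eq_zero] at hk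
  have h : algebraMap O F b ∈ emb K F I ⊓ C.L k := ⟨⟨b, hb, rfl⟩, hb'⟩
  rw [hk, Submodule.mem_bot] at h
  simpa using h

theorem exists_mem_of_l_ne_zero (C : Crv K O F) {I : Ideal O} {k : ℤ} (hk : C.l I k ≠ 0) :
    ∃ b ∈ I, b ≠ 0 ∧ algebraMap O F b ∈ C.L k := by
  by_contra! h
  apply hk
  have : emb K F I ⊓ C.L k = ⊥ := by
    rw [eq_bot_iff]
    rintro f ⟨⟨b, hb, rfl⟩, hb'⟩
    by_contra h0
    exact h b hb (fun h1 => h0 (by simp [h1])) hb'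
  rw [l, this]; simp

theorem sup_eq_top_of_i_eq_zero (C : Crv K O F) {I : Ideal O} (hI : I ≠ ⊥) {k : ℤ}
    (hk : C.i I k = 0) : emb K F I ⊔ C.L k = ⊤ := by
  have := C.finite_sup hI k
  rw [i, Module.finrank_zero_iff] at hk
  exact Submodule.Quotient.subsingleton_iff.1 hk

theorem codim_le (C : Crv K O F) {I J : Ideal O} (hI : I ≠ ⊥) (h : I ≤ J) :
    codim K J ≤ codim K I := by
  have := C.finite_quotient hI
  exact LinearMap.finrank_le_finrank_of_surjective (f := (Ideal.Quotient.factorₐ K h).toLinearMap)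
    (Ideal.Quotient.factor_surjective h)

theorem eq_of_codim_le (C : Crv K O F) {I J : Ideal O} (hI : I ≠ ⊥) (h : I ≤ J)
    (hc : codim K I ≤ codim K J) : I = J := by
  have := C.finite_quotient hI
  refine le_antisymm h fun x hx => ?_
  have hs : Function.Surjective (Ideal.Quotient.factorₐ K h).toLinearMap :=
    Ideal.Quotient.factor_surjective h
  have hJ : J ≠ ⊥ := fun h0 => hI (le_bot_iff.1 (h0 ▸ h))
  have := C.finite_quotient hJ
  have := LinearMap.injective_iff_surjective_of_finrank_eq_finrank
    (le_antisymm hc (C.codim_le hI h)) |>.2 hs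
  have h0 : (Ideal.Quotient.factorₐ K h).toLinearMap (Ideal.Quotient.mk I x) = 0 :=
    Ideal.Quotient.eq_zero_iff_mem.2 hx
  exact Ideal.Quotient.eq_zero_iff_mem.1 ((map_eq_zero_iff _ this).1 h0)

end Crv

theorem Ideal.exists_mul_sup_span_eq {O : Type*} [CommRing O] [IsDedekindDomain O]
    (I J : Ideal O) (hI : I ≠ ⊥) (hJ : J ≠ ⊥) : ∃ a ∈ I, a ≠ 0 ∧ I * J ⊔ Ideal.span {a} = I := by
  have hIJ : I * J ≠ ⊥ := mul_ne_zero hI hJ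
  obtain ⟨a, ha⟩ := IsDedekindDomain.exists_sup_span_eq Ideal.mul_le_left hIJ
  have haI : a ∈ I := ha ▸ Ideal.mem_sup_right (Ideal.mem_span_singleton_self a)
  by_cases h0 : a = 0
  · obtain ⟨b, hb, hb0⟩ := Submodule.exists_mem_ne_zero_of_ne_bot hIJ
    refine ⟨b, Ideal.mul_le_left hb, hb0, ?_⟩
    rw [sup_eq_left.2 ((Ideal.span_singleton_le_iff_mem _).2 hb)]
    simpa [h0] using ha
  · exact ⟨a, haI, h0, ha⟩

namespace Crv

variable {K O F : Type} [Field K] [CommRing O] [Field F] [Algebra K O] [Algebra O F]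
    [Algebra K F] [IsScalarTower K O F] [IsDedekindDomain O] [IsFractionRing O F] [Finite K]

theorem codim_mul (C : Crv K O F) {I J : Ideal O} (hI : I ≠ ⊥) (hJ : J ≠ ⊥) :
    codim K (I * J) = codim K I + codim K J := by
  obtain ⟨a, haI, ha0, ha⟩ := Ideal.exists_mul_sup_span_eq I J hI hJ
  have hIJ : I * J ≠ ⊥ := mul_ne_zero hI hJ
  obtain ⟨I', hI'⟩ := Ideal.dvd_span_singleton.2 haI
  have hcop : J ⊔ I' = ⊤ := by
    have : I * (J ⊔ I') = I * ⊤ := by rw [Ideal.mul_sup, ← hI', ha, Ideal.mul_top]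
    exact mul_left_cancel₀ hI this
  have := C.finite_quotient hIJ
  have hfin : Module.Finite K (O ⧸ I * J) := inferInstance
  let f : O →ₗ[K] O ⧸ I * J := (Ideal.Quotient.mkₐ K (I * J)).toLinearMap ∘ₗ LinearMap.mulLeft K a
  have hle : I * J ≤ I := Ideal.mul_le_left
  let g : (O ⧸ I * J) →ₗ[K] O ⧸ I := (Ideal.Quotient.factorₐ K hle).toLinearMap
  have hg : Function.Surjective g := Ideal.Quotient.factor_surjective hle
  have hfker : LinearMap.ker f = J.restrictScalars K := by
    ext x
    have : x ∈ LinearMap.ker f ↔ a * x ∈ I * J := by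
      rw [LinearMap.mem_ker]; exact Ideal.Quotient.eq_zero_iff_mem
    rw [this, Submodule.restrictScalars_mem]
    constructor
    · intro h
      rw [← Ideal.dvd_span_singleton, ← Ideal.span_singleton_mul_span_singleton, hI',
        mul_assoc] at h
      have h2 := (mul_dvd_mul_iff_left hI).1 h
      have h3 : I' * Ideal.span {x} ≤ J := Ideal.le_of_dvd h2
      have : (⊤ : Ideal O) * Ideal.span {x} ≤ J := by
        rw [← hcop, Ideal.sup_mul]
        exact sup_le Ideal.mul_le_left h3
      rw [Ideal.top_mul] at this
      exact (Ideal.span_singleton_le_iff_mem _).1 this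
    · exact fun h => Ideal.mul_mem_mul haI h
  have hrange : LinearMap.range f = LinearMap.ker g := by
    ext y
    obtain ⟨y, rfl⟩ := Ideal.Quotient.mk_surjective y
    have : Ideal.Quotient.mk (I * J) y ∈ LinearMap.ker g ↔ y ∈ I := by
      rw [LinearMap.mem_ker]; exact Ideal.Quotient.eq_zero_iff_mem
    rw [this]
    constructor
    · rintro ⟨x, hx⟩
      have h1 : a * x - y ∈ I * J := Ideal.Quotient.eq.1 hx
      have h2 := Ideal.mul_le_left h1
      have := I.sub_mem (I.mul_mem_right x haI) h2
      simpa using this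
    · intro hy
      rw [← ha] at hy
      obtain ⟨z, hz, w, hw, rfl⟩ := Submodule.mem_sup.1 hy
      obtain ⟨x, rfl⟩ := Ideal.mem_span_singleton.1 hw
      refine ⟨x, ?_⟩
      change Ideal.Quotient.mk (I * J) (a * x) = _
      rw [Ideal.Quotient.eq]
      simpa using hz
  have e1 : Module.finrank K (LinearMap.range f) = codim K J :=
    (LinearEquiv.finrank_eq ((Submodule.quotEquivOfEq _ _ hfker).symm.trans
      f.quotKerEquivRange)).symm
  have e2 := LinearMap.finrank_range_add_finrank_ker g
  rw [LinearMap.range_eq_top.2 hg, finrank_top, ← hrange, e1] at e2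
  exact e2.symm

theorem codim_top : codim K (⊤ : Ideal O) = 0 := by
  have : Subsingleton (O ⧸ (⊤ : Ideal O)) := Ideal.Quotient.subsingleton_iff.2 rfl
  exact Module.finrank_zero_of_subsingleton

theorem eq_top_of_codim_eq_zero (C : Crv K O F) {I : Ideal O} (hI : I ≠ ⊥)
    (h : codim K I = 0) : I = ⊤ :=
  C.eq_of_codim_le hI le_top (by rw [h]; exact Nat.zero_le _)

theorem exists_const_of_isUnit (C : Crv K O F) {u : O} (hu : IsUnit u) :
    ∃ c : K, c ≠ 0 ∧ algebraMap K O c = u := by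
  obtain ⟨u, rfl⟩ := hu
  have h1 := C.one_le _ u.ne_zero
  have h2 := C.one_le _ (u⁻¹).ne_zero
  have h3 : C.v (algebraMap O F u) * C.v (algebraMap O F ↑u⁻¹) = 1 := by
    rw [← map_mul, ← map_mul]; simp
  have h4 : C.v (algebraMap O F u) ≤ 1 := by
    rw [← h3]; exact le_mul_of_one_le_right' h2
  obtain ⟨c, hc⟩ := C.emb_inf_L_zero h4
  refine ⟨c, ?_, hc⟩
  rintro rfl
  exact u.ne_zero (by rw [← hc, map_zero])

/-- `ω` vanishes on the ideal `I` and on `C.L k`. -/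
def Kills (C : Crv K O F) (ω : F →ₗ[K] K) (I : Ideal O) (k : ℤ) : Prop :=
  (∀ b ∈ I, ω (algebraMap O F b) = 0) ∧ ∀ f ∈ C.L k, ω f = 0

theorem kills_iff {C : Crv K O F} {ω : F →ₗ[K] K} {I : Ideal O} {k : ℤ} :
    C.Kills ω I k ↔ ω ∈ (emb K F I ⊔ C.L k).dualAnnihilator := by
  rw [Submodule.mem_dualAnnihilator]
  constructor
  · rintro ⟨h1, h2⟩ x hx
    obtain ⟨_, ⟨b, hb, rfl⟩, g, hg, rfl⟩ := Submodule.mem_sup.1 hx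
    rw [map_add, h2 g hg]
    exact (add_zero _).trans (h1 b hb)
  · intro h
    exact ⟨fun b hb => h _ (Submodule.mem_sup_left ⟨b, hb, rfl⟩),
      fun f hf => h f (Submodule.mem_sup_right hf)⟩

theorem card_kills (C : Crv K O F) {I : Ideal O} (hI : I ≠ ⊥) (k : ℤ) :
    Nat.card {ω : F →ₗ[K] K // C.Kills ω I k} = Nat.card K ^ C.i I k := by
  have := C.finite_sup hI k
  have e : {ω : F →ₗ[K] K // C.Kills ω I k} ≃ Module.Dual K (F ⧸ (emb K F I ⊔ C.L k)) :=
    (Equiv.subtypeEquivRight fun ω => kills_iff).trans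
      (emb K F I ⊔ C.L k).dualQuotEquivDualAnnihilator.symm.toEquiv
  rw [Nat.card_congr e]
  have : Module.Finite K (Module.Dual K (F ⧸ (emb K F I ⊔ C.L k))) := inferInstance
  have := Module.finite_of_finite K (M := Module.Dual K (F ⧸ (emb K F I ⊔ C.L k)))
  rw [Module.natCard_eq_pow_finrank (K := K), Subspace.dual_finrank_eq, i]

theorem finite_kills (C : Crv K O F) {I : Ideal O} (hI : I ≠ ⊥) (k : ℤ) :
    Finite {ω : F →ₗ[K] K // C.Kills ω I k} := by
  refine Nat.finite_of_card_ne_zero ?_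
  rw [C.card_kills hI]
  exact pow_ne_zero _ Nat.card_pos.ne'

variable (K) in
/-- The functional `x ↦ ω (f * x)`. -/
def act (f : F) (ω : F →ₗ[K] K) : F →ₗ[K] K := ω ∘ₗ LinearMap.mulLeft K f

@[simp] theorem act_apply (f : F) (ω : F →ₗ[K] K) (x : F) : act K f ω x = ω (f * x) := rfl

theorem act_eq_zero {f : F} {ω : F →ₗ[K] K} (h : act K f ω = 0) (hω : ω ≠ 0) : f = 0 := by
  by_contra hf
  apply hω
  ext x
  have := LinearMap.congr_fun h (f⁻¹ * x)
  simpa [hf] using this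

theorem exists_act_eq (C : Crv K O F) {ω₁ ω₂ : F →ₗ[K] K} (h1 : ω₁ ≠ 0) {I₁ I₂ : Ideal O}
    {k₁ k₂ : ℤ} (hI₁ : I₁ ≠ ⊥) (hI₂ : I₂ ≠ ⊥) (hk₁ : C.Kills ω₁ I₁ k₁) (hk₂ : C.Kills ω₂ I₂ k₂) :
    ∃ f, ω₂ = act K f ω₁ := by
  by_contra! hne
  set I := I₁ * I₂
  have hI : I ≠ ⊥ := mul_ne_zero hI₁ hI₂
  set k := min k₁ k₂
  obtain ⟨m, hm⟩ : ∃ m : ℤ, 3 * C.genus + codim K I - k < m ∧ k < m :=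
    ⟨max (3 * C.genus + codim K I - k) k + 1, by omega, by omega⟩
  let S := ↥(emb K F (⊤ : Ideal O) ⊓ C.L m)
  have key : ∀ (ω : F →ₗ[K] K) (J : Ideal O) (k' : ℤ), C.Kills ω J k' → I ≤ J → k ≤ k' →
      ∀ a : S, C.Kills (act K a.1 ω) I (k - m) := by
    rintro ω J k' h hIJ hkk ⟨_, ⟨b, -, rfl⟩, hb⟩
    refine ⟨fun x hx => ?_, fun f hf => ?_⟩
    · have := h.1 (b * x) (hIJ (I.mul_mem_left b hx))
      rw [map_mul] at this
      exact this
    · refine h.2 _ (C.L_mono hkk ?_)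
      have := mul_mem_L hb hf
      rwa [add_sub_cancel] at this
  have hfin := C.finite_kills hI (k - m)
  let Φ : S × S → {ω : F →ₗ[K] K // C.Kills ω I (k - m)} := fun z =>
    ⟨act K z.1.1 ω₁ + act K z.2.1 ω₂, by
      have a1 := key ω₁ I₁ k₁ hk₁ Ideal.mul_le_left (min_le_left _ _) z.1
      have a2 := key ω₂ I₂ k₂ hk₂ Ideal.mul_le_right (min_le_right _ _) z.2
      exact ⟨fun b hb => by rw [LinearMap.add_apply, a1.1 b hb, a2.1 b hb, add_zero],
        fun b hb => by rw [LinearMap.add_apply, a1.2 b hb, a2.2 b hb, add_zero]⟩⟩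
  have hΦ : Function.Injective Φ := by
    rintro ⟨⟨a, ha⟩, ⟨b, hb⟩⟩ ⟨⟨a', ha'⟩, ⟨b', hb'⟩⟩ h
    have h : act K a ω₁ + act K b ω₂ = act K a' ω₁ + act K b' ω₂ := congrArg Subtype.val h
    have h' : act K (a - a') ω₁ = act K (b' - b) ω₂ := by
      ext x
      have := LinearMap.congr_fun h x
      simp only [LinearMap.add_apply, act_apply] at this
      simp only [act_apply, sub_mul, map_sub]
      linear_combination this
    have hbb : b' - b = 0 := by
      by_contra h0
      refine hne ((a - a') / (b' - b)) ?_
      ext x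
      have := LinearMap.congr_fun h' ((b' - b)⁻¹ * x)
      simp only [act_apply, mul_inv_cancel_left₀ h0] at this
      rw [← this, act_apply]
      congr 1
      ring
    rw [hbb] at h'
    have haa : a - a' = 0 := act_eq_zero (h'.trans (by ext; simp)) h1
    have e1 := sub_eq_zero.1 hbb
    have e2 := sub_eq_zero.1 haa
    subst e1 e2
    rfl
  have hcard := Nat.card_le_card_of_injective Φ hΦ
  rw [Nat.card_prod, C.card_kills hI, C.card_inf top_ne_bot, ← pow_add] at hcard
  have hle := (Nat.pow_le_pow_iff_right (Finite.one_lt_card (α := K))).1 hcard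
  have r1 := C.rr_top m
  have r2 := C.rr hI (k - m)
  have r3 : C.l I (k - m) = 0 := by
    rw [l, C.emb_top_inf_L_neg (by omega)]; simp
  omega

theorem exists_bound_kills (C : Crv K O F) : ∃ N : ℤ, ∀ (ω : F →ₗ[K] K) (I : Ideal O) (k : ℤ),
    ω ≠ 0 → I ≠ ⊥ → C.Kills ω I k → k - codim K I ≤ N := by
  obtain ⟨c, hc⟩ := C.exists_add
  refine ⟨C.genus + c, fun ω I k hω hI h => ?_⟩
  by_contra! hlt
  have r := C.rr hI (k - c)
  obtain ⟨b, hbI, hb0, hb⟩ := C.exists_mem_of_l_ne_zero (I := I) (k := k - c) (by omega)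
  have hb0' : algebraMap O F b ≠ 0 := by simpa using hb0
  refine hb0' (act_eq_zero (K := K) ?_ hω)
  ext x
  obtain ⟨d, hd⟩ := hc x
  rw [act_apply, ← add_sub_cancel (algebraMap O F d) x, mul_add, map_add, ← map_mul,
    h.1 _ (I.mul_mem_right d hbI), zero_add]
  refine h.2 _ ?_
  have := mul_mem_L hb (show x - algebraMap O F d ∈ C.L c from hd)
  rwa [sub_add_cancel] at this

theorem exists_dualizing (C : Crv K O F) : ∃ (ω₀ : F →ₗ[K] K) (I₀ : Ideal O) (k₀ : ℤ), ω₀ ≠ 0 ∧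
    I₀ ≠ ⊥ ∧ C.Kills ω₀ I₀ k₀ ∧ k₀ - codim K I₀ ≤ 2 * C.genus - 2 ∧
    ∀ (ω : F →ₗ[K] K) (I : Ideal O) (k : ℤ), ω ≠ 0 → I ≠ ⊥ → C.Kills ω I k →
      k - codim K I ≤ k₀ - codim K I₀ := by
  obtain ⟨N, hN⟩ := C.exists_bound_kills
  let P : ℤ → Prop := fun z => ∃ (ω : F →ₗ[K] K) (I : Ideal O) (k : ℤ), ω ≠ 0 ∧ I ≠ ⊥ ∧
    C.Kills ω I k ∧ z = k - codim K I
  have hne : ∃ z, P z := by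
    have r := C.rr_top (-2)
    have hf := C.finite_kills (top_ne_bot (α := Ideal O)) (-2)
    have hc : 1 < Nat.card {ω : F →ₗ[K] K // C.Kills ω ⊤ (-2)} := by
      rw [C.card_kills top_ne_bot]
      exact Nat.one_lt_pow (by omega) Finite.one_lt_card
    have := (Finite.one_lt_card_iff_nontrivial).1 hc
    obtain ⟨ω, hω⟩ := exists_ne (⟨0, by simp [Kills]⟩ : {ω : F →ₗ[K] K // C.Kills ω ⊤ (-2)})
    exact ⟨_, ω.1, ⊤, -2, fun h => hω (Subtype.ext h), top_ne_bot, ω.2, rfl⟩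
  obtain ⟨z, ⟨ω₀, I₀, k₀, hω, hI, hk, rfl⟩, hmax⟩ := Int.exists_greatest_of_bdd (P := P)
    ⟨N, by rintro z ⟨ω, I, k, h1, h2, h3, rfl⟩; exact hN ω I k h1 h2 h3⟩ hne
  refine ⟨ω₀, I₀, k₀, hω, hI, hk, ?_, fun ω I k h1 h2 h3 => hmax _ ⟨ω, I, k, h1, h2, h3, rfl⟩⟩
  have r := C.rr hI k₀
  have hi : C.i I₀ k₀ ≠ 0 := by
    intro h0
    have hc := C.card_kills hI k₀
    rw [h0, pow_zero, Nat.card_eq_one_iff_unique] at hc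
    have := hc.1.elim ⟨ω₀, hk⟩ ⟨0, by simp [Kills]⟩
    exact hω (congrArg Subtype.val this)
  have hl : C.l I₀ k₀ ≤ C.genus := by
    have hf := C.finite_kills (top_ne_bot (α := Ideal O)) 0
    let Φ : ↥(emb K F I₀ ⊓ C.L k₀) → {ω : F →ₗ[K] K // C.Kills ω ⊤ 0} := fun z =>
      ⟨act K z.1 ω₀, by
        obtain ⟨_, ⟨b, hb, rfl⟩, hz⟩ := z
        refine ⟨fun x _ => ?_, fun f hf => ?_⟩
        · have := hk.1 (b * x) (I₀.mul_mem_right x hb)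
          rw [map_mul] at this
          exact this
        · refine hk.2 _ ?_
          have := mul_mem_L hz hf
          rwa [add_zero] at this⟩
    have hΦ : Function.Injective Φ := by
      intro a b h
      have h : act K a.1 ω₀ = act K b.1 ω₀ := congrArg Subtype.val h
      refine Subtype.ext (sub_eq_zero.1 (act_eq_zero (ω := ω₀) (K := K) ?_ hω))
      ext x
      have := LinearMap.congr_fun h x
      simp only [act_apply] at this
      simp [sub_mul, this]
    have hcard := Nat.card_le_card_of_injective Φ hΦ
    rw [C.card_kills top_ne_bot, C.card_inf hI] at hcard
    exact (Nat.pow_le_pow_iff_right (Finite.one_lt_card (α := K))).1 hcard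
  omega

end Crv

section Cls

variable {O : Type} [CommRing O] [IsDedekindDomain O]

open Classical in
/-- The ideal class of a nonzero ideal. -/
noncomputable def cls (I : Ideal O) : ClassGroup O :=
  if h : I = ⊥ then 1 else ClassGroup.mk0 ⟨I, mem_nonZeroDivisors_of_ne_zero h⟩

theorem cls_eq {I : Ideal O} (hI : I ≠ ⊥) :
    cls I = ClassGroup.mk0 ⟨I, mem_nonZeroDivisors_of_ne_zero hI⟩ := dif_neg hI

theorem cls_mul {I J : Ideal O} (hI : I ≠ ⊥) (hJ : J ≠ ⊥) : cls (I * J) = cls I * cls J := by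
  rw [cls_eq hI, cls_eq hJ, cls_eq (mul_ne_zero hI hJ), ← map_mul]; rfl

theorem cls_eq_iff {I J : Ideal O} (hI : I ≠ ⊥) (hJ : J ≠ ⊥) :
    cls I = cls J ↔ ∃ x y : O, ∃ (_ : x ≠ 0) (_ : y ≠ 0),
      Ideal.span {x} * I = Ideal.span {y} * J := by
  rw [cls_eq hI, cls_eq hJ, ClassGroup.mk0_eq_mk0_iff]

theorem cls_top : cls (⊤ : Ideal O) = 1 := by
  rw [cls_eq top_ne_bot]; exact (ClassGroup.mk0_eq_one_iff _).2 ⟨1, by simp⟩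

theorem cls_span {b : O} (hb : b ≠ 0) : cls (Ideal.span {b}) = 1 := by
  rw [← cls_top, cls_eq_iff (by simpa using hb) top_ne_bot]
  exact ⟨1, b, one_ne_zero, hb, by simp⟩

theorem exists_cls_eq (c : ClassGroup O) : ∃ I : Ideal O, I ≠ ⊥ ∧ cls I = c := by
  obtain ⟨I, rfl⟩ := ClassGroup.mk0_surjective c
  have h : I.1 ≠ ⊥ := nonZeroDivisors.coe_ne_zero I
  exact ⟨I.1, h, cls_eq h⟩

theorem exists_span_eq_of_cls_mul {I J : Ideal O} (hI : I ≠ ⊥) (hJ : J ≠ ⊥)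
    (h : cls I * cls J = 1) : ∃ b : O, b ≠ 0 ∧ Ideal.span {b} = I * J := by
  rw [← cls_mul hI hJ, ← cls_top, cls_eq_iff (mul_ne_zero hI hJ) top_ne_bot] at h
  obtain ⟨x, y, hx, hy, h⟩ := h
  have hy' : y ∈ Ideal.span {x} * (I * J) := by
    rw [h, Ideal.mul_top]; exact Ideal.mem_span_singleton_self y
  obtain ⟨b, hb, rfl⟩ := Ideal.mem_span_singleton_mul.1 hy'
  refine ⟨b, right_ne_zero_of_mul hy, ?_⟩
  rw [Ideal.mul_top, ← Ideal.span_singleton_mul_span_singleton] at h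
  exact (mul_left_cancel₀ (by simpa using hx) h).symm

end Cls

namespace Crv

variable {K O F : Type} [Field K] [CommRing O] [Field F] [Algebra K O] [Algebra O F]
    [Algebra K F] [IsScalarTower K O F] [IsDedekindDomain O] [IsFractionRing O F] [Finite K]

variable (K O) in
/-- The nonzero ideals of codimension at most `m`. -/
abbrev Eff (m : ℤ) : Type := {E : Ideal O // E ≠ ⊥ ∧ (codim K E : ℤ) ≤ m}

variable (K) in
/-- The nonzero ideals of codimension at most `m` in the class `c`. -/
abbrev EffCl (c : ClassGroup O) (m : ℤ) : Type := {E : Eff K O m // cls E.1 = c}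

theorem one_le_l (C : Crv K O F) {I : Ideal O} (hI : I ≠ ⊥) {k : ℤ}
    (hk : C.genus + codim K I ≤ k) : C.l I k ≠ 0 := by
  have := C.rr hI k
  omega

theorem exists_mul_eq_span (C : Crv K O F) {J : Ideal O} (hJ : J ≠ ⊥) {k : ℤ}
    (h : C.l J k ≠ 0) : ∃ b : O, ∃ E : Ideal O, b ≠ 0 ∧ algebraMap O F b ∈ C.L k ∧ E ≠ ⊥ ∧
      Ideal.span {b} = J * E ∧ (codim K E : ℤ) ≤ k - codim K J := by
  obtain ⟨b, hbJ, hb0, hb⟩ := exists_mem_of_l_ne_zero C h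
  obtain ⟨E, hE⟩ := Ideal.dvd_span_singleton.2 hbJ
  have hE0 : E ≠ ⊥ := by
    rintro rfl
    rw [Ideal.mul_bot] at hE
    exact hb0 (by simpa using hE)
  refine ⟨b, E, hb0, hb, hE0, hE, ?_⟩
  have h1 := C.codim_span hb0
  rw [hE, C.codim_mul hJ hE0] at h1
  have := (mem_L_iff (C := C) (k := k) (by simpa using hb0 : algebraMap O F b ≠ 0)).1 hb
  push_cast at h1
  omega

theorem exists_eff_of_l_ne_zero (C : Crv K O F) {J : Ideal O} (hJ : J ≠ ⊥) {k : ℤ}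
    (h : C.l J k ≠ 0) : ∃ E : Ideal O, E ≠ ⊥ ∧ cls J * cls E = 1 ∧
      (codim K E : ℤ) ≤ k - codim K J := by
  obtain ⟨b, E, hb, -, hE, hbE, hc⟩ := C.exists_mul_eq_span hJ h
  exact ⟨E, hE, by rw [← cls_mul hJ hE, ← hbE, cls_span hb], hc⟩

theorem finite_eff (C : Crv K O F) (m : ℤ) : Finite (Eff K O m) := by
  have hfin : (({b : O | b ≠ 0 ∧ algebraMap O F b ∈ C.L (m + C.genus)} : Set O)).Finite := by
    have := C.finite_inf (top_ne_bot (α := Ideal O)) (m + C.genus)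
    refine Set.Finite.of_finite_image (f := algebraMap O F) ?_
      (IsFractionRing.injective O F).injOn
    refine Set.Finite.subset (Set.toFinite
      ((emb K F (⊤ : Ideal O) ⊓ C.L (m + C.genus) : Submodule K F) : Set F)) ?_
    rintro _ ⟨b, hb, rfl⟩
    exact ⟨⟨b, trivial, rfl⟩, hb.2⟩
  have : (⋃ b ∈ {b : O | b ≠ 0 ∧ algebraMap O F b ∈ C.L (m + C.genus)},
      {E : Ideal O | E ∣ Ideal.span {b}}).Finite := by
    refine Set.Finite.biUnion hfin fun b hb => ?_
    have h0 : Ideal.span {b} ≠ (0 : Ideal O) := by simpa using hb.1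
    have : Finite {E : Ideal O | E ∣ Ideal.span {b}} :=
      (UniqueFactorizationMonoid.fintypeSubtypeDvd (Ideal.span {b}) h0).finite
    exact Set.toFinite {E : Ideal O | E ∣ Ideal.span {b}}
  refine Set.Finite.subset this ?_
  rintro E ⟨hE, hc⟩
  obtain ⟨b, E', hb, hb', -, h, -⟩ := C.exists_mul_eq_span hE
    (C.one_le_l hE (show C.genus + codim K E ≤ m + C.genus by omega))
  simp only [Set.mem_iUnion]
  exact ⟨b, ⟨hb, hb'⟩, E', h⟩

theorem finite_effCl (C : Crv K O F) (c : ClassGroup O) (m : ℤ) : Finite (EffCl K c m) := by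
  have := C.finite_eff m
  exact Subtype.finite

theorem finite_classGroup (C : Crv K O F) : Finite (ClassGroup O) := by
  have := C.finite_eff C.genus
  refine Finite.of_surjective (fun E : Eff K O C.genus => cls E.1) fun c => ?_
  obtain ⟨J, hJ, hc⟩ := exists_cls_eq c⁻¹
  obtain ⟨E, hE, hJE, hE'⟩ := C.exists_eff_of_l_ne_zero hJ (C.one_le_l hJ le_rfl)
  refine ⟨⟨E, hE, by omega⟩, ?_⟩
  rw [hc] at hJE
  exact (inv_mul_eq_one.1 hJE).symm

theorem card_eff [Fintype (ClassGroup O)] (C : Crv K O F) (m : ℤ) :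
    Nat.card (Eff K O m) = ∑ c : ClassGroup O, Nat.card (EffCl K c m) := by
  have := fun c => C.finite_effCl c m
  rw [← Nat.card_sigma]
  exact (Nat.card_congr (Equiv.sigmaFiberEquiv (fun E : Eff K O m => cls E.1))).symm

theorem card_effCl_mul_le (C : Crv K O F) {J : Ideal O} (hJ : J ≠ ⊥) {c : ClassGroup O}
    (hc : cls J * c = 1) {m : ℤ} :
    Nat.card (EffCl K c m) * (Nat.card K - 1) + 1 ≤ Nat.card K ^ C.l J (m + codim K J) := by
  have hf := C.finite_inf hJ (m + codim K J)
  have := C.finite_effCl c m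
  have hg : ∀ E : EffCl K c m, ∃ b : O, b ≠ 0 ∧ Ideal.span {b} = J * E.1.1 := fun E =>
    exists_span_eq_of_cls_mul hJ E.1.2.1 (by rw [E.2, hc])
  choose b hb0 hb using hg
  let V := ↥(emb K F J ⊓ C.L (m + codim K J))
  have hmem : ∀ (E : EffCl K c m) (u : K), algebraMap O F (algebraMap K O u * b E) ∈
      emb K F J ⊓ C.L (m + codim K J) := by
    intro E u
    refine ⟨⟨_, J.mul_mem_left _ ?_, rfl⟩, ?_⟩
    · exact Ideal.mul_le_left (hb E ▸ Ideal.mem_span_singleton_self _)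
    · rw [map_mul, ← IsScalarTower.algebraMap_apply]
      have h1 : algebraMap O F (b E) ≠ 0 := by simpa using hb0 E
      have h2 : C.deg (algebraMap O F (b E)) ≤ m + codim K J := by
        rw [← C.codim_span (hb0 E), hb E, C.codim_mul hJ E.1.2.1]
        have := E.1.2.2
        push_cast
        omega
      have h3 := mul_mem_L (C := C) (k := 0) (m := m + codim K J)
        (show algebraMap K F u ∈ C.L 0 from C.v_algebraMap_le u) ((mem_L_iff h1).2 h2)
      rwa [zero_add] at h3
  let Φ : Option (EffCl K c m × Kˣ) → V := fun z => z.elim 0 fun z => ⟨_, hmem z.1 z.2⟩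
  have hinj : Function.Injective Φ := by
    have hne : ∀ z : EffCl K c m × Kˣ, Φ (some z) ≠ 0 := by
      intro z h
      have h1 : algebraMap O F (algebraMap K O z.2 * b z.1) = 0 := congrArg Subtype.val h
      rw [map_mul, ← IsScalarTower.algebraMap_apply, mul_eq_zero] at h1
      rcases h1 with h1 | h1
      · exact z.2.ne_zero ((map_eq_zero _).1 h1)
      · exact hb0 z.1 (by simpa using h1)
    rintro (_ | ⟨E, u⟩) (_ | ⟨E', u'⟩) h
    · rfl
    · exact absurd h.symm (hne _)
    · exact absurd h (hne _)
    · have h1 : algebraMap O F (algebraMap K O u * b E) =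
        algebraMap O F (algebraMap K O u' * b E') := congrArg Subtype.val h
      have h1 := IsFractionRing.injective O F h1
      have hu : ∀ w : Kˣ, IsUnit (algebraMap K O w) := fun w => w.isUnit.map _
      have h2 : Ideal.span {b E} = Ideal.span {b E'} := by
        rw [← Ideal.span_singleton_mul_left_unit (hu u), h1,
          Ideal.span_singleton_mul_left_unit (hu u')]
      rw [hb, hb] at h2
      have h3 : E = E' := Subtype.ext (Subtype.ext (mul_left_cancel₀ hJ h2))
      subst h3
      have h4 := (algebraMap K O).injective (mul_right_cancel₀ (hb0 E) h1)
      rw [Units.ext h4]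
  have h := Nat.card_le_card_of_injective Φ hinj
  rw [C.card_inf hJ, Finite.card_option, Nat.card_prod, Nat.card_units] at h
  exact h

/-- Data of a functional of maximal degree, playing the role of a canonical divisor. -/
structure Dualizing (C : Crv K O F) where
  ω : F →ₗ[K] K
  I : Ideal O
  k : ℤ
  ω_ne : ω ≠ 0
  I_ne : I ≠ ⊥
  kills : C.Kills ω I k
  le : k - codim K I ≤ 2 * C.genus - 2
  maximal : ∀ (ω' : F →ₗ[K] K) (J : Ideal O) (m : ℤ), ω' ≠ 0 → J ≠ ⊥ → C.Kills ω' J m →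
    m - codim K J ≤ k - codim K I

theorem nonempty_dualizing (C : Crv K O F) : Nonempty C.Dualizing := by
  obtain ⟨ω, I, k, h1, h2, h3, h4, h5⟩ := C.exists_dualizing
  exact ⟨⟨ω, I, k, h1, h2, h3, h4, h5⟩⟩

theorem Dualizing.exists_ideal {C : Crv K O F} (D : C.Dualizing) {ω : F →ₗ[K] K} (hω : ω ≠ 0)
    {J : Ideal O} (hJ : J ≠ ⊥) {m : ℤ} (h : C.Kills ω J m) :
    ∃ (b d : O) (E : Ideal O), b ≠ 0 ∧ d ≠ 0 ∧ E ≠ ⊥ ∧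
      ω = act K (algebraMap O F b / algebraMap O F d) D.ω ∧
      Ideal.span {b} * J = Ideal.span {d} * D.I * E ∧
      (codim K E : ℤ) ≤ 2 * C.genus - 2 - m + codim K J := by
  obtain ⟨f, hf⟩ := C.exists_act_eq D.ω_ne D.I_ne hJ D.kills h
  obtain ⟨b, d, hd, rfl⟩ := IsFractionRing.div_surjective O f
  have hd0 : d ≠ 0 := nonZeroDivisors.ne_zero hd
  have hd' : algebraMap O F d ≠ 0 := by simpa using hd0
  have hb0 : b ≠ 0 := by
    rintro rfl
    exact hω (by rw [hf]; ext; simp)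
  have hb' : algebraMap O F b ≠ 0 := by simpa using hb0
  have hds : Ideal.span {d} ≠ ⊥ := by simpa using hd0
  have hbs : Ideal.span {b} ≠ ⊥ := by simpa using hb0
  set H := Ideal.span {d} * D.I ⊔ Ideal.span {b} * J with hH
  have hdI : Ideal.span {d} * D.I ≠ ⊥ := mul_ne_zero hds D.I_ne
  have hbJ : Ideal.span {b} * J ≠ ⊥ := mul_ne_zero hbs hJ
  have hH0 : H ≠ ⊥ := fun h0 => hdI (le_bot_iff.1 (h0 ▸ le_sup_left))
  have hω1 : act K (algebraMap O F d)⁻¹ D.ω ≠ 0 := fun h0 =>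
    inv_ne_zero hd' (act_eq_zero h0 D.ω_ne)
  have hk : C.Kills (act K (algebraMap O F d)⁻¹ D.ω) H
      (max (D.k + C.deg (algebraMap O F d)) (m + C.deg (algebraMap O F b))) := by
    constructor
    · intro x hx
      obtain ⟨y, hy, z, hz, rfl⟩ := Submodule.mem_sup.1 hx
      obtain ⟨y, hy', rfl⟩ := Ideal.mem_span_singleton_mul.1 hy
      obtain ⟨z, hz', rfl⟩ := Ideal.mem_span_singleton_mul.1 hz
      rw [map_add, map_add, act_apply, act_apply, map_mul (algebraMap O F),
     map_mul (algebraMap O F),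
        inv_mul_cancel_left₀ hd', D.kills.1 _ hy', zero_add]
      have := h.1 z hz'
      rw [hf, act_apply] at this
      rw [← this]
      congr 1
      ring
    · intro x hx
      rcases max_choice (D.k + C.deg (algebraMap O F d)) (m + C.deg (algebraMap O F b)) with h1 | h1
      · rw [h1] at hx
        refine D.kills.2 _ ?_
        have := mul_mem_L (C.mem_L_deg (algebraMap O F d)⁻¹) hx
        rwa [C.deg_inv, neg_add_cancel_comm_assoc] at this
      · rw [h1] at hx
        have h2 : (algebraMap O F b)⁻¹ * x ∈ C.L m := by
          have := mul_mem_L (C.mem_L_deg (algebraMap O F b)⁻¹) hx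
          rw [C.deg_inv] at this
          convert this using 2
          ring
        have h3 := h.2 _ h2
        rw [hf, act_apply] at h3
        rw [← h3, act_apply]
        congr 1
        field_simp
  have hmax := D.maximal _ _ _ hω1 hH0 hk
  have c1 := C.codim_mul hds D.I_ne
  have c2 := C.codim_mul hbs hJ
  have c3 := C.codim_span hd0
  have c4 := C.codim_span hb0
  have m1 := le_max_left (D.k + C.deg (algebraMap O F d)) (m + C.deg (algebraMap O F b))
  have m2 := le_max_right (D.k + C.deg (algebraMap O F d)) (m + C.deg (algebraMap O F b))
  have heq : Ideal.span {d} * D.I = H := C.eq_of_codim_le hdI le_sup_left (by omega)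
  obtain ⟨E, hE⟩ : Ideal.span {d} * D.I ∣ Ideal.span {b} * J :=
    Ideal.dvd_iff_le.2 (heq ▸ le_sup_right)
  have hE0 : E ≠ ⊥ := by
    rintro rfl
    rw [Ideal.mul_bot] at hE
    exact hbJ hE
  refine ⟨b, d, E, hb0, hd0, hE0, hf, hE, ?_⟩
  have c5 := C.codim_mul hdI hE0
  rw [← hE] at c5
  rw [← heq] at hmax
  have := D.le
  omega

theorem Dualizing.cls_eq {C : Crv K O F} (D : C.Dualizing) {J E : Ideal O} {b d : O} (hb : b ≠ 0)
    (hd : d ≠ 0) (hJ : J ≠ ⊥) (hE : E ≠ ⊥)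
    (h : Ideal.span {b} * J = Ideal.span {d} * D.I * E) : cls E = cls J * (cls D.I)⁻¹ := by
  have hds : Ideal.span {d} ≠ ⊥ := by simpa using hd
  have hbs : Ideal.span {b} ≠ ⊥ := by simpa using hb
  have := congrArg cls h
  rw [cls_mul hbs hJ, cls_mul (mul_ne_zero hds D.I_ne) hE, cls_mul hds D.I_ne, cls_span hb,
    cls_span hd, one_mul, one_mul] at this
  rw [this, mul_comm, inv_mul_cancel_left]

theorem Dualizing.pow_i_le {C : Crv K O F} (D : C.Dualizing) {J : Ideal O} (hJ : J ≠ ⊥) (m : ℤ) :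
    Nat.card K ^ C.i J m ≤ Nat.card (EffCl K (cls J * (cls D.I)⁻¹)
      (2 * C.genus - 2 - m + codim K J)) * (Nat.card K - 1) + 1 := by
  classical
  set c := cls J * (cls D.I)⁻¹
  set N := 2 * (C.genus : ℤ) - 2 - m + codim K J
  have := C.finite_kills hJ m
  have := C.finite_effCl c N
  have key : ∀ ω : {ω : F →ₗ[K] K // C.Kills ω J m}, ω.1 ≠ 0 → ∃ (E : EffCl K c N) (b d : O),
      b ≠ 0 ∧ d ≠ 0 ∧ ω.1 = act K (algebraMap O F b / algebraMap O F d) D.ω ∧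
      Ideal.span {b} * J = Ideal.span {d} * D.I * E.1.1 := by
    intro ω h0
    obtain ⟨b, d, E, hb, hd, hE, h1, h2, h3⟩ := D.exists_ideal h0 hJ ω.2
    exact ⟨⟨⟨E, hE, h3⟩, D.cls_eq hb hd hJ hE h2⟩, b, d, hb, hd, h1, h2⟩
  choose e b d hb hd h1 h2 using key
  have fib : ∀ ω hω ω' hω', e ω hω = e ω' hω' → ∃ u : Kˣ, ω.1 = u • ω'.1 := by
    intro ω hω ω' hω' he
    have h3 : Ideal.span {b ω hω * d ω' hω'} = Ideal.span {b ω' hω' * d ω hω} := by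
      refine mul_right_cancel₀ hJ ?_
      rw [← Ideal.span_singleton_mul_span_singleton, ← Ideal.span_singleton_mul_span_singleton,
        mul_right_comm, h2, mul_right_comm (Ideal.span {b ω' hω'}), h2, he]
      ring
    obtain ⟨u, hu⟩ := Ideal.span_singleton_eq_span_singleton.1 h3
    obtain ⟨c, hc0, hc⟩ := C.exists_const_of_isUnit u⁻¹.isUnit
    refine ⟨Units.mk0 c hc0, ?_⟩
    have hb1 : algebraMap O F (b ω hω) ≠ 0 := by simpa using hb ω hω
    have hd1 : algebraMap O F (d ω hω) ≠ 0 := by simpa using hd ω hω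
    have hd1' : algebraMap O F (d ω' hω') ≠ 0 := by simpa using hd ω' hω'
    have hu' : b ω hω * d ω' hω' = algebraMap K O c * (b ω' hω' * d ω hω) := by
      rw [hc, ← hu, mul_comm (_ * _) (u : O), Units.inv_mul_cancel_left]
    have hu'' := congrArg (algebraMap O F) hu'
    simp only [map_mul] at hu''
    rw [← IsScalarTower.algebraMap_apply] at hu''
    have : algebraMap O F (b ω hω) / algebraMap O F (d ω hω) =
        algebraMap K F c * (algebraMap O F (b ω' hω') / algebraMap O F (d ω' hω')) := by
      field_simp
      linear_combination hu''
    rw [h1 ω hω, this, h1 ω' hω']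
    ext x
    rw [act_apply, mul_assoc, ← Algebra.smul_def, map_smul]
    rfl
  let ref : EffCl K c N → (F →ₗ[K] K) := fun E =>
    if h : ∃ ω hω, e ω hω = E then (Classical.choose h).1 else 0
  have href : ∀ ω hω, ∃ u : Kˣ, ω.1 = u • ref (e ω hω) := by
    intro ω hω
    have h : ∃ ω' hω', e ω' hω' = e ω hω := ⟨ω, hω, rfl⟩
    obtain ⟨h3, h4⟩ := Classical.choose_spec h
    obtain ⟨u, hu⟩ := fib ω hω _ h3 h4.symm
    refine ⟨u, ?_⟩
    simp only [ref]
    rw [dif_pos h]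
    exact hu
  choose u hu using href
  let Φ : {ω : F →ₗ[K] K // C.Kills ω J m} → Option (EffCl K c N × Kˣ) := fun ω =>
    if h : ω.1 = 0 then none else some (e ω h, u ω h)
  have hinj : Function.Injective Φ := by
    intro ω ω' h
    simp only [Φ] at h
    split_ifs at h with h3 h4 h5
    · exact Subtype.ext (h3.trans h4.symm)
    · rw [Option.some_inj, Prod.mk.injEq] at h
      refine Subtype.ext ?_
      rw [hu ω h3, hu ω' h5, h.1, h.2]
  have h := Nat.card_le_card_of_injective Φ hinj
  rw [C.card_kills hJ, Finite.card_option, Nat.card_prod, Nat.card_units] at h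
  exact h

theorem Dualizing.exists_eff_of_i_ne_zero {C : Crv K O F} (D : C.Dualizing) {J : Ideal O}
    (hJ : J ≠ ⊥) {m : ℤ} (h : C.i J m ≠ 0) : ∃ E : Ideal O, E ≠ ⊥ ∧
      cls E = cls J * (cls D.I)⁻¹ ∧ (codim K E : ℤ) ≤ 2 * C.genus - 2 - m + codim K J := by
  have := D.pow_i_le hJ m
  have h1 : 1 < Nat.card K ^ C.i J m := Nat.one_lt_pow h Finite.one_lt_card
  have h2 : Nat.card (EffCl K (cls J * (cls D.I)⁻¹) (2 * C.genus - 2 - m + codim K J)) ≠ 0 := by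
    intro h0
    rw [h0, zero_mul] at this
    omega
  obtain ⟨E⟩ := (Nat.card_ne_zero.1 h2).1
  exact ⟨E.1.1, E.1.2.1, E.2, E.1.2.2⟩

theorem card_eff_genus_le (C : Crv K O F) : Nat.card (Eff K O C.genus) ≤
    Nat.card (ClassGroup O) + Nat.card K * Nat.card (Eff K O (C.genus - 2)) := by
  have := C.finite_classGroup
  have := Fintype.ofFinite (ClassGroup O)
  obtain ⟨D⟩ := C.nonempty_dualizing
  rw [C.card_eff, C.card_eff, Nat.card_eq_fintype_card (α := ClassGroup O),
    Finset.mul_sum, ← ((Equiv.inv _).trans (Equiv.mulRight (cls D.I)⁻¹)).sum_comp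
    (fun c => Nat.card K * Nat.card (EffCl K c (C.genus - 2))), Fintype.card_eq_sum_ones,
    ← Finset.sum_add_distrib]
  refine Finset.sum_le_sum fun c _ => ?_
  obtain ⟨J, hJ, hc⟩ := exists_cls_eq c⁻¹
  have h1 := C.card_effCl_mul_le hJ (c := c) (by rw [hc, inv_mul_cancel]) (m := C.genus)
  have h2 := D.pow_i_le hJ (C.genus + codim K J)
  have hr := C.rr hJ (C.genus + codim K J)
  rw [show C.l J (C.genus + codim K J) = C.i J (C.genus + codim K J) + 1 by omega, pow_succ] at h1
  rw [hc, show 2 * (C.genus : ℤ) - 2 - (C.genus + codim K J) + codim K J =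
    C.genus - 2 by ring] at h2
  change _ ≤ 1 + Nat.card K * Nat.card (EffCl K (c⁻¹ * (cls D.I)⁻¹) (C.genus - 2))
  have hq : 1 < Nat.card K := Finite.one_lt_card
  obtain ⟨q, hq'⟩ : ∃ q, Nat.card K = q + 2 := ⟨Nat.card K - 2, by omega⟩
  generalize Nat.card (EffCl K (c⁻¹ * (cls D.I)⁻¹) (C.genus - 2)) = A at *
  generalize Nat.card (EffCl K c C.genus) = B at *
  have h3 := h1.trans (Nat.mul_le_mul_right _ h2)
  rw [hq', show q + 2 - 1 = q + 1 by omega] at h3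
  rw [hq']
  have h4 : (q + 1) * B ≤ (q + 1) * (1 + (q + 2) * A) := by nlinarith
  exact Nat.le_of_mul_le_mul_left h4 (by omega)

end Crv

theorem exists_cls_eq_sup_eq_top {O : Type} [CommRing O] [IsDedekindDomain O] (c : ClassGroup O)
    {N : Ideal O} (hN : N ≠ ⊥) : ∃ I : Ideal O, I ≠ ⊥ ∧ cls I = c ∧ I ⊔ N = ⊤ := by
  obtain ⟨J, hJ, hc⟩ := exists_cls_eq c⁻¹
  obtain ⟨a, haJ, ha0, ha⟩ := Ideal.exists_mul_sup_span_eq J N hJ hN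
  obtain ⟨I, hI⟩ := Ideal.dvd_span_singleton.2 haJ
  have hI0 : I ≠ ⊥ := by
    rintro rfl
    rw [Ideal.mul_bot] at hI
    exact ha0 (by simpa using hI)
  refine ⟨I, hI0, ?_, ?_⟩
  · have := congrArg cls hI
    rw [cls_span ha0, cls_mul hJ hI0, hc] at this
    exact (inv_mul_eq_one.1 this.symm).symm
  · have : J * (I ⊔ N) = J * ⊤ := by rw [Ideal.mul_sup, ← hI, sup_comm, ha, Ideal.mul_top]
    exact mul_left_cancel₀ hJ this

namespace Crv

variable {K O F : Type} [Field K] [CommRing O] [Field F] [Algebra K O] [Algebra O F]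
    [Algebra K F] [IsScalarTower K O F] [IsDedekindDomain O] [IsFractionRing O F] [Finite K]

open UniqueFactorizationMonoid Classical in
theorem card_eff_growth (C : Crv K O F) (S : Finset (Ideal O))
    (hS : ∀ P ∈ S, P ≠ ⊥ ∧ P.IsPrime ∧ codim K P = 2) (hS0 : S.Nonempty) {m : ℕ} (hm : 0 < m) :
    (2 * (S.card : ℤ) + m - 2) * Nat.card (Eff K O (m - 2)) ≤ m * Nat.card (Eff K O m) := by
  have hfin : ∀ k : ℤ, {E : Ideal O | E ≠ ⊥ ∧ (codim K E : ℤ) ≤ k}.Finite := C.finite_eff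
  let T : ℤ → Finset (Ideal O) := fun k => (hfin k).toFinset
  have hT : ∀ k E, E ∈ T k ↔ E ≠ ⊥ ∧ (codim K E : ℤ) ≤ k := fun k E => by simp [T]
  have hcard : ∀ k, Nat.card (Eff K O k) = (T k).card := fun k =>
    Nat.card_eq_card_finite_toFinset (hfin k)
  let w : Ideal O → Multiset (Ideal O) := fun E => (normalizedFactors E).filter (· ∈ S)
  have hw : ∀ E, ∑ P ∈ S, (w E).count P = (w E).card := fun E =>
    Multiset.sum_count_eq_card fun P hP => (Multiset.mem_filter.1 hP).2
  have hwmul : ∀ J P, J ≠ ⊥ → P ∈ S → w (J * P) = w J + {P} := by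
    intro J P hJ hP
    have hPp : Prime P := Ideal.prime_of_isPrime (hS P hP).1 (hS P hP).2.1
    simp only [w]
    rw [normalizedFactors_mul hJ (hS P hP).1, normalizedFactors_irreducible hPp.irreducible,
      Multiset.filter_add, normalize_eq, Multiset.filter_singleton, if_pos hP]
  have hcod : ∀ s : Multiset (Ideal O), (∀ P ∈ s, P ∈ S) →
      s.prod ≠ ⊥ ∧ codim K s.prod = 2 * s.card := by
    intro s
    induction s using Multiset.induction_on with
    | empty => intro _; simp [codim_top]
    | cons P s ih =>
      intro h
      obtain ⟨h1, h2⟩ := ih fun Q hQ => h Q (Multiset.mem_cons_of_mem hQ)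
      have hP := hS P (h P (Multiset.mem_cons_self _ _))
      rw [Multiset.prod_cons, C.codim_mul hP.1 h1, hP.2.2, h2, Multiset.card_cons]
      exact ⟨mul_ne_zero hP.1 h1, by ring⟩
  have hws : ∀ E, E ≠ ⊥ → 2 * (w E).card ≤ codim K E := by
    intro E hE
    obtain ⟨h1, h2⟩ := hcod (w E) fun P hP => (Multiset.mem_filter.1 hP).2
    rw [← h2]
    refine C.codim_le hE (Ideal.le_of_dvd ?_)
    have := Multiset.prod_dvd_prod_of_le (Multiset.filter_le (· ∈ S) (normalizedFactors E))
    rwa [prod_normalizedFactors_eq hE, normalize_eq] at this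
  let f : Ideal O → Ideal O → ℚ := fun E P => (w E).count P / (w E).card
  have up : ∑ P ∈ S, ∑ E ∈ T m, f E P ≤ (T m).card := by
    rw [Finset.sum_comm, Finset.cast_card]
    refine Finset.sum_le_sum fun E _ => ?_
    simp only [f]
    rw [← Finset.sum_div, ← Nat.cast_sum, hw]
    exact div_self_le_one _
  have low : ∑ P ∈ S, ∑ J ∈ T (m - 2), f (J * P) P ≤ ∑ P ∈ S, ∑ E ∈ T m, f E P := by
    refine Finset.sum_le_sum fun P hP => ?_
    rw [← Finset.sum_image (f := fun E => f E P) (g := fun J => J * P)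
      fun J _ J' _ h => mul_right_cancel₀ (hS P hP).1 h]
    refine Finset.sum_le_sum_of_subset_of_nonneg ?_ fun E _ _ => by positivity
    intro E hE
    obtain ⟨J, hJ, rfl⟩ := Finset.mem_image.1 hE
    obtain ⟨h1, h2⟩ := (hT _ _).1 hJ
    refine (hT _ _).2 ⟨mul_ne_zero h1 (hS P hP).1, ?_⟩
    rw [C.codim_mul h1 (hS P hP).1, (hS P hP).2.2]
    push_cast
    omega
  have hm' : (0 : ℚ) < m := by exact_mod_cast hm
  have low2 : ((T (m - 2)).card : ℚ) * ((2 * S.card + m - 2) / m) ≤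
      ∑ P ∈ S, ∑ J ∈ T (m - 2), f (J * P) P := by
    rw [Finset.sum_comm, Finset.cast_card, Finset.sum_mul]
    refine Finset.sum_le_sum fun J hJ => ?_
    obtain ⟨h1, h2⟩ := (hT _ _).1 hJ
    have e1 : ∀ P ∈ S, f (J * P) P = ((w J).count P + 1) / ((w J).card + 1) := by
      intro P hP
      simp only [f]
      rw [hwmul J P h1 hP, Multiset.count_add, Multiset.count_singleton_self, Multiset.card_add,
        Multiset.card_singleton]
      push_cast
      rfl
    rw [Finset.sum_congr rfl e1, ← Finset.sum_div, Finset.sum_add_distrib, ← Nat.cast_sum, hw,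
      one_mul, div_le_div_iff₀ hm' (by positivity)]
    have h3 := hws J h1
    have h4 : (2 * ((w J).card : ℚ)) ≤ m - 2 := by
      have : (2 * ((w J).card : ℤ)) ≤ m - 2 := by omega
      exact_mod_cast this
    have h5 : (1 : ℚ) ≤ S.card := by exact_mod_cast hS0.card_pos
    simp only [Finset.sum_const, nsmul_eq_mul, mul_one]
    nlinarith
  have := (low2.trans low).trans up
  rw [mul_div_assoc', div_le_iff₀ hm'] at this
  rw [hcard, hcard]
  have h : ((2 * (S.card : ℚ) + m - 2) * (T (m - 2)).card) ≤ m * (T m).card := by linarith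
  exact_mod_cast h

theorem card_eff_neg {m : ℤ} (hm : m < 0) : Nat.card (Eff K O m) = 0 := by
  have : IsEmpty (Eff K O m) := ⟨fun E => by have := E.2.2; omega⟩
  exact Nat.card_of_isEmpty

theorem two_mul_card_eff_lt (C : Crv K O F) (S : Finset (Ideal O))
    (hS : ∀ P ∈ S, P ≠ ⊥ ∧ P.IsPrime ∧ codim K P = 2) {D j : ℕ}
    (hD : Nat.card K * C.genus + D + 2 ≤ 2 * S.card + C.genus)
    (hj : 2 * C.genus < D * Nat.card K ^ j) :
    2 * Nat.card (Eff K O (C.genus - 2 - 2 * j)) < Nat.card (ClassGroup O) := by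
  have := C.finite_classGroup
  have hpos : 0 < Nat.card (ClassGroup O) := Nat.card_pos
  rcases Nat.eq_zero_or_pos C.genus with hg | hg
  · rw [card_eff_neg (by omega)]; omega
  have hq : 1 < Nat.card K := Finite.one_lt_card
  have hq1 : C.genus ≤ Nat.card K * C.genus := Nat.le_mul_of_pos_left _ (by omega)
  have hS0 : S.Nonempty := by
    rw [← Finset.card_pos]
    omega
  have step : ∀ i : ℕ, Nat.card K ^ i * Nat.card (Eff K O (C.genus - 2 - 2 * i)) ≤
      Nat.card (Eff K O (C.genus - 2)) := by
    intro i
    induction i with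
    | zero => simp
    | succ i ih =>
      refine le_trans ?_ ih
      rw [pow_succ, mul_assoc]
      refine Nat.mul_le_mul_left _ ?_
      rcases lt_or_ge ((C.genus : ℤ) - 2 - 2 * i) 1 with h | h
      · rw [card_eff_neg (by push_cast; omega)]
        simp
      · obtain ⟨m, hm⟩ : ∃ m : ℕ, (m : ℤ) = C.genus - 2 - 2 * i :=
          ⟨_, Int.toNat_of_nonneg (by omega)⟩
        have := C.card_eff_growth S hS hS0 (m := m) (by omega)
        rw [show (C.genus : ℤ) - 2 - 2 * ((i + 1 : ℕ) : ℤ) = m - 2 by push_cast; omega, ← hm]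
        generalize Nat.card (Eff K O (m - 2)) = A at *
        generalize Nat.card (Eff K O m) = B at *
        have hmg : m ≤ C.genus := by omega
        have h1 : (m : ℤ) * Nat.card K ≤ 2 * S.card + m - 2 := by
          have h3 : ((Nat.card K : ℤ) - 1) * m ≤ (Nat.card K - 1) * C.genus :=
            mul_le_mul_of_nonneg_left (by exact_mod_cast hmg) (by omega)
          zify at hD
          nlinarith
        have h2 : (m : ℤ) * (Nat.card K * A) ≤ m * B := by
          refine le_trans ?_ this
          rw [← mul_assoc]
          exact mul_le_mul_of_nonneg_right h1 (by positivity)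
        have := le_of_mul_le_mul_left h2 (by omega)
        exact_mod_cast this
  have h1 := C.card_eff_growth S hS hS0 hg
  have h2 := C.card_eff_genus_le
  have h3 := step j
  generalize Nat.card (Eff K O (C.genus - 2 - 2 * j)) = X at *
  generalize Nat.card (Eff K O (C.genus - 2)) = A at *
  generalize Nat.card (Eff K O C.genus) = B at *
  generalize Nat.card (ClassGroup O) = h at *
  generalize Nat.card K = q at *
  generalize C.genus = g at *
  generalize S.card = s at *
  have h4 : D * A ≤ g * h := by
    zify at *
    have : ((q : ℤ) * g + D) * A ≤ g * (h + q * A) := by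
      calc ((q : ℤ) * g + D) * A ≤ (2 * s + g - 2) * A :=
            mul_le_mul_of_nonneg_right (by linarith) (by positivity)
        _ ≤ g * B := h1
        _ ≤ _ := mul_le_mul_of_nonneg_left h2 (by positivity)
    linarith
  have h5 : D * q ^ j * X ≤ g * h := by
    refine le_trans ?_ h4
    rw [mul_assoc]
    exact Nat.mul_le_mul_left _ h3
  rcases Nat.eq_zero_or_pos X with rfl | hX
  · simpa using hpos
  · by_contra! hle
    have h6 : 2 * (g * h) ≤ 2 * g * (2 * X) := by nlinarith
    have h7 : g * h ≤ g * (2 * X) := Nat.mul_le_mul_left _ hle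
    have h8 : 2 * g * X < D * q ^ j * X := Nat.mul_lt_mul_of_pos_right hj hX
    linarith

theorem codim_ker {L : Type} [Field L] [Algebra K L] (φ : O →ₐ[K] L)
    (hφ : Function.Surjective φ) : codim K (RingHom.ker φ) = Module.finrank K L :=
  (Ideal.quotientKerAlgEquivOfSurjective hφ).toLinearEquiv.finrank_eq

theorem ker_ne_bot (C : Crv K O F) {L : Type} [Field L] [Algebra K L] [Module.Finite K L]
    (φ : O →ₐ[K] L) : RingHom.ker φ ≠ ⊥ := by
  intro h
  have hinj : Function.Injective φ := (RingHom.injective_iff_ker_eq_bot _).2 h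
  have : Module.Finite K O := Module.Finite.of_injective φ.toLinearMap hinj
  have hr := C.rr_top (C.genus + Module.finrank K O)
  have hf := C.finite_inf (top_ne_bot (α := Ideal O)) (C.genus + Module.finrank K O)
  let T := LinearMap.range ((Algebra.ofId O F).restrictScalars K).toLinearMap
  have hle : emb K F (⊤ : Ideal O) ⊓ C.L (C.genus + Module.finrank K O) ≤ T := by
    rintro _ ⟨⟨b, -, rfl⟩, -⟩
    exact ⟨b, rfl⟩
  have h1 := Submodule.finrank_mono hle
  have h2 := LinearMap.finrank_range_le ((Algebra.ofId O F).restrictScalars K).toLinearMap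
  have h3 : C.l ⊤ (C.genus + Module.finrank K O) ≤ Module.finrank K O := h1.trans h2
  omega

theorem exists_good_section (C : Crv K O F) {L : Type} [Field L] [Algebra K L] (φ : O →ₐ[K] L)
    (hφ : Function.Surjective φ) {I : Ideal O} (hI : I ⊔ RingHom.ker φ = ⊤)
    {k : ℤ} (h : emb K F (I * RingHom.ker φ) ⊔ C.L k = ⊤) :
    ∃ f : L →ₗ[K] O, ∀ x, f x ∈ I ∧ algebraMap O F (f x) ∈ C.L k ∧ φ (f x) = x := by
  let ι : O →ₗ[K] F := ((Algebra.ofId O F).restrictScalars K).toLinearMap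
  let W : Submodule K O := I.restrictScalars K ⊓ (C.L k).comap ι
  let ψ : W →ₗ[K] L := φ.toLinearMap ∘ₗ W.subtype
  have hψ : LinearMap.range ψ = ⊤ := by
    rw [LinearMap.range_eq_top]
    intro y
    obtain ⟨b, rfl⟩ := hφ y
    obtain ⟨i, hi, j, hj, hij⟩ :=
      Submodule.mem_sup.1 (hI ▸ Submodule.mem_top : b ∈ I ⊔ RingHom.ker φ)
    obtain ⟨_, ⟨e, he, rfl⟩, l, hl, hel⟩ := Submodule.mem_sup.1
      (h ▸ Submodule.mem_top : algebraMap O F i ∈ emb K F (I * RingHom.ker φ) ⊔ C.L k)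
    refine ⟨⟨i - e, I.sub_mem hi (Ideal.mul_le_left he), ?_⟩, ?_⟩
    · have : ι (i - e) = l := by
        rw [map_sub, sub_eq_iff_eq_add']
        exact hel.symm
      rw [SetLike.mem_coe, Submodule.mem_comap, this]
      exact hl
    · change φ (i - e) = φ b
      have he0 : φ e = 0 := Ideal.mul_le_right he
      have hj0 : φ j = 0 := hj
      rw [← hij, map_sub, map_add, he0, hj0, sub_zero, add_zero]
  obtain ⟨f, hf⟩ := ψ.exists_rightInverse_of_surjective hψ
  exact ⟨W.subtype ∘ₗ f, fun x => ⟨(f x).2.1, (f x).2.2, LinearMap.congr_fun hf x⟩⟩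

theorem hasRank (C : Crv K O F) {γ : ℤ}
    (hA : 2 * Nat.card (Eff K O (C.genus - 1 - γ)) < Nat.card (ClassGroup O))
    {L E : Type} [Field L] [Algebra K L] [Module.Finite K L] [Field E] [Algebra K E]
    (hE : Module.finrank K E = 2) (φ : O →ₐ[K] L) (hφ : Function.Surjective φ) {s : ℕ}
    (ψ : Fin s → (O →ₐ[K] E)) (hψ : ∀ i, Function.Surjective (ψ i))
    (hker : ∀ i j, i ≠ j → RingHom.ker (ψ i) ≠ RingHom.ker (ψ j))
    (hs : 2 * (Module.finrank K L : ℤ) + C.genus - 1 + 3 * γ ≤ 2 * s) : HasRank K L (3 * s) := by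
  classical
  have : Module.Finite K E := Module.finite_of_finrank_pos (by omega)
  have := C.finite_classGroup
  have := C.finite_eff (C.genus - 1 - γ)
  obtain ⟨D⟩ := C.nonempty_dualizing
  set n := Module.finrank K L
  set Q := RingHom.ker φ with hQdef
  have hQ : Q ≠ ⊥ := C.ker_ne_bot φ
  have hQn : codim K Q = n := codim_ker φ hφ
  have hP : ∀ i, RingHom.ker (ψ i) ≠ ⊥ := fun i => C.ker_ne_bot (ψ i)
  have hmax : ∀ i, (RingHom.ker (ψ i)).IsMaximal := fun i =>
    RingHom.ker_isMaximal_of_surjective _ (hψ i)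
  set G : Ideal O := ∏ i, RingHom.ker (ψ i) with hG
  have hG0 : G ≠ ⊥ := Finset.prod_ne_zero_iff.2 fun i _ => hP i
  have hGc : codim K G = 2 * s := by
    have : ∀ t : Finset (Fin s), codim K (∏ i ∈ t, RingHom.ker (ψ i)) = 2 * t.card := by
      intro t
      induction t using Finset.induction_on with
      | empty => simpa using codim_top
      | insert a t ha ih =>
        rw [Finset.prod_insert ha, C.codim_mul (hP a) (Finset.prod_ne_zero_iff.2 fun i _ => hP i),
          ih, codim_ker _ (hψ a), hE, Finset.card_insert_of_notMem ha]
        ring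
    rw [hG, this, Finset.card_univ, Fintype.card_fin]
  -- choice of the classes
  let t : Eff K O (C.genus - 1 - γ) → ClassGroup O := fun E => cls E.1 * cls D.I * (cls Q)⁻¹
  obtain ⟨c₁, hc₁⟩ : ∃ c, ∀ E, t E ≠ c := by
    by_contra! h
    have := Nat.card_le_card_of_surjective t h
    omega
  obtain ⟨c₂, hc₂⟩ : ∃ c, ∀ E, (Sum.elim t fun E : Eff K O (C.genus - 1 - γ) =>
      (c₁ * cls G * cls E.1)⁻¹) E ≠ c := by
    by_contra! h
    have := Nat.card_le_card_of_surjective _ h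
    rw [Nat.card_sum] at this
    omega
  have hQG : Q * G ≠ ⊥ := mul_ne_zero hQ hG0
  have hi : ∀ {I : Ideal O}, I ≠ ⊥ → (∀ E, t E ≠ cls I) →
      emb K F (I * Q) ⊔ C.L (codim K I + n + C.genus - 1 + γ) = ⊤ := by
    intro I hI h
    have hIQ : I * Q ≠ ⊥ := mul_ne_zero hI hQ
    refine C.sup_eq_top_of_i_eq_zero hIQ ?_
    by_contra h0
    obtain ⟨E, hE, hcl, hcd⟩ := D.exists_eff_of_i_ne_zero hIQ h0
    rw [C.codim_mul hI hQ, hQn] at hcd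
    refine h ⟨E, hE, by push_cast at hcd; omega⟩ ?_
    simp only [t]
    rw [hcl, cls_mul hI hQ]
    group
  obtain ⟨I₁, hI₁, hcl₁, hco₁⟩ := exists_cls_eq_sup_eq_top c₁ hQG
  obtain ⟨I₂, hI₂, hcl₂, hco₂⟩ := exists_cls_eq_sup_eq_top c₂ hQG
  have sup1 : ∀ {I : Ideal O}, I ⊔ Q * G = ⊤ → I ⊔ Q = ⊤ ∧ I ⊔ G = ⊤ := fun {I} h =>
    ⟨top_le_iff.1 (h ▸ sup_le_sup_left Ideal.mul_le_left I),
      top_le_iff.1 (h ▸ sup_le_sup_left Ideal.mul_le_right I)⟩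
  obtain ⟨f, hf⟩ := C.exists_good_section φ hφ (sup1 hco₁).1
    (hi hI₁ (fun E => hcl₁ ▸ hc₁ E))
  obtain ⟨h, hh⟩ := C.exists_good_section φ hφ (sup1 hco₂).1
    (hi hI₂ (fun E => hcl₂ ▸ hc₂ (Sum.inl E)))
  set k₁ : ℤ := codim K I₁ + n + C.genus - 1 + γ
  set k₂ : ℤ := codim K I₂ + n + C.genus - 1 + γ
  have hI₁₂ : I₁ * I₂ ≠ ⊥ := mul_ne_zero hI₁ hI₂
  have hl : C.l (I₁ * I₂ * G) (k₁ + k₂) = 0 := by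
    by_contra h0
    have hne : I₁ * I₂ * G ≠ ⊥ := mul_ne_zero hI₁₂ hG0
    obtain ⟨E, hE, hcl, hcd⟩ := C.exists_eff_of_l_ne_zero hne h0
    rw [C.codim_mul hI₁₂ hG0, C.codim_mul hI₁ hI₂, hGc] at hcd
    refine hc₂ (Sum.inr ⟨E, hE, by push_cast at hcd; omega⟩) ?_
    rw [cls_mul hI₁₂ hG0, cls_mul hI₁ hI₂, hcl₁, hcl₂] at hcl
    simp only [Sum.elim_inr]
    rw [inv_eq_iff_mul_eq_one, ← hcl]
    ac_rfl
  let ι : O →ₗ[K] F := ((Algebra.ofId O F).restrictScalars K).toLinearMap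
  let W : Submodule K O := (I₁ * I₂).restrictScalars K ⊓ (C.L (k₁ + k₂)).comap ι
  let ev : W →ₗ[K] (Fin s → E) := (LinearMap.pi fun i => (ψ i).toLinearMap) ∘ₗ W.subtype
  have hev : LinearMap.ker ev = ⊥ := by
    rw [LinearMap.ker_eq_bot']
    rintro ⟨b, hb1, hb2⟩ hb
    have hbi : ∀ i, b ∈ RingHom.ker (ψ i) := fun i => congrFun hb i
    have hbG : b ∈ G := by
      rw [← Ideal.dvd_span_singleton]
      refine Fintype.prod_dvd_of_coprime (fun i j hij => ?_) fun i =>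
        Ideal.dvd_span_singleton.2 (hbi i)
      rw [Function.onFun, Ideal.isCoprime_iff_sup_eq]
      exact Ideal.IsMaximal.coprime_of_ne (hmax i) (hmax j) (hker i j hij)
    have hcop : I₁ * I₂ ⊔ G = ⊤ :=
      (Ideal.mul_sup_eq_of_coprime_left (sup1 hco₁).2).trans (sup1 hco₂).2
    have hbIG : b ∈ I₁ * I₂ * G := by
      rw [Ideal.mul_eq_inf_of_coprime hcop]
      exact ⟨hb1, hbG⟩
    exact Subtype.ext (C.l_eq_zero (mul_ne_zero hI₁₂ hG0) hl hbIG hb2)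
  obtain ⟨T, hT⟩ := ev.exists_leftInverse_of_injective hev
  have hE3 : HasRank K E 3 := by
    have := HasRank.karatsuba (K := K) (L := E)
    rwa [hE] at this
  refine hE3.of_evaluation ψ f h (φ.toLinearMap ∘ₗ W.subtype ∘ₗ T) fun x y => ?_
  have hW : f x * h y ∈ W := ⟨Ideal.mul_mem_mul (hf x).1 (hh y).1, by
    change algebraMap O F (f x * h y) ∈ C.L (k₁ + k₂)
    rw [map_mul]
    exact mul_mem_L (hf x).2.1 (hh y).2.1⟩
  have := LinearMap.congr_fun hT ⟨f x * h y, hW⟩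
  change T (fun i => ψ i (f x * h y)) = ⟨f x * h y, hW⟩ at this
  rw [LinearMap.comp_apply, LinearMap.comp_apply, this]
  change x * y = φ (f x * h y)
  rw [map_mul, (hf x).2.2, (hh y).2.2]

end Crv

theorem WithZero.exp_injective' {a b : ℤ}
    (h : (WithZero.exp a : ℤᵐ⁰) = WithZero.exp b) : a = b := by
  simpa using h

/-- The data of an extension `R = F[w]` of degree `p` with `w ^ p = β w + y`, where `y` has a
simple pole at infinity. -/
structure ASData {K O F : Type} [Field K] [CommRing O] [Field F] [Algebra K O] [Algebra O F]
    [Algebra K F] (C : Crv K O F) (p : ℕ) (β : K) (y : F) (R : Type) [CommRing R]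
    [Algebra F R] where
  w : R
  B : Module.Basis (Fin p) F R
  one_lt : 1 < p
  B_eq : ∀ i, B i = w ^ (i : ℕ)
  pow_eq : w ^ p = algebraMap F R (algebraMap K F β) * w + algebraMap F R y
  v_y : C.v y = WithZero.exp (1 : ℤ)

namespace ASData

variable {K O F : Type} [Field K] [CommRing O] [Field F] [Algebra K O] [Algebra O F]
    [Algebra K F] {C : Crv K O F} {p : ℕ} {β : K} {y : F} {R : Type} [CommRing R]
    [Algebra F R] (A : ASData C p β y R)

/-- The extension of the valuation. -/
noncomputable def ν (x : R) : ℤᵐ⁰ :=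
  Finset.univ.sup fun i => C.v (A.B.repr x i) ^ p * WithZero.exp ((i : ℕ) : ℤ)

variable {A}

theorem ν_le_iff {x : R} {c : ℤᵐ⁰} :
    A.ν x ≤ c ↔ ∀ i, C.v (A.B.repr x i) ^ p * WithZero.exp ((i : ℕ) : ℤ) ≤ c := by
  simp [ν]

theorem le_ν (x : R) (i : Fin p) : C.v (A.B.repr x i) ^ p * WithZero.exp ((i : ℕ) : ℤ) ≤ A.ν x :=
  ν_le_iff.1 le_rfl i

theorem exists_ν_eq (x : R) : ∃ i, A.ν x = C.v (A.B.repr x i) ^ p * WithZero.exp ((i : ℕ) : ℤ) := by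
  have := A.one_lt
  obtain ⟨i, -, hi⟩ := Finset.exists_mem_eq_sup Finset.univ ⟨⟨0, by omega⟩, Finset.mem_univ _⟩
    fun i => C.v (A.B.repr x i) ^ p * WithZero.exp ((i : ℕ) : ℤ)
  exact ⟨i, hi⟩

theorem ν_add_le (x x' : R) : A.ν (x + x') ≤ max (A.ν x) (A.ν x') := by
  rw [ν_le_iff]
  intro i
  rw [map_add, Finsupp.add_apply]
  rcases le_max_iff.1 (C.v.map_add (A.B.repr x i) (A.B.repr x' i)) with h | h
  · exact le_max_of_le_left ((mul_le_mul_left (pow_le_pow_left' h p) _).trans (le_ν x i))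
  · exact le_max_of_le_right ((mul_le_mul_left (pow_le_pow_left' h p) _).trans (le_ν x' i))

theorem ν_smul (f : F) (x : R) : A.ν (f • x) = C.v f ^ p * A.ν x := by
  apply le_antisymm
  · rw [ν_le_iff]
    intro i
    rw [map_smul, Finsupp.smul_apply, smul_eq_mul, map_mul, mul_pow, mul_assoc]
    exact mul_le_mul_right (le_ν x i) _
  · obtain ⟨i, hi⟩ := exists_ν_eq (A := A) x
    have h := le_ν (A := A) (f • x) i
    rwa [map_smul, Finsupp.smul_apply, smul_eq_mul, map_mul, mul_pow, mul_assoc, ← hi] at h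

theorem ν_eq_zero {x : R} : A.ν x = 0 ↔ x = 0 := by
  have hp := A.one_lt
  constructor
  · intro h
    apply A.B.repr.injective
    ext i
    have h1 := le_ν (A := A) x i
    rw [h, le_zero_iff, mul_eq_zero, or_iff_left WithZero.exp_ne_zero,
      pow_eq_zero_iff (by omega), map_eq_zero] at h1
    simp [h1]
  · rintro rfl
    rw [← le_zero_iff, ν_le_iff]
    intro i
    simp [show p ≠ 0 by omega]

theorem ν_neg (x : R) : A.ν (-x) = A.ν x := by
  rw [← neg_one_smul F x, ν_smul, Valuation.map_neg, map_one, one_pow, one_mul]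

theorem ν_basis (i : Fin p) : A.ν (A.w ^ (i : ℕ)) = WithZero.exp ((i : ℕ) : ℤ) := by
  have hp := A.one_lt
  rw [← A.B_eq]
  apply le_antisymm
  · rw [ν_le_iff]
    intro j
    rw [A.B.repr_self]
    rcases eq_or_ne i j with rfl | h
    · simp
    · simp [Finsupp.single_eq_of_ne h.symm, show p ≠ 0 by omega]
  · refine le_trans ?_ (le_ν _ i)
    simp

theorem ν_sum_le {ι : Type*} {s : Finset ι} {f : ι → R} {c : ℤᵐ⁰} (h : ∀ i ∈ s, A.ν (f i) ≤ c) :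
    A.ν (∑ i ∈ s, f i) ≤ c := by
  classical
  induction s using Finset.induction_on with
  | empty => simp [ν_eq_zero.2]
  | insert a s ha ih =>
    rw [Finset.sum_insert ha]
    exact (ν_add_le _ _).trans (max_le (h a (Finset.mem_insert_self _ _))
      (ih fun i hi => h i (Finset.mem_insert_of_mem hi)))

theorem ν_algebraMap (f : F) : A.ν (algebraMap F R f) = C.v f ^ p := by
  have h := ν_basis (A := A) ⟨0, by have := A.one_lt; omega⟩
  simp only [pow_zero, Nat.cast_zero, WithZero.exp_zero] at h
  rw [Algebra.algebraMap_eq_smul_one, ν_smul, h, mul_one]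

theorem ν_pow_le {j : ℕ} (hj : j ≤ p) : A.ν (A.w ^ j) ≤ WithZero.exp (j : ℤ) := by
  have hp := A.one_lt
  rcases hj.lt_or_eq with h | rfl
  · exact (ν_basis (A := A) ⟨j, h⟩).le
  · rw [A.pow_eq]
    refine (ν_add_le _ _).trans (max_le ?_ ?_)
    · rw [← Algebra.smul_def, ν_smul]
      have h1 := ν_basis (A := A) ⟨1, hp⟩
      rw [pow_one] at h1
      rw [h1]
      refine (mul_le_of_le_one_left' (pow_le_one' (C.v_algebraMap_le _) _)).trans ?_
      rw [WithZero.exp_le_exp]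
      exact_mod_cast hp.le
    · rw [ν_algebraMap, A.v_y, ← WithZero.exp_nsmul]
      simp

theorem eq_sum (x : R) : x = ∑ i, A.B.repr x i • A.w ^ (i : ℕ) := by
  conv_lhs => rw [← A.B.sum_repr x]
  simp only [A.B_eq]

theorem ν_w_mul_le (x : R) : A.ν (A.w * x) ≤ WithZero.exp (1 : ℤ) * A.ν x := by
  conv_lhs => rw [eq_sum (A := A) x]
  rw [Finset.mul_sum]
  refine ν_sum_le fun i _ => ?_
  rw [mul_smul_comm, ν_smul, ← pow_succ']
  refine (mul_le_mul_right (ν_pow_le i.2) _).trans ?_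
  rw [show ((i.1 + 1 : ℕ) : ℤ) = 1 + (i.1 : ℤ) by push_cast; ring, WithZero.exp_add, mul_left_comm]
  exact mul_le_mul_right (le_ν x i) _

theorem ν_w_pow_mul_le (j : ℕ) (x : R) : A.ν (A.w ^ j * x) ≤ WithZero.exp (j : ℤ) * A.ν x := by
  induction j with
  | zero => simp
  | succ j ih =>
    rw [pow_succ', mul_assoc]
    refine (ν_w_mul_le _).trans ((mul_le_mul_right ih _).trans ?_)
    rw [← mul_assoc, ← WithZero.exp_add]
    push_cast
    rw [add_comm]

theorem ν_w_mul (x : R) : A.ν (A.w * x) = WithZero.exp (1 : ℤ) * A.ν x := by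
  have hp := A.one_lt
  rcases eq_or_ne x 0 with rfl | hx
  · simp [ν_eq_zero.2]
  refine le_antisymm (ν_w_mul_le x) ?_
  have h0 : A.ν x ≠ 0 := fun h => hx (ν_eq_zero.1 h)
  have e1 : y • x = A.w ^ p * x + -(algebraMap K F β • (A.w * x)) := by
    rw [A.pow_eq, Algebra.smul_def, Algebra.smul_def]; ring
  have h1 : A.ν (y • x) = WithZero.exp (p : ℤ) * A.ν x := by
    rw [ν_smul, A.v_y, ← WithZero.exp_nsmul]; simp
  have h2 : A.ν (-(algebraMap K F β • (A.w * x))) < WithZero.exp (p : ℤ) * A.ν x := by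
    rw [ν_neg, ν_smul]
    refine (mul_le_of_le_one_left' (pow_le_one' (C.v_algebraMap_le _) _)).trans_lt ?_
    refine (ν_w_mul_le x).trans_lt ?_
    refine mul_lt_mul_of_pos_right ?_ (zero_lt_iff.2 h0)
    rw [WithZero.exp_lt_exp]
    exact_mod_cast hp
  have h3 : WithZero.exp (p : ℤ) * A.ν x ≤ A.ν (A.w ^ p * x) := by
    have := ν_add_le (A := A) (A.w ^ p * x) (-(algebraMap K F β • (A.w * x)))
    rw [← e1, h1] at this
    exact (le_max_iff.1 this).resolve_right (not_le.2 h2)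
  obtain ⟨j, rfl⟩ : ∃ j, p = j + 1 := ⟨p - 1, by omega⟩
  rw [pow_succ, mul_assoc] at h3
  have h4 := h3.trans (ν_w_pow_mul_le _ _)
  push_cast at h4
  rw [WithZero.exp_add, mul_assoc] at h4
  exact (mul_le_mul_iff_right₀ (WithZero.exp_pos)).1 h4

theorem ν_w_pow_mul (j : ℕ) (x : R) : A.ν (A.w ^ j * x) = WithZero.exp (j : ℤ) * A.ν x := by
  induction j with
  | zero => simp
  | succ j ih =>
    rw [pow_succ', mul_assoc, ν_w_mul, ih, ← mul_assoc, ← WithZero.exp_add]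
    push_cast
    rw [add_comm]

theorem ν_mul_le (x x' : R) : A.ν (x * x') ≤ A.ν x * A.ν x' := by
  conv_lhs => rw [eq_sum (A := A) x]
  rw [Finset.sum_mul]
  refine ν_sum_le fun i _ => ?_
  rw [smul_mul_assoc, ν_smul, ν_w_pow_mul, ← mul_assoc]
  exact mul_le_mul_left (le_ν x i) _

theorem term_injective {f f' : F} (hf : f ≠ 0) {i j : Fin p}
    (h : C.v f ^ p * WithZero.exp ((i : ℕ) : ℤ) = C.v f' ^ p * WithZero.exp ((j : ℕ) : ℤ)) :
    i = j := by
  have hf' : f' ≠ 0 := by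
    rintro rfl
    have : p ≠ 0 := by have := i.2; omega
    simp [this, hf] at h
  rw [C.v_eq hf, C.v_eq hf', ← WithZero.exp_nsmul, ← WithZero.exp_nsmul, ← WithZero.exp_add,
    ← WithZero.exp_add] at h
  have h := WithZero.exp_injective' h
  simp only [nsmul_eq_mul] at h
  have h1 := congrArg (· % (p : ℤ)) h
  simp only [Int.mul_add_emod_self_left] at h1
  rw [Int.emod_eq_of_lt (by omega) (by exact_mod_cast i.2),
    Int.emod_eq_of_lt (by omega) (by exact_mod_cast j.2)] at h1
  exact Fin.ext (by exact_mod_cast h1)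

theorem ν_mul (x x' : R) : A.ν (x * x') = A.ν x * A.ν x' := by
  classical
  rcases eq_or_ne x 0 with rfl | hx
  · simp [ν_eq_zero.2]
  rcases eq_or_ne x' 0 with rfl | hx'
  · simp [ν_eq_zero.2]
  refine le_antisymm (ν_mul_le x x') ?_
  obtain ⟨i, hi⟩ := exists_ν_eq (A := A) x
  have h0 : A.ν x ≠ 0 := fun h => hx (ν_eq_zero.1 h)
  have h0' : A.ν x' ≠ 0 := fun h => hx' (ν_eq_zero.1 h)
  have hfi : A.B.repr x i ≠ 0 := by
    intro h
    rw [h, map_zero, zero_pow (by have := A.one_lt; omega), zero_mul] at hi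
    exact h0 hi
  set z := ∑ j ∈ Finset.univ.erase i, A.B.repr x j • A.w ^ (j : ℕ) with hz
  have hxz : x = A.B.repr x i • A.w ^ (i : ℕ) + z := by
    rw [hz, Finset.add_sum_erase _ (fun j => A.B.repr x j • A.w ^ (j : ℕ)) (Finset.mem_univ i)]
    exact eq_sum x
  have hzlt : A.ν z < A.ν x := by
    have : ∀ s : Finset (Fin p), i ∉ s →
        A.ν (∑ j ∈ s, A.B.repr x j • A.w ^ (j : ℕ)) < A.ν x := by
      intro s
      induction s using Finset.induction_on with
      | empty => intro _; simpa [ν_eq_zero.2] using zero_lt_iff.2 h0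
      | insert a s ha ih =>
        intro his
        rw [Finset.mem_insert, not_or] at his
        rw [Finset.sum_insert ha]
        refine (ν_add_le _ _).trans_lt (max_lt ?_ (ih his.2))
        rw [ν_smul, ν_basis]
        refine lt_of_le_of_ne (le_ν x a) fun h => his.1 ?_
        exact term_injective hfi (hi.symm.trans h.symm)
    exact this _ (Finset.notMem_erase _ _)
  have e1 : A.ν ((A.B.repr x i • A.w ^ (i : ℕ)) * x') = A.ν x * A.ν x' := by
    rw [smul_mul_assoc, ν_smul, ν_w_pow_mul, ← mul_assoc, ← hi]
  have e2 : A.ν (-(z * x')) < A.ν x * A.ν x' := by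
    rw [ν_neg]
    exact (ν_mul_le _ _).trans_lt (mul_lt_mul_of_pos_right hzlt (zero_lt_iff.2 h0'))
  have e3 := ν_add_le (A := A) (x * x') (-(z * x'))
  have e4 : x * x' + -(z * x') = (A.B.repr x i • A.w ^ (i : ℕ)) * x' := by
    nth_rw 1 [hxz]; ring
  rw [e4, e1] at e3
  exact (le_max_iff.1 e3).resolve_right (not_le.2 e2)

theorem isDomain (A : ASData C p β y R) : IsDomain R := by
  have h01 : (1 : R) ≠ 0 := by
    intro h
    have h1 := ν_algebraMap (A := A) 1
    rw [map_one, h, ν_eq_zero.2 rfl] at h1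
    simp at h1
  have : Nontrivial R := ⟨1, 0, h01⟩
  have : NoZeroDivisors R := ⟨fun {a b} h => by
    rw [← ν_eq_zero (A := A), ν_mul, mul_eq_zero] at h
    exact h.imp ν_eq_zero.1 ν_eq_zero.1⟩
  exact NoZeroDivisors.to_isDomain R

variable (A) in
/-- The extended valuation. -/
noncomputable def val : Valuation R ℤᵐ⁰ where
  toFun := A.ν
  map_zero' := ν_eq_zero.2 rfl
  map_one' := by rw [← map_one (algebraMap F R), ν_algebraMap, map_one, one_pow]
  map_mul' := ν_mul
  map_add_le_max' := ν_add_le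

variable (A) in
theorem val_w : A.val A.w = WithZero.exp (1 : ℤ) := by
  have := ν_basis (A := A) ⟨1, A.one_lt⟩
  rwa [pow_one] at this

end ASData

open Polynomial in
theorem Crv.exists_asData {K O F : Type} [Field K] [CommRing O] [Field F] [Algebra K O]
    [Algebra O F] [Algebra K F] (Cv : Crv K O F) {p : ℕ} (hp : 1 < p) (β : K) {y : F}
    (hy : Cv.v y = WithZero.exp (1 : ℤ)) :
    ∃ (F' : Type) (_ : Field F') (_ : Algebra F F'), Nonempty (ASData Cv p β y F') := by
  set f : F[X] := X ^ p - (C (algebraMap K F β) * X + C y) with hf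
  have hdeg : (Polynomial.C (algebraMap K F β) * X + Polynomial.C y).degree < (p : WithBot ℕ) := by
    refine (degree_linear_le).trans_lt ?_
    exact_mod_cast hp
  have hm : f.Monic := monic_X_pow_sub hdeg
  have hn : f.natDegree = p := by
    refine natDegree_eq_of_degree_eq_some ?_
    rw [hf, degree_sub_eq_left_of_degree_lt (by rwa [degree_X_pow]), degree_X_pow]
  let B := (AdjoinRoot.powerBasis' hm).basis.reindex (finCongr (hn : _ = p))
  have hroot : AdjoinRoot.root f ^ p = algebraMap F _ (algebraMap K F β) * AdjoinRoot.root f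
      + algebraMap F _ y := by
    have := AdjoinRoot.eval₂_root f
    rw [hf] at this
    simp only [eval₂_sub, eval₂_add, eval₂_mul, eval₂_pow, eval₂_X, eval₂_C] at this
    exact sub_eq_zero.1 this
  let A : ASData Cv p β y (AdjoinRoot f) :=
    { w := AdjoinRoot.root f
      B := B
      one_lt := hp
      B_eq := fun i => by simp [B]; rfl
      pow_eq := hroot
      v_y := hy }
  have hd : IsDomain (F[X] ⧸ Ideal.span {f}) := A.isDomain
  have hprime : Prime f := by
    rw [Ideal.Quotient.isDomain_iff_prime] at hd
    exact (Ideal.span_singleton_prime hm.ne_zero).1 hd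
  have : Fact (Irreducible f) := ⟨hprime.irreducible⟩
  exact ⟨AdjoinRoot f, inferInstance, inferInstance, ⟨A⟩⟩

open Polynomial in
theorem IsIntegral.of_pow_eq_mul_add {R A : Type*} [CommRing R] [CommRing A] [Algebra R A] {p : ℕ}
    (hp : 1 < p) {x : A} {a b : R} (h : x ^ p = algebraMap R A a * x + algebraMap R A b) :
    IsIntegral R x := by
  nontriviality R
  refine ⟨X ^ p - (C a * X + C b), monic_X_pow_sub ?_, ?_⟩
  · refine (degree_linear_le).trans_lt ?_
    exact_mod_cast hp
  · simp [h]

namespace ASData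

variable {K O F : Type} [Field K] [CommRing O] [Field F] [Algebra K O] [Algebra O F]
    [Algebra K F] {C : Crv K O F} {p : ℕ} {β : K} {y : F} {F' : Type} [Field F']
    [Algebra F F'] (A : ASData C p β y F')

theorem finite (A : ASData C p β y F') : Module.Finite F F' := Module.Finite.of_basis A.B

theorem finrank_eq (A : ASData C p β y F') : Module.finrank F F' = p := by
  rw [Module.finrank_eq_card_basis A.B, Fintype.card_fin]

theorem adjoin_w (A : ASData C p β y F') : Algebra.adjoin F {A.w} = ⊤ := by
  rw [eq_top_iff]
  rintro x -
  rw [eq_sum (A := A) x]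
  exact Subalgebra.sum_mem _ fun i _ => Subalgebra.smul_mem _
    (Subalgebra.pow_mem _ (Algebra.self_mem_adjoin_singleton F A.w) _) _

open Polynomial in
theorem isSeparable (A : ASData C p β y F') [CharP F p] (hβ : β ≠ 0) :
    Algebra.IsSeparable F F' := by
  have := A.finite
  have h1 : IsSeparable F A.w := by
    set f : F[X] := X ^ p - (Polynomial.C (algebraMap K F β) * X + Polynomial.C y) with hf
    have hd : f.derivative = Polynomial.C (-algebraMap K F β) := by
      simp [hf, derivative_X_pow]
    have hs : f.Separable := by
      rw [Separable, hd]
      refine (isCoprime_one_right (x := f)).of_isCoprime_of_dvd_right ?_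
      refine IsUnit.dvd (isUnit_C.2 ?_)
      simpa using hβ
    refine hs.of_dvd (minpoly.dvd F A.w ?_)
    simp [hf, A.pow_eq]
  have h2 : IntermediateField.adjoin F {A.w} = ⊤ := by
    rw [eq_top_iff]
    intro x _
    have : x ∈ Algebra.adjoin F {A.w} := by rw [A.adjoin_w]; trivial
    exact IntermediateField.algebra_adjoin_le_adjoin _ _ this
  have h3 := (IntermediateField.isSeparable_adjoin_simple_iff_isSeparable F F').2 h1
  rw [h2] at h3
  exact Algebra.IsSeparable.of_algHom F (⊤ : IntermediateField F F')
    IntermediateField.topEquiv.symm.toAlgHom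

section crv

variable {O' : Type} [CommRing O'] [Algebra K O'] [Algebra O O'] [Algebra O' F'] [Algebra O F']
  [Algebra K F'] [IsScalarTower K F F'] [IsScalarTower O F F'] [IsScalarTower O O' F']
  [IsScalarTower K O' F'] [IsDedekindDomain O] [IsFractionRing O F]
  [IsIntegralClosure O' O F']

theorem v_norm_le (x : F') : C.v (Algebra.norm F x) ≤ A.val x := by
  classical
  have hp : p ≠ 0 := by have := A.one_lt; omega
  rw [Algebra.norm_eq_matrix_det A.B, Matrix.det_apply]
  refine C.v.map_sum_le fun σ _ => ?_
  have hs : C.v (Equiv.Perm.sign σ • ∏ i, Algebra.leftMulMatrix A.B x (σ i) i) =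
      ∏ i, C.v (Algebra.leftMulMatrix A.B x (σ i) i) := by
    rcases Int.units_eq_one_or (Equiv.Perm.sign σ) with h | h <;> simp [h, Valuation.map_neg]
  rw [hs]
  have h1 : ∀ i, C.v (Algebra.leftMulMatrix A.B x (σ i) i) ^ p * WithZero.exp ((σ i : ℕ) : ℤ) ≤
      A.val x * WithZero.exp ((i : ℕ) : ℤ) := by
    intro i
    rw [Algebra.leftMulMatrix_eq_repr_mul]
    refine (le_ν (A := A) _ _).trans_eq ?_
    rw [ν_mul, A.B_eq, ν_basis]; rfl
  have h2 := Finset.prod_le_prod' (s := Finset.univ) fun i _ => h1 i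
  rw [Finset.prod_mul_distrib, Finset.prod_mul_distrib,
    Equiv.prod_comp σ fun i : Fin p => WithZero.exp ((i : ℕ) : ℤ), Finset.prod_const,
    Finset.card_univ, Fintype.card_fin, Finset.prod_pow] at h2
  have h3 : (0 : ℤᵐ⁰) < ∏ i : Fin p, WithZero.exp ((i : ℕ) : ℤ) := by
    rw [zero_lt_iff, Finset.prod_ne_zero_iff]
    exact fun i _ => WithZero.exp_ne_zero
  have h4 := (mul_le_mul_iff_left₀ h3).1 h2
  exact (pow_le_pow_iff_left₀ zero_le zero_le hp).1 h4

/-- The affine curve attached to the extension. -/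
noncomputable def crv : Crv K O' F' where
  v := A.val
  v_const c hc := by
    rw [IsScalarTower.algebraMap_apply K F F']
    exact (ν_algebraMap _).trans (by rw [C.v_const c hc, one_pow])
  residue f hf := by
    have hp := A.one_lt
    have h0 := (le_ν (A := A) f ⟨0, by omega⟩).trans hf
    simp only [Nat.cast_zero, WithZero.exp_zero, mul_one] at h0
    obtain ⟨c, hc⟩ := C.residue _ ((pow_le_one_iff (by omega)).1 h0)
    refine ⟨c, ?_⟩
    have hr : A.B.repr (algebraMap K F' c) =
        Finsupp.single ⟨0, by omega⟩ (algebraMap K F c) := by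
      rw [IsScalarTower.algebraMap_apply K F F', Algebra.algebraMap_eq_smul_one,
        ← pow_zero A.w]
      have := A.B_eq ⟨0, by omega⟩
      simp only at this
      rw [← this, map_smul, A.B.repr_self, Finsupp.smul_single, smul_eq_mul, mul_one]
    obtain ⟨i, hi⟩ := exists_ν_eq (A := A) (f - algebraMap K F' c)
    refine lt_of_eq_of_lt hi ?_
    rw [map_sub, hr, Finsupp.sub_apply]
    by_cases h : i = ⟨0, by omega⟩
    · rw [h]
      simpa using pow_lt_one₀ zero_le hc (by omega)
    · rw [Finsupp.single_eq_of_ne h, sub_zero]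
      refine lt_of_le_of_ne ((le_ν (A := A) f i).trans hf) fun h1 => h ?_
      refine (term_injective (C := C) (f := 1) (f' := A.B.repr f i)
        (i := ⟨0, by omega⟩) one_ne_zero ?_).symm
      rw [h1]
      simp
  exists_exp_one := ⟨A.w, A.val_w⟩
  one_le b hb := by
    have := A.finite
    have hb' : algebraMap O' F' b ≠ 0 := by
      rw [Ne, ← map_zero (algebraMap O' F')]
      exact fun h => hb (IsIntegralClosure.algebraMap_injective O' O F' h)
    have h1 : IsIntegral O (Algebra.norm F (algebraMap O' F' b)) :=
      Algebra.isIntegral_norm F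
        ((IsIntegralClosure.isIntegral_iff (R := O) (A := O')).2 ⟨b, rfl⟩)
    obtain ⟨a, ha⟩ := IsIntegrallyClosed.isIntegral_iff.1 h1
    refine le_trans ?_ (A.v_norm_le _)
    rw [← ha]
    refine C.one_le a ?_
    rintro rfl
    rw [map_zero] at ha
    exact hb' (Algebra.norm_eq_zero_iff.1 ha.symm)
  exists_add := by
    have hp := A.one_lt
    have := A.finite
    obtain ⟨k, hk⟩ := C.exists_add
    obtain ⟨d, hd0, hd⟩ : ∃ d : O, d ≠ 0 ∧ IsIntegral O (algebraMap O F' d * A.w) := by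
      have : IsAlgebraic O A.w :=
        (IsFractionRing.isAlgebraic_iff O F F').2 (Algebra.IsAlgebraic.isAlgebraic _)
      obtain ⟨d, hd0, hd⟩ := this.exists_integral_multiple
      exact ⟨d, hd0, by rwa [Algebra.smul_def] at hd⟩
    have hd' : algebraMap O F d ≠ 0 := by simpa using hd0
    set δ := C.deg (algebraMap O F d) with hδ
    have hδ0 : 0 ≤ δ := by
      have := C.one_le d hd0
      rwa [C.v_eq hd', ← WithZero.exp_zero, WithZero.exp_le_exp] at this
    refine ⟨p * k + p * (p * δ) + p, fun f => ?_⟩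
    choose b hb using fun i : Fin p => hk (A.B.repr f i / algebraMap O F d ^ (i : ℕ))
    have hint : IsIntegral O (∑ i : Fin p, algebraMap O F' (b i) *
        (algebraMap O F' d * A.w) ^ (i : ℕ)) :=
      IsIntegral.sum _ fun i _ => isIntegral_algebraMap.mul (hd.pow _)
    obtain ⟨b', hb'⟩ := (IsIntegralClosure.isIntegral_iff (R := O) (A := O')).1 hint
    refine ⟨b', ?_⟩
    rw [hb']
    conv_lhs => rw [eq_sum (A := A) f]
    rw [← Finset.sum_sub_distrib]
    refine ν_sum_le (A := A) fun i _ => ?_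
    have e1 : A.B.repr f i • A.w ^ (i : ℕ) - algebraMap O F' (b i) *
        (algebraMap O F' d * A.w) ^ (i : ℕ) = ((A.B.repr f i / algebraMap O F d ^ (i : ℕ) -
          algebraMap O F (b i)) * algebraMap O F d ^ (i : ℕ)) • A.w ^ (i : ℕ) := by
      rw [sub_mul, div_mul_cancel₀ _ (pow_ne_zero _ hd'), sub_smul, mul_pow,
        IsScalarTower.algebraMap_apply O F F', IsScalarTower.algebraMap_apply O F F',
        Algebra.smul_def (_ * _), map_mul, map_pow]
      ring
    rw [e1, ν_smul, ν_basis, map_mul, mul_pow, map_pow, C.v_eq hd', ← hδ, ← WithZero.exp_nsmul,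
      ← WithZero.exp_nsmul]
    have h1 := pow_le_pow_left' (hb i) p
    rw [← WithZero.exp_nsmul] at h1
    refine (mul_le_mul_left (mul_le_mul_left h1 _) _).trans ?_
    rw [← WithZero.exp_add, ← WithZero.exp_add, WithZero.exp_le_exp]
    simp only [nsmul_eq_mul]
    have hi : ((i : ℕ) : ℤ) ≤ p := by exact_mod_cast i.2.le
    have h3 : ((i : ℕ) : ℤ) * δ ≤ p * δ := mul_le_mul_of_nonneg_right hi hδ0
    have h4 : (p : ℤ) * (((i : ℕ) : ℤ) * δ) ≤ p * (p * δ) :=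
      mul_le_mul_of_nonneg_left h3 (by positivity)
    linarith

theorem crv_v : (A.crv : Crv K O' F').v = A.val := rfl

end crv

section genus

variable {O' : Type} [CommRing O'] [Algebra K O'] [Algebra O O'] [Algebra O' F'] [Algebra O F']
  [Algebra K F'] [IsScalarTower K F F'] [IsScalarTower O F F'] [IsScalarTower O O' F']
  [IsScalarTower K O' F'] [IsDedekindDomain O] [IsFractionRing O F]
  [IsIntegralClosure O' O F'] [IsScalarTower K O F]

theorem sub_pow_eq [Fact p.Prime] [CharP F' p] (z : F) :
    (A.w - algebraMap F F' z) ^ p = algebraMap F F' (algebraMap K F β) *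
      (A.w - algebraMap F F' z) +
      algebraMap F F' (y - (z ^ p - algebraMap K F β * z)) := by
  rw [sub_pow_char, A.pow_eq]
  simp only [map_sub, map_mul, map_pow]
  ring

theorem isIntegral_mul_sub_pow [Fact p.Prime] [CharP F' p] {z : F} {e b : O}
    (h : algebraMap O F b = algebraMap O F e * (y - (z ^ p - algebraMap K F β * z))) {j : ℕ}
    (hj : j < p) :
    IsIntegral O (algebraMap O F' e * (A.w - algebraMap F F' z) ^ j) := by
  have hp := A.one_lt
  set x := A.w - algebraMap F F' z with hx
  have hOF : ∀ a, algebraMap O F' a = algebraMap F F' (algebraMap O F a) :=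
    IsScalarTower.algebraMap_apply O F F'
  have hb : algebraMap O F' b = algebraMap O F' e *
      algebraMap F F' (y - (z ^ p - algebraMap K F β * z)) := by
    rw [hOF, h, map_mul, ← hOF]
  have hβ : algebraMap F F' (algebraMap K F β) = algebraMap O F' (algebraMap K O β) := by
    rw [hOF, ← IsScalarTower.algebraMap_apply K O F]
  have hxp := A.sub_pow_eq z
  rw [← hx, hβ] at hxp
  obtain ⟨m, rfl⟩ : ∃ m, p = m + 1 := ⟨p - 1, by omega⟩
  have h1 : IsIntegral O (algebraMap O F' e * x) := by
    refine IsIntegral.of_pow_eq_mul_add hp (a := e ^ m * algebraMap K O β) (b := e ^ m * b) ?_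
    rw [mul_pow, hxp]
    simp only [map_mul, map_pow, hb]
    ring
  refine IsIntegral.of_pow (n := m + 1) (by omega) ?_
  obtain ⟨i, hi⟩ : ∃ i, m + 1 = i + j := ⟨m + 1 - j, by omega⟩
  have e1 : (algebraMap O F' e * x ^ j) ^ (m + 1) = algebraMap O F' e ^ i *
      (algebraMap O F' (algebraMap K O β) * (algebraMap O F' e * x) + algebraMap O F' b) ^ j := by
    rw [mul_pow, ← pow_mul, mul_comm j, pow_mul, hxp, hb]
    have e2 : algebraMap O F' (algebraMap K O β) * (algebraMap O F' e * x) + algebraMap O F' e *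
        algebraMap F F' (y - (z ^ (m + 1) - algebraMap K F β * z)) = algebraMap O F' e *
        (algebraMap O F' (algebraMap K O β) * x +
        algebraMap F F' (y - (z ^ (m + 1) - algebraMap K F β * z))) := by ring
    rw [e2, mul_pow, ← mul_assoc, ← pow_add, ← hi]
  rw [e1]
  exact (isIntegral_algebraMap.pow _).mul
    (((isIntegral_algebraMap.mul h1).add isIntegral_algebraMap).pow _)

variable (O') in
theorem genus_crv_le [Finite K] [Fact p.Prime] [CharP F' p] [IsDomain O'] [IsFractionRing O' F']
    (z : F) {E : Ideal O} (hE : E ≠ ⊥)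
    (h : ∀ e ∈ E, ∃ b, algebraMap O F b =
      algebraMap O F e * (y - (z ^ p - algebraMap K F β * z))) :
    (A.crv : Crv K O' F').genus ≤ C.genus + (p - 1) * (C.genus + Crv.codim K E) := by
  classical
  have hp := A.one_lt
  set C' : Crv K O' F' := A.crv with hC'
  set E' : Fin p → Ideal O := fun j => if (j : ℕ) = 0 then ⊤ else E with hE'
  set k : Fin p → ℤ := fun j => if (j : ℕ) = 0 then 0 else -1 with hk
  have hE'0 : ∀ j, E' j ≠ ⊥ := by
    intro j
    simp only [hE']
    split_ifs
    exacts [top_ne_bot, hE]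
  have hfin := fun j => C.finite_sup (hE'0 j) (k j)
  choose R hR using fun j => Submodule.exists_isCompl (Crv.emb K F (E' j) ⊔ C.L (k j))
  let T : Fin p → F →ₗ[K] F' := fun j =>
    (LinearMap.mulRight K (A.w ^ (j : ℕ))).comp (IsScalarTower.toAlgHom K F F').toLinearMap
  have hT : ∀ j f, T j f = f • A.w ^ (j : ℕ) := fun j f => by
    rw [Algebra.smul_def]; rfl
  let Ψ : (∀ j, R j) →ₗ[K] F' := LinearMap.lsum K (fun j => R j) K fun j => (T j).comp (R j).subtype
  have hΨ : ∀ j (r : R j), T j r ∈ LinearMap.range Ψ := fun j r =>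
    ⟨Pi.single j r, by simp only [Ψ, LinearMap.lsum_piSingle]; rfl⟩
  set N := Crv.emb K F' (⊤ : Ideal O') ⊔ C'.L 0 with hN
  have key : ∀ (m : ℕ) (j : Fin p), (j : ℕ) = m → ∀ f, T j f ∈ N ⊔ LinearMap.range Ψ := by
    intro m
    induction m using Nat.strong_induction_on with
    | _ m ih =>
    intro j hj f
    have hf : f ∈ (Crv.emb K F (E' j) ⊔ C.L (k j)) ⊔ R j := by
      rw [(hR j).sup_eq_top]; trivial
    obtain ⟨f', hf', r, hr, rfl⟩ := Submodule.mem_sup.1 hf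
    obtain ⟨f1, ⟨e, he, rfl⟩, l, hl, rfl⟩ := Submodule.mem_sup.1 hf'
    rw [map_add, map_add]
    refine add_mem (add_mem ?_ ?_) (Submodule.mem_sup_right (hΨ j ⟨r, hr⟩))
    · rw [hT]
      change algebraMap O F e • A.w ^ (j : ℕ) ∈ _
      have hint : IsIntegral O (algebraMap O F' e * (A.w - algebraMap F F' z) ^ (j : ℕ)) := by
        rcases eq_or_ne (j : ℕ) 0 with h0 | h0
        · rw [h0, pow_zero, mul_one]; exact isIntegral_algebraMap
        · have he' : e ∈ E := by
            have := he
            simp only [hE', h0, if_false] at this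
            exact this
          obtain ⟨b, hb⟩ := h e he'
          exact A.isIntegral_mul_sub_pow hb j.2
      obtain ⟨b', hb'⟩ := (IsIntegralClosure.isIntegral_iff (R := O) (A := O')).1 hint
      have e1 : algebraMap O F e • A.w ^ (j : ℕ) = algebraMap O' F' b' -
          ∑ i : Fin (j : ℕ), T ⟨i, i.2.trans j.2⟩
            (algebraMap O F e * ((-z) ^ ((j : ℕ) - i) * ((j : ℕ).choose i : F))) := by
        rw [hb', sub_eq_add_neg A.w, add_pow, Finset.sum_range_succ, eq_sub_iff_add_eq,
          Finset.sum_range, mul_add, Finset.mul_sum, add_comm, Algebra.smul_def,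
          IsScalarTower.algebraMap_apply O F F']
        congr 1
        · refine Finset.sum_congr rfl fun i _ => ?_
          rw [hT, Algebra.smul_def]
          simp only [map_mul, map_pow, map_neg, map_natCast]
          ring
        · simp
      rw [e1]
      refine sub_mem (Submodule.mem_sup_left (Submodule.mem_sup_left ⟨b', trivial, rfl⟩)) ?_
      exact Submodule.sum_mem _ fun i _ => ih i (by omega) _ rfl _
    · refine Submodule.mem_sup_left (Submodule.mem_sup_right ?_)
      rw [hT, Crv.mem_L, hC', crv_v]
      refine (ν_smul _ _).trans_le ?_
      rw [ν_basis]
      refine (mul_le_mul_left (pow_le_pow_left' hl p) _).trans ?_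
      rw [← WithZero.exp_nsmul, ← WithZero.exp_add, WithZero.exp_le_exp]
      simp only [hk]
      split_ifs with h0
      · simp [h0]
      · have := j.2
        simp only [nsmul_eq_mul]
        omega
  have htop : N ⊔ LinearMap.range Ψ = ⊤ := by
    rw [eq_top_iff]
    rintro x -
    rw [eq_sum (A := A) x]
    exact Submodule.sum_mem _ fun j _ => by rw [← hT]; exact key _ j rfl _
  have hsurj : LinearMap.range (N.mkQ.comp Ψ) = ⊤ := by
    rw [LinearMap.range_comp, Submodule.map_mkQ_eq_top, htop]
  have hRe : ∀ j, Module.finrank K (R j) = C.i (E' j) (k j) := fun j =>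
    ((Submodule.quotientEquivOfIsCompl _ _ (hR j)).finrank_eq).symm
  have hRf : ∀ j, Module.Finite K (R j) := fun j =>
    have : Module.Finite K (F ⧸ (Crv.emb K F (E' j) ⊔ C.L (k j))) := by
      have := hfin j; infer_instance
    Module.Finite.equiv (Submodule.quotientEquivOfIsCompl _ _ (hR j))
  have hle : C'.genus ≤ ∑ j, C.i (E' j) (k j) := by
    have h1 := LinearMap.finrank_range_le (N.mkQ.comp Ψ)
    rw [hsurj, finrank_top, Module.finrank_pi_fintype] at h1
    simp only [hRe] at h1
    exact h1
  refine hle.trans (le_of_eq ?_)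
  have hi : (C.i E (-1) : ℤ) = C.genus + Crv.codim K E := by
    have h1 := C.rr hE (-1)
    have h2 : C.l E (-1) = 0 := by
      rw [Crv.l, C.emb_top_inf_L_neg (by norm_num)]; simp
    rw [h2] at h1
    push_cast at h1
    linarith
  obtain ⟨m, rfl⟩ : ∃ m, p = m + 1 := ⟨p - 1, by omega⟩
  rw [Fin.sum_univ_succ]
  simp only [hE', hk, Fin.val_zero, if_true, Fin.val_succ, Nat.succ_ne_zero, if_false,
    Finset.sum_const, Finset.card_univ, Fintype.card_fin, smul_eq_mul, Nat.add_sub_cancel]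
  rw [show C.i E (-1) = C.genus + Crv.codim K E by exact_mod_cast hi]
  rfl

end genus

end ASData

namespace ASData

variable {K O F : Type} [Field K] [CommRing O] [Field F] [Algebra K O] [Algebra O F]
    [Algebra K F] {C : Crv K O F} {p : ℕ} {β : K} {y : F} {F' : Type} [Field F']
    [Algebra F F'] (A : ASData C p β y F')
  {O' : Type} [CommRing O'] [Algebra K O'] [Algebra O O'] [Algebra O' F'] [Algebra O F']
  [Algebra K F'] [IsScalarTower K F F'] [IsScalarTower O F F'] [IsScalarTower O O' F']
  [IsScalarTower K O' F'] [IsDedekindDomain O] [IsFractionRing O F]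
  [IsIntegralClosure O' O F'] [IsScalarTower K O F] [IsScalarTower K O O']
  [IsDedekindDomain O'] [IsFractionRing O' F'] [Module.IsTorsionFree O O']

open Polynomial in
theorem minpoly_eq [Fact p.Prime] [CharP F' p] {z : F} {b c : O} (hb : b ≠ 0) {ω : O'}
    (hω : algebraMap O' F' ω = algebraMap O F' b * (A.w - algebraMap F F' z))
    (hc : algebraMap O F c = algebraMap O F b ^ p * (y - (z ^ p - algebraMap K F β * z))) :
    Algebra.adjoin F {algebraMap O' F' ω} = ⊤ ∧
    minpoly O ω = X ^ p -
      (Polynomial.C (algebraMap K O β * b ^ (p - 1)) * X + Polynomial.C c) := by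
  have hp := A.one_lt
  have := A.finite
  have hOF : ∀ a, algebraMap O F' a = algebraMap F F' (algebraMap O F a) :=
    IsScalarTower.algebraMap_apply O F F'
  have hOO' : ∀ a, algebraMap O F' a = algebraMap O' F' (algebraMap O O' a) :=
    IsScalarTower.algebraMap_apply O O' F'
  have hβO : algebraMap F F' (algebraMap K F β) = algebraMap O F' (algebraMap K O β) := by
    rw [hOF, ← IsScalarTower.algebraMap_apply K O F]
  have hb' : algebraMap O F b ≠ 0 := by simpa using hb
  have hadj : Algebra.adjoin F {algebraMap O' F' ω} = ⊤ := by
    rw [eq_top_iff, ← A.adjoin_w, Algebra.adjoin_le_iff, Set.singleton_subset_iff]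
    have h1 : A.w = (algebraMap O F b)⁻¹ • algebraMap O' F' ω + algebraMap F F' z := by
      rw [hω, Algebra.smul_def, hOF, ← mul_assoc, ← map_mul, inv_mul_cancel₀ hb', map_one, one_mul,
        sub_add_cancel]
    rw [h1]
    exact add_mem (Subalgebra.smul_mem _ (Algebra.self_mem_adjoin_singleton _ _) _)
      (Subalgebra.algebraMap_mem _ _)
  set f : O[X] := X ^ p - (Polynomial.C (algebraMap K O β * b ^ (p - 1)) * X + Polynomial.C c)
    with hf
  have hlin : (Polynomial.C (algebraMap K O β * b ^ (p - 1)) * X + Polynomial.C c).degree <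
      (p : WithBot ℕ) := by
    refine (degree_linear_le).trans_lt ?_
    exact_mod_cast hp
  have hfm : f.Monic := monic_X_pow_sub hlin
  have hfd : f.natDegree = p := by
    refine natDegree_eq_of_degree_eq_some ?_
    rw [hf, degree_sub_eq_left_of_degree_lt (by rwa [degree_X_pow]), degree_X_pow]
  have hω0 : aeval ω f = 0 := by
    apply IsIntegralClosure.algebraMap_injective O' O F'
    rw [← aeval_algebraMap_apply, map_zero, hω]
    simp only [hf, map_sub, map_add, map_mul, map_pow, aeval_X, aeval_C]
    have h1 := A.sub_pow_eq z
    have h2 : algebraMap O F' c = algebraMap O F' b ^ p *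
        algebraMap F F' (y - (z ^ p - algebraMap K F β * z)) := by
      rw [hOF, hc, map_mul, map_pow, ← hOF]
    have h3 : algebraMap O F' b ^ p = algebraMap O F' b ^ (p - 1) * algebraMap O F' b := by
      rw [← pow_succ, Nat.sub_add_cancel hp.le]
    rw [mul_pow, h1, h2, hβO, h3]
    ring
  refine ⟨hadj, Eq.symm ?_⟩
  · refine IsIntegrallyClosed.minpoly.unique hfm hω0 fun Q hQ hQ0 => ?_
    have h1 : (minpoly F (algebraMap O' F' ω)).natDegree = p := by
      have h2 : IntermediateField.adjoin F {algebraMap O' F' ω} = ⊤ := by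
        rw [eq_top_iff]
        intro x _
        refine IntermediateField.algebra_adjoin_le_adjoin _ _ ?_
        rw [hadj]; trivial
      rw [← A.finrank_eq, ← IntermediateField.finrank_top', ← h2,
        IntermediateField.adjoin.finrank (Algebra.IsIntegral.isIntegral _)]
    have h3 : minpoly F (algebraMap O' F' ω) ∣ Q.map (algebraMap O F) := by
      refine minpoly.dvd _ _ ?_
      rw [aeval_map_algebraMap, aeval_algebraMap_apply, hQ0, map_zero]
    have h4 := natDegree_le_of_dvd h3 (hQ.map _).ne_zero
    rw [h1, hQ.natDegree_map] at h4
    rw [degree_eq_natDegree hfm.ne_zero, degree_eq_natDegree hQ.ne_zero, hfd]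
    exact_mod_cast h4

open Polynomial in
theorem conductor_mul_differentIdeal (A : ASData C p β y F') [Fact p.Prime] [CharP F p]
    [CharP F' p] (hβ : β ≠ 0)
    {z : F} {b c : O} (hb : b ≠ 0) {ω : O'}
    (hω : algebraMap O' F' ω = algebraMap O F' b * (A.w - algebraMap F F' z))
    (hc : algebraMap O F c = algebraMap O F b ^ p * (y - (z ^ p - algebraMap K F β * z))) :
    conductor O ω * differentIdeal O O' =
      Ideal.span {algebraMap O O' (algebraMap K O β * b ^ (p - 1))} := by
  have := A.finite
  have := A.isSeparable hβ
  obtain ⟨hadj, hmin⟩ := A.minpoly_eq hb hω hc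
  have hCO : CharP O p := (algebraMap O F).charP (IsFractionRing.injective O F) p
  rw [_root_.conductor_mul_differentIdeal O F F' ω hadj, hmin]
  have : (X ^ p - (Polynomial.C (algebraMap K O β * b ^ (p - 1)) * X +
      Polynomial.C c)).derivative = -Polynomial.C (algebraMap K O β * b ^ (p - 1)) := by
    generalize algebraMap K O β * b ^ (p - 1) = u
    simp [derivative_X_pow]
  rw [this, map_neg, aeval_C, Ideal.span_singleton_neg]

end ASData

namespace IsDedekindDomain.HeightOneSpectrum

variable {O F O' F' : Type} [CommRing O] [IsDedekindDomain O] [Field F] [Algebra O F]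
  [IsFractionRing O F] [CommRing O'] [IsDedekindDomain O'] [Field F'] [Algebra O' F']
  [IsFractionRing O' F'] [Algebra O O'] [Algebra F F'] [Algebra O F'] [IsScalarTower O F F']
  [IsScalarTower O O' F']

theorem valuation_algebraMap_eq_one {P : HeightOneSpectrum O} {P' : HeightOneSpectrum O'}
    (h : P'.asIdeal.comap (algebraMap O O') = P.asIdeal) {f : F} (hf : P.valuation F f = 1) :
    P'.valuation F' (algebraMap F F' f) = 1 := by
  have hmem : ∀ a : O, a ∉ P.asIdeal →
      P'.valuation F' (algebraMap F F' (algebraMap O F a)) = 1 := by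
    intro a ha
    rw [← IsScalarTower.algebraMap_apply O F F', IsScalarTower.algebraMap_apply O O' F',
      valuation_eq_one_iff_notMem]
    intro h1
    apply ha
    rw [← h]
    exact h1
  obtain ⟨a, s, hs⟩ := P.exists_primeCompl_mul_eq_of_integer f hf.le
  have hs' : (s : O) ∉ P.asIdeal := s.2
  have ha : a ∉ P.asIdeal := by
    rw [← P.valuation_eq_one_iff_notMem (K := F), ← hs, map_mul, hf,
      (P.valuation_eq_one_iff_notMem (K := F)).2 hs', one_mul]
  have h1 := hmem a ha
  rw [← hs, map_mul, map_mul, hmem _ hs'] at h1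
  simpa using h1

theorem exists_valuation_algebraMap_eq_pow (F F' : Type) [Field F] [Algebra O F]
    [IsFractionRing O F] [Field F'] [Algebra O' F'] [IsFractionRing O' F'] [Algebra F F']
    [Algebra O F'] [IsScalarTower O F F'] [IsScalarTower O O' F']
    {P : HeightOneSpectrum O} {P' : HeightOneSpectrum O'}
    (h : P'.asIdeal.comap (algebraMap O O') = P.asIdeal) :
    ∃ e : ℕ, e ≠ 0 ∧ (∀ f : F, P'.valuation F' (algebraMap F F' f) = P.valuation F f ^ e) ∧
      P.asIdeal.map (algebraMap O O') ≤ P'.asIdeal ^ e := by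
  obtain ⟨π, hπ⟩ := P.intValuation_exists_uniformizer
  have hπP : π ∈ P.asIdeal := by
    rw [← P.intValuation_lt_one_iff_mem, hπ, ← WithZero.exp_zero, WithZero.exp_lt_exp]
    norm_num
  have hπ0 : algebraMap O F π ≠ 0 := by
    intro h0
    have : π = 0 := by simpa using h0
    rw [this, map_zero] at hπ
    exact WithZero.exp_ne_zero hπ.symm
  have hv : P.valuation F (algebraMap O F π) = WithZero.exp (-1) := by
    rw [valuation_of_algebraMap, hπ]
  have hv'0 : P'.valuation F' (algebraMap F F' (algebraMap O F π)) ≠ 0 := by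
    simpa using hπ0
  have hv'1 : P'.valuation F' (algebraMap F F' (algebraMap O F π)) < 1 := by
    rw [← IsScalarTower.algebraMap_apply O F F', IsScalarTower.algebraMap_apply O O' F',
      valuation_lt_one_iff_mem]
    exact Ideal.mem_comap.1 (h ▸ hπP)
  obtain ⟨k, hk⟩ : ∃ k : ℤ, P'.valuation F' (algebraMap F F' (algebraMap O F π)) = WithZero.exp k :=
    ⟨_, (WithZero.exp_log hv'0).symm⟩
  rw [hk, ← WithZero.exp_zero, WithZero.exp_lt_exp] at hv'1
  obtain ⟨e, rfl⟩ : ∃ e : ℕ, k = -e := ⟨k.natAbs, by omega⟩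
  have key : ∀ f : F, P'.valuation F' (algebraMap F F' f) = P.valuation F f ^ e := by
    intro f
    by_cases hf : f = 0
    · simp [hf, show e ≠ 0 by omega]
    have hf0 : P.valuation F f ≠ 0 := by simpa using hf
    obtain ⟨m, hm⟩ : ∃ m : ℤ, P.valuation F f = WithZero.exp m := ⟨_, (WithZero.exp_log hf0).symm⟩
    have h1 : P.valuation F (f * algebraMap O F π ^ m) = 1 := by
      rw [map_mul, map_zpow₀, hv, hm, ← WithZero.exp_zsmul, ← WithZero.exp_add]
      simp
    have h2 := valuation_algebraMap_eq_one (F' := F') h h1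
    rw [map_mul, map_mul, map_zpow₀, map_zpow₀, hk, ← WithZero.exp_zsmul] at h2
    rw [(eq_mul_inv_iff_mul_eq₀ WithZero.exp_ne_zero).2 h2, hm, one_mul, ← WithZero.exp_neg,
      ← WithZero.exp_nsmul]
    congr 1
    simp [mul_comm]
  refine ⟨e, by omega, key, ?_⟩
  rw [Ideal.map_le_iff_le_comap]
  intro x hx
  rw [Ideal.mem_comap, ← intValuation_le_pow_iff_mem, ← valuation_of_algebraMap (K := F')]
  change P'.valuation F' (algebraMap O' F' (algebraMap O O' x)) ≤ _
  rw [← IsScalarTower.algebraMap_apply, IsScalarTower.algebraMap_apply O F F', key]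
  have : P.valuation F (algebraMap O F x) ≤ WithZero.exp (-((1 : ℕ) : ℤ)) := by
    rw [valuation_of_algebraMap, intValuation_le_pow_iff_mem, pow_one]
    exact hx
  calc _ ≤ WithZero.exp (-((1 : ℕ) : ℤ)) ^ e := by gcongr
    _ = _ := by rw [← WithZero.exp_nsmul]; congr 1; simp

end IsDedekindDomain.HeightOneSpectrum

namespace Crv

variable {K O F O' F' : Type} [Field K] [CommRing O] [IsDedekindDomain O] [Field F] [Algebra K O]
  [Algebra O F] [Algebra K F] [IsScalarTower K O F] [IsFractionRing O F] [Finite K]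
  [CommRing O'] [IsDedekindDomain O'] [Field F'] [Algebra K O'] [Algebra O' F'] [Algebra K F']
  [IsScalarTower K O' F'] [IsFractionRing O' F'] [Algebra O O'] [Algebra F F'] [Algebra O F']
  [IsScalarTower O F F'] [IsScalarTower O O' F'] [IsScalarTower K O O']

set_option linter.deprecated false in
theorem codim_map [Module.Finite O O'] (P : Ideal O) [P.IsMaximal] :
    codim K (P.map (algebraMap O O')) = codim K P * Module.finrank F F' := by
  let := Ideal.Quotient.field P
  rw [← Ideal.finrank_quotient_map (S := O') P F F']
  have : IsScalarTower K (O ⧸ P) (O' ⧸ P.map (algebraMap O O')) := by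
    refine IsScalarTower.of_algebraMap_eq fun r => ?_
    change Ideal.Quotient.mk _ (algebraMap K O' r) =
      Ideal.Quotient.mk _ (algebraMap O O' (algebraMap K O r))
    rw [← IsScalarTower.algebraMap_apply]
  exact (Module.finrank_mul_finrank K (O ⧸ P) (O' ⧸ P.map (algebraMap O O'))).symm

theorem codim_le_of_comap (C' : Crv K O' F') {P : Ideal O} {P' : Ideal O'} (hP' : P' ≠ ⊥)
    (h : P'.comap (algebraMap O O') = P) : codim K P ≤ codim K P' := by
  have := C'.finite_quotient hP'
  refine LinearMap.finrank_le_finrank_of_injective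
    (f := (Ideal.quotientMapₐ P' (IsScalarTower.toAlgHom K O O') h.ge).toLinearMap) ?_
  exact Ideal.quotientMap_injective' (H := h.ge) h.le

theorem codim_pow (C : Crv K O F) {I : Ideal O} (hI : I ≠ ⊥) (m : ℕ) :
    codim K (I ^ m) = m * codim K I := by
  induction m with
  | zero => rw [pow_zero, Ideal.one_eq_top, codim_top, zero_mul]
  | succ m ih => rw [pow_succ, C.codim_mul (pow_ne_zero _ hI) hI, ih]; ring

theorem codim_prod (C : Crv K O F) {ι : Type*} (s : Finset ι) {I : ι → Ideal O}
    (hI : ∀ i ∈ s, I i ≠ ⊥) : codim K (∏ i ∈ s, I i) = ∑ i ∈ s, codim K (I i) := by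
  classical
  induction s using Finset.induction_on with
  | empty => simp [Ideal.one_eq_top, codim_top]
  | insert a s ha ih =>
    rw [Finset.prod_insert ha, Finset.sum_insert ha, C.codim_mul (hI _ (by simp)), ih]
    · exact fun i hi => hI i (by simp [hi])
    · exact Finset.prod_ne_zero_iff.2 fun i hi => hI i (by simp [hi])

theorem sum_codim_le [Module.Finite O O'] [Module.IsTorsionFree O O'] (C' : Crv K O' F')
    (P : HeightOneSpectrum O) {m : ℕ} (T : Finset (HeightOneSpectrum O'))
    (hT : ∀ P' ∈ T, P.asIdeal.map (algebraMap O O') ≤ P'.asIdeal ^ m) :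
    m * ∑ P' ∈ T, codim K P'.asIdeal ≤ codim K P.asIdeal * Module.finrank F F' := by
  have := P.isMaximal
  rw [← codim_map (O' := O') P.asIdeal, Finset.mul_sum]
  have h0 : P.asIdeal.map (algebraMap O O') ≠ ⊥ :=
    (Ideal.map_eq_bot_iff_of_injective (FaithfulSMul.algebraMap_injective O O')).not.2 P.ne_bot
  have h1 : P.asIdeal.map (algebraMap O O') ≤ ∏ P' ∈ T, P'.asIdeal ^ m := by
    rw [← Ideal.dvd_iff_le]
    refine Finset.prod_dvd_of_coprime ?_ fun P' hP' => Ideal.dvd_iff_le.2 (hT P' hP')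
    intro P₁ _ P₂ _ hne
    refine IsCoprime.pow ?_
    rw [Ideal.isCoprime_iff_sup_eq]
    have := P₁.isMaximal
    have := P₂.isMaximal
    exact Ideal.IsMaximal.coprime_of_ne ‹_› ‹_› fun h => hne (HeightOneSpectrum.ext h)
  refine le_trans (le_of_eq ?_) (C'.codim_le h0 h1)
  rw [C'.codim_prod _ fun P' _ => pow_ne_zero _ P'.ne_bot]
  exact Finset.sum_congr rfl fun P' _ => (C'.codim_pow P'.ne_bot m).symm

end Crv

namespace ASData

variable {K O F : Type} [Field K] [CommRing O] [Field F] [Algebra K O] [Algebra O F]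
    [Algebra K F] {C : Crv K O F} {p : ℕ} {β : K} {y : F} {F' : Type} [Field F']
    [Algebra F F'] (A : ASData C p β y F')
  {O' : Type} [CommRing O'] [Algebra K O'] [Algebra O O'] [Algebra O' F'] [Algebra O F']
  [Algebra K F'] [IsScalarTower K F F'] [IsScalarTower O F F'] [IsScalarTower O O' F']
  [IsScalarTower K O' F'] [IsDedekindDomain O] [IsFractionRing O F]
  [IsIntegralClosure O' O F'] [IsScalarTower K O F] [IsScalarTower K O O']
  [IsDedekindDomain O'] [IsFractionRing O' F'] [Module.IsTorsionFree O O']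

theorem finite_integralClosure (A : ASData C p β y F') [CharP F p] (hβ : β ≠ 0) :
    Module.Finite O O' := by
  have := A.finite
  have := A.isSeparable hβ
  exact IsIntegralClosure.finite O F F' O'

theorem exists_integral_mul_sub [Fact p.Prime] [CharP F' p] {z : F} {b c : O}
    (h : algebraMap O F c = algebraMap O F b * (y - (z ^ p - algebraMap K F β * z))) :
    ∃ ω : O', algebraMap O' F' ω = algebraMap O F' b * (A.w - algebraMap F F' z) := by
  have := A.isIntegral_mul_sub_pow h (j := 1) A.one_lt
  rw [pow_one] at this
  exact (IsIntegralClosure.isIntegral_iff (R := O)).1 this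

theorem valuation_eq_of_sub_le (A : ASData C p β y F') [Fact p.Prime] [CharP F p] [CharP F' p]
   (hβ : β ≠ 0)
    {P : HeightOneSpectrum O} {P' : HeightOneSpectrum O'}
    (h : P'.asIdeal.comap (algebraMap O O') = P.asIdeal) {z : F}
    (hz : P.valuation F (y - (z ^ p - algebraMap K F β * z)) ≤ 1) (f : F) :
    P'.valuation F' (algebraMap F F' f) = P.valuation F f := by
  have hp := A.one_lt
  have := A.finite
  have := A.isSeparable hβ
  have := A.finite_integralClosure hβ (O' := O')
  obtain ⟨e, he0, he, hmap⟩ := HeightOneSpectrum.exists_valuation_algebraMap_eq_pow F F' h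
  suffices e = 1 by rw [he, this, pow_one]
  by_contra he1
  obtain ⟨c, b, hb⟩ := P.exists_primeCompl_mul_eq_of_integer _ hz
  have hbP : (b : O) ∉ P.asIdeal := b.2
  have hb0 : (b : O) ≠ 0 := fun h0 => hbP (h0 ▸ P.asIdeal.zero_mem)
  rw [mul_comm] at hb
  obtain ⟨ω, hω⟩ := A.exists_integral_mul_sub (O' := O') hb.symm
  have hcond := A.conductor_mul_differentIdeal hβ hb0 hω
    (c := (b : O) ^ (p - 1) * c) (by
      rw [map_mul, ← hb, map_pow, ← mul_assoc, ← pow_succ, Nat.sub_add_cancel hp.le])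
  have := P.isMaximal
  have h1 := pow_sub_one_dvd_differentIdeal_aux O F F' (p := P.asIdeal) P'.asIdeal he0 P.ne_bot
    (Ideal.dvd_iff_le.2 hmap)
  have h2 : algebraMap O O' (algebraMap K O β * (b : O) ^ (p - 1)) ∈ P'.asIdeal := by
    have h3 : algebraMap O O' (algebraMap K O β * (b : O) ^ (p - 1)) ∈
        conductor O ω * differentIdeal O O' := by
      rw [hcond]; exact Ideal.mem_span_singleton_self _
    exact Ideal.pow_le_self (by omega : e - 1 ≠ 0) (Ideal.le_of_dvd h1 (Ideal.mul_le_right h3))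
  have h3 : algebraMap K O β * (b : O) ^ (p - 1) ∈ P.asIdeal := by
    exact h.le h2
  rcases P.isPrime.mem_or_mem h3 with h4 | h4
  · exact P.isPrime.ne_top (Ideal.eq_top_of_isUnit_mem _ h4
      ((isUnit_iff_ne_zero.2 hβ).map (algebraMap K O)))
  · exact hbP (P.isPrime.mem_of_pow_mem _ h4)

theorem valuation_w_of_exp_one [Finite K] [Fact p.Prime] [CharP F p] (hβ : β ≠ 0)
    {P : HeightOneSpectrum O} {P' : HeightOneSpectrum O'}
    (h : P'.asIdeal.comap (algebraMap O O') = P.asIdeal)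
    (hy : P.valuation F y = WithZero.exp 1) :
    P'.valuation F' A.w = WithZero.exp 1 ∧ P.asIdeal.map (algebraMap O O') ≤ P'.asIdeal ^ p := by
  have hp := A.one_lt
  have := A.finite
  have := A.isSeparable hβ
  have := A.finite_integralClosure hβ (O' := O')
  obtain ⟨e, he0, he, hmap⟩ := HeightOneSpectrum.exists_valuation_algebraMap_eq_pow F F' h
  have C' : Crv K O' F' := A.crv
  have hle : e ≤ p := by
    have h1 := C'.sum_codim_le (F := F) P {P'} (m := e) (by simpa using hmap)
    rw [Finset.sum_singleton, A.finrank_eq, mul_comm] at h1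
    have h2 : Crv.codim K P.asIdeal ≤ Crv.codim K P'.asIdeal := C'.codim_le_of_comap P'.ne_bot h
    have h3 : 0 < Crv.codim K P.asIdeal := Nat.pos_of_ne_zero fun h0 =>
      P.isPrime.ne_top (C.eq_top_of_codim_eq_zero P.ne_bot h0)
    by_contra! hlt
    nlinarith
  have hv' : P'.valuation F' (algebraMap F F' y) = WithZero.exp (e : ℤ) := by
    rw [he, hy, ← WithZero.exp_nsmul]; simp
  have hβ' : P'.valuation F' (algebraMap F F' (algebraMap K F β)) ≤ 1 := by
    rw [IsScalarTower.algebraMap_apply K O F, ← IsScalarTower.algebraMap_apply O F F',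
      IsScalarTower.algebraMap_apply O O' F']
    exact P'.valuation_le_one _
  have hpow := A.pow_eq
  have hy1 : 1 < P'.valuation F' (algebraMap F F' y) := by
    rw [hv', ← WithZero.exp_zero, WithZero.exp_lt_exp]; omega
  have hw1 : 1 < P'.valuation F' A.w := by
    by_contra! hle1
    refine absurd ?_ hy1.not_ge
    have : algebraMap F F' y = A.w ^ p - algebraMap F F' (algebraMap K F β) * A.w := by
      rw [hpow]; ring
    rw [this]
    refine (Valuation.map_sub _ _ _).trans (max_le ?_ ?_)
    · rw [map_pow]; exact pow_le_one₀ zero_le hle1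
    · rw [map_mul]; exact mul_le_one₀ hβ' zero_le hle1
  have hwp : P'.valuation F' A.w ^ p = WithZero.exp (e : ℤ) := by
    rw [← hv', ← map_pow]
    have : algebraMap F F' y = A.w ^ p - algebraMap F F' (algebraMap K F β) * A.w := by
      rw [hpow]; ring
    rw [this]
    refine (Valuation.map_sub_eq_of_lt_left _ ?_).symm
    rw [map_mul, map_pow]
    calc _ ≤ P'.valuation F' A.w := mul_le_of_le_one_left' hβ'
      _ < _ := lt_self_pow₀ hw1 hp
  have hw0 : P'.valuation F' A.w ≠ 0 := (zero_lt_one.trans hw1).ne'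
  obtain ⟨m, hm⟩ : ∃ m : ℤ, P'.valuation F' A.w = WithZero.exp m := ⟨_, (WithZero.exp_log hw0).symm⟩
  rw [hm, ← WithZero.exp_nsmul] at hwp
  have hwp' := WithZero.exp_injective' hwp
  rw [nsmul_eq_mul] at hwp'
  have hm1 : m = 1 := by
    have : (0:ℤ) < m := by
      by_contra! hneg
      have : (p:ℤ) * m ≤ 0 := by nlinarith
      omega
    nlinarith
  subst hm1
  refine ⟨hm, ?_⟩
  have : p = e := by zify; linarith
  rw [this]; exact hmap

end ASData

/-- The field element `f` is regular at the point `φ` and takes the value `t` there. -/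
def Ev {K O L : Type} (F : Type) [Field K] [CommRing O] [Field F] [Field L] [Algebra K O]
   [Algebra O F]
    [Algebra K L] (φ : O →ₐ[K] L) (f : F) (t : L) : Prop :=
  ∃ a b : O, φ b ≠ 0 ∧ algebraMap O F b * f = algebraMap O F a ∧ φ a = φ b * t

namespace Ev

variable {K O F L : Type} [Field K] [CommRing O] [Field F] [Field L] [Algebra K O] [Algebra O F]
    [Algebra K L] {φ : O →ₐ[K] L} {f g : F} {s t : L}

theorem of_mem (a : O) : Ev F φ (algebraMap O F a) (φ a) :=
  ⟨a, 1, by simp, by simp, by simp⟩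

theorem const [Algebra K F] [IsScalarTower K O F] (c : K) :
    Ev F φ (algebraMap K F c) (algebraMap K L c) := by
  have := Ev.of_mem (F := F) (φ := φ) (algebraMap K O c)
  rwa [← IsScalarTower.algebraMap_apply, φ.commutes] at this

theorem add (hf : Ev F φ f s) (hg : Ev F φ g t) : Ev F φ (f + g) (s + t) := by
  obtain ⟨a, b, hb, h1, h2⟩ := hf
  obtain ⟨a', b', hb', h1', h2'⟩ := hg
  refine ⟨a * b' + a' * b, b * b', by simp [hb, hb'], ?_, ?_⟩
  · simp only [map_mul, map_add, ← h1, ← h1']; ring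
  · simp only [map_mul, map_add, h2, h2']; ring

theorem mul (hf : Ev F φ f s) (hg : Ev F φ g t) : Ev F φ (f * g) (s * t) := by
  obtain ⟨a, b, hb, h1, h2⟩ := hf
  obtain ⟨a', b', hb', h1', h2'⟩ := hg
  refine ⟨a * a', b * b', by simp [hb, hb'], ?_, ?_⟩
  · simp only [map_mul, ← h1, ← h1']; ring
  · simp only [map_mul, h2, h2']; ring

theorem neg (hf : Ev F φ f s) : Ev F φ (-f) (-s) := by
  obtain ⟨a, b, hb, h1, h2⟩ := hf
  exact ⟨-a, b, hb, by simp [h1], by simp [h2]⟩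

theorem sub (hf : Ev F φ f s) (hg : Ev F φ g t) : Ev F φ (f - g) (s - t) := by
  simpa [sub_eq_add_neg] using hf.add hg.neg

theorem pow (hf : Ev F φ f s) (n : ℕ) : Ev F φ (f ^ n) (s ^ n) := by
  induction n with
  | zero => simpa using Ev.of_mem (F := F) (φ := φ) (1 : O)
  | succ n ih => rw [pow_succ, pow_succ]; exact ih.mul hf

theorem inv [FaithfulSMul O F] (hf : Ev F φ f s) (hs : s ≠ 0) : Ev F φ f⁻¹ s⁻¹ := by
  obtain ⟨a, b, hb, h1, h2⟩ := hf
  have ha : φ a ≠ 0 := by rw [h2]; exact mul_ne_zero hb hs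
  have hf0 : f ≠ 0 := by
    rintro rfl
    rw [mul_zero, eq_comm] at h1
    have : a = 0 := (FaithfulSMul.algebraMap_injective O F) (by rw [h1, map_zero])
    simp [this] at ha
  refine ⟨b, a, ha, ?_, ?_⟩
  · rw [← h1]; field_simp
  · rw [h2]; field_simp

theorem unique [FaithfulSMul O F] (hf : Ev F φ f s) (hg : Ev F φ f t) : s = t := by
  obtain ⟨a, b, hb, h1, h2⟩ := hf
  obtain ⟨a', b', hb', h1', h2'⟩ := hg
  have h3 : a * b' = a' * b := by
    apply FaithfulSMul.algebraMap_injective O F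
    rw [map_mul, map_mul, ← h1, ← h1']; ring
  have h4 := congrArg φ h3
  rw [map_mul, map_mul, h2, h2'] at h4
  have : φ b * φ b' * (s - t) = 0 := by linear_combination h4
  simpa [hb, hb', sub_eq_zero] using this

theorem map {O' F' : Type} [CommRing O'] [Field F'] [Algebra K O'] [Algebra O' F'] [Algebra O O']
    [Algebra F F'] [Algebra O F'] [IsScalarTower O F F'] [IsScalarTower O O' F']
    {φ' : O' →ₐ[K] L} (hφ : ∀ a, φ' (algebraMap O O' a) = φ a) (hf : Ev F φ f s) :
    Ev F' φ' (algebraMap F F' f) s := by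
  obtain ⟨a, b, hb, h1, h2⟩ := hf
  refine ⟨algebraMap O O' a, algebraMap O O' b, by rwa [hφ], ?_, by rw [hφ, hφ, h2]⟩
  rw [← IsScalarTower.algebraMap_apply, ← IsScalarTower.algebraMap_apply,
    IsScalarTower.algebraMap_apply O F F', IsScalarTower.algebraMap_apply O F F', ← map_mul, h1]

theorem exists_of_valuation_le_one [IsDedekindDomain O] [IsFractionRing O F]
    {P : HeightOneSpectrum O} (hP : P.asIdeal = RingHom.ker φ) (hf : P.valuation F f ≤ 1) :
    ∃ t, Ev F φ f t := by
  obtain ⟨a, b, hb⟩ := P.exists_primeCompl_mul_eq_of_integer f hf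
  have hb' : φ b ≠ 0 := by
    have h1 : (b : O) ∉ P.asIdeal := b.2
    have h2 : (b : O) ∉ RingHom.ker φ := fun h => h1 (hP.ge h)
    exact h2
  exact ⟨φ a / φ b, a, b, hb', by rw [← hb, mul_comm], by field_simp⟩

end Ev

namespace ASData

variable {K O F : Type} [Field K] [CommRing O] [Field F] [Algebra K O] [Algebra O F]
    [Algebra K F] {C : Crv K O F} {p : ℕ} {β : K} {y : F} {F' : Type} [Field F']
    [Algebra F F'] (A : ASData C p β y F')
  {O' : Type} [CommRing O'] [Algebra K O'] [Algebra O O'] [Algebra O' F'] [Algebra O F']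
  [Algebra K F'] [IsScalarTower K F F'] [IsScalarTower O F F'] [IsScalarTower O O' F']
  [IsScalarTower K O' F'] [IsDedekindDomain O] [IsFractionRing O F]
  [IsIntegralClosure O' O F'] [IsScalarTower K O F] [IsScalarTower K O O']
  [IsDedekindDomain O'] [IsFractionRing O' F'] [Module.IsTorsionFree O O']
  {L : Type} [Field L] [Algebra K L]

open Polynomial in
theorem exists_conductor_data (A : ASData C p β y F') [Fact p.Prime] [CharP F p] [CharP F' p]
    (hβ : β ≠ 0) {φ : O →ₐ[K] L} {η θ : L} (hη : Ev F φ y η)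
    (hθ : θ ^ p = algebraMap K L β * θ + η) :
    ∃ (b D : O) (ω : O'), φ b ≠ 0 ∧ φ D ≠ 0 ∧ algebraMap O' F' ω = algebraMap O F' b * A.w ∧
      (∀ s : O', ∃ Q : O[X], algebraMap O O' D * s = aeval ω Q) ∧
      (∀ Q : O[X], aeval ω Q = 0 → Q.eval₂ (φ : O →+* L) (φ b * θ) = 0) := by
  have hp := A.one_lt
  obtain ⟨a, b, hb, h1, h2⟩ := hη
  have hb0 : b ≠ 0 := fun h => hb (by rw [h, map_zero])
  have h3 : algebraMap O F a = algebraMap O F b * (y - (0 ^ p - algebraMap K F β * 0)) := by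
    rw [zero_pow (by omega), mul_zero, sub_zero, sub_zero, h1]
  obtain ⟨ω, hω⟩ := A.exists_integral_mul_sub (O' := O') h3
  have hc : algebraMap O F (b ^ (p - 1) * a) =
      algebraMap O F b ^ p * (y - (0 ^ p - algebraMap K F β * 0)) := by
    rw [map_mul, h3, map_pow, ← mul_assoc, ← pow_succ, Nat.sub_add_cancel hp.le]
  have hcond := A.conductor_mul_differentIdeal hβ hb0 hω hc
  obtain ⟨-, hmin⟩ := A.minpoly_eq hb0 hω hc
  refine ⟨b, algebraMap K O β * b ^ (p - 1), ω, hb, ?_, ?_, fun s => ?_, fun Q hQ => ?_⟩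
  · rw [map_mul, φ.commutes, map_pow]
    exact mul_ne_zero (by simpa using hβ) (pow_ne_zero _ hb)
  · rw [hω, map_zero, sub_zero]
  · have h4 : algebraMap O O' (algebraMap K O β * b ^ (p - 1)) ∈ conductor O ω :=
      Ideal.mul_le_left (hcond.ge (Ideal.mem_span_singleton_self _))
    have h5 := mem_conductor_iff.1 h4 s
    rw [Algebra.adjoin_singleton_eq_range_aeval] at h5
    obtain ⟨Q, hQ⟩ := h5
    exact ⟨Q, hQ.symm⟩
  · have : IsIntegral O ω := IsIntegralClosure.isIntegral O F' ω
    obtain ⟨R, rfl⟩ := minpoly.isIntegrallyClosed_dvd this hQ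
    rw [eval₂_mul, hmin]
    simp only [eval₂_sub, eval₂_add, eval₂_mul, eval₂_pow, eval₂_X, eval₂_C, RingHom.coe_coe,
      map_mul, map_pow, φ.commutes, mul_pow, hθ, h2]
    obtain ⟨m, rfl⟩ : ∃ m, p = m + 1 := ⟨p - 1, by omega⟩
    rw [Nat.add_sub_cancel]
    ring

open Polynomial in
theorem exists_hom (A : ASData C p β y F') [Fact p.Prime] [CharP F p] [CharP F' p]
    (hβ : β ≠ 0) {φ : O →ₐ[K] L} {η θ : L} (hη : Ev F φ y η)
    (hθ : θ ^ p = algebraMap K L β * θ + η) :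
    ∃ φ' : O' →ₐ[K] L, (∀ a, φ' (algebraMap O O' a) = φ a) ∧ Ev F' φ' A.w θ := by
  obtain ⟨b, D, ω, hb, hD, hω, hrep, hker⟩ := A.exists_conductor_data (O' := O') hβ hη hθ
  choose Q hQ using hrep
  set ev : O[X] →+* L := eval₂RingHom (φ : O →+* L) (φ b * θ) with hev
  have hwd : ∀ Q₁ Q₂ : O[X], aeval ω Q₁ = aeval ω Q₂ → ev Q₁ = ev Q₂ := fun Q₁ Q₂ h => by
    rw [← sub_eq_zero, ← map_sub]
    exact hker _ (by rw [map_sub, h, sub_self])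
  have hval : ∀ (s : O') (R : O[X]), algebraMap O O' D * s = aeval ω R → ev (Q s) = ev R :=
    fun s R h => hwd _ _ (by rw [← hQ, h])
  have hevC : ∀ a, ev (Polynomial.C a) = φ a := fun a => by simp [hev]
  have hbase : ∀ a : O, ev (Q (algebraMap O O' a)) = φ D * φ a := fun a => by
    rw [hval _ (Polynomial.C (D * a)) (by simp), hevC, map_mul]
  let φ' : O' →ₐ[K] L :=
    { toFun := fun s => ev (Q s) / φ D
      map_one' := by
        have := hbase 1
        rw [map_one, map_one, mul_one] at this
        rw [this, div_self hD]
      map_mul' := fun s t => by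
        have h := hwd (Polynomial.C D * Q (s * t)) (Q s * Q t) (by
          rw [map_mul, map_mul, aeval_C, ← hQ, ← hQ, ← hQ]; ring)
        rw [map_mul, map_mul, hevC] at h
        field_simp
        linear_combination h
      map_zero' := by
        have := hbase 0
        rw [map_zero, map_zero, mul_zero] at this
        rw [this, zero_div]
      map_add' := fun s t => by
        rw [hval (s + t) (Q s + Q t) (by rw [map_add, ← hQ, ← hQ]; ring), map_add, add_div]
      commutes' := fun c => by
        rw [IsScalarTower.algebraMap_apply K O O', hbase, φ.commutes]
        field_simp }
  have hφ' : ∀ a, φ' (algebraMap O O' a) = φ a := fun a => by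
    change ev (Q (algebraMap O O' a)) / φ D = φ a
    rw [hbase]; field_simp
  refine ⟨φ', hφ', ω, algebraMap O O' b, by rwa [hφ'], ?_, ?_⟩
  · rw [← IsScalarTower.algebraMap_apply, hω]
  · rw [hφ']
    change ev (Q ω) / φ D = _
    rw [hval ω (Polynomial.C D * X) (by simp), map_mul, hevC]
    simp only [hev, coe_eval₂RingHom, eval₂_X]
    field_simp

open Polynomial in
theorem hom_ext (A : ASData C p β y F') [Fact p.Prime] [CharP F p] [CharP F' p]
    (hβ : β ≠ 0) {φ₁ φ₂ : O' →ₐ[K] L} {θ η : L}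
    (h : ∀ a, φ₁ (algebraMap O O' a) = φ₂ (algebraMap O O' a))
    (hη : Ev F (φ₁.comp (IsScalarTower.toAlgHom K O O')) y η)
    (hθ : θ ^ p = algebraMap K L β * θ + η)
    (h₁ : Ev F' φ₁ A.w θ) (h₂ : Ev F' φ₂ A.w θ) : φ₁ = φ₂ := by
  obtain ⟨b, D, ω, hb, hD, hω, hrep, -⟩ := A.exists_conductor_data (O' := O') hβ hη hθ
  have hcoe : ∀ a, φ₁.comp (IsScalarTower.toAlgHom K O O') a = φ₁ (algebraMap O O' a) :=
    fun a => rfl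
  rw [hcoe] at hb hD
  have key : ∀ φ' : O' →ₐ[K] L, Ev F' φ' A.w θ → φ' ω = φ' (algebraMap O O' b) * θ := by
    intro φ' h'
    have h3 := (Ev.of_mem (F := F') (φ := φ') (algebraMap O O' b)).mul h'
    rw [← IsScalarTower.algebraMap_apply, ← hω] at h3
    exact (Ev.of_mem (F := F') (φ := φ') ω).unique h3
  refine AlgHom.ext fun s => ?_
  obtain ⟨Q, hQ⟩ := hrep s
  have hval : ∀ φ' : O' →ₐ[K] L, φ' (aeval ω Q) =
      Q.eval₂ ((φ' : O' →+* L).comp (algebraMap O O')) (φ' ω) := fun φ' => by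
    rw [aeval_def, ← RingHom.coe_coe φ', hom_eval₂]
  have hcomp : (φ₁ : O' →+* L).comp (algebraMap O O') = (φ₂ : O' →+* L).comp (algebraMap O O') :=
    RingHom.ext h
  have h4 : φ₁ (aeval ω Q) = φ₂ (aeval ω Q) := by
    rw [hval, hval, key φ₁ h₁, key φ₂ h₂, hcomp, h]
  rw [← hQ, map_mul, map_mul, ← h] at h4
  exact mul_left_cancel₀ hD h4

end ASData

/-- The composition of the additive polynomials `T ^ p - β T`, with `β` running through `l`. -/
def AL {K R : Type} [Field K] [CommRing R] [Algebra K R] (p : ℕ) : List K → R → R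
  | [], T => T
  | β :: l, T => AL p l T ^ p - algebraMap K R β * AL p l T

namespace AL

variable {K R : Type} [Field K] [CommRing R] [Algebra K R] {p : ℕ}

theorem append (l l' : List K) (T : R) : AL p (l ++ l') T = AL p l (AL p l' T) := by
  induction l with
  | nil => rfl
  | cons β l ih => simp only [List.cons_append, AL, ih]

theorem map {S : Type} [CommRing S] [Algebra K S] (φ : R →ₐ[K] S) (l : List K) (T : R) :
    φ (AL p l T) = AL p l (φ T) := by
  induction l with
  | nil => rfl
  | cons β l ih => simp only [AL, map_sub, map_mul, map_pow, ih, φ.commutes]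

theorem ev {O F L : Type} [CommRing O] [Field F] [Field L] [Algebra K O] [Algebra O F]
    [Algebra K L] [Algebra K F] [IsScalarTower K O F] {φ : O →ₐ[K] L} {f : F} {t : L}
    (h : Ev F φ f t) (l : List K) : Ev F φ (AL p l f) (AL p l t) := by
  induction l with
  | nil => exact h
  | cons β l ih => exact (ih.pow p).sub ((Ev.const β).mul ih)

variable [Fact p.Prime] [CharP R p]

theorem zero (l : List K) : AL p l (0 : R) = 0 := by
  induction l with
  | nil => rfl
  | cons β l ih => simp [AL, ih, (Fact.out : p.Prime).ne_zero]

theorem sub (l : List K) (S T : R) : AL p l (S - T) = AL p l S - AL p l T := by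
  induction l with
  | nil => rfl
  | cons β l ih => simp only [AL, ih, sub_pow_char]; ring

theorem neg (l : List K) (T : R) : AL p l (-T) = -AL p l T := by
  rw [← zero_sub, sub, zero, zero_sub]

theorem add (l : List K) (S T : R) : AL p l (S + T) = AL p l S + AL p l T := by
  rw [← sub_neg_eq_add, sub, neg, sub_neg_eq_add]

theorem natCast_mul (l : List K) (n : ℕ) (T : R) : AL p l (n * T) = n * AL p l T := by
  induction n with
  | zero => simp [zero]
  | succ n ih => rw [Nat.cast_succ, add_mul, one_mul, add, ih]; ring

theorem pow_card [Fintype K] (l : List K) (T : R) (q a : ℕ) (hq : Fintype.card K = q)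
    (hqa : q = p ^ a) : AL p l T ^ q = AL p l (T ^ q) := by
  induction l with
  | nil => rfl
  | cons β l ih =>
    simp only [AL]
    conv_lhs => rw [hqa, sub_pow_char_pow, ← hqa, mul_pow, ← pow_mul, mul_comm p, pow_mul, ih,
      ← map_pow, ← hq, FiniteField.pow_card β]
    rw [hq]

section Valuation

variable {F Γ : Type} [Field F] [Algebra K F] [CharP F p] [LinearOrderedCommGroupWithZero Γ]
  {v : Valuation F Γ}

theorem _root_.Valuation.le_one_of_pow_sub (hv : ∀ c : K, v (algebraMap K F c) ≤ 1) {β : K} {T : F}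
    (h : v (T ^ p - algebraMap K F β * T) ≤ 1) : v T ≤ 1 := by
  by_contra! h1
  refine absurd h (not_le.2 ?_)
  have h2 : v (algebraMap K F β * T) < v (T ^ p) := by
    rw [map_mul, map_pow]
    calc _ ≤ v T := mul_le_of_le_one_left' (hv β)
      _ < _ := lt_self_pow₀ h1 (Fact.out : p.Prime).one_lt
  rw [Valuation.map_sub_eq_of_lt_left _ h2, map_pow]
  exact one_lt_pow₀ h1 (Fact.out : p.Prime).ne_zero

theorem val_le_one_of (hv : ∀ c : K, v (algebraMap K F c) ≤ 1) (l : List K) {T : F}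
    (h : v (AL p l T) ≤ 1) : v T ≤ 1 := by
  induction l with
  | nil => exact h
  | cons β l ih => exact ih (Valuation.le_one_of_pow_sub (p := p) hv h)

end Valuation

section Poly

open Polynomial

variable (K p) in
theorem poly_natDegree [CharP K p] (l : List K) :
    (AL p l (X : K[X])).Monic ∧ (AL p l (X : K[X])).natDegree = p ^ l.length := by
  have hp := (Fact.out : p.Prime).one_lt
  induction l with
  | nil => exact ⟨monic_X, by simp [AL]⟩
  | cons β l ih =>
    obtain ⟨hm, hd⟩ := ih
    have hlt : (algebraMap K K[X] β * AL p l (X : K[X])).degree <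
       (AL p l (X : K[X]) ^ p).degree := by
      have h1 : (algebraMap K K[X] β * AL p l (X : K[X])).degree ≤ (AL p l (X : K[X])).degree := by
        rw [← Algebra.smul_def]
        exact degree_smul_le _ _
      refine h1.trans_lt ?_
      rw [degree_pow, degree_eq_natDegree hm.ne_zero, hd]
      have : p ^ l.length < p * p ^ l.length := by
        have := pow_pos (zero_lt_one.trans hp) l.length
        nlinarith
      rw [nsmul_eq_mul]
      exact_mod_cast this
    refine ⟨(hm.pow p).sub_of_left hlt, ?_⟩
    refine natDegree_eq_of_degree_eq_some ?_
    rw [AL, degree_sub_eq_left_of_degree_lt hlt, degree_pow, degree_eq_natDegree hm.ne_zero, hd,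
      List.length_cons, pow_succ', nsmul_eq_mul]
    rfl

variable (K p) in
theorem poly_separable [CharP K p] (l : List K) (hl : ∀ β ∈ l, β ≠ 0) :
    (AL p l (X : K[X])).Separable := by
  have h : ∃ c : K, c ≠ 0 ∧ derivative (AL p l (X : K[X])) = C c := by
    induction l with
    | nil => exact ⟨1, one_ne_zero, by simp [AL]⟩
    | cons β l ih =>
      obtain ⟨c, hc, h⟩ := ih fun γ hγ => hl γ (by simp [hγ])
      refine ⟨-(β * c), neg_ne_zero.2 (mul_ne_zero (hl β (by simp)) hc), ?_⟩
      simp [AL, derivative_pow, algebraMap_eq, h]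
  obtain ⟨c, hc, h⟩ := h
  rw [Separable, h]
  refine IsCoprime.of_isCoprime_of_dvd_right isCoprime_one_right ?_
  exact isUnit_iff_dvd_one.1 (isUnit_C.2 (isUnit_iff_ne_zero.2 hc))

theorem aeval_poly [CharP K p] (l : List K) (T : R) : aeval T (AL p l (X : K[X])) = AL p l T := by
  rw [AL.map, aeval_X]

theorem exists_natCast_of_pow_eq {Ω : Type} [Field Ω] [CharP Ω p] {x : Ω} (hx : x ^ p = x) :
    ∃ n : ℕ, x = n := by
  classical
  let f : ZMod p →+* Ω := ZMod.castHom dvd_rfl Ω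
  obtain ⟨z, hz⟩ : ∃ z : ZMod p, f z = x := by
    have hp := (Fact.out : p.Prime).one_lt
    have h0 : (X ^ p - X : Polynomial Ω) ≠ 0 := FiniteField.X_pow_card_sub_X_ne_zero Ω hp
    have h1 : (Finset.univ.image f) = (X ^ p - X : Polynomial Ω).roots.toFinset := by
      refine Finset.eq_of_subset_of_card_le ?_ ?_
      · intro u hu
        obtain ⟨z, -, rfl⟩ := Finset.mem_image.1 hu
        rw [Multiset.mem_toFinset, mem_roots h0]
        simp [IsRoot, ← map_pow, ZMod.pow_card]
      · rw [Finset.card_image_of_injective _ f.injective, Finset.card_univ, ZMod.card]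
        refine (Multiset.toFinset_card_le _).trans ((card_roots' _).trans ?_)
        rw [FiniteField.X_pow_card_sub_X_natDegree_eq Ω hp]
    have h2 : x ∈ (X ^ p - X : Polynomial Ω).roots.toFinset := by
      rw [Multiset.mem_toFinset, mem_roots h0]
      simp [IsRoot, hx]
    rw [← h1] at h2
    obtain ⟨z, -, hz⟩ := Finset.mem_image.1 h2
    exact ⟨z, hz⟩
  exact ⟨z.val, by rw [← hz, ← map_natCast f, ZMod.natCast_zmod_val]⟩

theorem exists_algebraMap_of_pow_eq {Ω : Type} [Field Ω] [Algebra K Ω] [Fintype K] {x : Ω}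
    (hx : x ^ Fintype.card K = x) : ∃ c : K, x = algebraMap K Ω c := by
  have h0 : (X ^ Fintype.card K - X : Polynomial Ω) ≠ 0 :=
    FiniteField.X_pow_card_sub_X_ne_zero Ω Fintype.one_lt_card
  have h1 : (Finset.univ.map ⟨algebraMap K Ω, (algebraMap K Ω).injective⟩).val ≤
      (X ^ Fintype.card K - X : Polynomial Ω).roots := by
    rw [Multiset.le_iff_subset (Finset.nodup _)]
    intro u hu
    obtain ⟨z, -, rfl⟩ := Finset.mem_map.1 hu
    rw [mem_roots h0]
    simp [IsRoot, ← map_pow, FiniteField.pow_card]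
  have h2 := Multiset.eq_of_le_of_card_le h1 (by
    refine (card_roots' _).trans ?_
    rw [FiniteField.X_pow_card_sub_X_natDegree_eq Ω Fintype.one_lt_card]
    simp)
  have h3 : x ∈ (X ^ Fintype.card K - X : Polynomial Ω).roots := by
    rw [mem_roots h0]
    simp [IsRoot, hx]
  rw [← h2] at h3
  obtain ⟨z, -, hz⟩ := Finset.mem_map.1 h3
  exact ⟨z, hz.symm⟩

variable (K p) in
theorem exists_eq_pow_card_add [CharP K p] [Fintype K] {q a : ℕ} (hq : Fintype.card K = q)
    (hqa : q = p ^ a) :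
    ∃ l : List K, l.length = a ∧ (∀ β ∈ l, β ≠ 0) ∧
      ∀ (R : Type) [CommRing R] [Algebra K R] (T : R), AL p l T = T ^ q + T := by
  have hpp := (Fact.out : p.Prime)
  have hq1 : 1 < q := hq ▸ Fintype.one_lt_card
  let Ω := AlgebraicClosure K
  have : CharP Ω p := charP_of_injective_algebraMap (algebraMap K Ω).injective p
  set W : K[X] := X ^ q + X with hW
  have hWd : W.natDegree = q := by 
    rw [hW]; 
    refine natDegree_eq_of_degree_eq_some ?_
    rw [degree_add_eq_left_of_degree_lt, degree_X_pow]
    rw [degree_X, degree_X_pow]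
    exact_mod_cast hq1
  have hWm : W.Monic := by
    rw [hW]; exact monic_X_pow_add (by rw [degree_X]; exact_mod_cast hq1)
  have hWs : W.Separable := by
    rw [Separable, hW]
    have : (q : K[X]) = 0 := by
      rw [← Polynomial.C_eq_natCast, ← hq, FiniteField.cast_card_eq_zero, C_0]
    simp [derivative_X_pow, this, isCoprime_one_right]
  have key : ∀ i ≤ a, ∃ l : List K, l.length = i ∧ (∀ β ∈ l, β ≠ 0) ∧
      ∀ T : Ω, AL p l T = 0 → T ^ q = -T := by
    intro i
    induction i with
    | zero =>
      intro _
      refine ⟨[], rfl, by simp, fun T hT => ?_⟩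
      simp only [AL] at hT
      rw [hT, zero_pow (by omega), neg_zero]
    | succ i ih =>
      intro hi
      obtain ⟨l, hl, hl0, hker⟩ := ih (by omega)
      obtain ⟨v, hv, hc⟩ : ∃ v : Ω, v ^ q = -v ∧ AL p l v ≠ 0 := by
        by_contra! hcon
        have h1 : W.rootSet Ω ⊆ (AL p l (X : K[X])).rootSet Ω := by
          intro v hv
          rw [mem_rootSet] at hv ⊢
          refine ⟨(poly_natDegree K p l).1.ne_zero, ?_⟩
          rw [aeval_poly]
          refine hcon v ?_
          have := hv.2
          simp only [hW, map_add, map_pow, aeval_X] at this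
          exact eq_neg_of_add_eq_zero_left this
        have h2 := Fintype.card_le_of_injective _ (Set.inclusion_injective h1)
        rw [card_rootSet_eq_natDegree hWs (IsAlgClosed.splits _),
          card_rootSet_eq_natDegree (poly_separable K p l hl0) (IsAlgClosed.splits _), hWd,
          (poly_natDegree K p l).2, hl, hqa] at h2
        exact absurd h2 (not_le.2 (Nat.pow_lt_pow_right hpp.one_lt (by omega)))
      set c := AL p l v with hcdef
      have hcq : c ^ q = -c := by rw [hcdef, pow_card l v q a hq hqa, hv, neg]
      have hβq : (c ^ (p - 1)) ^ Fintype.card K = c ^ (p - 1) := by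
        rw [hq, ← pow_mul, mul_comm, pow_mul, hcq]
        rcases hpp.eq_two_or_odd' with rfl | hodd
        · rw [CharTwo.neg_eq]
        · exact (Nat.Odd.sub_odd hodd odd_one).neg_pow c
      obtain ⟨β, hβ⟩ := exists_algebraMap_of_pow_eq hβq
      refine ⟨β :: l, by simp [hl], ?_, ?_⟩
      · intro γ hγ
        rcases List.mem_cons.1 hγ with rfl | hγ
        · rintro rfl
          rw [map_zero] at hβ
          exact pow_ne_zero _ hc hβ
        · exact hl0 γ hγ
      · intro T hT
        simp only [AL, ← hβ] at hT
        have h1 : (AL p l T / c) ^ p = AL p l T / c := by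
          have h2 : c ^ p = c ^ (p - 1) * c := by
            rw [← pow_succ, Nat.sub_add_cancel hpp.one_lt.le]
          rw [div_pow, sub_eq_zero.1 hT, h2, mul_div_mul_left _ _ (pow_ne_zero _ hc)]
        obtain ⟨n, hn⟩ := exists_natCast_of_pow_eq h1
        rw [div_eq_iff hc] at hn
        have h3 := hker (T - n * v) (by rw [sub, natCast_mul, hn, sub_self])
        have hnq : (n : Ω) ^ q = n := by
          have : (n : Ω) = algebraMap K Ω (n : K) := by simp
          rw [this, ← map_pow, ← hq, FiniteField.pow_card]
        rw [hqa, sub_pow_char_pow, ← hqa, mul_pow, hnq, hv] at h3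
        linear_combination h3
  obtain ⟨l, hl, hl0, hker⟩ := key a le_rfl
  refine ⟨l, hl, hl0, ?_⟩
  have hdvd : AL p l (X : K[X]) ∣ W := by
    rw [← map_dvd_map' (algebraMap K Ω)]
    refine (IsAlgClosed.splits _).dvd_of_roots_le_roots
      (((poly_natDegree K p l).1.map _).ne_zero) ?_
    rw [Multiset.le_iff_subset (nodup_roots (poly_separable K p l hl0).map)]
    intro T hT
    rw [mem_roots ((hWm.map _).ne_zero), IsRoot, eval_map_algebraMap]
    rw [mem_roots (((poly_natDegree K p l).1.map _).ne_zero), IsRoot, eval_map_algebraMap,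
      aeval_poly] at hT
    simp [hW, hker T hT]
  have heq := eq_of_monic_of_dvd_of_natDegree_le (poly_natDegree K p l).1 hWm hdvd
    (by rw [hWd, (poly_natDegree K p l).2, hl, hqa])
  intro R _ _ T
  have := congrArg (aeval T) heq
  rw [map, aeval_X] at this
  rw [← this, hW]
  simp

/-- Solutions of `c ^ p = β c`, for `β` occurring in a flag, are anti-invariant under
`x ↦ x ^ q`. -/
theorem pow_eq_neg_of_pow_eq {L : Type} [Field L] [Algebra K L] [CharP K p] [Fintype K] {q a : ℕ}
    (hq : Fintype.card K = q) (hqa : q = p ^ a) {pre l : List K} {β : K}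
    (h : ∀ (R : Type) [CommRing R] [Algebra K R] (T : R), AL p (pre ++ β :: l) T = T ^ q + T)
    {c : L} (hc : c ^ p = algebraMap K L β * c) : c ^ q = -c := by
  let Ω := AlgebraicClosure L
  have : CharP Ω p := charP_of_injective_algebraMap (algebraMap K Ω).injective p
  apply (algebraMap L Ω).injective
  rw [map_pow, map_neg]
  obtain ⟨hm, hd⟩ := poly_natDegree K p l
  obtain ⟨T, hT⟩ : ∃ T : Ω, AL p l T = algebraMap L Ω c := by
    have h1 : ((AL p l (X : K[X])).map (algebraMap K Ω) -
        Polynomial.C (algebraMap L Ω c)).degree ≠ 0 := by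
      have := pow_pos (Fact.out : p.Prime).pos l.length
      rw [degree_sub_C, degree_map, degree_eq_natDegree hm.ne_zero, hd]
      · exact_mod_cast this.ne'
      · rw [degree_map, degree_eq_natDegree hm.ne_zero, hd]
        exact_mod_cast this
    obtain ⟨T, hT⟩ := IsAlgClosed.exists_root _ h1
    refine ⟨T, ?_⟩
    rwa [IsRoot, eval_sub, eval_C, eval_map_algebraMap, aeval_poly, sub_eq_zero] at hT
  have h2 : T ^ q + T = 0 := by
    rw [← h Ω T, append, AL, hT, ← map_pow, hc, map_mul, ← IsScalarTower.algebraMap_apply,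
      sub_self, zero]
  rw [← hT, pow_card l T q a hq hqa, eq_neg_of_add_eq_zero_left h2, neg]

end Poly

end AL

/-- The rational function `x - x ^ 2 / (x ^ q + x)` which defines the recursive tower. -/
def towerMap {F : Type} [Field F] (q : ℕ) (x : F) : F := x - x ^ 2 / (x ^ q + x)

section TowerMap

variable {F : Type} [Field F] {q : ℕ} {x : F}

theorem pow_add_self_eq (hq : 2 ≤ q) : x ^ q + x = x * (x ^ (q - 1) + 1) := by
  obtain ⟨n, rfl⟩ := Nat.exists_eq_add_of_le' (show 1 ≤ q by omega)
  simp only [Nat.add_sub_cancel]; ring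

theorem towerMap_eq (hq : 2 ≤ q) (hx : x ^ q + x ≠ 0) :
    towerMap q x = x ^ q / (x ^ (q - 1) + 1) := by
  rw [pow_add_self_eq hq] at hx
  have h1 := left_ne_zero_of_mul hx
  have h2 := right_ne_zero_of_mul hx
  rw [towerMap, pow_add_self_eq hq]
  obtain ⟨n, rfl⟩ := Nat.exists_eq_add_of_le' (show 1 ≤ q by omega)
  simp only [Nat.add_sub_cancel] at *
  field_simp
  ring

theorem inv_towerMap (hq : 2 ≤ q) (hx : x ^ q + x ≠ 0) :
    (towerMap q x)⁻¹ = x⁻¹ + x⁻¹ ^ q := by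
  rw [towerMap_eq hq hx, inv_div]
  rw [pow_add_self_eq hq] at hx
  have h1 := left_ne_zero_of_mul hx
  have h2 := right_ne_zero_of_mul hx
  obtain ⟨n, rfl⟩ := Nat.exists_eq_add_of_le' (show 1 ≤ q by omega)
  simp only [Nat.add_sub_cancel] at *
  rw [inv_pow]
  field_simp
  ring

theorem inv_pow_add_self (hq : 2 ≤ q) (hx : x ^ q + x ≠ 0) :
    (x ^ q + x)⁻¹ = x⁻¹ - x ^ (q - 2) / (x ^ (q - 1) + 1) := by
  rw [pow_add_self_eq hq] at hx ⊢
  have h1 := left_ne_zero_of_mul hx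
  have h2 := right_ne_zero_of_mul hx
  obtain ⟨n, rfl⟩ := Nat.exists_eq_add_of_le' hq
  simp only [Nat.add_sub_cancel, show n + 2 - 1 = n + 1 by omega] at *
  field_simp
  ring

end TowerMap

namespace Valuation

variable {F Γ : Type} [Field F] [LinearOrderedCommGroupWithZero Γ] (v : Valuation F Γ) {q : ℕ}
  {x : F}

theorem map_pow_add_one_of_lt (hq : 2 ≤ q) (hx : v x < 1) : v (x ^ (q - 1) + 1) = 1 := by
  rw [← v.map_one]
  apply v.map_add_eq_of_lt_right
  rw [map_pow, map_one]
  exact pow_lt_one₀ zero_le hx (by omega)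

theorem pow_add_self_ne_zero_of_lt (hq : 2 ≤ q) (hx : v x < 1) (hx0 : x ≠ 0) :
    x ^ q + x ≠ 0 := by
  rw [pow_add_self_eq hq]
  refine mul_ne_zero hx0 fun h => ?_
  have := v.map_pow_add_one_of_lt hq hx
  simp [h] at this

theorem map_towerMap_of_lt (hq : 2 ≤ q) (hx : v x < 1) (hx0 : x ≠ 0) :
    v (towerMap q x) = v x ^ q := by
  rw [towerMap_eq hq (v.pow_add_self_ne_zero_of_lt hq hx hx0), map_div₀, map_pow,
    v.map_pow_add_one_of_lt hq hx, div_one]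

theorem map_pow_add_self_of_one_lt (hq : 2 ≤ q) (hx : 1 < v x) : v (x ^ q + x) = v x ^ q := by
  rw [← map_pow, add_comm]
  apply v.map_add_eq_of_lt_right
  rw [map_pow]
  calc v x = v x ^ 1 := (pow_one _).symm
    _ < v x ^ q := pow_lt_pow_right₀ hx (by omega)

theorem map_sq_div_le_one (hq : 2 ≤ q) (hx : 1 < v x) : v (x ^ 2 / (x ^ q + x)) ≤ 1 := by
  rw [map_div₀, map_pow, v.map_pow_add_self_of_one_lt hq hx]
  exact div_le_one_of_le₀ (pow_le_pow_right₀ hx.le hq) zero_le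

theorem map_towerMap_of_one_lt (hq : 2 ≤ q) (hx : 1 < v x) : v (towerMap q x) = v x := by
  rw [towerMap]
  exact v.map_sub_eq_of_lt_left ((v.map_sq_div_le_one hq hx).trans_lt hx)

theorem exists_map_sub_le {K : Type} [Field K] [Fintype K] [Algebra K F] {p : ℕ} [Fact p.Prime]
    [CharP F p] {a : ℕ} (hq : Fintype.card K = q) (hqa : q = p ^ a) (hq2 : 2 ≤ q)
    (h : v (x ^ q - x) < 1) :
    ∃ c : K, v (x - algebraMap K F c) ≤ v (x ^ q - x) := by
  have hprod : ∏ c : K, (x - algebraMap K F c) = x ^ q - x := by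
    have h0 := FiniteField.roots_X_pow_card_sub_X K
    have h2 := Polynomial.prod_multiset_X_sub_C_of_monic_of_roots_card_eq
      (p := (Polynomial.X ^ Fintype.card K - Polynomial.X : Polynomial K))
      (Polynomial.monic_X_pow_sub (by simpa using Fintype.one_lt_card))
      (by rw [h0, FiniteField.X_pow_card_sub_X_natDegree_eq K Fintype.one_lt_card]; rfl)
    rw [h0] at h2
    simpa [hq, map_prod] using congrArg (Polynomial.aeval x) h2
  have : ∃ c : K, v (x - algebraMap K F c) < 1 := by
    by_contra! hc
    rw [← hprod, map_prod] at h
    refine h.not_ge (Finset.prod_induction _ (1 ≤ ·) (fun _ _ => one_le_mul) le_rfl fun c _ => hc c)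
  obtain ⟨c, hc⟩ := this
  refine ⟨c, ?_⟩
  have e : x ^ q - x = (x - algebraMap K F c) ^ q - (x - algebraMap K F c) := by
    conv_rhs => rw [hqa, sub_pow_char_pow, ← hqa, ← map_pow, ← hq, FiniteField.pow_card, hq]
    ring
  rcases eq_or_ne (x - algebraMap K F c) 0 with h0 | h0
  · simp [h0]
  · generalize x - algebraMap K F c = d at *
    rw [e, v.map_sub_eq_of_lt_right]
    rw [map_pow]
    calc v d ^ q < v d ^ 1 :=
        pow_lt_pow_right_of_lt_one₀ (by simpa [zero_lt_iff] using h0) hc (by omega)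
      _ = _ := pow_one _

end Valuation

section CuspState

variable {K F : Type} [Field K] [Field F] [Algebra K F]

/-- The possible behaviour of the functions `x 0, …, x k, y` at a zero of `x 0 ^ q + x 0`:
either `y` has a simple pole there, or (after modification by an element of the image of `AL`)
`y` is regular. -/
def CuspState (v : Valuation F ℤᵐ⁰) (p : ℕ) (l : List K) (x : ℕ → F) (k : ℕ) (y : F) : Prop :=
  v y = WithZero.exp 1 ∨ (v (x 0) = WithZero.exp (-1) ∧
    ((v y ≤ 1 ∧ ∀ i ≤ k, v (x i) < 1) ∨
      ∃ m < k, ∃ α : K, α ≠ 0 ∧ (∀ i ≤ m, v (x i) < 1) ∧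
        v (y - AL p l (algebraMap K F α / x m)) ≤ 1))

variable {v : Valuation F ℤᵐ⁰} {p q a k : ℕ} {x : ℕ → F} {y : F}

theorem CuspState.ne_zero (hq2 : 2 ≤ q) (hx0 : v (x 0) = WithZero.exp (-1)) {m : ℕ} (hm : m ≤ k)
    (hv : ∀ i < m, v (x i) < 1) (hx : ∀ i < k, x (i + 1) ^ q + x (i + 1) = towerMap q (x i)) :
    x m ≠ 0 := by
  induction m with
  | zero =>
    intro h
    rw [h, map_zero] at hx0
    exact WithZero.exp_ne_zero hx0.symm
  | succ m ih =>
    have h := ih (by omega) fun i hi => hv i (by omega)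
    intro h0
    have h1 := hx m (by omega)
    have h2 := v.map_towerMap_of_lt hq2 (hv m (by omega)) h
    rw [← h1, h0, zero_pow (by omega), add_zero, map_zero] at h2
    exact h ((map_eq_zero v).1 (pow_eq_zero_iff (by omega) |>.1 h2.symm))

theorem CuspState.rebase [Fact p.Prime] [CharP F p] [Fintype K] (hq : Fintype.card K = q)
    (hqa : q = p ^ a) (hq2 : 2 ≤ q) (hvK : ∀ c : K, v (algebraMap K F c) ≤ 1)
    (h : CuspState v p ([] : List K) x k y)
    (hx : ∀ i < k, x (i + 1) ^ q + x (i + 1) = towerMap q (x i)) {x' : ℕ → F}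
    (hx' : ∀ i ≤ k, x' i = x i) (hx'' : x' (k + 1) = y) (hy : y ^ q + y = towerMap q (x k))
    {l : List K} (hl : ∀ T : F, AL p l T = T ^ q + T) :
    CuspState v p l x' (k + 1) (towerMap q y) := by
  rcases h with h | ⟨hx0, ⟨hy1, hlt⟩ | ⟨m, hmk, α, hα, hlt, hm⟩⟩
  · left
    rw [v.map_towerMap_of_one_lt hq2 (by rw [h]; decide), h]
  · have hk0 : x k ≠ 0 := CuspState.ne_zero hq2 hx0 le_rfl (fun i hi => hlt i hi.le) hx
    have hu := v.map_towerMap_of_lt hq2 (hlt k le_rfl) hk0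
    have hu1 : v (towerMap q (x k)) < 1 := by
      rw [hu]; exact pow_lt_one₀ zero_le (hlt k le_rfl) (by omega)
    have hu0 : towerMap q (x k) ≠ 0 := by
      intro h0
      rw [h0, map_zero] at hu
      exact hk0 ((map_eq_zero v).1 (pow_eq_zero_iff (by omega) |>.1 hu.symm))
    have hy0 : y ≠ 0 := by
      rintro rfl
      rw [zero_pow (by omega), add_zero] at hy
      exact hu0 hy.symm
    right
    refine ⟨by rw [hx' 0 (by omega), hx0], ?_⟩
    rcases hy1.lt_or_eq with hy1 | hy1
    · left
      refine ⟨?_, fun i hi => ?_⟩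
      · rw [v.map_towerMap_of_lt hq2 hy1 hy0]
        exact pow_le_one₀ zero_le hy1.le
      · rcases Nat.lt_or_ge k i with h | h
        · rw [show i = k + 1 by omega, hx'']; exact hy1
        · rw [hx' i h]; exact hlt i h
    · right
      have h2 : v ((y ^ 2) ^ q - y ^ 2) ≤ v (x k) ^ q := by
        rw [← hu, ← hy, show (y ^ 2) ^ q - y ^ 2 = (y ^ q - y) * (y ^ q + y) by ring, map_mul]
        refine mul_le_of_le_one_left zero_le ((v.map_sub _ _).trans ?_)
        simp [hy1]
      obtain ⟨c, hc⟩ := v.exists_map_sub_le hq hqa hq2 (h2.trans_lt (hu ▸ hu1))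
      replace hc := hc.trans h2
      refine ⟨k, by omega, -c, ?_, fun i hi => ?_, ?_⟩
      · rintro h0
        rw [neg_eq_zero] at h0
        rw [h0, map_zero, sub_zero, map_pow, hy1, one_pow, ← hu] at hc
        exact hu1.not_ge hc
      · rw [hx' i hi]; exact hlt i hi
      · have e : towerMap q y - AL p l (algebraMap K F (-c) / x' k) =
            y - (y ^ 2 - algebraMap K F c) * (towerMap q (x k))⁻¹ := by
          have hcq : (-c) ^ q = -c := by rw [← hq, FiniteField.pow_card]
          rw [hl, div_pow, ← map_pow, hcq, hx' k le_rfl, towerMap, hy, div_eq_mul_inv,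
            inv_towerMap hq2 (v.pow_add_self_ne_zero_of_lt hq2 (hlt k le_rfl) hk0), map_neg]
          simp only [inv_pow]
          ring
        rw [e]
        refine (v.map_sub _ _).trans (max_le hy1.le ?_)
        rw [map_mul, map_inv₀, hu]
        exact mul_inv_le_one_of_le₀ hc zero_le
  · have hm0 : x m ≠ 0 := CuspState.ne_zero hq2 hx0 hmk.le (fun i hi => hlt i hi.le) hx
    simp only [AL] at hm
    have hαv : v (algebraMap K F α) = 1 := by
      refine le_antisymm (hvK α) ?_
      have h1 := hvK α⁻¹
      rw [map_inv₀, map_inv₀] at h1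
      exact (inv_le_one₀ (by simpa [zero_lt_iff] using hα)).1 h1
    have hz : v (algebraMap K F α / x m) = (v (x m))⁻¹ := by rw [map_div₀, hαv, one_div]
    have hz1 : 1 < v (algebraMap K F α / x m) := by
      rw [hz]; exact (one_lt_inv₀ (by simpa [zero_lt_iff] using hm0)).2 (hlt m le_rfl)
    have hyv : v y = v (algebraMap K F α / x m) := by
      simpa using v.map_add_eq_of_lt_right (hm.trans_lt hz1)
    have hyu : v (towerMap q y - algebraMap K F α / x m) ≤ 1 := by
      rw [towerMap, sub_right_comm]
      exact (v.map_sub _ _).trans (max_le hm (v.map_sq_div_le_one hq2 (hyv ▸ hz1)))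
    rcases Nat.eq_zero_or_pos m with rfl | hmpos
    · left
      rw [v.map_towerMap_of_one_lt hq2 (hyv ▸ hz1), hyv, hz, hx0, ← WithZero.exp_neg, neg_neg]
    · right
      obtain ⟨m, rfl⟩ := Nat.exists_eq_add_of_le' hmpos
      have hmm0 : x m ≠ 0 := CuspState.ne_zero hq2 hx0 (by omega) (fun i hi => hlt i (by omega)) hx
      refine ⟨by rw [hx' 0 (by omega), hx0], Or.inr ⟨m, by omega, α, hα, fun i hi => ?_, ?_⟩⟩
      · rw [hx' i (by omega)]; exact hlt i (by omega)
      · have h1 := inv_pow_add_self hq2 (v.pow_add_self_ne_zero_of_lt hq2 (hlt (m + 1) le_rfl) hm0)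
        rw [hx m (by omega), inv_towerMap hq2
          (v.pow_add_self_ne_zero_of_lt hq2 (hlt m (by omega)) hmm0)] at h1
        have e : towerMap q y - AL p l (algebraMap K F α / x' m) =
            (towerMap q y - algebraMap K F α / x (m + 1)) +
              algebraMap K F α * (x (m + 1) ^ (q - 2) / (x (m + 1) ^ (q - 1) + 1)) := by
          have hcq : α ^ q = α := by rw [← hq, FiniteField.pow_card]
          rw [hl, div_pow, ← map_pow, hcq, hx' m (by omega)]
          have h3 : algebraMap K F α / x m ^ q = algebraMap K F α * (x m)⁻¹ ^ q := by
            rw [inv_pow, div_eq_mul_inv]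
          rw [h3]
          linear_combination (-algebraMap K F α) * h1
        rw [e]
        refine (v.map_add _ _).trans (max_le hyu ?_)
        rw [map_mul, hαv, one_mul, map_div₀, v.map_pow_add_one_of_lt hq2 (hlt _ le_rfl), div_one,
          map_pow]
        exact pow_le_one₀ zero_le (hlt _ le_rfl).le

theorem CuspState.start {x : F} (hq2 : 2 ≤ q) (hx : v x ≤ 1)
    (h : v (x ^ q + x) = WithZero.exp (-1)) (l : List K) :
    CuspState v p l (fun _ => x) 0 (towerMap q x) := by
  rcases hx.lt_or_eq with hx | hx
  · right
    have h0 : x ≠ 0 := by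
      rintro rfl
      rw [zero_pow (by omega), add_zero, map_zero] at h
      exact WithZero.exp_ne_zero h.symm
    refine ⟨?_, Or.inl ⟨?_, fun _ _ => hx⟩⟩
    · rwa [pow_add_self_eq hq2, map_mul, v.map_pow_add_one_of_lt hq2 hx, mul_one] at h
    · rw [v.map_towerMap_of_lt hq2 hx h0]
      exact pow_le_one₀ zero_le hx.le
  · left
    have h1 : v (x ^ 2 / (x ^ q + x)) = WithZero.exp 1 := by
      rw [map_div₀, h, map_pow, hx, one_pow, one_div, ← WithZero.exp_neg, neg_neg]
    rw [towerMap, v.map_sub_eq_of_lt_right, h1]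
    rw [h1, hx]; decide

end CuspState

namespace IsDedekindDomain.HeightOneSpectrum

variable {O F : Type} [CommRing O] [IsDedekindDomain O] [Field F] [Algebra O F] [IsFractionRing O F]

theorem exists_valuation_sub_le_one (P : HeightOneSpectrum O) (z : F) :
    ∃ z₀ : F, P.valuation F (z₀ - z) ≤ 1 ∧
      ∀ Q : HeightOneSpectrum O, Q ≠ P → Q.valuation F z₀ ≤ 1 := by
  obtain ⟨n, d, hd, rfl⟩ := IsFractionRing.div_surjective (A := O) z
  have hd0 : d ≠ 0 := nonZeroDivisors.ne_zero hd
  have hI : Ideal.span {d} ≠ (⊥ : Ideal O) := by simpa using hd0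
  have hfin : FiniteMultiplicity P.asIdeal (Ideal.span {d}) :=
    FiniteMultiplicity.of_not_isUnit (by
      rw [Ideal.isUnit_iff]; exact P.isPrime.ne_top) hI
  obtain ⟨J, hJ, hPJ⟩ := hfin.exists_eq_pow_mul_and_not_dvd
  set e := multiplicity P.asIdeal (Ideal.span {d})
  have hcop : P.asIdeal ^ e ⊔ J = ⊤ := by
    have h1 : P.asIdeal ⊔ J = ⊤ :=
      P.isMaximal.out.2 _ (left_lt_sup.2 fun h => hPJ (Ideal.dvd_iff_le.2 h))
    exact Ideal.isCoprime_iff_sup_eq.1 (Ideal.isCoprime_iff_sup_eq.2 h1).pow_left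
  obtain ⟨s, hs, u, hu, hsu⟩ := Submodule.mem_sup.1 (hcop ▸ Submodule.mem_top : (1 : O) ∈ _)
  have key : ∀ (Q : HeightOneSpectrum O) (b c : O), b * c ∈ Ideal.span {d} → c ∉ Q.asIdeal →
      Q.valuation F (algebraMap O F b) ≤ Q.valuation F (algebraMap O F d) := by
    intro Q b c hbc hc
    obtain ⟨r, hr⟩ := Ideal.mem_span_singleton'.1 hbc
    have h1 : Q.valuation F (algebraMap O F (b * c)) = Q.valuation F (algebraMap O F b) := by
      rw [map_mul, map_mul, Q.valuation_eq_one_iff_notMem.2 hc, mul_one]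
    rw [← h1, ← hr, map_mul, map_mul]
    exact mul_le_of_le_one_left zero_le (Q.valuation_le_one r)
  have hdv : ∀ Q : HeightOneSpectrum O, 0 < Q.valuation F (algebraMap O F d) := fun Q => by
    simpa [zero_lt_iff] using hd0
  have hle : ∀ (Q : HeightOneSpectrum O) (b : O),
      Q.valuation F (algebraMap O F b) ≤ Q.valuation F (algebraMap O F d) →
      Q.valuation F (algebraMap O F b * (algebraMap O F n / algebraMap O F d)) ≤ 1 := by
    intro Q b hb
    rw [map_mul, map_div₀, ← mul_div_assoc]
    refine div_le_one_of_le₀ ?_ zero_le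
    calc _ ≤ Q.valuation F (algebraMap O F b) * 1 := by gcongr; exact Q.valuation_le_one n
      _ ≤ _ := by rwa [mul_one]
  refine ⟨algebraMap O F u * (algebraMap O F n / algebraMap O F d), ?_, fun Q hQ => ?_⟩
  · obtain ⟨j, hj, hjP⟩ : ∃ j ∈ J, j ∉ P.asIdeal := by
      by_contra! h
      exact hPJ (Ideal.dvd_iff_le.2 h)
    have h1 : algebraMap O F u = 1 - algebraMap O F s := by
      rw [eq_sub_iff_add_eq', ← map_add, hsu, map_one]
    rw [h1, sub_mul, one_mul, sub_sub_cancel_left, Valuation.map_neg]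
    refine hle P s (key P s j ?_ hjP)
    rw [hJ]
    exact Ideal.mul_mem_mul hs hj
  · obtain ⟨j, hj, hjQ⟩ : ∃ j ∈ P.asIdeal, j ∉ Q.asIdeal := by
      by_contra! h
      exact hQ (HeightOneSpectrum.ext (P.isMaximal.eq_of_le Q.isPrime.ne_top h)).symm
    refine hle Q u (key Q u (j ^ e) ?_ fun h => hjQ (Q.isPrime.mem_of_pow_mem _ h))
    rw [hJ, mul_comm u]
    exact Ideal.mul_mem_mul (Ideal.pow_mem_pow hj e) hu

theorem exists_forall_valuation_sub_le_one (T : Finset (HeightOneSpectrum O))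
    (z : HeightOneSpectrum O → F) : ∃ z₀ : F, (∀ P ∈ T, P.valuation F (z₀ - z P) ≤ 1) ∧
      ∀ Q ∉ T, Q.valuation F z₀ ≤ 1 := by
  classical
  choose f hf hf' using fun P : HeightOneSpectrum O => P.exists_valuation_sub_le_one (z P)
  refine ⟨∑ P ∈ T, f P, fun P hP => ?_, fun Q hQ => ?_⟩
  · rw [← Finset.add_sum_erase _ _ hP, add_sub_right_comm]
    refine (Valuation.map_add _ _ _).trans (max_le (hf P) (Valuation.map_sum_le _ fun Q hQ => ?_))
    exact hf' Q P (Finset.ne_of_mem_erase hQ).symm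
  · exact Valuation.map_sum_le _ fun P hP => hf' P Q fun h => hQ (h ▸ hP)

end IsDedekindDomain.HeightOneSpectrum

namespace ASData

open HeightOneSpectrum

variable {K O F : Type} [Field K] [CommRing O] [Field F] [Algebra K O] [Algebra O F]
    [Algebra K F] {C : Crv K O F} {p : ℕ} {β : K} {y : F} {F' : Type} [Field F']
    [Algebra F F'] (A : ASData C p β y F')
  {O' : Type} [CommRing O'] [Algebra K O'] [Algebra O O'] [Algebra O' F'] [Algebra O F']
  [Algebra K F'] [IsScalarTower K F F'] [IsScalarTower O F F'] [IsScalarTower O O' F']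
  [IsScalarTower K O' F'] [IsDedekindDomain O] [IsFractionRing O F]
  [IsIntegralClosure O' O F'] [IsScalarTower K O F] [IsScalarTower K O O']
  [IsDedekindDomain O'] [IsFractionRing O' F'] [Module.IsTorsionFree O O']
  [Finite K] [Fact p.Prime] [CharP F p] [CharP F' p]

theorem exists_local_of_cuspState {v : Valuation F ℤᵐ⁰} {l : List K} {x : ℕ → F} {k : ℕ}
    (h : CuspState v p (β :: l) x k y) (hv : v y ≠ WithZero.exp 1) :
    ∃ z, v (y - (z ^ p - algebraMap K F β * z)) ≤ 1 := by
  rcases h with h | ⟨-, ⟨h, -⟩ | ⟨m, -, α, -, -, h⟩⟩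
  · exact absurd h hv
  · exact ⟨0, by simpa [(Fact.out : p.Prime).ne_zero] using h⟩
  · exact ⟨_, h⟩

theorem cuspState (A : ASData C p β y F') (hβ : β ≠ 0) {P : HeightOneSpectrum O}
    {P' : HeightOneSpectrum O'} (hP : P'.asIdeal.comap (algebraMap O O') = P.asIdeal) {l : List K}
    {x : ℕ → F} {k : ℕ} (h : CuspState (P.valuation F) p (β :: l) x k y) :
    CuspState (P'.valuation F') p l (fun i => algebraMap F F' (x i)) k A.w := by
  have hK : ∀ c : K, P'.valuation F' (algebraMap K F' c) ≤ 1 := fun c => by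
    rw [IsScalarTower.algebraMap_apply K O' F']
    exact P'.valuation_le_one _
  by_cases hS : P.valuation F y = WithZero.exp 1
  · exact Or.inl (A.valuation_w_of_exp_one hβ hP hS).1
  · obtain ⟨z, hz⟩ := exists_local_of_cuspState h hS
    have hv := A.valuation_eq_of_sub_le hβ hP hz
    rcases h with h | ⟨hx0, ⟨h, hx⟩ | ⟨m, hm, α, hα, hx, h⟩⟩
    · exact absurd h hS
    · refine Or.inr ⟨by rw [hv, hx0], Or.inl ⟨?_, fun i hi => by rw [hv]; exact hx i hi⟩⟩
      refine Valuation.le_one_of_pow_sub (p := p) hK (β := β) ?_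
      rw [A.pow_eq, ← IsScalarTower.algebraMap_apply K F F', add_sub_cancel_left, hv]
      exact h
    · refine Or.inr ⟨by rw [hv, hx0], Or.inr ⟨m, hm, α, hα, fun i hi => by
        rw [hv]; exact hx i hi, ?_⟩⟩
      refine Valuation.le_one_of_pow_sub (p := p) hK (β := β) ?_
      have e : AL p l (algebraMap K F' α / algebraMap F F' (x m)) =
          algebraMap F F' (AL p l (algebraMap K F α / x m)) := by
        rw [← IsScalarTower.toAlgHom_apply K F F' (AL p l _), AL.map]
        simp
      rw [e, IsScalarTower.algebraMap_apply K F F' β, A.sub_pow_eq, add_sub_cancel_left, hv]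
      exact h

theorem genus_add_sum_le (A : ASData C p β y F') (hβ : β ≠ 0) {d : O}
    {T : Finset (HeightOneSpectrum O)} (hT : ∀ P, P ∈ T ↔ d ∈ P.asIdeal)
    {T' : Finset (HeightOneSpectrum O')} (hT' : ∀ P, P ∈ T' ↔ algebraMap O O' d ∈ P.asIdeal)
    {l : List K} {x : ℕ → F} {k : ℕ}
    (hcusp : ∀ P ∈ T, CuspState (P.valuation F) p (β :: l) x k y)
    (hreg : ∀ P ∉ T, P.valuation F y ≤ 1) :
    (A.crv : Crv K O' F').genus + ∑ P ∈ T', Crv.codim K P.asIdeal ≤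
        p * (C.genus + ∑ P ∈ T, Crv.codim K P.asIdeal) ∧
      ∑ P ∈ T, Crv.codim K P.asIdeal ≤ ∑ P ∈ T', Crv.codim K P.asIdeal := by
  classical
  have := A.finite
  have := A.isSeparable hβ
  have := A.finite_integralClosure hβ (O' := O')
  have hp := (Fact.out : p.Prime).pos
  set C' : Crv K O' F' := A.crv
  set S := {P ∈ T | P.valuation F y = WithZero.exp 1} with hS
  have hK : ∀ (P : HeightOneSpectrum O) (c : K), P.valuation F (algebraMap K F c) ≤ 1 :=
    fun P c => by
      rw [IsScalarTower.algebraMap_apply K O F]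
      exact P.valuation_le_one _
  have hloc : ∀ P : HeightOneSpectrum O, ∃ z, P ∈ T → P ∉ S →
      P.valuation F (y - (z ^ p - algebraMap K F β * z)) ≤ 1 := by
    intro P
    by_cases h : P ∈ T ∧ P ∉ S
    · have hv : P.valuation F y ≠ WithZero.exp 1 := fun hv => h.2 (by simp [hS, h.1, hv])
      obtain ⟨z, hz⟩ := exists_local_of_cuspState (hcusp P h.1) hv
      exact ⟨z, fun _ _ => hz⟩
    · exact ⟨0, fun h1 h2 => absurd ⟨h1, h2⟩ h⟩
  choose zl hzl using hloc
  obtain ⟨z, hz1, hz2⟩ := exists_forall_valuation_sub_le_one (T \ S) zl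
  have hsmall : ∀ (P : HeightOneSpectrum O) (s : F), P.valuation F s ≤ 1 →
      P.valuation F (s ^ p - algebraMap K F β * s) ≤ 1 := fun P s hs => by
    refine (Valuation.map_sub _ _ _).trans (max_le ?_ ?_)
    · rw [map_pow]; exact pow_le_one₀ zero_le hs
    · rw [map_mul]; exact mul_le_one₀ (hK P β) zero_le hs
  have ht1 : ∀ P ∉ S, P.valuation F (y - (z ^ p - algebraMap K F β * z)) ≤ 1 := by
    intro P hP
    by_cases hPT : P ∈ T
    · have h1 := hzl P hPT hP
      have h2 := hsmall P _ (hz1 P (by simp [hPT, hP]))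
      rw [sub_pow_char] at h2
      have e : y - (z ^ p - algebraMap K F β * z) =
          (y - (zl P ^ p - algebraMap K F β * zl P)) -
            (z ^ p - zl P ^ p - algebraMap K F β * (z - zl P)) := by ring
      rw [e]
      exact (Valuation.map_sub _ _ _).trans (max_le h1 h2)
    · exact (Valuation.map_sub _ _ _).trans
        (max_le (hreg P hPT) (hsmall P z (hz2 P (by simp [hPT]))))
  have ht2 : ∀ P ∈ S, P.valuation F (y - (z ^ p - algebraMap K F β * z)) ≤ WithZero.exp 1 := by
    intro P hP
    refine (Valuation.map_sub _ _ _).trans (max_le (Finset.mem_filter.1 hP).2.le ?_)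
    exact (hsmall P z (hz2 P (by simp [hP]))).trans (by decide)
  have hE : ∏ P ∈ S, P.asIdeal ≠ ⊥ := Finset.prod_ne_zero_iff.2 fun P _ => P.ne_bot
  have hg := A.genus_crv_le O' z hE (fun e he => by
    obtain ⟨b, hb⟩ := mem_integers_of_valuation_le_one F
      (algebraMap O F e * (y - (z ^ p - algebraMap K F β * z))) fun P => by
        rw [map_mul]
        by_cases hP : P ∈ S
        · have h1 : P.valuation F (algebraMap O F e) ≤ WithZero.exp (-1) := by
            rw [valuation_of_algebraMap]
            have := (P.intValuation_le_pow_iff_mem e 1).2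
              (by rw [pow_one]; exact Ideal.le_of_dvd (Finset.dvd_prod_of_mem _ hP) he)
            simpa using this
          calc _ ≤ WithZero.exp (-1 : ℤ) * WithZero.exp 1 := mul_le_mul' h1 (ht2 P hP)
            _ = 1 := by rw [← WithZero.exp_add]; simp
        · exact mul_le_one₀ (P.valuation_le_one e) zero_le (ht1 P hP)
    exact ⟨b, hb⟩)
  rw [C.codim_prod _ fun P _ => P.ne_bot] at hg
  have hnb : ∀ P' : HeightOneSpectrum O', P'.asIdeal.comap (algebraMap O O') ≠ ⊥ := fun P' h =>
    P'.ne_bot (Ideal.eq_bot_of_comap_eq_bot h)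
  let π : HeightOneSpectrum O' → HeightOneSpectrum O := fun P' =>
    ⟨P'.asIdeal.comap (algebraMap O O'), P'.isPrime.comap _, hnb P'⟩
  have hπT : ∀ P' ∈ T', π P' ∈ T := fun P' h => (hT _).2 ((hT' _).1 h)
  have hsum : ∑ P' ∈ T', Crv.codim K P'.asIdeal =
      ∑ P ∈ T, ∑ P' ∈ T' with π P' = P, Crv.codim K P'.asIdeal :=
    (Finset.sum_fiberwise_of_maps_to hπT _).symm
  have hST : S ⊆ T := Finset.filter_subset _ _
  have hbound : ∀ P ∈ T, ∑ P' ∈ T' with π P' = P, Crv.codim K P'.asIdeal ≤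
      if P ∈ S then Crv.codim K P.asIdeal else p * Crv.codim K P.asIdeal := by
    intro P hP
    split_ifs with hPS
    · have h1 := C'.sum_codim_le (F := F) P (m := p) {P' ∈ T' | π P' = P} fun P' hP' => by
        have h2 : P'.asIdeal.comap (algebraMap O O') = P.asIdeal :=
          congrArg asIdeal (Finset.mem_filter.1 hP').2
        exact (A.valuation_w_of_exp_one hβ h2 (Finset.mem_filter.1 hPS).2).2
      rw [A.finrank_eq, mul_comm] at h1
      exact Nat.le_of_mul_le_mul_right h1 hp
    · have h1 := C'.sum_codim_le (F := F) P (m := 1) {P' ∈ T' | π P' = P} fun P' hP' => by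
        have h2 := (Finset.mem_filter.1 hP').2
        rw [pow_one, Ideal.map_le_iff_le_comap]
        exact (congrArg asIdeal h2).ge
      rwa [A.finrank_eq, one_mul, mul_comm] at h1
  constructor
  · have h1 : ∑ P' ∈ T', Crv.codim K P'.asIdeal ≤
        ∑ P ∈ S, Crv.codim K P.asIdeal + p * ∑ P ∈ T \ S, Crv.codim K P.asIdeal := by
      rw [hsum]
      refine (Finset.sum_le_sum hbound).trans_eq ?_
      rw [← Finset.sum_sdiff hST, add_comm, Finset.mul_sum]
      congr 1
      · exact Finset.sum_congr rfl fun P hP => if_pos hP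
      · exact Finset.sum_congr rfl fun P hP => if_neg (Finset.mem_sdiff.1 hP).2
    rw [← Finset.sum_sdiff hST]
    obtain ⟨n, rfl⟩ := Nat.exists_eq_add_of_le' hp
    simp only [Nat.add_sub_cancel] at hg
    nlinarith
  · rw [hsum]
    refine Finset.sum_le_sum fun P hP => ?_
    have : Algebra.IsIntegral O O' := inferInstance
    obtain ⟨Q, -, hQp, hQ⟩ := Ideal.exists_ideal_over_prime_of_isIntegral P.asIdeal (⊥ : Ideal O')
      (by rw [← RingHom.ker_eq_comap_bot, (RingHom.injective_iff_ker_eq_bot _).1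
            (FaithfulSMul.algebraMap_injective O O')]; exact bot_le)
    have hQ0 : Q ≠ ⊥ := by
      rintro rfl
      rw [← RingHom.ker_eq_comap_bot, (RingHom.injective_iff_ker_eq_bot _).1
            (FaithfulSMul.algebraMap_injective O O')] at hQ
      exact P.ne_bot hQ.symm
    have hmem : (⟨Q, hQp, hQ0⟩ : HeightOneSpectrum O') ∈ {P' ∈ T' | π P' = P} := by
      rw [Finset.mem_filter, hT']
      refine ⟨?_, HeightOneSpectrum.ext hQ⟩
      have := (hT P).1 hP
      rw [← hQ] at this
      exact this
    refine (C'.codim_le_of_comap hQ0 hQ).trans ?_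
    generalize {P' ∈ T' | π P' = P} = U at hmem ⊢
    have h3 : ∀ i ∈ U, 0 ≤ Crv.codim K i.asIdeal := fun _ _ => Nat.zero_le _
    have h4 := Finset.single_le_sum h3 hmem
    exact h4

end ASData

namespace RatFunc

open scoped Classical

variable (K : Type) [Field K]

variable {K} in
theorem inftyValuation_algebraMap {b : Polynomial K} (hb : b ≠ 0) :
    inftyValuation K (algebraMap (Polynomial K) (RatFunc K) b) = WithZero.exp (b.natDegree : ℤ) :=
  inftyValuation.polynomial K hb

variable {K} in
theorem exists_inftyValuation_sub_lt (f : RatFunc K) : ∃ b : Polynomial K,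
    inftyValuation K (f - algebraMap (Polynomial K) (RatFunc K) b) < 1 := by
  refine ⟨f.num /ₘ f.denom, ?_⟩
  have hd : algebraMap (Polynomial K) (RatFunc K) f.denom ≠ 0 := by simpa using f.denom_ne_zero
  have h1 := congrArg (algebraMap (Polynomial K) (RatFunc K))
    (Polynomial.modByMonic_add_div f.num f.denom)
  have h2 : f - algebraMap (Polynomial K) (RatFunc K) (f.num /ₘ f.denom) =
      algebraMap (Polynomial K) (RatFunc K) (f.num %ₘ f.denom) / algebraMap _ _ f.denom := by
    have h3 := f.num_div_denom
    rw [div_eq_iff hd] at h3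
    rw [eq_div_iff hd, sub_mul, ← h3, ← h1, map_add, map_mul]
    ring
  rw [h2, map_div₀]
  by_cases hr : f.num %ₘ f.denom = 0
  · rw [hr, map_zero, map_zero, zero_div]
    exact zero_lt_one
  · rw [inftyValuation_algebraMap hr, inftyValuation_algebraMap f.denom_ne_zero, ← WithZero.exp_sub,
      ← WithZero.exp_zero, WithZero.exp_lt_exp]
    have := Polynomial.natDegree_lt_natDegree hr
      (Polynomial.degree_modByMonic_lt f.num f.monic_denom)
    omega

/-- The affine line. -/
noncomputable def crv : Crv K (Polynomial K) (RatFunc K) where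
  v := inftyValuation K
  v_const c hc := by
    rw [IsScalarTower.algebraMap_apply K (Polynomial K), inftyValuation_algebraMap (by simpa)]
    simp
  residue f hf := by
    obtain ⟨b, hb⟩ := exists_inftyValuation_sub_lt f
    rcases eq_or_ne b 0 with rfl | hb0
    · exact ⟨0, by simpa using hb⟩
    have h1 : inftyValuation K (algebraMap (Polynomial K) (RatFunc K) b) ≤ 1 := by
      rw [← sub_sub_cancel f (algebraMap (Polynomial K) (RatFunc K) b)]
      exact (Valuation.map_sub _ _ _).trans (max_le hf hb.le)
    rw [inftyValuation_algebraMap hb0, ← WithZero.exp_zero, WithZero.exp_le_exp] at h1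
    have h2 := Polynomial.eq_C_of_natDegree_eq_zero (p := b) (by omega)
    refine ⟨b.coeff 0, ?_⟩
    rw [IsScalarTower.algebraMap_apply K (Polynomial K), Polynomial.algebraMap_eq, ← h2]
    exact hb
  exists_exp_one := ⟨X, inftyValuation.X K⟩
  one_le b hb := by
    rw [inftyValuation_algebraMap hb, ← WithZero.exp_zero, WithZero.exp_le_exp]
    omega
  exists_add := ⟨0, fun f => (exists_inftyValuation_sub_lt f).imp fun b hb => hb.le⟩

theorem genus_crv [Finite K] : (crv K).genus = 0 := by
  have h : Crv.emb K (RatFunc K) (⊤ : Ideal (Polynomial K)) ⊔ (crv K).L 0 = ⊤ := by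
    refine eq_top_iff.2 fun f _ => ?_
    obtain ⟨b, hb⟩ := exists_inftyValuation_sub_lt f
    rw [← add_sub_cancel (algebraMap (Polynomial K) (RatFunc K) b) f]
    exact Submodule.add_mem_sup (Crv.algebraMap_mem_emb.2 trivial) (Crv.mem_L.2 hb.le)
  rw [Crv.genus, Crv.i, h]
  exact Module.finrank_zero_of_subsingleton

end RatFunc

namespace IsDedekindDomain.HeightOneSpectrum

variable {O F : Type} [CommRing O] [IsDedekindDomain O] [Field F] [Algebra O F] [IsFractionRing O F]

theorem span_eq_prod (F : Type) [Field F] [Algebra O F] [IsFractionRing O F] {d : O} (hd0 : d ≠ 0)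
    {T : Finset (HeightOneSpectrum O)} (hT : ∀ P, P ∈ T ↔ d ∈ P.asIdeal)
    (hd : ∀ P ∈ T, P.valuation F (algebraMap O F d) = WithZero.exp (-1)) :
    Ideal.span {d} = ∏ P ∈ T, P.asIdeal := by
  apply le_antisymm
  · rw [← Ideal.dvd_iff_le]
    refine Finset.prod_dvd_of_coprime (fun P _ Q _ hPQ => ?_) fun P hP =>
      Ideal.dvd_iff_le.2 ((Ideal.span_singleton_le_iff_mem _).2 ((hT P).1 hP))
    have := P.isMaximal
    have := Q.isMaximal
    exact Ideal.isCoprime_of_isMaximal fun h => hPQ (HeightOneSpectrum.ext h)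
  · intro e he
    have hdF : algebraMap O F d ≠ 0 := by simpa using hd0
    obtain ⟨b, hb⟩ := mem_integers_of_valuation_le_one F
      (algebraMap O F e / algebraMap O F d) fun P => by
        rw [map_div₀]
        by_cases hP : P ∈ T
        · rw [hd P hP, valuation_of_algebraMap]
          refine div_le_one_of_le₀ ?_ zero_le
          simpa using (P.intValuation_le_pow_iff_mem e 1).2
            (by rw [pow_one]; exact Ideal.le_of_dvd (Finset.dvd_prod_of_mem _ hP) he)
        · rw [P.valuation_eq_one_iff_notMem.2 fun h => hP ((hT P).2 h), div_one]
          exact P.valuation_le_one e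
    rw [eq_div_iff hdF, ← map_mul] at hb
    exact Ideal.mem_span_singleton'.2 ⟨b, IsFractionRing.injective O F hb⟩

theorem valuation_eq_exp_neg_one_of_squarefree {d : O} (hd : Squarefree d)
    {P : HeightOneSpectrum O} (hP : d ∈ P.asIdeal) [IsPrincipalIdealRing O] :
    P.valuation F (algebraMap O F d) = WithZero.exp (-1) := by
  rw [valuation_of_algebraMap]
  apply le_antisymm
  · simpa using (P.intValuation_le_pow_iff_mem d 1).2 (by rwa [pow_one])
  · by_contra! h
    have h1 : P.intValuation d ≤ WithZero.exp (-((2 : ℕ) : ℤ)) := by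
      rcases eq_or_ne (P.intValuation d) 0 with h0 | h0
      · rw [h0]; exact zero_le
      · obtain ⟨n, hn⟩ : ∃ n, P.intValuation d = WithZero.exp n :=
          ⟨_, (WithZero.exp_log h0).symm⟩
        rw [hn, WithZero.exp_lt_exp] at h
        rw [hn, WithZero.exp_le_exp]
        push_cast; omega
    rw [intValuation_le_pow_iff_mem] at h1
    obtain ⟨π, hπ⟩ := IsPrincipalIdealRing.principal P.asIdeal
    rw [Ideal.submodule_span_eq] at hπ
    rw [hπ, Ideal.span_singleton_pow, Ideal.mem_span_singleton, sq] at h1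
    have := hd π h1
    exact P.isPrime.ne_top (by rw [hπ]; exact Ideal.span_singleton_eq_top.2 this)

end IsDedekindDomain.HeightOneSpectrum

namespace ASData

section auto

variable {K O F : Type} [Field K] [CommRing O] [Field F] [Algebra K O] [Algebra O F]
    [Algebra K F] {C : Crv K O F} {p : ℕ} {β : K} {y : F} {F' : Type} [Field F']
    [Algebra F F'] (A : ASData C p β y F') [Algebra K F'] [IsScalarTower K F F']

open Polynomial in
theorem exists_algHom (A : ASData C p β y F') [Fact p.Prime] [CharP F' p] {c : K}
    (hc : c ^ p = β * c) : ∃ τ : F' →ₐ[F] F', τ A.w = A.w + algebraMap K F' c := by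
  have hp := A.one_lt
  let pb : PowerBasis F F' := ⟨A.w, p, A.B, A.B_eq⟩
  set f : F[X] := X ^ p - (Polynomial.C (algebraMap K F β) * X + Polynomial.C y) with hf
  have hlin : (Polynomial.C (algebraMap K F β) * X + Polynomial.C y).degree < (p : WithBot ℕ) := by
    refine (degree_linear_le).trans_lt ?_
    exact_mod_cast hp
  have hfm : f.Monic := monic_X_pow_sub hlin
  have hfd : f.natDegree = p := by
    refine natDegree_eq_of_degree_eq_some ?_
    rw [hf, degree_sub_eq_left_of_degree_lt (by rwa [degree_X_pow]), degree_X_pow]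
  have hw0 : aeval A.w f = 0 := by simp [hf, A.pow_eq]
  have hmin : f = minpoly F A.w := by
    refine eq_of_monic_of_dvd_of_natDegree_le (minpoly.monic pb.isIntegral_gen) hfm
      (minpoly.dvd F A.w hw0) ?_
    rw [hfd]
    exact pb.natDegree_minpoly.ge
  refine ⟨pb.lift (A.w + algebraMap K F' c) ?_, pb.lift_gen _ _⟩
  change aeval _ (minpoly F A.w) = 0
  rw [← hmin]
  simp only [hf, map_sub, map_add, map_mul, map_pow, aeval_X, aeval_C]
  rw [add_pow_char, A.pow_eq, ← map_pow, hc, map_mul, ← IsScalarTower.algebraMap_apply K F F']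
  ring

theorem val_algHom_le (A : ASData C p β y F') {c : K} {τ : F' →ₐ[F] F'}
    (hτ : τ A.w = A.w + algebraMap K F' c) (x : F') : A.val (τ x) ≤ A.val x := by
  have hw : A.val (A.w + algebraMap K F' c) ≤ WithZero.exp (1 : ℤ) := by
    refine (Valuation.map_add _ _ _).trans (max_le A.val_w.le ?_)
    change A.ν _ ≤ _
    rw [IsScalarTower.algebraMap_apply K F F', ν_algebraMap]
    exact (pow_le_one₀ zero_le (C.v_algebraMap_le c)).trans (by decide)
  conv_lhs => rw [eq_sum (A := A) x]
  rw [map_sum]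
  refine ν_sum_le fun i _ => ?_
  rw [map_smul, map_pow, hτ, ν_smul]
  refine le_trans ?_ (le_ν x i)
  refine mul_le_mul' le_rfl ?_
  change A.val _ ≤ _
  rw [map_pow]
  refine (pow_le_pow_left₀ zero_le hw _).trans ?_
  rw [← WithZero.exp_nsmul]
  simp

end auto

variable {K O F : Type} [Field K] [CommRing O] [Field F] [Algebra K O] [Algebra O F]
    [Algebra K F] {C : Crv K O F} {p : ℕ} {β : K} {y : F} {F' : Type} [Field F']
    [Algebra F F'] (A : ASData C p β y F')
  {O' : Type} [CommRing O'] [Algebra K O'] [Algebra O O'] [Algebra O' F'] [Algebra O F']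
  [Algebra K F'] [IsScalarTower K F F'] [IsScalarTower O F F'] [IsScalarTower O O' F']
  [IsScalarTower K O' F'] [IsDedekindDomain O] [IsFractionRing O F]
  [IsIntegralClosure O' O F'] [IsScalarTower K O F] [IsScalarTower K O O']

theorem exists_auto (A : ASData C p β y F') [Fact p.Prime] [CharP F' p] {c : K}
    (hc : c ^ p = β * c) : ∃ σ : O' →ₐ[K] O',
      (∀ a, σ (algebraMap O O' a) = algebraMap O O' a) ∧
      (∀ s, A.val (algebraMap O' F' (σ s)) = A.val (algebraMap O' F' s)) ∧
      ∀ (L : Type) [Field L] [Algebra K L] (φ : O' →ₐ[K] L) (θ : L), Ev F' φ A.w θ →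
        Ev F' (φ.comp σ) A.w (θ + algebraMap K L c) := by
  have := A.finite
  obtain ⟨τ, hτ⟩ := A.exists_algHom hc
  have hc' : (-c) ^ p = β * -c := by
    have h : (-c) ^ p = - c ^ p := by
      have : CharP K p := (algebraMap K F').charP (algebraMap K F').injective p
      rw [neg_eq_zero_sub, sub_pow_char, zero_pow (Fact.out : p.Prime).ne_zero]
      ring
    rw [h, hc]; ring
  obtain ⟨τ', hτ'⟩ := A.exists_algHom hc'
  have hFw : ∀ d : K, algebraMap K F' d = algebraMap F F' (algebraMap K F d) :=
    IsScalarTower.algebraMap_apply K F F'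
  have hcomp : ∀ τ₁ τ₂ : F' →ₐ[F] F', τ₁ (τ₂ A.w) = A.w → ∀ x, τ₁ (τ₂ x) = x := by
    intro τ₁ τ₂ h x
    have : τ₁.comp τ₂ = AlgHom.id F F' := AlgHom.ext_of_adjoin_eq_top A.adjoin_w (by
      rintro _ rfl; exact h)
    exact DFunLike.congr_fun this x
  have h1 : ∀ x, τ (τ' x) = x := hcomp _ _ (by
    rw [hτ', map_add, hτ, hFw (-c), τ.commutes, hFw, map_neg, map_neg]; ring)
  have h2 : ∀ x, τ' (τ x) = x := hcomp _ _ (by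
    rw [hτ, map_add, hτ', hFw c, τ'.commutes, hFw, map_neg, map_neg]; ring)
  let σ := galRestrictHom O F F' O' τ
  let σ' := galRestrictHom O F F' O' τ'
  have hσ : ∀ s, algebraMap O' F' (σ s) = τ (algebraMap O' F' s) :=
    algebraMap_galRestrictHom_apply O F F' O' τ
  have hσ' : ∀ s, algebraMap O' F' (σ' s) = τ' (algebraMap O' F' s) :=
    algebraMap_galRestrictHom_apply O F F' O' τ'
  have hinj : Function.Injective (algebraMap O' F') :=
    IsIntegralClosure.algebraMap_injective O' O F'
  refine ⟨σ.restrictScalars K, fun a => σ.commutes a, fun s => ?_, ?_⟩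
  · change A.val (algebraMap O' F' (σ s)) = _
    rw [hσ]
    refine le_antisymm (A.val_algHom_le hτ _) ?_
    conv_lhs => rw [← h2 (algebraMap O' F' s)]
    exact A.val_algHom_le hτ' _
  · rintro L _ _ φ θ ⟨a, b, hb, hab, hφ⟩
    have hs : ∀ s, σ (σ' s) = s := fun s => hinj (by rw [hσ, hσ', h1])
    have hcs : ∀ s, (φ.comp (σ.restrictScalars K)) (σ' s) = φ s := fun s => congrArg φ (hs s)
    refine ⟨σ' (a + algebraMap K O' c * b), σ' b, by rwa [hcs], ?_, ?_⟩
    · rw [hσ', hσ']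
      have : A.w = τ' (A.w + algebraMap K F' c) := by rw [← hτ, h2]
      have e : algebraMap O' F' (a + algebraMap K O' c * b) =
          algebraMap O' F' a + algebraMap K F' c * algebraMap O' F' b := by
        rw [map_add, map_mul, ← IsScalarTower.algebraMap_apply K O' F']
      rw [this, ← map_mul, mul_add, hab, e, mul_comm (algebraMap O' F' b)]
    · rw [hcs, hcs, map_add, map_mul, φ.commutes, hφ]; ring

end ASData

/-- An intermediate curve in the tower: `O` is its coordinate ring, `x 0, …, x k` are coordinates
of the Bezerra–Garcia type tower, and `y` is the function used for the next Artin–Schreier type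
extension `w ^ p = β w + y`. -/
structure Stage (K : Type) [Field K] (p q : ℕ) (l₀ : List K) : Type 1 where
  O : Type
  F : Type
  [commRing : CommRing O]
  [dedekind : IsDedekindDomain O]
  [field : Field F]
  [algKO : Algebra K O]
  [algOF : Algebra O F]
  [algKF : Algebra K F]
  [tower : IsScalarTower K O F]
  [frac : IsFractionRing O F]
  C : Crv K O F
  X : O
  x : ℕ → F
  k : ℕ
  y : F
  pre : List K
  β : K
  suf : List K
  split : pre ++ β :: suf = l₀
  x_zero : x 0 = algebraMap O F X
  X_ne : X ^ q + X ≠ 0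
  rel : ∀ i < k, x (i + 1) ^ q + x (i + 1) = towerMap q (x i)
  AL_y : AL p pre y = towerMap q (x k)
  v_y : C.v y = WithZero.exp (1 : ℤ)
  T : Finset (HeightOneSpectrum O)
  mem_T : ∀ P, P ∈ T ↔ X ^ q + X ∈ P.asIdeal
  cusp : ∀ P ∈ T, CuspState (P.valuation F) p (β :: suf) x k y

namespace Stage

attribute [instance] commRing dedekind field algKO algOF algKF tower frac

section

variable {K : Type} [Field K] {p q : ℕ} {l₀ : List K} (S : Stage K p q l₀)

/-- The total degree of the points at which `x 0 ^ q + x 0` vanishes. -/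
noncomputable def cuspDeg : ℕ := ∑ P ∈ S.T, Crv.codim K P.asIdeal

theorem charP [CharP K p] : CharP S.F p :=
  charP_of_injective_algebraMap (algebraMap K S.F).injective p

theorem valuation_const_le (P : HeightOneSpectrum S.O) (c : K) :
    P.valuation S.F (algebraMap K S.F c) ≤ 1 := by
  rw [IsScalarTower.algebraMap_apply K S.O S.F]
  exact P.valuation_le_one _

theorem valuation_x (hq : 2 ≤ q) {P : HeightOneSpectrum S.O} (hP : P ∉ S.T) {i : ℕ} (hi : i ≤ S.k) :
    P.valuation S.F (S.x i) ≤ 1 ∧ P.valuation S.F (S.x i ^ q + S.x i) = 1 ∧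
      P.valuation S.F (towerMap q (S.x i)) = 1 := by
  have hu : ∀ f : S.F, P.valuation S.F f ≤ 1 → P.valuation S.F (f ^ q + f) = 1 →
      P.valuation S.F (towerMap q f) = 1 := by
    intro f h1 h2
    have h0 : f ^ q + f ≠ 0 := fun h => by simp [h] at h2
    rw [pow_add_self_eq hq, map_mul] at h2
    have h3 : P.valuation S.F (f ^ (q - 1) + 1) ≤ 1 := by
      refine (Valuation.map_add _ _ _).trans (max_le ?_ (by simp))
      rw [map_pow]; exact pow_le_one₀ zero_le h1
    have h4 : P.valuation S.F f = 1 := le_antisymm h1 (by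
      rw [← h2]; exact mul_le_of_le_one_right' h3)
    rw [h4, one_mul] at h2
    rw [towerMap_eq hq h0, map_div₀, h2, map_pow, h4, one_pow, div_one]
  have key : P.valuation S.F (S.x i) ≤ 1 ∧ P.valuation S.F (S.x i ^ q + S.x i) = 1 := by
    induction i with
    | zero =>
      rw [S.x_zero]
      refine ⟨P.valuation_le_one _, ?_⟩
      rw [← map_pow, ← map_add, HeightOneSpectrum.valuation_eq_one_iff_notMem, ← S.mem_T]
      exact hP
    | succ i ih =>
      have h1 := ih (by omega)
      have h2 := hu _ h1.1 h1.2
      rw [← S.rel i (by omega)] at h2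
      refine ⟨?_, h2⟩
      by_contra! h3
      rw [Valuation.map_pow_add_self_of_one_lt _ hq h3] at h2
      exact absurd h2 (one_lt_pow₀ h3 (by omega)).ne'
  exact ⟨key.1, key.2, hu _ key.1 key.2⟩

theorem valuation_y [Fact p.Prime] [CharP K p] (hq : 2 ≤ q) {P : HeightOneSpectrum S.O}
    (hP : P ∉ S.T) : P.valuation S.F S.y ≤ 1 := by
  have := S.charP
  refine AL.val_le_one_of (p := p) (S.valuation_const_le P) S.pre ?_
  rw [S.AL_y]
  exact (S.valuation_x hq hP le_rfl).2.2.le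

end

/-- The relation between a stage of the tower and the next one. -/
structure Step {K : Type} [Field K] {p q : ℕ} {l₀ : List K} (S S' : Stage K p q l₀) : Type 1 where
  ι : S.O →ₐ[K] S'.O
  w : S'.F
  map_X : ι S.X = S'.X
  genus_add : S'.C.genus + S'.cuspDeg ≤ p * (S.C.genus + S.cuspDeg)
  cuspDeg_le : S.cuspDeg ≤ S'.cuspDeg
  exists_hom : ∀ {L : Type} [Field L] [Algebra K L] {φ : S.O →ₐ[K] L} {η θ : L},
    Ev S.F φ S.y η → θ ^ p = algebraMap K L S.β * θ + η →
      ∃ φ' : S'.O →ₐ[K] L, φ'.comp ι = φ ∧ Ev S'.F φ' w θ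
  hom_ext : ∀ {L : Type} [Field L] [Algebra K L] {φ₁ φ₂ : S'.O →ₐ[K] L} {η θ : L},
    φ₁.comp ι = φ₂.comp ι → Ev S.F (φ₁.comp ι) S.y η → θ ^ p = algebraMap K L S.β * θ + η →
      Ev S'.F φ₁ w θ → Ev S'.F φ₂ w θ → φ₁ = φ₂
  pow_eq : ∀ {L : Type} [Field L] [Algebra K L] {φ : S'.O →ₐ[K] L} {η θ : L},
    Ev S.F (φ.comp ι) S.y η → Ev S'.F φ w θ → θ ^ p = algebraMap K L S.β * θ + η
  y_eq : S'.y = w ∨ S'.x S'.k = w ∧ S'.y = towerMap q w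
  exists_auto : ∀ c : K, c ^ p = S.β * c → ∃ σ : S'.O →ₐ[K] S'.O, (∀ s, σ (ι s) = ι s) ∧
    (∀ s, S'.C.v (algebraMap S'.O S'.F (σ s)) = S'.C.v (algebraMap S'.O S'.F s)) ∧
    ∀ (L : Type) [Field L] [Algebra K L] (φ : S'.O →ₐ[K] L) (θ : L), Ev S'.F φ w θ →
      Ev S'.F (φ.comp σ) w (θ + algebraMap K L c)

section

variable {K : Type} [Field K] [Fintype K] {p q a : ℕ} [Fact p.Prime] [CharP K p] {l₀ : List K}

theorem exists_next_data (hq : Fintype.card K = q) (hqa : q = p ^ a) (hq2 : 2 ≤ q)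
    (hAL : ∀ (R : Type) [CommRing R] [Algebra K R] (T : R), AL p l₀ T = T ^ q + T)
    (S : Stage K p q l₀) (hβ : S.β ≠ 0)
    {F' : Type} [Field F'] [Algebra S.F F'] (A : ASData S.C p S.β S.y F')
    {O' : Type} [CommRing O'] [Algebra K O'] [Algebra S.O O'] [Algebra O' F'] [Algebra S.O F']
    [Algebra K F'] [IsScalarTower K S.F F'] [IsScalarTower S.O S.F F'] [IsScalarTower S.O O' F']
    [IsScalarTower K O' F'] [IsIntegralClosure O' S.O F'] [IsScalarTower K S.O O']
    [IsDedekindDomain O'] [IsFractionRing O' F'] [Module.IsTorsionFree S.O O'] :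
    ∃ S' : Stage K p q l₀, Nonempty (Step S S') := by
  classical
  have := S.charP
  have hF' : CharP F' p := charP_of_injective_algebraMap (algebraMap K F').injective p
  have hOF : ∀ a, algebraMap S.O F' a = algebraMap S.F F' (algebraMap S.O S.F a) :=
    IsScalarTower.algebraMap_apply S.O S.F F'
  have hOO' : ∀ a, algebraMap S.O F' a = algebraMap O' F' (algebraMap S.O O' a) :=
    IsScalarTower.algebraMap_apply S.O O' F'
  have hu : ∀ f, algebraMap S.F F' (towerMap q f) = towerMap q (algebraMap S.F F' f) := fun f => by
    simp [towerMap]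
  have hALF : ∀ (l : List K) f, algebraMap S.F F' (AL p l f) = AL p l (algebraMap S.F F' f) :=
    fun l f => AL.map (IsScalarTower.toAlgHom K S.F F') l f
  have hw1 : AL p S.pre (AL p [S.β] A.w) = towerMap q (algebraMap S.F F' (S.x S.k)) := by
    have : AL p [S.β] A.w = algebraMap S.F F' S.y := by
      simp only [AL]
      rw [A.pow_eq, ← IsScalarTower.algebraMap_apply K S.F F']
      ring
    rw [this, ← hALF, S.AL_y, hu]
  let C' : Crv K O' F' := A.crv
  set d := S.X ^ q + S.X with hd
  have hd' : algebraMap S.O O' d = algebraMap S.O O' S.X ^ q + algebraMap S.O O' S.X := by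
    rw [hd, map_add, map_pow]
  have hnb : ∀ P' : HeightOneSpectrum O', P'.asIdeal.comap (algebraMap S.O O') ≠ ⊥ := fun P' h => by
    have := A.finite
    have : Algebra.IsIntegral S.O O' := IsIntegralClosure.isIntegral_algebra S.O F'
    exact P'.ne_bot (Ideal.eq_bot_of_comap_eq_bot h)
  let π : HeightOneSpectrum O' → HeightOneSpectrum S.O := fun P' =>
    ⟨P'.asIdeal.comap (algebraMap S.O O'), P'.isPrime.comap _, hnb P'⟩
  have hd0 : algebraMap S.O O' d ≠ 0 := by
    intro h
    exact S.X_ne (FaithfulSMul.algebraMap_injective S.O O' (by rw [h, map_zero]))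
  have hfin : {P : HeightOneSpectrum O' | algebraMap S.O O' d ∈ P.asIdeal}.Finite := by
    refine (Ideal.finite_factors (I := Ideal.span {algebraMap S.O O' d}) ?_).subset fun P hP => ?_
    · simpa using hd0
    · exact Ideal.dvd_iff_le.2 ((Ideal.span_singleton_le_iff_mem _).2 hP)
  let T' := hfin.toFinset
  have hT' : ∀ P, P ∈ T' ↔ algebraMap S.O O' d ∈ P.asIdeal := fun P => by simp [T']
  have hcusp : ∀ P ∈ T', CuspState (P.valuation F') p S.suf
      (fun i => algebraMap S.F F' (S.x i)) S.k A.w := fun P' hP' => by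
    have h1 : P'.asIdeal.comap (algebraMap S.O O') = (π P').asIdeal := rfl
    have h2 : π P' ∈ S.T := (S.mem_T _).2 ((hT' _).1 hP')
    exact A.cuspState hβ h1 (S.cusp _ h2)
  have hgen := A.genus_add_sum_le hβ (d := d) S.mem_T hT' S.cusp fun P hP => S.valuation_y hq2 hP
  obtain ⟨x', k', y', pre', β', suf', h1, h2, h3, h4, h5, h6, h7⟩ : ∃ (x' : ℕ → F') (k' : ℕ)
      (y' : F') (pre' : List K) (β' : K) (suf' : List K), pre' ++ β' :: suf' = l₀ ∧
        x' 0 = algebraMap S.F F' (S.x 0) ∧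
        (∀ i < k', x' (i + 1) ^ q + x' (i + 1) = towerMap q (x' i)) ∧
        AL p pre' y' = towerMap q (x' k') ∧ A.val y' = WithZero.exp (1 : ℤ) ∧
        (∀ P ∈ T', CuspState (P.valuation F') p (β' :: suf') x' k' y') ∧
        (y' = A.w ∨ x' k' = A.w ∧ y' = towerMap q A.w) := by
    have hrel : ∀ i < S.k, algebraMap S.F F' (S.x (i + 1)) ^ q + algebraMap S.F F' (S.x (i + 1)) =
        towerMap q (algebraMap S.F F' (S.x i)) := fun i hi => by
      rw [← hu, ← S.rel i hi, map_add, map_pow]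
    rcases hsuf : S.suf with _ | ⟨b, suf'⟩
    · have hsplit := S.split
      rw [hsuf] at hsplit hcusp
      obtain ⟨b, l', hb⟩ : ∃ b l', l₀ = b :: l' := by
        cases h : l₀ with
        | nil => exact absurd (hsplit.trans h) (by simp)
        | cons b l' => exact ⟨b, l', rfl⟩
      have hwq : A.w ^ q + A.w = towerMap q (algebraMap S.F F' (S.x S.k)) := by
        rw [← hAL, ← hw1, ← AL.append]
        exact congrArg (AL p · A.w) hsplit.symm
      have hone : 1 < A.val A.w := by rw [A.val_w]; decide
      let x' : ℕ → F' := fun i => if i ≤ S.k then algebraMap S.F F' (S.x i) else A.w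
      have hx1 : ∀ i ≤ S.k, x' i = algebraMap S.F F' (S.x i) := fun i hi => if_pos hi
      have hx2 : x' (S.k + 1) = A.w := if_neg (by omega)
      refine ⟨x', S.k + 1, towerMap q A.w, [], b, l', hb.symm, hx1 0 (Nat.zero_le _), ?_,
        by rw [hx2]; rfl, by rw [A.val.map_towerMap_of_one_lt hq2 hone, A.val_w], fun P hP => ?_,
        Or.inr ⟨hx2, rfl⟩⟩
      · intro i hi
        rcases Nat.lt_succ_iff_lt_or_eq.1 hi with hi | rfl
        · rw [hx1 _ hi.le, hx1 _ hi]; exact hrel i hi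
        · rw [hx1 _ le_rfl, hx2, hwq]
      · rw [← hb]
        refine (hcusp P hP).rebase hq hqa hq2 (fun c => ?_) hrel hx1 hx2 hwq (hAL F')
        rw [IsScalarTower.algebraMap_apply K O' F']
        exact P.valuation_le_one _
    · rw [hsuf] at hcusp
      refine ⟨_, S.k, A.w, S.pre ++ [S.β], b, suf', ?_, rfl, hrel, ?_, A.val_w, hcusp, Or.inl rfl⟩
      · rw [List.append_assoc, List.singleton_append, ← hsuf, S.split]
      · rw [AL.append, hw1]
  let S' : Stage K p q l₀ :=
    { O := O', F := F', C := C', X := algebraMap S.O O' S.X, x := x', k := k', y := y',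
      pre := pre', β := β', suf := suf', split := h1,
      x_zero := by rw [h2, S.x_zero, ← hOF, hOO']
      X_ne := by rwa [← hd']
      rel := h3, AL_y := h4, v_y := h5, T := T', mem_T := fun P => by rw [hT', hd'], cusp := h6 }
  refine ⟨S', ⟨?_⟩⟩
  exact
    { ι := IsScalarTower.toAlgHom K S.O O'
      w := A.w
      map_X := rfl
      genus_add := hgen.1
      cuspDeg_le := hgen.2
      exists_hom := fun hη hθ => by
        obtain ⟨φ', h, h'⟩ := A.exists_hom (O' := O') hβ hη hθ
        exact ⟨φ', AlgHom.ext h, h'⟩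
      hom_ext := fun h hη hθ h₁ h₂ => A.hom_ext hβ (fun a => DFunLike.congr_fun h a) hη hθ h₁ h₂
      pow_eq := fun {L} _ _ {φ η θ} hη hθ => by
        have h1 : Ev F' (O := O') φ (algebraMap S.F F' S.y) η :=
          Ev.map (O := S.O) (φ := AlgHom.comp φ (IsScalarTower.toAlgHom K S.O O')) (fun a => rfl) hη
        have h2 : Ev F' (O := O') φ (algebraMap K F' S.β) (algebraMap K L S.β) := Ev.const _
        have h3 := (h2.mul hθ).add h1
        rw [IsScalarTower.algebraMap_apply K S.F F', ← A.pow_eq] at h3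
        have h4 : Ev F' (O := O') φ (A.w ^ p) (θ ^ p) := hθ.pow p
        exact h4.unique h3
      y_eq := h7
      exists_auto := fun c hc => A.exists_auto (O' := O') hc }

end

end Stage

namespace Stage

variable {K : Type} [Field K] [Fintype K] {p q a : ℕ} [Fact p.Prime] [CharP K p] {l₀ : List K}

theorem β_mem (S : Stage K p q l₀) : S.β ∈ l₀ := by
  have := S.split
  have h : S.β ∈ S.pre ++ S.β :: S.suf := by simp
  exact (congrArg (S.β ∈ ·) this).mp h

theorem exists_next (hq : Fintype.card K = q) (hqa : q = p ^ a) (hq2 : 2 ≤ q)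
    (hAL : ∀ (R : Type) [CommRing R] [Algebra K R] (T : R), AL p l₀ T = T ^ q + T)
    (hl₀ : ∀ β ∈ l₀, β ≠ 0) (S : Stage K p q l₀) :
    ∃ S' : Stage K p q l₀, Nonempty (Step S S') := by
  have hβ := hl₀ _ S.β_mem
  have := S.charP
  obtain ⟨F', _, _, ⟨A⟩⟩ := S.C.exists_asData (Fact.out : p.Prime).one_lt S.β S.v_y
  let _ : Algebra K F' := ((algebraMap S.F F').comp (algebraMap K S.F)).toAlgebra
  let _ : Algebra S.O F' := ((algebraMap S.F F').comp (algebraMap S.O S.F)).toAlgebra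
  have : IsScalarTower K S.F F' := IsScalarTower.of_algebraMap_eq' rfl
  have : IsScalarTower S.O S.F F' := IsScalarTower.of_algebraMap_eq' rfl
  have := A.finite
  have := A.isSeparable hβ
  let O' := integralClosure S.O F'
  let _ : Algebra K O' := ((algebraMap S.O O').comp (algebraMap K S.O)).toAlgebra
  have : IsScalarTower K S.O O' := IsScalarTower.of_algebraMap_eq' rfl
  have : IsScalarTower K O' F' := IsScalarTower.of_algebraMap_eq fun c => by
    change algebraMap S.F F' (algebraMap K S.F c) =
      algebraMap O' F' (algebraMap S.O O' (algebraMap K S.O c))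
    rw [← IsScalarTower.algebraMap_apply S.O O' F', IsScalarTower.algebraMap_apply S.O S.F F',
      ← IsScalarTower.algebraMap_apply K S.O S.F]
  have : IsDedekindDomain O' := integralClosure.isDedekindDomain S.O S.F F'
  have : IsFractionRing O' F' := integralClosure.isFractionRing_of_finite_extension S.F F'
  have h : Function.Injective (algebraMap S.O F') := by
    rw [IsScalarTower.algebraMap_eq S.O S.F F']
    exact (algebraMap S.F F').injective.comp (IsFractionRing.injective S.O S.F)
  have h2 : Function.Injective (algebraMap S.O O') := fun x y hxy => h (by
    rw [IsScalarTower.algebraMap_apply S.O O' F', hxy, ← IsScalarTower.algebraMap_apply S.O O' F'])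
  have := (faithfulSMul_iff_algebraMap_injective S.O O').2 h2
  exact exists_next_data hq hqa hq2 hAL S hβ A (O' := O')

end Stage

variable {K : Type} [Field K] [Fintype K] {p q a : ℕ} [Fact p.Prime] [CharP K p] {l₀ : List K}

open Polynomial in
theorem exists_base_stage (hq : Fintype.card K = q) (hq2 : 2 ≤ q)
    (hl₀ : l₀ ≠ []) : ∃ S : Stage K p q l₀, S.C.genus = 0 ∧ S.cuspDeg = q ∧ S.pre = [] ∧ S.k = 0 ∧
      ∀ {L : Type} [Field L] [Algebra K L] (t : L), ∃! φ : S.O →ₐ[K] L, φ S.X = t := by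
  classical
  obtain ⟨b, l', hb⟩ := List.exists_cons_of_ne_nil hl₀
  have hq0 : (q : K) = 0 := by
    rw [← hq]; exact Nat.cast_card_eq_zero K
  have hsep : (X ^ q + X : K[X]).Separable := by
    rw [Separable]
    simp only [derivative_add, derivative_X_pow, derivative_X, hq0, map_zero, zero_mul, zero_add]
    exact isCoprime_one_right
  have hX0 : (X ^ q + X : K[X]) ≠ 0 := hsep.ne_zero
  have hdeg : (X ^ q + X : K[X]).natDegree = q := by
    rw [natDegree_add_eq_left_of_natDegree_lt] <;> simp
    omega
  have hfin : {P : HeightOneSpectrum K[X] | X ^ q + X ∈ P.asIdeal}.Finite := by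
    refine (Ideal.finite_factors (I := Ideal.span {(X ^ q + X : K[X])}) ?_).subset fun P hP => ?_
    · simpa using hX0
    · exact Ideal.dvd_iff_le.2 ((Ideal.span_singleton_le_iff_mem _).2 hP)
  have hT : ∀ P, P ∈ hfin.toFinset ↔ X ^ q + X ∈ P.asIdeal := fun P => by simp
  have hval : ∀ P ∈ hfin.toFinset,
      P.valuation (RatFunc K) (algebraMap K[X] (RatFunc K) (X ^ q + X)) = WithZero.exp (-1) :=
    fun P hP => HeightOneSpectrum.valuation_eq_exp_neg_one_of_squarefree hsep.squarefree
      ((hT P).1 hP)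
  have hvX : (RatFunc.crv K).v (algebraMap K[X] (RatFunc K) X) = WithZero.exp (1 : ℤ) := by
    change RatFunc.inftyValuation K _ = _
    rw [RatFunc.inftyValuation_algebraMap X_ne_zero, natDegree_X, Nat.cast_one]
  have hone : 1 < (RatFunc.crv K).v (algebraMap K[X] (RatFunc K) X) := by rw [hvX]; decide
  let S : Stage K p q l₀ :=
    { O := K[X], F := RatFunc K, C := RatFunc.crv K, X := X,
      x := fun _ => algebraMap K[X] (RatFunc K) X, k := 0,
      y := towerMap q (algebraMap K[X] (RatFunc K) X), pre := [], β := b, suf := l'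
      split := hb.symm
      x_zero := rfl
      X_ne := hX0
      rel := fun i hi => absurd hi (Nat.not_lt_zero i)
      AL_y := rfl
      v_y := by rw [Valuation.map_towerMap_of_one_lt _ hq2 hone, hvX]
      T := hfin.toFinset
      mem_T := hT
      cusp := fun P hP => CuspState.start hq2 (P.valuation_le_one _) (by
        rw [← map_pow, ← map_add]; exact hval P hP) _ }
  refine ⟨S, RatFunc.genus_crv K, ?_, rfl, rfl,
    fun {L} _ _ t => ⟨aeval t, aeval_X t, fun φ h => ?_⟩⟩
  · have h1 := HeightOneSpectrum.span_eq_prod (RatFunc K) hX0 hT hval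
    have h2 := (RatFunc.crv K).codim_span hX0
    rw [h1, (RatFunc.crv K).codim_prod _ fun P _ => P.ne_bot] at h2
    have h3 : (RatFunc.crv K).deg (algebraMap K[X] (RatFunc K) (X ^ q + X)) = q := by
      have h4 := (RatFunc.crv K).v_eq (f := algebraMap K[X] (RatFunc K) (X ^ q + X))
        ((map_ne_zero_iff _ (IsFractionRing.injective K[X] (RatFunc K))).2 hX0)
      change RatFunc.inftyValuation K _ = _ at h4
      rw [RatFunc.inftyValuation_algebraMap hX0, hdeg] at h4
      exact (WithZero.exp_injective' h4).symm
    rw [h3] at h2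
    exact_mod_cast h2
  · exact Polynomial.algHom_ext (by rw [aeval_X]; exact h)

theorem exists_stage_tower (hq : Fintype.card K = q) (hqa : q = p ^ a) (hq2 : 2 ≤ q) (ha : 0 < a) :
    ∃ (l₀ : List K) (S : ℕ → Stage K p q l₀), l₀.length = a ∧ (∀ β ∈ l₀, β ≠ 0) ∧
      (∀ (R : Type) [CommRing R] [Algebra K R] (T : R), AL p l₀ T = T ^ q + T) ∧
      ((S 0).C.genus = 0 ∧ (S 0).cuspDeg = q ∧ (S 0).pre = [] ∧ (S 0).k = 0 ∧
        ∀ {L : Type} [Field L] [Algebra K L] (t : L), ∃! φ : (S 0).O →ₐ[K] L, φ (S 0).X = t) ∧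
      ∀ j, Nonempty (Stage.Step (S j) (S (j + 1))) := by
  obtain ⟨l₀, h1, h2, h3⟩ := AL.exists_eq_pow_card_add K p hq hqa
  obtain ⟨S₀, h4⟩ := exists_base_stage hq hq2 (List.ne_nil_of_length_pos (h1 ▸ ha))
  choose f hf using Stage.exists_next hq hqa hq2 h3 h2
  refine ⟨l₀, fun j => f^[j] S₀, h1, h2, h3, h4, fun j => ?_⟩
  simp only [Function.iterate_succ_apply']
  exact hf _

theorem towerMap_pow_eq {K L : Type} [Field K] [Fintype K] [Field L] [Algebra K L] {p q a : ℕ}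
    [Fact p.Prime] [CharP L p] (hqa : q = p ^ a) {t : L} (h : t ^ q ^ 2 = t) (ht : t ^ q + t ≠ 0) :
    towerMap q t ^ q = towerMap q t := by
  have e : towerMap q t = t ^ q * t / (t ^ q + t) := by
    rw [towerMap]
    field_simp
    ring
  have h2 : (t ^ q) ^ q = t := by rw [← pow_mul, ← sq, h]
  rw [e, div_pow, mul_pow, h2]
  have : (t ^ q + t) ^ q = t + t ^ q := by
    conv_lhs => rw [hqa, add_pow_char_pow, ← hqa, h2]
  rw [this, add_comm t, mul_comm t]

namespace Stage

variable {K : Type} [Field K] [Fintype K] {p q a : ℕ} [Fact p.Prime] [CharP K p] {l₀ : List K}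
  (S : Stage K p q l₀) {L : Type} [Field L] [Algebra K L]

theorem ev_towerMap {φ : S.O →ₐ[K] L} {f : S.F} {t : L} (h : Ev S.F φ f t) (ht : t ^ q + t ≠ 0) :
    Ev S.F φ (towerMap q f) (towerMap q t) := by
  have := (h.pow 2).mul (((h.pow q).add h).inv ht)
  rw [← div_eq_mul_inv, ← div_eq_mul_inv] at this
  exact h.sub this

variable [Module.Finite K L]

theorem exists_prime_of_hom (φ : S.O →ₐ[K] L) (hφ : φ S.X ^ q + φ S.X ≠ 0) :
    ∃ P : HeightOneSpectrum S.O, P.asIdeal = RingHom.ker φ ∧ P ∉ S.T := by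
  refine ⟨⟨RingHom.ker φ, RingHom.ker_isPrime _, S.C.ker_ne_bot φ⟩, rfl, fun h => hφ ?_⟩
  have : φ (S.X ^ q + S.X) = 0 := (S.mem_T _).1 h
  rwa [map_add, map_pow] at this

theorem exists_ev_x (hq2 : 2 ≤ q) (φ : S.O →ₐ[K] L) (hφ : φ S.X ^ q + φ S.X ≠ 0) {i : ℕ}
    (hi : i ≤ S.k) : ∃ t, Ev S.F φ (S.x i) t ∧ t ^ q + t ≠ 0 := by
  obtain ⟨P, hP, hPT⟩ := S.exists_prime_of_hom φ hφ
  obtain ⟨h1, h2, -⟩ := S.valuation_x hq2 hPT hi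
  obtain ⟨t, ht⟩ := Ev.exists_of_valuation_le_one hP h1
  have h0 : S.x i ^ q + S.x i ≠ 0 := fun h => by simp [h] at h2
  have h3 : P.valuation S.F (S.x i ^ q + S.x i)⁻¹ ≤ 1 := by rw [map_inv₀, h2, inv_one]
  obtain ⟨s, hs⟩ := Ev.exists_of_valuation_le_one hP h3
  refine ⟨t, ht, fun h => ?_⟩
  have h4 := (((ht.pow q).add ht).mul hs)
  rw [mul_inv_cancel₀ h0, h, zero_mul] at h4
  have h5 := Ev.of_mem (F := S.F) (φ := φ) 1
  rw [map_one, map_one] at h5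
  exact one_ne_zero (h5.unique h4)

theorem exists_ev_y (hq2 : 2 ≤ q) (φ : S.O →ₐ[K] L) (hφ : φ S.X ^ q + φ S.X ≠ 0) :
    ∃ η, Ev S.F φ S.y η := by
  obtain ⟨P, hP, hPT⟩ := S.exists_prime_of_hom φ hφ
  exact Ev.exists_of_valuation_le_one hP (S.valuation_y hq2 hPT)

theorem exists_AL_pre_eq (hq2 : 2 ≤ q) {φ : S.O →ₐ[K] L} (hφ : φ S.X ^ q + φ S.X ≠ 0) {η : L}
    (hη : Ev S.F φ S.y η) : ∃ t, t ^ q + t ≠ 0 ∧ AL p S.pre η = towerMap q t := by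
  obtain ⟨t, ht, ht0⟩ := S.exists_ev_x hq2 φ hφ le_rfl
  have h1 := AL.ev (p := p) hη S.pre
  rw [S.AL_y] at h1
  exact ⟨t, ht0, h1.unique (S.ev_towerMap ht ht0)⟩

namespace Step

variable {S} {S' : Stage K p q l₀} (f : Step S S')

theorem exists_ev_w (hq2 : 2 ≤ q) {φ : S'.O →ₐ[K] L} (hφ : φ S'.X ^ q + φ S'.X ≠ 0) :
    ∃ θ, Ev S'.F φ f.w θ := by
  rcases f.y_eq with h | ⟨h, -⟩
  · rw [← h]; exact S'.exists_ev_y hq2 φ hφ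
  · obtain ⟨t, ht, -⟩ := S'.exists_ev_x hq2 φ hφ le_rfl
    exact ⟨t, h ▸ ht⟩

theorem exists_ev_y_eq (hq2 : 2 ≤ q) {φ : S'.O →ₐ[K] L} (hφ : φ S'.X ^ q + φ S'.X ≠ 0) {θ : L}
    (hθ : Ev S'.F φ f.w θ) : Ev S'.F φ S'.y θ ∨ Ev S'.F φ S'.y (towerMap q θ) := by
  rcases f.y_eq with h | ⟨h, h'⟩
  · rw [h]; exact Or.inl hθ
  · obtain ⟨t, ht, ht0⟩ := S'.exists_ev_x hq2 φ hφ le_rfl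
    rw [h] at ht
    rw [h']
    right
    obtain rfl := ht.unique hθ
    exact S'.ev_towerMap ht ht0

theorem map_X' (φ : S'.O →ₐ[K] L) : (φ.comp f.ι) S.X = φ S'.X := by
  rw [AlgHom.comp_apply, f.map_X]

end Step

end Stage

open Polynomial in
theorem Polynomial.monic_artinSchreier {R : Type} [Field R] {p : ℕ} (hp : 1 < p) (b c : R) :
    (X ^ p - (C b * X + C c) : Polynomial R).Monic ∧
      (X ^ p - (C b * X + C c) : Polynomial R).natDegree = p := by
  have hlin : (C b * X + C c : Polynomial R).degree < (p : WithBot ℕ) :=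
    (degree_linear_le).trans_lt (by exact_mod_cast hp)
  refine ⟨monic_X_pow_sub hlin, natDegree_eq_of_degree_eq_some ?_⟩
  rw [degree_sub_eq_left_of_degree_lt (by rwa [degree_X_pow]), degree_X_pow]

section

variable {K : Type} [Field K] [Fintype K] {p q a : ℕ} [Fact p.Prime] [CharP K p] {l₀ : List K}
  (S : Stage K p q l₀) {L : Type} [Field L] [Algebra K L] [Module.Finite K L]

open Polynomial in
theorem exists_roots_of_card_sq {φ : S.O →ₐ[K] L} (hq2 : 2 ≤ q) (hqa : q = p ^ a)
    (hAL : ∀ (R : Type) [CommRing R] [Algebra K R] (T : R), AL p l₀ T = T ^ q + T) (hβ : S.β ≠ 0)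
    (hL : Nat.card L = q ^ 2) (hφ : φ S.X ^ q + φ S.X ≠ 0) {η : L} (hη : Ev S.F φ S.y η) :
    ∃ θ : Fin p → L, Function.Injective θ ∧ ∀ i, θ i ^ p = algebraMap K L S.β * θ i + η := by
  classical
  have : Finite L := Module.finite_of_finite K
  have := Fintype.ofFinite L
  rw [Nat.card_eq_fintype_card] at hL
  obtain ⟨t, ht0, ht⟩ := S.exists_AL_pre_eq hq2 hφ hη
  let Ω := AlgebraicClosure L
  have hL' : CharP L p := charP_of_injective_algebraMap (algebraMap K L).injective p
  have hΩ : CharP Ω p := charP_of_injective_algebraMap (algebraMap K Ω).injective p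
  have hu : towerMap q t ^ q = towerMap q t := towerMap_pow_eq (K := K) hqa (by
    rw [← hL]; exact FiniteField.pow_card t) ht0
  have hp := (Fact.out : p.Prime).one_lt
  have hdeg := fun (R : Type) [Field R] (b c : R) => monic_artinSchreier hp b c
  have hsurj : ∀ (l : List K) (θ : Ω), ∃ T, AL p l T = θ := by
    intro l
    induction l with
    | nil => exact fun θ => ⟨θ, rfl⟩
    | cons b l ih =>
      intro θ
      obtain ⟨z, hz⟩ :=
          IsAlgClosed.exists_root (X ^ p - (C (algebraMap K Ω b) * X + C θ) : Polynomial Ω) (by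
        rw [degree_eq_natDegree (hdeg Ω _ _).1.ne_zero, (hdeg Ω _ _).2]
        exact_mod_cast (by omega : p ≠ 0))
      obtain ⟨T, hT⟩ := ih z
      refine ⟨T, ?_⟩
      simp only [IsRoot, eval_sub, eval_add, eval_mul, eval_pow, eval_X, eval_C] at hz
      simp only [AL, hT]
      linear_combination hz
  have hin : ∀ θ : Ω, θ ^ p = algebraMap K Ω S.β * θ + algebraMap L Ω η →
      ∃ c : L, θ = algebraMap L Ω c := by
    intro θ hθ
    obtain ⟨T, hT⟩ := hsurj S.suf θ
    have h1 : AL p (S.pre ++ S.β :: S.suf) T = algebraMap L Ω (towerMap q t) := by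
      rw [AL.append]
      simp only [AL]
      rw [hT, hθ, add_sub_cancel_left, ← ht]
      exact (AL.map (IsScalarTower.toAlgHom K L Ω) _ _).symm
    have h2 : T ^ q + T = algebraMap L Ω (towerMap q t) := by
      rw [← hAL, ← h1]
      exact congrArg (AL p · T) S.split.symm
    have h3 : T ^ Fintype.card L = T := by
      have h4 : T ^ q = algebraMap L Ω (towerMap q t) - T := eq_sub_of_add_eq h2
      rw [hL, sq, pow_mul, h4]
      have h5 : (algebraMap L Ω (towerMap q t) - T) ^ q =
          algebraMap L Ω (towerMap q t) ^ q - T ^ q := by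
        conv_lhs => rw [hqa, sub_pow_char_pow, ← hqa]
      rw [h5, ← map_pow, hu, h4, sub_sub_cancel]
    obtain ⟨c, hc⟩ := AL.exists_algebraMap_of_pow_eq h3
    refine ⟨AL p S.suf c, ?_⟩
    rw [← hT, hc]
    exact (AL.map (IsScalarTower.toAlgHom K L Ω) _ _).symm
  set f : Polynomial L := X ^ p - (C (algebraMap K L S.β) * X + C η) with hf
  have hsep : f.Separable := by
    have hd : f.derivative = C (-algebraMap K L S.β) := by simp [hf, derivative_X_pow]
    rw [Separable, hd]
    refine (isCoprime_one_right (x := f)).of_isCoprime_of_dvd_right ?_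
    refine IsUnit.dvd (isUnit_C.2 ?_)
    simpa using hβ
  have hcard : Fintype.card (f.rootSet Ω) = p := by
    rw [card_rootSet_eq_natDegree hsep (IsAlgClosed.splits _), (hdeg L _ _).2]
  let e := Fintype.equivFinOfCardEq hcard
  have hroot : ∀ i : Fin p, ∃ c : L, (e.symm i : Ω) = algebraMap L Ω c := fun i => by
    refine hin _ ?_
    have h := (mem_rootSet.1 (e.symm i).2).2
    simp only [hf, map_sub, map_add, map_mul, map_pow, aeval_X, aeval_C] at h
    rw [IsScalarTower.algebraMap_apply K L Ω]
    exact sub_eq_zero.1 h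
  choose θ hθ using hroot
  refine ⟨θ, fun i j h => ?_, fun i => ?_⟩
  · have : (e.symm i : Ω) = e.symm j := by rw [hθ, hθ, h]
    exact e.symm.injective (Subtype.ext this)
  · have h := (mem_rootSet.1 (e.symm i).2).2
    rw [hθ, aeval_algebraMap_apply, map_eq_zero] at h
    simp only [hf, map_sub, map_add, map_mul, map_pow, aeval_X, aeval_C] at h
    exact sub_eq_zero.1 h

end

section

variable {K : Type} [Field K] [Fintype K] {p q a : ℕ} [Fact p.Prime] [CharP K p] {l₀ : List K}
  {E : Type} [Field E] [Algebra K E] [Module.Finite K E]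

theorem Stage.Step.exists_homs {S S' : Stage K p q l₀} (f : Stage.Step S S') (hq2 : 2 ≤ q)
    (hqa : q = p ^ a)
    (hAL : ∀ (R : Type) [CommRing R] [Algebra K R] (T : R), AL p l₀ T = T ^ q + T) (hβ : S.β ≠ 0)
    (hE : Nat.card E = q ^ 2) {N : ℕ} {g : Fin N → (S.O →ₐ[K] E)} (hg : Function.Injective g)
    (hX : ∀ i, g i S.X ^ q + g i S.X ≠ 0) :
    ∃ g' : Fin (N * p) → (S'.O →ₐ[K] E), Function.Injective g' ∧
      ∀ i, g' i S'.X ^ q + g' i S'.X ≠ 0 := by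
  choose η hη using fun i => S.exists_ev_y hq2 (g i) (hX i)
  choose θ hθi hθ using fun i => exists_roots_of_card_sq S hq2 hqa hAL hβ hE (hX i) (hη i)
  choose φ' h1 h2 using fun i j => f.exists_hom (hη i) (hθ i j)
  have hX' : ∀ i j, φ' i j S'.X = g i S.X := fun i j => by rw [← f.map_X', h1]
  refine ⟨fun m => φ' (finProdFinEquiv.symm m).1 (finProdFinEquiv.symm m).2, fun m m' h => ?_,
    fun m => by rw [hX']; exact hX _⟩
  have e : ∀ i j i' j', φ' i j = φ' i' j' → i = i' ∧ j = j' := by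
    intro i j i' j' h
    obtain rfl : i = i' := hg (by rw [← h1 i j, h, h1])
    refine ⟨rfl, hθi i ((h2 i j).unique (h ▸ h2 i j'))⟩
  obtain ⟨h3, h4⟩ := e _ _ _ _ h
  exact finProdFinEquiv.symm.injective (Prod.ext h3 h4)

open Polynomial in
theorem exists_injective_pow_add_ne_zero {E : Type} [Field E] [Finite E] {q N : ℕ} (hq2 : 2 ≤ q)
    (hE : Nat.card E = N) :
    ∃ t : Fin (N - q) → E, Function.Injective t ∧ ∀ i, t i ^ q + t i ≠ 0 := by
  classical
  have := Fintype.ofFinite E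
  have h0 : (X ^ q + X : Polynomial E).natDegree = q := by
    rw [natDegree_add_eq_left_of_natDegree_lt] <;> simp
    omega
  have h1 : (X ^ q + X : Polynomial E) ≠ 0 := by
    intro h; rw [h] at h0; simp at h0; omega
  set s := (X ^ q + X : Polynomial E).roots.toFinset with hs
  have h2 : s.card ≤ q := (Multiset.toFinset_card_le _).trans ((card_roots' _).trans h0.le)
  have h3 : N - q ≤ sᶜ.card := by
    rw [Finset.card_compl, ← Nat.card_eq_fintype_card, hE]
    omega
  have h4 : Fintype.card (Fin (N - q)) ≤ Fintype.card (sᶜ : Finset E) := by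
    rwa [Fintype.card_fin, Fintype.card_coe]
  obtain ⟨e⟩ := Function.Embedding.nonempty_of_card_le h4
  refine ⟨fun i => e i, fun i j h => e.injective (Subtype.ext h), fun i h => ?_⟩
  have h5 := (e i).2
  rw [Finset.mem_compl] at h5
  exact h5 (Multiset.mem_toFinset.2 ((mem_roots h1).2 (by simpa using h)))

theorem exists_homs_tower {S : ℕ → Stage K p q l₀} (hq2 : 2 ≤ q) (hqa : q = p ^ a)
    (hAL : ∀ (R : Type) [CommRing R] [Algebra K R] (T : R), AL p l₀ T = T ^ q + T)
    (hl : ∀ β ∈ l₀, β ≠ 0)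
    (h0 : ∀ {L : Type} [Field L] [Algebra K L] (t : L), ∃! φ : (S 0).O →ₐ[K] L, φ (S 0).X = t)
    (hS : ∀ j, Nonempty (Stage.Step (S j) (S (j + 1)))) (hE : Nat.card E = q ^ 2) (j : ℕ) :
    ∃ g : Fin ((q ^ 2 - q) * p ^ j) → ((S j).O →ₐ[K] E), Function.Injective g ∧
      ∀ i, g i (S j).X ^ q + g i (S j).X ≠ 0 := by
  induction j with
  | zero =>
    have : Finite E := Module.finite_of_finite K
    obtain ⟨t, ht, ht0⟩ := exists_injective_pow_add_ne_zero hq2 hE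
    choose g hg using fun i => (h0 (t i)).exists
    rw [pow_zero, mul_one]
    refine ⟨g, fun i i' h => ht ?_, fun i => by rw [hg]; exact ht0 i⟩
    rw [← hg, h, hg]
  | succ j ih =>
    obtain ⟨g, hg, hX⟩ := ih
    obtain ⟨f⟩ := hS j
    rw [pow_succ p, ← mul_assoc]
    exact f.exists_homs hq2 hqa hAL (hl _ (S j).β_mem) hE hg hX

theorem Ev.pow_eq_self {O F L : Type} [CommRing O] [Field F] [Field L] [Algebra K O] [Algebra O F]
    [Algebra K L] {φ : O →ₐ[K] L} (h : ∀ s, φ s ^ q = φ s) {f : F} {t : L} (ht : Ev F φ f t) :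
    t ^ q = t := by
  obtain ⟨a, b, hb, -, hab⟩ := ht
  have := congrArg (· ^ q) hab
  rw [mul_pow, h, h] at this
  exact mul_left_cancel₀ hb (this.symm.trans hab)

/-- In odd characteristic, a rational point of the tower away from the cusps is determined by
its image in the bottom stage. -/
theorem rational_hom_ext {S : ℕ → Stage K p q l₀} (hq : Fintype.card K = q) (hq2 : 2 ≤ q)
    (hqa : q = p ^ a)
    (hAL : ∀ (R : Type) [CommRing R] [Algebra K R] (T : R), AL p l₀ T = T ^ q + T)
    (h0 : ∀ {L : Type} [Field L] [Algebra K L] (t : L), ∃! φ : (S 0).O →ₐ[K] L, φ (S 0).X = t)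
    (hS : ∀ j, Nonempty (Stage.Step (S j) (S (j + 1)))) (hp2 : p ≠ 2) (j : ℕ)
    {φ₁ φ₂ : (S j).O →ₐ[K] E} (h1 : ∀ s, φ₁ s ^ q = φ₁ s) (h2 : ∀ s, φ₂ s ^ q = φ₂ s)
    (hX : φ₁ (S j).X = φ₂ (S j).X) (hφ : φ₁ (S j).X ^ q + φ₁ (S j).X ≠ 0) : φ₁ = φ₂ := by
  induction j with
  | zero => exact (h0 _).unique rfl hX.symm
  | succ j ih =>
    obtain ⟨f⟩ := hS j
    have hX₁ := f.map_X' φ₁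
    have hX₂ := f.map_X' φ₂
    have h3 : φ₁.comp f.ι = φ₂.comp f.ι :=
      ih (fun s => h1 _) (fun s => h2 _) (by rw [hX₁, hX₂, hX]) (by rwa [hX₁])
    obtain ⟨η, hη⟩ := (S j).exists_ev_y hq2 (φ₁.comp f.ι) (by rwa [hX₁])
    obtain ⟨θ₁, hθ₁⟩ := f.exists_ev_w hq2 hφ
    obtain ⟨θ₂, hθ₂⟩ := f.exists_ev_w hq2 (φ := φ₂) (by rwa [← hX])
    have h4 := f.pow_eq hη hθ₁
    have h5 := f.pow_eq (h3 ▸ hη) hθ₂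
    have hpE : CharP E p := charP_of_injective_algebraMap (algebraMap K E).injective p
    have h6 : (θ₁ - θ₂) ^ p = algebraMap K E (S j).β * (θ₁ - θ₂) := by
      rw [sub_pow_char, h4, h5]; ring
    have h7 : (θ₁ - θ₂) ^ q = -(θ₁ - θ₂) :=
      AL.pow_eq_neg_of_pow_eq (pre := (S j).pre) (l := (S j).suf) hq hqa (fun R _ _ T => by
        rw [← hAL]; exact congrArg (AL p · T) (S j).split) h6
    have h8 : (θ₁ - θ₂) ^ q = θ₁ - θ₂ := by
      have e : (θ₁ - θ₂) ^ q = θ₁ ^ q - θ₂ ^ q := by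
        conv_lhs => rw [hqa, sub_pow_char_pow, ← hqa]
      rw [e, hθ₁.pow_eq_self h1, hθ₂.pow_eq_self h2]
    have h9 : (2 : E) * (θ₁ - θ₂) = 0 := by
      rw [two_mul]; nth_rewrite 1 [← h8]; rw [h7, neg_add_cancel]
    have h10 : (2 : E) ≠ 0 := Ring.two_ne_zero (by rwa [ringChar.eq E p])
    have h11 : θ₁ = θ₂ := sub_eq_zero.1 ((mul_eq_zero.1 h9).resolve_left h10)
    exact f.hom_ext h3 hη h4 hθ₁ (h11 ▸ hθ₂)

theorem AlgHom.pow_eq_self_of_not_surjective {O : Type} [CommRing O] [Algebra K O]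
    (hq : Fintype.card K = q) (hE : Module.finrank K E = 2)
    {φ : O →ₐ[K] E} (hφ : ¬ Function.Surjective φ) (s : O) : φ s ^ q = φ s := by
  have := Subalgebra.isSimpleOrder_of_finrank_prime K E (by rw [hE]; exact Nat.prime_two)
  rcases eq_bot_or_eq_top φ.range with h | h
  · have h1 : φ s ∈ φ.range := ⟨s, rfl⟩
    rw [h, Algebra.mem_bot] at h1
    obtain ⟨c, hc⟩ := h1
    rw [← hc, ← map_pow, ← hq, FiniteField.pow_card]
  · exact absurd (AlgHom.range_eq_top φ |>.1 h) hφ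

theorem AlgHom.card_le_two_of_ker_eq {O : Type} [CommRing O] [Algebra K O]
    (hE : Module.finrank K E = 2) (H : Finset (O →ₐ[K] E)) (I : Ideal O)
    (hH : ∀ φ ∈ H, Function.Surjective φ ∧ RingHom.ker φ = I) : H.card ≤ 2 := by
  classical
  rcases H.eq_empty_or_nonempty with rfl | ⟨φ₀, hφ₀⟩
  · simp
  have hle : Fintype.card (E →ₐ[K] E) ≤ 2 := by
    rw [← hE, ← Nat.card_eq_fintype_card]
    exact card_algHom_le_finrank K E E
  have hex : ∀ φ : H, ∃ σ : E →ₐ[K] E, σ.comp φ₀ = φ := fun φ => by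
    have h1 := (hH φ₀ hφ₀)
    have h2 := hH φ φ.2
    refine ⟨(Ideal.Quotient.liftₐ (RingHom.ker φ₀) φ.1 fun a ha => ?_).comp
      (Ideal.quotientKerAlgEquivOfSurjective h1.1).symm.toAlgHom, ?_⟩
    · have : a ∈ RingHom.ker φ.1 := by rw [h2.2, ← h1.2]; exact ha
      exact this
    · ext s
      have : (Ideal.quotientKerAlgEquivOfSurjective h1.1).symm (φ₀ s) =
          Ideal.Quotient.mk (RingHom.ker φ₀) s := by
        rw [AlgEquiv.symm_apply_eq]; rfl
      rw [AlgHom.comp_apply, AlgHom.comp_apply]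
      exact (congrArg _ this).trans (Ideal.Quotient.lift_mk _ _ _)
  choose σ hσ using hex
  refine le_trans ?_ hle
  rw [← Fintype.card_coe]
  exact Fintype.card_le_of_injective σ fun φ φ' h => Subtype.ext (by rw [← hσ, h, hσ])

/-- Each stage of the tower has many points of degree two. -/
theorem exists_quadratic_points {S : ℕ → Stage K p q l₀} (hq : Fintype.card K = q) (hq2 : 2 ≤ q)
    (hqa : q = p ^ a)
    (hAL : ∀ (R : Type) [CommRing R] [Algebra K R] (T : R), AL p l₀ T = T ^ q + T)
    (hl : ∀ β ∈ l₀, β ≠ 0)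
    (h0 : ∀ {L : Type} [Field L] [Algebra K L] (t : L), ∃! φ : (S 0).O →ₐ[K] L, φ (S 0).X = t)
    (hS : ∀ j, Nonempty (Stage.Step (S j) (S (j + 1)))) (hE : Module.finrank K E = 2) (j : ℕ) :
    ∃ (s : ℕ) (ψ : Fin s → ((S j).O →ₐ[K] E)), (∀ i, Function.Surjective (ψ i)) ∧
      (∀ i i', i ≠ i' → RingHom.ker (ψ i) ≠ RingHom.ker (ψ i')) ∧
      (q ^ 2 - q) * p ^ j ≤ 2 * s + if p = 2 then 0 else q - 1 := by
  classical
  have hpE : CharP E p := charP_of_injective_algebraMap (algebraMap K E).injective p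
  have hE' : Nat.card E = q ^ 2 := by
    rw [Module.natCard_eq_pow_finrank (K := K), hE, Nat.card_eq_fintype_card, hq]
  obtain ⟨g, hg, hX⟩ := exists_homs_tower hq2 hqa hAL hl h0 hS hE' j
  have hrat : (Finset.univ.filter fun i => ¬ Function.Surjective (g i)).card ≤
      if p = 2 then 0 else q - 1 := by
    have hfix := fun (i : Fin ((q ^ 2 - q) * p ^ j)) (hi : ¬ Function.Surjective (g i)) =>
      AlgHom.pow_eq_self_of_not_surjective hq hE hi
    split_ifs with hp2
    · rw [Nat.le_zero, Finset.card_eq_zero, Finset.filter_eq_empty_iff]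
      intro i _ hi
      refine hX i ?_
      subst hp2
      rw [hfix i hi, CharTwo.add_self_eq_zero]
    · have hc : ∀ i : {i // ¬ Function.Surjective (g i)}, ∃ c : Kˣ,
          g i (S j).X = algebraMap K E c := fun i => by
        have h1 := hfix i i.2 (S j).X
        obtain ⟨c, hc⟩ := AL.exists_algebraMap_of_pow_eq (K := K) (by rw [hq]; exact h1)
        refine ⟨Units.mk0 c fun h => ?_, hc⟩
        have h2 := hX i
        rw [hc, h, map_zero, zero_pow (by omega), add_zero] at h2
        exact h2 rfl
      choose c hc using hc
      have hu : Fintype.card Kˣ = q - 1 := by rw [Fintype.card_units, hq]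
      rw [← hu, ← Fintype.card_subtype]
      refine Fintype.card_le_of_injective c fun i i' h => ?_
      have h1 : g i (S j).X = g i' (S j).X := by rw [hc, hc, h]
      exact Subtype.ext (hg (rational_hom_ext hq hq2 hqa hAL h0 hS hp2 j (hfix i i.2)
        (hfix i' i'.2) h1 (hX i)))
  set G := (Finset.univ.filter fun i => Function.Surjective (g i)).image g with hG
  have hGs : ∀ φ ∈ G, Function.Surjective φ := fun φ hφ => by
    obtain ⟨i, hi, rfl⟩ := Finset.mem_image.1 hφ
    exact (Finset.mem_filter.1 hi).2
  have hGc : (q ^ 2 - q) * p ^ j ≤ G.card + if p = 2 then 0 else q - 1 := by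
    rw [hG, Finset.card_image_of_injective _ hg]
    have := Finset.card_filter_add_card_filter_not (s := Finset.univ)
      (fun i => Function.Surjective (g i))
    rw [Finset.card_univ, Fintype.card_fin] at this
    omega
  set I := G.image fun φ => RingHom.ker φ with hI
  have hGI : G.card ≤ 2 * I.card := by
    refine Finset.card_le_mul_card_image G 2 fun J _ => ?_
    refine AlgHom.card_le_two_of_ker_eq hE _ J fun φ hφ => ?_
    rw [Finset.mem_filter] at hφ
    exact ⟨hGs φ hφ.1, hφ.2⟩
  let e := I.equivFin.symm
  have hψ : ∀ i, ∃ φ ∈ G, RingHom.ker φ = (e i : Ideal (S j).O) := fun i =>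
    Finset.mem_image.1 (e i).2
  choose ψ h1 h2 using hψ
  refine ⟨I.card, ψ, fun i => hGs _ (h1 i), fun i i' hii' h => hii' ?_, by omega⟩
  rw [h2, h2] at h
  exact e.injective (Subtype.ext h)

theorem genus_add_cuspDeg_le {S : ℕ → Stage K p q l₀} (hg : (S 0).C.genus = 0)
    (hc : (S 0).cuspDeg = q) (hS : ∀ j, Nonempty (Stage.Step (S j) (S (j + 1)))) (j : ℕ) :
    (S j).C.genus + (S j).cuspDeg ≤ q * p ^ j ∧ q ≤ (S j).cuspDeg := by
  induction j with
  | zero => rw [hg, hc]; simp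
  | succ j ih =>
    obtain ⟨f⟩ := hS j
    refine ⟨f.genus_add.trans ?_, ih.2.trans f.cuspDeg_le⟩
    rw [pow_succ, ← mul_assoc, mul_comm]
    exact Nat.mul_le_mul_right _ ih.1

end

section

variable {K : Type} [Field K] [Fintype K] {p q a : ℕ} [Fact p.Prime] [CharP K p] {l₀ : List K}
  {L : Type} [Field L] [Algebra K L]

/-- Points of the tower with coordinates in a subgroup `V` which is stable under the defining
operations of the tower. -/
theorem exists_hom_of_stable {S : ℕ → Stage K p q l₀}
    (hpre : (S 0).pre = []) (hk : (S 0).k = 0)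
    (h0 : ∀ {L : Type} [Field L] [Algebra K L] (t : L), ∃! φ : (S 0).O →ₐ[K] L, φ (S 0).X = t)
    (hS : ∀ j, Nonempty (Stage.Step (S j) (S (j + 1)))) [Module.Finite K L] (hq2 : 2 ≤ q)
    (V : AddSubgroup L) (hu : ∀ x ∈ V, x ^ q + x ≠ 0 → towerMap q x ∈ V)
    (hV : ∀ β ∈ l₀, ∀ η ∈ V, ∃ θ ∈ V, θ ^ p = algebraMap K L β * θ + η)
    {t : L} (ht : t ∈ V) (ht0 : t ^ q + t ≠ 0) (j : ℕ) :
    ∃ φ : (S j).O →ₐ[K] L, φ (S j).X = t ∧ ∃ η ∈ V, Ev (S j).F φ (S j).y η := by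
  induction j with
  | zero =>
    obtain ⟨φ, hφ, -⟩ := h0 t
    refine ⟨φ, hφ, towerMap q t, hu t ht ht0, ?_⟩
    have h1 := (S 0).AL_y
    rw [hpre, hk, (S 0).x_zero] at h1
    have h2 : (S 0).y = towerMap q (algebraMap (S 0).O (S 0).F (S 0).X) := h1
    rw [h2]
    refine Stage.ev_towerMap _ ?_ ht0
    rw [← hφ]
    exact Ev.of_mem _
  | succ j ih =>
    obtain ⟨f⟩ := hS j
    obtain ⟨φ, hφ, η, hη, hev⟩ := ih
    obtain ⟨θ, hθ, hθη⟩ := hV _ (S j).β_mem η hη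
    obtain ⟨φ', h1, h2⟩ := f.exists_hom hev hθη
    have hX : φ' (S (j + 1)).X = t := by rw [← f.map_X', h1, hφ]
    refine ⟨φ', hX, ?_⟩
    rcases f.exists_ev_y_eq hq2 (φ := φ') (by rwa [hX]) h2 with h | h
    · exact ⟨θ, hθ, h⟩
    · refine ⟨towerMap q θ, ?_, h⟩
      rcases f.y_eq with h3 | ⟨h3, -⟩
      · rw [h3] at h
        rw [h.unique h2]
        exact hθ
      · obtain ⟨t', ht', ht0'⟩ := (S (j + 1)).exists_ev_x hq2 φ' (by rwa [hX]) le_rfl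
        rw [h3] at ht'
        rw [ht'.unique h2] at ht0'
        exact hu θ hθ ht0'

theorem Ev.pow_card_pow_of_not_surjective {n : ℕ} (hq : Fintype.card K = q)
    (hL : Module.finrank K L = n) (hn : 0 < n) {O F : Type} [CommRing O] [Field F] [Algebra K O]
    [Algebra O F] {φ : O →ₐ[K] L} (hφ : ¬ Function.Surjective φ) :
    ∃ d, 0 < d ∧ d ∣ n ∧ d < n ∧ ∀ (f : F) (t : L), Ev F φ f t → t ^ q ^ d = t := by
  have : Module.Finite K L := Module.finite_of_finrank_pos (by omega)
  let R := φ.range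
  have hf : IsField R := isField_of_isIntegral_of_isField' (Field.toIsField K)
  let _ : Field R := hf.toField
  have h1 : Module.finrank K R * Module.finrank R L = n := by
    rw [Module.finrank_mul_finrank, hL]
  refine ⟨Module.finrank K R, Module.finrank_pos, ⟨_, h1.symm⟩, ?_, fun f t ht => ?_⟩
  · rw [← hL]
    refine Submodule.finrank_lt (s := Subalgebra.toSubmodule R) fun h => hφ ?_
    rw [← AlgHom.range_eq_top]
    exact Algebra.toSubmodule_eq_top.1 h
  · refine ht.pow_eq_self fun s => ?_
    have : Finite R := Module.finite_of_finite K
    have := Fintype.ofFinite R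
    have hc : Fintype.card R = q ^ Module.finrank K R := by
      rw [← Nat.card_eq_fintype_card, Module.natCard_eq_pow_finrank (K := K),
        Nat.card_eq_fintype_card, hq]
    have h2 := FiniteField.pow_card (⟨φ s, s, rfl⟩ : R)
    rw [hc] at h2
    exact congrArg Subtype.val h2

theorem exists_primitive_root [Finite L] : ∃ g : L, g ≠ 0 ∧ orderOf g = Nat.card L - 1 := by
  obtain ⟨g, hg⟩ := IsCyclic.exists_generator (α := Lˣ)
  refine ⟨g, g.ne_zero, ?_⟩
  have := Fintype.ofFinite L
  rw [orderOf_units, orderOf_eq_card_of_forall_mem_zpowers hg, Nat.card_units]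

theorem orderOf_dvd_pred {g : L} (hg : g ≠ 0) {m : ℕ} (hm : 0 < m) (h : g ^ m = g) :
    orderOf g ∣ m - 1 := by
  refine orderOf_dvd_of_pow_eq_one (mul_left_cancel₀ hg ?_)
  rw [← pow_succ', Nat.sub_add_cancel hm, h, mul_one]

theorem le_of_pow_sub_one_dvd {d m : ℕ} (hq2 : 2 ≤ q) (hd : 0 < d) (h : q ^ m - 1 ∣ q ^ d - 1) :
    m ≤ d := by
  have h2 : 1 < q ^ d := Nat.one_lt_pow hd.ne' (by omega)
  have h1 := Nat.le_of_dvd (by omega) h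
  exact (Nat.pow_le_pow_iff_right (by omega : 1 < q)).1 (by omega)

theorem orderOf_dvd_of_pow_add_eq_zero {g : L} (hq2 : 2 ≤ q) (hg : g ≠ 0) (h : g ^ q + g = 0) :
    orderOf g ∣ 2 * (q - 1) := by
  have h1 : g ^ (q - 1) = -1 := by
    rw [pow_add_self_eq hq2] at h
    exact eq_neg_of_add_eq_zero_left ((mul_eq_zero.1 h).resolve_left hg)
  refine orderOf_dvd_of_pow_eq_one ?_
  rw [mul_comm, pow_mul, h1]; simp

theorem exists_surjective_base {S : ℕ → Stage K p q l₀} (hq : Fintype.card K = q) (hq3 : 3 ≤ q)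
    (h0 : ∀ {L : Type} [Field L] [Algebra K L] (t : L), ∃! φ : (S 0).O →ₐ[K] L, φ (S 0).X = t)
    {n : ℕ} (hL : Module.finrank K L = n) (hn : 2 ≤ n) :
    ∃ φ : (S 0).O →ₐ[K] L, Function.Surjective φ := by
  have : Module.Finite K L := Module.finite_of_finrank_pos (by omega)
  have : Finite L := Module.finite_of_finite K
  have hc : Nat.card L = q ^ n := by
    rw [Module.natCard_eq_pow_finrank (K := K), hL, Nat.card_eq_fintype_card, hq]
  obtain ⟨g, hg, hgo⟩ := exists_primitive_root (L := L)
  obtain ⟨φ, hφ, -⟩ := h0 g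
  refine ⟨φ, by_contra fun h => ?_⟩
  obtain ⟨d, hd, -, hdn, h1⟩ := Ev.pow_card_pow_of_not_surjective (F := (S 0).F) hq hL (by omega) h
  have h2 := h1 _ _ (Ev.of_mem (S 0).X)
  rw [hφ] at h2
  have h3 := orderOf_dvd_pred hg (by positivity) h2
  rw [hgo, hc] at h3
  exact absurd (le_of_pow_sub_one_dvd (by omega) hd h3) (by omega)

/-- The subgroup of all `x` with `x ^ q ^ m = (-1) ^ (m + 1) * x`. -/
def signedFixed (L : Type) [Field L] (p a m : ℕ) [Fact p.Prime] [CharP L p] : AddSubgroup L where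
  carrier := {x | x ^ (p ^ a) ^ m = (-1) ^ (m + 1) * x}
  zero_mem' := by
    have := (Fact.out : p.Prime).pos
    simp [zero_pow, this.ne']
  add_mem' {x y} hx hy := by
    simp only [Set.mem_ofPred_eq, ← pow_mul] at *
    rw [add_pow_char_pow, hx, hy, mul_add]
  neg_mem' {x} hx := by
    simp only [Set.mem_ofPred_eq, ← pow_mul] at *
    have := sub_pow_char_pow (p := p) (0 : L) x (n := a * m)
    rw [zero_sub, zero_pow (by simp [(Fact.out : p.Prime).ne_zero]), zero_sub] at this
    rw [this, hx, mul_neg]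

variable [CharP L p]

theorem mem_signedFixed {m : ℕ} {x : L} :
    x ∈ signedFixed L p a m ↔ x ^ (p ^ a) ^ m = (-1) ^ (m + 1) * x := Iff.rfl

theorem signedFixed_towerMap (hqa : q = p ^ a) {m : ℕ} {x : L} (hx : x ∈ signedFixed L p a m)
    (hx0 : x ^ q + x ≠ 0) (hp2 : p ≠ 2) : towerMap q x ∈ signedFixed L p a m := by
  subst hqa
  have hodd : Odd (p ^ a) := ((Fact.out : p.Prime).odd_of_ne_two hp2).pow
  have e : towerMap (p ^ a) x = x ^ p ^ a * x / (x ^ p ^ a + x) := by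
    rw [towerMap]; field_simp; ring
  rw [mem_signedFixed] at hx ⊢
  have hε : (((-1 : L) ^ (m + 1)) ^ p ^ a) = (-1) ^ (m + 1) := by
    rw [← pow_mul, mul_comm, pow_mul, hodd.neg_one_pow]
  have hxq : (x ^ p ^ a) ^ (p ^ a) ^ m = (-1) ^ (m + 1) * x ^ p ^ a := by
    rw [← pow_mul, mul_comm, pow_mul, hx, mul_pow, hε]
  have hs : (x ^ p ^ a + x) ^ (p ^ a) ^ m = (-1) ^ (m + 1) * (x ^ p ^ a + x) := by
    rw [mul_add, ← hx, ← hxq, ← pow_mul p a m, add_pow_char_pow]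
  have hε0 : ((-1 : L) ^ (m + 1)) ≠ 0 := pow_ne_zero _ (by simp)
  rw [e, div_pow, mul_pow, hxq, hs, hx]
  field_simp

theorem signedFixed_eq_zero (hqa : q = p ^ a) {m : ℕ} {c : L} (hc : c ∈ signedFixed L p a m)
    (h : c ^ q = -c) (hp2 : p ≠ 2) : c = 0 := by
  subst hqa
  have hodd : Odd (p ^ a) := ((Fact.out : p.Prime).odd_of_ne_two hp2).pow
  have h1 : ∀ m : ℕ, c ^ (p ^ a) ^ m = (-1) ^ m * c := fun m => by
    induction m with
    | zero => simp
    | succ m ih => rw [pow_succ, pow_mul, ih, mul_pow, h, ← pow_mul, mul_comm m, pow_mul,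
        hodd.neg_one_pow, pow_succ]; ring
  rw [mem_signedFixed, h1, pow_succ] at hc
  have h2 : (2 : L) * ((-1) ^ m * c) = 0 := by linear_combination hc
  have h10 : (2 : L) ≠ 0 := Ring.two_ne_zero (by rwa [ringChar.eq L p])
  have h3 := (mul_eq_zero.1 h2).resolve_left h10
  exact (mul_eq_zero.1 h3).resolve_left (pow_ne_zero _ (by simp))

theorem signedFixed_exists_root [Finite L] (hq : Fintype.card K = q) (hqa : q = p ^ a)
    (hAL : ∀ (R : Type) [CommRing R] [Algebra K R] (T : R), AL p l₀ T = T ^ q + T) (hp2 : p ≠ 2)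
    {m : ℕ} {β : K} (hβ : β ∈ l₀) {η : L} (hη : η ∈ signedFixed L p a m) :
    ∃ θ ∈ signedFixed L p a m, θ ^ p = algebraMap K L β * θ + η := by
  have hodd : Odd p := ((Fact.out : p.Prime).odd_of_ne_two hp2)
  have hmem : ∀ x ∈ signedFixed L p a m, x ^ p - algebraMap K L β * x ∈ signedFixed L p a m := by
    intro x hx
    refine sub_mem ?_ ?_
    · rw [mem_signedFixed] at hx ⊢
      rw [← pow_mul, mul_comm, pow_mul, hx, mul_pow, ← pow_mul, mul_comm (m + 1), pow_mul,
        hodd.neg_one_pow]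
    · rw [mem_signedFixed] at hx ⊢
      rw [mul_pow, hx, ← map_pow, ← hqa, ← hq, FiniteField.pow_card_pow]; ring
  obtain ⟨pre, suf, hsplit⟩ := List.append_of_mem hβ
  have hinj : Function.Injective fun x : signedFixed L p a m =>
      (⟨x ^ p - algebraMap K L β * x, hmem x x.2⟩ : signedFixed L p a m) := by
    intro x y hxy
    have h1 : (x : L) ^ p - algebraMap K L β * x = y ^ p - algebraMap K L β * y :=
      congrArg Subtype.val hxy
    have h2 : ((x : L) - y) ^ p = algebraMap K L β * (x - y) := by
      rw [sub_pow_char]; linear_combination h1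
    have h3 := AL.pow_eq_neg_of_pow_eq (pre := pre) (l := suf) hq hqa (fun R _ _ T => by
        rw [← hAL]; exact congrArg (AL p · T) hsplit.symm) h2
    exact Subtype.ext (sub_eq_zero.1 (signedFixed_eq_zero hqa (sub_mem x.2 y.2) h3 hp2))
  obtain ⟨θ, hθ⟩ := Finite.surjective_of_injective hinj ⟨η, hη⟩
  have h1 : (θ : L) ^ p - algebraMap K L β * θ = η := congrArg Subtype.val hθ
  exact ⟨θ, θ.2, by linear_combination h1⟩

theorem exists_pow_eq_mul [Fintype L] (hq : Fintype.card K = q) (hqa : q = p ^ a)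
    (hAL : ∀ (R : Type) [CommRing R] [Algebra K R] (T : R), AL p l₀ T = T ^ q + T) (hp2 : p ≠ 2)
    {m : ℕ} (hL : Fintype.card L = q ^ (2 * m)) {β : K} (hβ : β ∈ l₀) (hβ0 : β ≠ 0) :
    ∃ c : L, c ≠ 0 ∧ c ^ p = algebraMap K L β * c ∧ c ^ q = -c := by
  let Ω := AlgebraicClosure L
  have hodd : Odd q := hqa ▸ ((Fact.out : p.Prime).odd_of_ne_two hp2).pow
  obtain ⟨pre, suf, hsplit⟩ := List.append_of_mem hβ
  have hp := (Fact.out : p.Prime).two_le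
  obtain ⟨z, hz⟩ := IsAlgClosed.exists_pow_nat_eq (algebraMap K Ω β) (n := p - 1) (by omega)
  have hz1 : z ^ p = algebraMap K Ω β * z := by
    rw [← hz, ← pow_succ, Nat.sub_add_cancel (by omega)]
  have hΩ : CharP Ω p := charP_of_injective_algebraMap (algebraMap K Ω).injective p
  have hneg : ∀ (M : Type) [Field M] [Algebra K M] (c : M), c ^ p = algebraMap K M β * c →
      c ^ q = -c := fun M _ _ c hc =>
    AL.pow_eq_neg_of_pow_eq (pre := pre) (l := suf) hq hqa (fun R _ _ T => by
        rw [← hAL]; exact congrArg (AL p · T) hsplit.symm) hc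
  have hz2 : z ^ q ^ 2 = z := by rw [sq, pow_mul, hneg Ω z hz1, hodd.neg_pow, hneg Ω z hz1, neg_neg]
  have hz3 : z ^ Fintype.card L = z := by
    rw [hL, pow_mul]
    have : ∀ m : ℕ, z ^ (q ^ 2) ^ m = z := fun m => by
      induction m with
      | zero => simp
      | succ m ih => rw [pow_succ, pow_mul, ih, hz2]
    exact this m
  obtain ⟨c, rfl⟩ := AL.exists_algebraMap_of_pow_eq hz3
  have hc : c ^ p = algebraMap K L β * c := (algebraMap L Ω).injective (by
    rw [map_pow, map_mul, hz1, ← IsScalarTower.algebraMap_apply])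
  refine ⟨c, fun h => hβ0 ?_, hc, hneg L c hc⟩
  rw [h, map_zero, zero_pow (by omega)] at hz
  exact (map_eq_zero _).1 hz.symm

theorem exists_surjective_of_odd {S : ℕ → Stage K p q l₀} (hq : Fintype.card K = q)
    (hq3 : 3 ≤ q) (hqa : q = p ^ a)
    (hAL : ∀ (R : Type) [CommRing R] [Algebra K R] (T : R), AL p l₀ T = T ^ q + T)
    (hl : ∀ β ∈ l₀, β ≠ 0) (hpre : (S 0).pre = []) (hk : (S 0).k = 0)
    (h0 : ∀ {L : Type} [Field L] [Algebra K L] (t : L), ∃! φ : (S 0).O →ₐ[K] L, φ (S 0).X = t)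
    (hS : ∀ j, Nonempty (Stage.Step (S j) (S (j + 1)))) (hp2 : p ≠ 2) {n : ℕ}
    (hL : Module.finrank K L = n) (hn : 2 ≤ n) (j : ℕ) :
    ∃ φ : (S j).O →ₐ[K] L, Function.Surjective φ := by
  have : Module.Finite K L := Module.finite_of_finrank_pos (by omega)
  have : Finite L := Module.finite_of_finite K
  have := Fintype.ofFinite L
  have hc : Nat.card L = q ^ n := by
    rw [Module.natCard_eq_pow_finrank (K := K), hL, Nat.card_eq_fintype_card, hq]
  have hodd : Odd q := hqa ▸ ((Fact.out : p.Prime).odd_of_ne_two hp2).pow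
  obtain ⟨g, hg, hgo⟩ := exists_primitive_root (L := L)
  rw [hc] at hgo
  have key : ∀ (m : ℕ) (t : L), t ∈ signedFixed L p a m → t ^ q + t ≠ 0 →
      ∃ φ : (S j).O →ₐ[K] L, φ (S j).X = t ∧
        ∃ η ∈ signedFixed L p a m, Ev (S j).F φ (S j).y η := fun m t ht ht0 =>
    exists_hom_of_stable hpre hk h0 hS (by omega) (signedFixed L p a m)
      (fun x hx hx0 => signedFixed_towerMap hqa hx hx0 hp2)
      (fun β hβ η hη => signedFixed_exists_root hq hqa hAL hp2 hβ hη) ht ht0 j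
  have hsplit : ∀ m, q ^ (2 * m) - 1 = (q ^ m - 1) * (q ^ m + 1) := fun m => by
    rw [mul_comm 2, pow_mul, mul_comm, ← Nat.sq_sub_sq, one_pow]
  rcases Nat.even_or_odd n with he | ho
  · obtain ⟨m, hm⟩ := he
    rw [← two_mul] at hm
    have hQ : q ≤ q ^ m := Nat.le_self_pow (by omega) q
    rcases Nat.even_or_odd m with hme | hmo
    · have hQ2 : q < q ^ m := by
        obtain ⟨i, hi⟩ := hme
        exact lt_self_pow₀ (by omega) (by omega)
      obtain ⟨e, he⟩ : ∃ e, q ^ m + 1 = 2 * e := by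
        obtain ⟨e, he⟩ := hodd.pow (n := m)
        exact ⟨e + 1, by omega⟩
      have hto : orderOf (g ^ e) = 2 * (q ^ m - 1) := by
        have h2 : orderOf g = e * (2 * (q ^ m - 1)) := by rw [hgo, hm, hsplit, he]; ring
        rw [orderOf_pow_of_dvd (by omega) ⟨_, h2⟩, h2, Nat.mul_div_cancel_left _ (by omega)]
      have ht0 : g ^ e ≠ 0 := pow_ne_zero _ hg
      have hneg : (g ^ e) ^ (q ^ m - 1) = -1 := by
        have h1 := pow_orderOf_eq_one (g ^ e)
        rw [hto, mul_comm, pow_mul, sq, mul_self_eq_one_iff] at h1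
        refine h1.resolve_left fun h => ?_
        have := Nat.le_of_dvd (by omega) (orderOf_dvd_of_pow_eq_one h)
        omega
      have htV : g ^ e ∈ signedFixed L p a m := by
        rw [mem_signedFixed, ← hqa, hme.add_one.neg_one_pow, ← hneg, ← pow_succ,
          Nat.sub_add_cancel (by omega)]
      obtain ⟨φ, hφ, -⟩ := key m _ htV (fun h => by
        have h1 := orderOf_dvd_of_pow_add_eq_zero (by omega) ht0 h
        rw [hto] at h1
        have := Nat.le_of_dvd (by omega) h1
        omega)
      refine ⟨φ, by_contra fun h => ?_⟩
      obtain ⟨d, hd, ⟨k, hdk⟩, hdn, h1⟩ := Ev.pow_card_pow_of_not_surjective (F := (S j).F) hq hL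
        (by omega) h
      have h2 := h1 _ _ (Ev.of_mem (S j).X)
      rw [hφ] at h2
      have h3 := orderOf_dvd_pred ht0 (by positivity) h2
      rw [hto] at h3
      have h4 : 1 < q ^ d := Nat.one_lt_pow hd.ne' (by omega)
      have h5 := Nat.le_of_dvd (by omega) h3
      have h6 : d ≤ m := by
        have : 2 ≤ k := by
          by_contra hk
          interval_cases k <;> omega
        nlinarith
      have h7 : q ^ d ≤ q ^ m := Nat.pow_le_pow_right (by omega) h6
      omega
    · rcases j with _ | j
      · exact exists_surjective_base hq hq3 h0 hL hn
      have hto : orderOf (g ^ (q ^ m + 1)) = q ^ m - 1 := by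
        have h2 : orderOf g = (q ^ m + 1) * (q ^ m - 1) := by rw [hgo, hm, hsplit]; ring
        rw [orderOf_pow_of_dvd (by omega) ⟨_, h2⟩, h2, Nat.mul_div_cancel_left _ (by omega)]
      set t := g ^ (q ^ m + 1)
      have ht0 : t ≠ 0 := pow_ne_zero _ hg
      have htV : t ∈ signedFixed L p a m := by
        rw [mem_signedFixed, ← hqa, hmo.add_one.neg_one_pow, one_mul]
        have h1 := pow_orderOf_eq_one t
        rw [hto] at h1
        calc t ^ q ^ m = t ^ (q ^ m - 1) * t := by rw [← pow_succ, Nat.sub_add_cancel (by omega)]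
          _ = t := by rw [h1, one_mul]
      have ht0' : t ^ q + t ≠ 0 := fun h =>
        ht0 (signedFixed_eq_zero hqa htV (eq_neg_of_add_eq_zero_left h) hp2)
      obtain ⟨φ, hφ, η, hη, hev⟩ := exists_hom_of_stable hpre hk h0 hS (by omega)
        (signedFixed L p a m)
        (fun x hx hx0 => signedFixed_towerMap hqa hx hx0 hp2)
        (fun β hβ η hη => signedFixed_exists_root hq hqa hAL hp2 hβ hη) htV ht0' j
      obtain ⟨θ, hθ, hθη⟩ := signedFixed_exists_root hq hqa hAL hp2 (S j).β_mem hη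
      obtain ⟨c, hc0, hcp, hcq⟩ := exists_pow_eq_mul (L := L) hq hqa hAL hp2 (m := m) (by
        rw [← Nat.card_eq_fintype_card, hc, hm]) (S j).β_mem (hl _ (S j).β_mem)
      obtain ⟨f⟩ := hS j
      obtain ⟨φ', h1, h2⟩ := f.exists_hom hev (θ := θ + c) (by
        rw [add_pow_char, hθη, hcp]; ring)
      refine ⟨φ', by_contra fun h => ?_⟩
      obtain ⟨d, hd, ⟨k, hdk⟩, hdn, h3⟩ := Ev.pow_card_pow_of_not_surjective
        (F := (S (j + 1)).F) hq hL (by omega) h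
      have h4 := h3 _ _ (Ev.of_mem (S (j + 1)).X)
      rw [← f.map_X', h1, hφ] at h4
      have h5 := orderOf_dvd_pred ht0 (by positivity) h4
      rw [hto] at h5
      have h6 := le_of_pow_sub_one_dvd (by omega) hd h5
      have h7 : d ≤ m := by
        have : 2 ≤ k := by
          by_contra hk
          interval_cases k <;> omega
        nlinarith
      obtain rfl : d = m := le_antisymm h7 h6
      have h8 := h3 _ _ h2
      have h9 : θ + c ∈ signedFixed L p a d := by
        rw [mem_signedFixed, ← hqa, hmo.add_one.neg_one_pow, one_mul, h8]
      have h10 : c ∈ signedFixed L p a d := (add_mem_cancel_left hθ).1 h9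
      exact hc0 (signedFixed_eq_zero hqa h10 hcq hp2)
  · have htV : g ∈ signedFixed L p a n := by
      rw [mem_signedFixed, ← hqa, ho.add_one.neg_one_pow, one_mul, ← hc, Nat.card_eq_fintype_card,
        FiniteField.pow_card]
    obtain ⟨φ, hφ, -⟩ := key n g htV (fun h => hg
      (signedFixed_eq_zero hqa htV (eq_neg_of_add_eq_zero_left h) hp2))
    refine ⟨φ, by_contra fun h => ?_⟩
    obtain ⟨d, hd, -, hdn, h1⟩ := Ev.pow_card_pow_of_not_surjective (F := (S j).F) hq hL
      (by omega) h
    have h2 := h1 _ _ (Ev.of_mem (S j).X)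
    rw [hφ] at h2
    have h3 := orderOf_dvd_pred hg (by positivity) h2
    rw [hgo] at h3
    exact absurd (le_of_pow_sub_one_dvd (by omega) hd h3) (by omega)

end

namespace Crv

variable {K O F : Type} [Field K] [Finite K] [CommRing O] [Field F] [Algebra K O] [Algebra O F]
  [Algebra K F] [IsScalarTower K O F] [IsDomain O] [IsFractionRing O F]

theorem card_homs_le_deg (C : Crv K O F) {L : Type} [Field L] [Algebra K L] {h : O} (h0 : h ≠ 0)
    (G : Finset (O →ₐ[K] L)) (hG : ∀ φ ∈ G, φ h = 0) : (G.card : ℤ) ≤ C.deg (algebraMap O F h) := by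
  rw [← C.codim_span h0, Nat.cast_le]
  have hI : Ideal.span {h} ≠ ⊥ := by simpa using h0
  have := C.finite_quotient hI
  have h1 : Nat.card ((O ⧸ Ideal.span {h}) →ₐ[K] L) ≤ codim K (Ideal.span {h}) :=
    card_algHom_le_finrank K _ L
  refine le_trans ?_ h1
  have hk : ∀ φ ∈ G, ∀ a ∈ Ideal.span {h}, φ a = 0 := fun φ hφ a ha => by
    obtain ⟨b, rfl⟩ := Ideal.mem_span_singleton.1 ha
    rw [map_mul, hG φ hφ, zero_mul]
  have := Fintype.ofFinite ((O ⧸ Ideal.span {h}) →ₐ[K] L)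
  rw [Nat.card_eq_fintype_card, ← Fintype.card_coe]
  refine Fintype.card_le_of_injective
    (fun φ : G => Ideal.Quotient.liftₐ (Ideal.span {h}) φ.1 (hk φ.1 φ.2)) fun φ φ' h' => ?_
  refine Subtype.ext (AlgHom.ext fun x => ?_)
  exact DFunLike.congr_fun h' (Ideal.Quotient.mk _ x)

theorem i_antitone (C : Crv K O F) {k m : ℤ} (h : k ≤ m) : C.i ⊤ m ≤ C.i ⊤ k := by
  have := C.finite_sup (top_ne_bot (α := Ideal O)) k
  have hle : emb K F (⊤ : Ideal O) ⊔ C.L k ≤ emb K F (⊤ : Ideal O) ⊔ C.L m :=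
    sup_le_sup_left (C.L_mono h) _
  exact LinearMap.finrank_le_finrank_of_surjective (f := Submodule.factor hle)
    (Submodule.factor_surjective hle)

theorem l_top_le (C : Crv K O F) {m : ℤ} (hm : 0 ≤ m) : (C.l ⊤ m : ℤ) ≤ m + 1 := by
  have h1 := C.rr_top m
  have h2 : C.i ⊤ m ≤ C.genus := C.i_antitone hm
  omega

theorem le_l_top (C : Crv K O F) (m : ℤ) : m + 1 - C.genus ≤ C.l ⊤ m := by
  have h1 := C.rr_top m
  omega

theorem exists_degrees (C : Crv K O F) (m : ℕ) :
    ∃ D : Finset ℤ, C.l ⊤ ((m : ℤ) - 1) ≤ D.card ∧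
      ∀ d ∈ D, d < m ∧ ∃ s : O, s ≠ 0 ∧ C.deg (algebraMap O F s) = d := by
  induction m with
  | zero =>
    refine ⟨∅, ?_, by simp⟩
    rw [l, C.emb_top_inf_L_neg (by simp)]
    simp
  | succ m ih =>
    obtain ⟨D, h1, h2⟩ := ih
    push_cast
    rw [add_sub_cancel_right]
    by_cases h : ∃ s : O, s ≠ 0 ∧ C.deg (algebraMap O F s) = m
    · refine ⟨insert (m : ℤ) D, ?_, fun d hd => ?_⟩
      · rw [Finset.card_insert_of_notMem fun hm => lt_irrefl _ (h2 _ hm).1]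
        have h3 := C.rr_top m
        have h4 := C.rr_top ((m : ℤ) - 1)
        have h5 := C.i_antitone (show (m : ℤ) - 1 ≤ m by omega)
        omega
      · rcases Finset.mem_insert.1 hd with rfl | hd
        · exact ⟨by omega, h⟩
        · exact ⟨by have := (h2 d hd).1; omega, (h2 d hd).2⟩
    · refine ⟨D, ?_, fun d hd => ⟨by have := (h2 d hd).1; omega, (h2 d hd).2⟩⟩
      have : emb K F (⊤ : Ideal O) ⊓ C.L m = emb K F (⊤ : Ideal O) ⊓ C.L ((m : ℤ) - 1) := by
        refine le_antisymm ?_ (inf_le_inf_left _ (C.L_mono (by omega)))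
        rintro f ⟨⟨b, hb, rfl⟩, hf⟩
        refine ⟨⟨b, hb, rfl⟩, ?_⟩
        by_cases hb0 : b = 0
        · rw [hb0, map_zero]; exact zero_mem _
        have hbF : algebraMap O F b ≠ 0 := by simpa using hb0
        have h3 : C.deg (algebraMap O F b) ≤ m := (mem_L_iff hbF).1 hf
        have h4 : C.deg (algebraMap O F b) ≠ m := fun h' => h ⟨b, hb0, h'⟩
        exact (mem_L_iff hbF).2 (by omega)
      rw [l, this]
      exact h1

theorem deg_nonneg (C : Crv K O F) {b : O} (hb : b ≠ 0) : 0 ≤ C.deg (algebraMap O F b) := by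
  rw [← C.codim_span hb]; positivity

/-- Linear independence of functions with well-separated degrees. -/
theorem sum_mul_pow_ne_zero (C : Crv K O F) {ι : Type} [Fintype ι] {r : ℕ} {s b : ι → O}
    (hs : ∀ i, s i ≠ 0) (hdeg : Function.Injective fun i => C.deg (algebraMap O F (s i)))
    (hb : ∀ i, algebraMap O F (b i) ∈ C.L ((r : ℤ) - 1)) (hb0 : b ≠ 0) :
    ∑ i, b i * s i ^ r ≠ 0 := by
  classical
  set T := Finset.univ.filter fun i => b i ≠ 0 with hT
  have hTn : T.Nonempty := by
    obtain ⟨i, hi⟩ := Function.ne_iff.1 hb0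
    exact ⟨i, by simpa [hT] using hi⟩
  obtain ⟨i₀, hi₀, hmax⟩ := T.exists_max_image (fun i => C.deg (algebraMap O F (s i))) hTn
  have hsF : ∀ i, algebraMap O F (s i) ≠ 0 := fun i => by simpa using hs i
  have hpow : ∀ i, C.v (algebraMap O F (s i ^ r)) =
      WithZero.exp ((r : ℤ) * C.deg (algebraMap O F (s i))) := fun i => by
    rw [map_pow, map_pow, C.v_eq (hsF i), ← WithZero.exp_nsmul]; simp
  have hb1 := (Finset.mem_filter.1 hi₀).2
  have hbF : algebraMap O F (b i₀) ≠ 0 := by simpa using hb1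
  have h1 : C.v (algebraMap O F (b i₀ * s i₀ ^ r)) =
      WithZero.exp (C.deg (algebraMap O F (b i₀)) + r * C.deg (algebraMap O F (s i₀))) := by
    rw [map_mul, map_mul, hpow, C.v_eq hbF, WithZero.exp_add]
  have h0 := C.deg_nonneg hb1
  have h2 : C.v (∑ i ∈ Finset.univ.erase i₀, algebraMap O F (b i * s i ^ r)) <
      C.v (algebraMap O F (b i₀ * s i₀ ^ r)) := by
    rw [h1]
    refine Valuation.map_sum_lt _ WithZero.exp_ne_zero fun i hi => ?_
    by_cases hbi : b i = 0
    · rw [hbi, zero_mul, map_zero, map_zero]; exact WithZero.exp_pos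
    have h3 := hmax i (by simpa [hT] using hbi)
    have h4 : C.deg (algebraMap O F (s i)) ≠ C.deg (algebraMap O F (s i₀)) := fun h =>
      (Finset.mem_erase.1 hi).1 (hdeg h)
    have h5 : C.deg (algebraMap O F (s i)) ≤ C.deg (algebraMap O F (s i₀)) - 1 := by omega
    rw [map_mul, map_mul, hpow]
    refine lt_of_le_of_lt (mul_le_mul_left (mem_L.1 (hb i)) _) ?_
    rw [← WithZero.exp_add, WithZero.exp_lt_exp]
    nlinarith
  intro h
  have h6 := congrArg (algebraMap O F) h
  rw [map_sum, map_zero, ← Finset.add_sum_erase _ _ (Finset.mem_univ i₀)] at h6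
  have h7 := Valuation.map_add_eq_of_lt_left C.v h2
  rw [h6, map_zero, h1] at h7
  exact WithZero.exp_ne_zero h7.symm

/-- Stepanov's method: a bound for the number of points on which the `Q`-power Frobenius acts as
a given endomorphism of the curve. -/
theorem card_twisted_le (C : Crv K O F) {p : ℕ} [Fact p.Prime] [CharP K p] (σ : O →ₐ[K] O)
    (hσ : ∀ s, C.v (algebraMap O F (σ s)) = C.v (algebraMap O F s))
    {L : Type} [Field L] [Algebra K L] {u u' : ℕ} (hu : u' ≤ u)
    (hg : C.genus ^ 2 + 3 * C.genus + 1 < p ^ u) (G : Finset (O →ₐ[K] L))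
    (hG : ∀ φ ∈ G, ∀ s, φ s ^ (p ^ u * p ^ u') = φ (σ s)) :
    G.card ≤ p ^ u * p ^ u' + (2 * C.genus + 1) * p ^ u := by
  classical
  have hpF : CharP F p := charP_of_injective_algebraMap (algebraMap K F).injective p
  have hpL : CharP L p := charP_of_injective_algebraMap (algebraMap K L).injective p
  have hrr : p ^ u' ≤ p ^ u := Nat.pow_le_pow_right (Fact.out : p.Prime).pos hu
  have hp0 : p ^ u' ≠ 0 := pow_ne_zero _ (Fact.out : p.Prime).ne_zero
  set r := p ^ u with hr
  set r' := p ^ u' with hr'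
  set g := C.genus with hgdef
  obtain ⟨D, hD, hDs⟩ := C.exists_degrees (r' + 2 * g + 1)
  choose s hs0 hs using fun d : D => (hDs d d.2).2
  have hcard : r' + g + 1 ≤ D.card := by
    have := C.le_l_top (((r' + 2 * g + 1 : ℕ) : ℤ) - 1)
    push_cast at this hD
    omega
  let A := emb K F (⊤ : Ideal O) ⊓ C.L ((r : ℤ) - 1)
  let B := emb K F (⊤ : Ideal O) ⊓ C.L (((r : ℤ) - 1) * r' + (r' + 2 * g))
  have hA : Finite A := C.finite_inf top_ne_bot _
  have hB : Finite B := C.finite_inf top_ne_bot _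
  have hAc : Nat.card A = Nat.card K ^ C.l ⊤ ((r : ℤ) - 1) := C.card_inf top_ne_bot _
  have hBc : Nat.card B = Nat.card K ^ C.l ⊤ (((r : ℤ) - 1) * r' + (r' + 2 * g)) :=
    C.card_inf top_ne_bot _
  have hsL : ∀ d, algebraMap O F (s d) ∈ C.L ((r' : ℤ) + 2 * g) := fun d => by
    have h1 := (hDs d d.2).1
    have h2 := C.mem_L_deg (algebraMap O F (s d))
    rw [hs] at h2
    push_cast at h1
    exact C.L_mono (by omega) h2
  have hpowL : ∀ {f : F} {k : ℤ} (n : ℕ), f ∈ C.L k → f ^ n ∈ C.L (k * n) := by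
    intro f k n hf
    rw [mem_L, map_pow, mul_comm, ← smul_eq_mul, WithZero.exp_zsmul, zpow_natCast]
    exact pow_le_pow_left₀ zero_le hf n
  have hmap : ∀ y : D → A, ∑ d, (y d : F) ^ r' * algebraMap O F (σ (s d)) ∈ B := by
    intro y
    refine sum_mem fun d _ => ⟨?_, mul_mem_L (hpowL r' (y d).2.2) ?_⟩
    · obtain ⟨b, -, hb⟩ := (y d).2.1
      refine ⟨b ^ r' * σ (s d), trivial, ?_⟩
      rw [← hb]
      exact (map_mul (algebraMap O F) _ _).trans (by rw [map_pow]; rfl)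
    · rw [mem_L, hσ]; exact hsL d
  let Φ : (D → A) → B := fun y => ⟨_, hmap y⟩
  have hlt : Nat.card B < Nat.card (D → A) := by
    rw [Nat.card_fun, hAc, hBc, ← pow_mul, Nat.card_eq_fintype_card (α := D), Fintype.card_coe]
    refine Nat.pow_lt_pow_right Finite.one_lt_card ?_
    have h1 := C.le_l_top ((r : ℤ) - 1)
    have h2 : (C.l ⊤ (((r : ℤ) - 1) * r' + (r' + 2 * g)) : ℤ) ≤ _ :=
      C.l_top_le (by have : (1 : ℤ) ≤ r := by omega
                     have : 0 ≤ ((r : ℤ) - 1) * r' := mul_nonneg (by omega) (by omega)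
                     omega)
    have h3 : (r : ℤ) - g ≤ C.l ⊤ ((r : ℤ) - 1) := by omega
    have h4 : ((r : ℤ) - g) * (r' + g + 1) ≤ C.l ⊤ ((r : ℤ) - 1) * D.card := by
      refine mul_le_mul h3 (by exact_mod_cast hcard) (by positivity) (by positivity)
    have h5 : (g : ℤ) ^ 2 + 3 * g + 1 < r := by exact_mod_cast hg
    have h6 : (r' : ℤ) ≤ r := by exact_mod_cast hrr
    have h7 : (g : ℤ) * r' ≤ g * r := mul_le_mul_of_nonneg_left h6 (by positivity)
    zify
    refine lt_of_le_of_lt h2 (lt_of_lt_of_le ?_ h4)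
    nlinarith
  obtain ⟨y₁, y₂, hy, hne⟩ : ∃ y₁ y₂, Φ y₁ = Φ y₂ ∧ y₁ ≠ y₂ := by
    by_contra! h
    exact absurd (Nat.card_le_card_of_injective Φ fun a b hab => h a b hab) (by omega)
  choose b hb using fun d => ((y₁ - y₂) d).2.1
  have hb' : ∀ d, algebraMap O F (b d) = (y₁ d : F) - y₂ d := fun d => (hb d).2
  have hbL : ∀ d, algebraMap O F (b d) ∈ C.L ((r : ℤ) - 1) := fun d => by
    rw [hb']; exact ((y₁ - y₂) d).2.2
  have hb0 : b ≠ 0 := fun h => hne (funext fun d => Subtype.ext (sub_eq_zero.1 (by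
    rw [← hb', h, Pi.zero_apply, map_zero])))
  have hker : ∑ d, b d ^ r' * σ (s d) = 0 := by
    refine IsFractionRing.injective O F ?_
    have h1 : ∑ d, (y₁ d : F) ^ r' * algebraMap O F (σ (s d)) =
      ∑ d, (y₂ d : F) ^ r' * algebraMap O F (σ (s d)) := congrArg Subtype.val hy
    rw [map_zero, map_sum, ← sub_eq_zero.2 h1, ← Finset.sum_sub_distrib]
    refine Finset.sum_congr rfl fun d _ => ?_
    rw [map_mul, map_pow, hb', hr', sub_pow_char_pow, sub_mul]
  have hne' := C.sum_mul_pow_ne_zero hs0 (fun d d' h => Subtype.ext (by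
    simpa only [hs] using h)) hbL hb0
  have hzero : ∀ φ ∈ G, φ (∑ d, b d * s d ^ r) = 0 := fun φ hφ => by
    have h1 : φ (∑ d, b d * s d ^ r) ^ r' = 0 := by
      rw [map_sum, hr', sum_pow_char_pow, ← map_zero φ, ← hker, map_sum]
      refine Finset.sum_congr rfl fun d _ => ?_
      rw [map_mul, map_pow, mul_pow, ← pow_mul, hG φ hφ, map_mul, map_pow]
    exact pow_eq_zero_iff hp0 |>.1 h1
  have h1 := C.card_homs_le_deg hne' G hzero
  have h2 : algebraMap O F (∑ d, b d * s d ^ r) ∈ C.L ((r : ℤ) - 1 + (r' + 2 * g) * r) := by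
    rw [map_sum]
    refine sum_mem fun d _ => ?_
    rw [map_mul, map_pow]
    exact mul_mem_L (hbL d) (hpowL r (hsL d))
  have h3 := (mem_L_iff (C := C) (fun h => hne'
    (IsFractionRing.injective O F (h.trans (map_zero _).symm)))).1 h2
  zify
  refine h1.trans (h3.trans ?_)
  nlinarith

end Crv

section

variable {K : Type} [Field K] [Fintype K] {q a : ℕ} [CharP K 2] {l₀ : List K}
  {L : Type} [Field L] [Algebra K L]

theorem Ev.comp_left {O F L' : Type} [CommRing O] [Field F] [Field L'] [Algebra K O] [Algebra O F]
    [Algebra K L'] {φ : O →ₐ[K] L} {f : F} {t : L} (h : Ev F φ f t) (ψ : L →ₐ[K] L') :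
    Ev F (ψ.comp φ) f (ψ t) := by
  obtain ⟨a, b, hb, h1, h2⟩ := h
  exact ⟨a, b, (map_ne_zero ψ).2 hb, h1, (congrArg ψ h2).trans (map_mul ψ _ _)⟩

/-- In characteristic two, points at which the Artin–Schreier equation has a root have two
points above them. -/
theorem Stage.Step.exists_double {S S' : Stage K 2 q l₀} (f : Stage.Step S S') (hβ : S.β ≠ 0)
    (G : Finset (S.O →ₐ[K] L)) (hG : ∀ φ ∈ G, φ S.X ^ q + φ S.X ≠ 0)
    (hroot : ∀ φ ∈ G, ∃ η θ, Ev S.F φ S.y η ∧ θ ^ 2 = algebraMap K L S.β * θ + η) :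
    ∃ G' : Finset (S'.O →ₐ[K] L), G'.card = 2 * G.card ∧ ∀ φ' ∈ G', φ'.comp f.ι ∈ G ∧
      φ' S'.X ^ q + φ' S'.X ≠ 0 ∧ ∃ θ, Ev S'.F φ' f.w θ := by
  classical
  have hpL : CharP L 2 := charP_of_injective_algebraMap (algebraMap K L).injective 2
  have hβL : algebraMap K L S.β ≠ 0 := (map_ne_zero _).2 hβ
  choose η θ h1 h2 using fun φ : G => hroot φ φ.2
  let Θ : G → Bool → L := fun φ b => if b then θ φ + algebraMap K L S.β else θ φ
  have h3 : ∀ φ b, Θ φ b ^ 2 = algebraMap K L S.β * Θ φ b + η φ := by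
    rintro φ (_ | _)
    · exact h2 φ
    · change (θ φ + algebraMap K L S.β) ^ 2 = algebraMap K L S.β * (θ φ + algebraMap K L S.β) + η φ
      rw [CharTwo.add_sq, h2]; ring
  choose φ' h4 h5 using fun φ b => f.exists_hom (h1 φ) (h3 φ b)
  have hinj : Function.Injective fun x : G × Bool => φ' x.1 x.2 := by
    rintro ⟨φ, b⟩ ⟨ψ, c⟩ h
    have h6 : φ' φ b = φ' ψ c := h
    obtain rfl : φ = ψ := Subtype.ext (by rw [← h4 φ b, h6, h4])
    have h7 : Θ φ b = Θ φ c := (h5 φ b).unique (h6 ▸ h5 φ c)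
    have : b = c := by
      cases b <;> cases c <;> simp [Θ, hβL] at h7 ⊢
    rw [this]
  refine ⟨Finset.univ.image fun x : G × Bool => φ' x.1 x.2, ?_, ?_⟩
  · rw [Finset.card_image_of_injective _ hinj, Finset.card_univ, Fintype.card_prod,
      Fintype.card_coe, Fintype.card_bool, mul_comm]
  · intro ψ hψ
    obtain ⟨⟨φ, b⟩, -, rfl⟩ := Finset.mem_image.1 hψ
    refine ⟨by rw [h4]; exact φ.2, ?_, _, h5 φ b⟩
    rw [← f.map_X, ← AlgHom.comp_apply, h4]
    exact hG _ φ.2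

/-- In characteristic two, at most about half of the points do not lift to the next stage. -/
theorem Stage.Step.exists_lift {S S' : Stage K 2 q l₀} (f : Stage.Step S S') (hβ : S.β ≠ 0)
    (hq2 : 2 ≤ q) [Module.Finite K L] {u u' : ℕ} (hu : u' ≤ u)
    (hL : Nat.card L = 2 ^ u * 2 ^ u') (hg : S'.C.genus ^ 2 + 3 * S'.C.genus + 1 < 2 ^ u)
    (G : Finset (S.O →ₐ[K] L)) (hG : ∀ φ ∈ G, φ S.X ^ q + φ S.X ≠ 0) :
    ∃ G' : Finset (S'.O →ₐ[K] L), (∀ φ' ∈ G', φ'.comp f.ι ∈ G ∧ φ' S'.X ^ q + φ' S'.X ≠ 0) ∧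
      2 * G.card ≤ G'.card + (2 ^ u * 2 ^ u' + (2 * S'.C.genus + 1) * 2 ^ u) := by
  classical
  have : Finite L := Module.finite_of_finite K
  have := Fintype.ofFinite L
  choose η hη using fun φ : G => S.exists_ev_y hq2 φ.1 (hG φ φ.2)
  let split : (S.O →ₐ[K] L) → Prop := fun φ =>
    ∃ η θ, Ev S.F φ S.y η ∧ θ ^ 2 = algebraMap K L S.β * θ + η
  obtain ⟨G₁, hG₁, hG₁'⟩ := f.exists_double hβ (G.filter split)
    (fun φ hφ => hG φ (Finset.mem_filter.1 hφ).1) (fun φ hφ => (Finset.mem_filter.1 hφ).2)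
  refine ⟨G₁, fun φ' hφ' => ⟨(Finset.mem_filter.1 (hG₁' φ' hφ').1).1, (hG₁' φ' hφ').2.1⟩, ?_⟩
  let Ω := AlgebraicClosure L
  have hpΩ : CharP Ω 2 := charP_of_injective_algebraMap (algebraMap K Ω).injective 2
  let ι : L →ₐ[K] Ω := IsScalarTower.toAlgHom K L Ω
  have hιinj : Function.Injective fun φ : S.O →ₐ[K] L => ι.comp φ := fun φ ψ h =>
    AlgHom.ext fun s => ι.toRingHom.injective (DFunLike.congr_fun h s)
  obtain ⟨G₂, hG₂, hG₂'⟩ := f.exists_double (L := Ω) hβ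
    ((G.filter fun φ => ¬ split φ).image fun φ => ι.comp φ) (fun ψ hψ => by
      obtain ⟨φ, hφ, rfl⟩ := Finset.mem_image.1 hψ
      have := (map_ne_zero ι).2 (hG φ (Finset.mem_filter.1 hφ).1)
      rwa [map_add, map_pow] at this) (fun ψ hψ => by
      obtain ⟨φ, hφ, rfl⟩ := Finset.mem_image.1 hψ
      have h1 := (hη ⟨φ, (Finset.mem_filter.1 hφ).1⟩).comp_left ι
      obtain ⟨θ, hθ⟩ := IsAlgClosed.exists_root
        (Polynomial.X ^ 2 - Polynomial.C (algebraMap K Ω S.β) * Polynomial.X - Polynomial.C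
          (ι (η ⟨φ, (Finset.mem_filter.1 hφ).1⟩))) (by
          rw [sub_sub, Polynomial.degree_sub_eq_left_of_degree_lt]
          · simp
          · rw [Polynomial.degree_X_pow]
            exact (Polynomial.degree_linear_le).trans_lt (by norm_num))
      refine ⟨_, θ, h1, ?_⟩
      simp only [Polynomial.IsRoot.def, Polynomial.eval_sub, Polynomial.eval_pow, Polynomial.eval_X,
        Polynomial.eval_mul, Polynomial.eval_C] at hθ
      linear_combination hθ)
  obtain ⟨σ, hσι, hσv, hσw⟩ := f.exists_auto S.β (sq _)
  have hcL : Fintype.card L = 2 ^ u * 2 ^ u' := by rw [← Nat.card_eq_fintype_card, hL]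
  let Fr : Ω →ₐ[K] Ω := (FiniteField.frobeniusAlgHom L Ω).restrictScalars K
  have hFr : ∀ z : Ω, Fr z = z ^ (2 ^ u * 2 ^ u') := fun z => by
    rw [← hcL]; rfl
  have hFrι : ∀ z : L, Fr (ι z) = ι z := fun z => (FiniteField.frobeniusAlgHom L Ω).commutes z
  have key : ∀ φ' ∈ G₂, ∀ s, φ' s ^ (2 ^ u * 2 ^ u') = φ' (σ s) := by
    intro φ' hφ'
    obtain ⟨h1, -, θ, hθ⟩ := hG₂' φ' hφ'
    obtain ⟨φ, hφ, hφφ'⟩ := Finset.mem_image.1 h1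
    obtain ⟨hφG, hφs⟩ := Finset.mem_filter.1 hφ
    set e := η ⟨φ, hφG⟩ with he
    have hev : Ev S.F φ S.y e := hη ⟨φ, hφG⟩
    have hev' : Ev S.F (φ'.comp f.ι) S.y (ι e) := by
      rw [← hφφ']; exact hev.comp_left ι
    have h2 : θ ^ 2 = algebraMap K Ω S.β * θ + ι e := f.pow_eq hev' hθ
    have hFβ : Fr (algebraMap K Ω S.β) = algebraMap K Ω S.β := Fr.commutes _
    have h3 : Fr θ ^ 2 = algebraMap K Ω S.β * Fr θ + ι e := by
      rw [← map_pow, h2, map_add, map_mul, hFβ, hFrι]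
    have h4 : Fr θ ≠ θ := by
      intro h
      obtain ⟨c, hc⟩ := AL.exists_algebraMap_of_pow_eq (K := L) (x := θ) (by
        rw [hcL, ← hFr, h])
      refine hφs ⟨e, c, hev, ι.toRingHom.injective ?_⟩
      have h5 : ι c = θ := hc.symm
      change ι (c ^ 2) = ι (algebraMap K L S.β * c + e)
      rw [map_pow, map_add, map_mul, h5, h2, ι.commutes]
    have h5 : Fr θ = θ + algebraMap K Ω S.β := by
      have : (Fr θ - θ) * (Fr θ - θ - algebraMap K Ω S.β) = 0 := by
        have h6 : (2 : Ω) = 0 := CharTwo.two_eq_zero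
        linear_combination h3 - h2 - (Fr θ * θ - θ ^ 2) * h6
      have h7 := (mul_eq_zero.1 this).resolve_left (sub_ne_zero.2 h4)
      linear_combination h7
    have h6 : Fr.comp φ' = φ'.comp σ := by
      have h7 : (Fr.comp φ').comp f.ι = φ'.comp f.ι := by
        rw [AlgHom.comp_assoc, ← hφφ']
        exact AlgHom.ext fun s => hFrι (φ s)
      refine f.hom_ext (η := ι e) (θ := Fr θ) ?_ (by rw [h7]; exact hev') h3 (hθ.comp_left Fr) ?_
      · rw [h7]
        exact AlgHom.ext fun s => by
          simp only [AlgHom.comp_apply, hσι]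
      · rw [h5]; exact hσw Ω φ' θ hθ
    intro s
    rw [← hFr]
    exact DFunLike.congr_fun h6 s
  have h8 := Crv.card_twisted_le S'.C σ hσv hu hg G₂ key
  rw [Finset.card_image_of_injective _ hιinj] at hG₂
  have h9 := Finset.card_filter_add_card_filter_not (s := G) split
  omega

end

section

variable {K : Type} [Field K] [Fintype K] {q a : ℕ} [CharP K 2] {l₀ : List K}
  {L : Type} [Field L] [Algebra K L] [Module.Finite K L]

theorem Stage.Step.card_fiber_le {S S' : Stage K 2 q l₀} (f : Stage.Step S S') (hq2 : 2 ≤ q)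
    (H : Finset (S'.O →ₐ[K] L)) (hH : ∀ φ ∈ H, φ S'.X ^ q + φ S'.X ≠ 0) (ψ : S.O →ₐ[K] L)
    (hψ : ∀ φ ∈ H, φ.comp f.ι = ψ) : H.card ≤ 2 := by
  classical
  have hpL : CharP L 2 := charP_of_injective_algebraMap (algebraMap K L).injective 2
  rcases H.eq_empty_or_nonempty with rfl | ⟨φ₀, hφ₀⟩
  · simp
  have hX : ∀ φ ∈ H, φ S'.X = ψ S.X := fun φ hφ => by rw [← f.map_X', hψ φ hφ]
  obtain ⟨η, hη⟩ := S.exists_ev_y hq2 ψ (by rw [← hX _ hφ₀]; exact hH _ hφ₀)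
  choose! θ hθ using fun φ (hφ : φ ∈ H) => f.exists_ev_w hq2 (hH φ hφ)
  have hr : ∀ φ ∈ H, θ φ ^ 2 = algebraMap K L S.β * θ φ + η := fun φ hφ =>
    f.pow_eq (by rw [hψ φ hφ]; exact hη) (hθ φ hφ)
  refine (Finset.card_le_card_of_injOn θ (t := {θ φ₀, θ φ₀ + algebraMap K L S.β})
    (fun φ hφ => ?_) fun φ hφ φ' hφ' h => ?_).trans Finset.card_le_two
  · have h6 : (2 : L) = 0 := CharTwo.two_eq_zero
    have h1 : (θ φ - θ φ₀) * (θ φ - θ φ₀ - algebraMap K L S.β) = 0 := by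
      linear_combination hr φ hφ - hr φ₀ hφ₀ - (θ φ * θ φ₀ - θ φ₀ ^ 2) * h6
    rw [Finset.mem_coe, Finset.mem_insert, Finset.mem_singleton]
    rcases mul_eq_zero.1 h1 with h | h
    · exact Or.inl (sub_eq_zero.1 h)
    · right; linear_combination h
  · exact f.hom_ext (by rw [hψ φ hφ, hψ φ' hφ']) (by rw [hψ φ hφ]; exact hη) (hr φ hφ) (hθ φ hφ)
      (h ▸ hθ φ' hφ')

theorem card_homs_le {S : ℕ → Stage K 2 q l₀} (hq2 : 2 ≤ q)
    (h0 : ∀ {L : Type} [Field L] [Algebra K L] (t : L), ∃! φ : (S 0).O →ₐ[K] L, φ (S 0).X = t)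
    (hS : ∀ j, Nonempty (Stage.Step (S j) (S (j + 1)))) (U : Finset L) (j : ℕ)
    (H : Finset ((S j).O →ₐ[K] L)) (hH : ∀ φ ∈ H, φ (S j).X ^ q + φ (S j).X ≠ 0)
    (hU : ∀ φ ∈ H, φ (S j).X ∈ U) : H.card ≤ 2 ^ j * U.card := by
  classical
  induction j with
  | zero =>
    rw [pow_zero, one_mul]
    exact Finset.card_le_card_of_injOn (fun φ => φ (S 0).X) hU
      fun φ _ φ' _ h => (h0 _).unique rfl h.symm
  | succ j ih =>
    obtain ⟨f⟩ := hS j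
    have h1 := ih (H.image fun φ => φ.comp f.ι) (fun ψ hψ => by
      obtain ⟨φ, hφ, rfl⟩ := Finset.mem_image.1 hψ
      rw [f.map_X']; exact hH φ hφ) (fun ψ hψ => by
      obtain ⟨φ, hφ, rfl⟩ := Finset.mem_image.1 hψ
      rw [f.map_X']; exact hU φ hφ)
    have h2 : H.card ≤ 2 * (H.image fun φ => φ.comp f.ι).card :=
      Finset.card_le_mul_card_image H 2 fun ψ _ => f.card_fiber_le hq2 _
        (fun φ hφ => hH φ (Finset.mem_filter.1 hφ).1) ψ fun φ hφ => (Finset.mem_filter.1 hφ).2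
    rw [pow_succ]
    linarith

theorem exists_homs_of_even {S : ℕ → Stage K 2 q l₀} (hq2 : 2 ≤ q)
    (hl : ∀ β ∈ l₀, β ≠ 0)
    (h0 : ∀ {L : Type} [Field L] [Algebra K L] (t : L), ∃! φ : (S 0).O →ₐ[K] L, φ (S 0).X = t)
    (hS : ∀ j, Nonempty (Stage.Step (S j) (S (j + 1))))
    {u u' : ℕ} (hu : u' ≤ u) (hL : Nat.card L = 2 ^ u * 2 ^ u') (j : ℕ)
    (hg : ∀ i ≤ j, (S i).C.genus ^ 2 + 3 * (S i).C.genus + 1 < 2 ^ u ∧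
      (S i).C.genus + 1 ≤ q * 2 ^ i) :
    ∃ H : Finset ((S j).O →ₐ[K] L), (∀ φ ∈ H, φ (S j).X ^ q + φ (S j).X ≠ 0) ∧
      2 ^ u * 2 ^ u' ≤ H.card + q * 2 ^ j * (1 + 2 * j * 2 ^ u) := by
  classical
  induction j with
  | zero =>
    have : Finite L := Module.finite_of_finite K
    obtain ⟨t, ht, ht0⟩ := exists_injective_pow_add_ne_zero hq2 hL
    choose g hg using fun i => (h0 (t i)).exists
    have hgi : Function.Injective g := fun i i' h => ht (by rw [← hg, h, hg])
    refine ⟨Finset.univ.image g, fun φ hφ => ?_, ?_⟩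
    · obtain ⟨i, -, rfl⟩ := Finset.mem_image.1 hφ
      rw [hg]; exact ht0 i
    · rw [Finset.card_image_of_injective _ hgi, Finset.card_univ, Fintype.card_fin]
      simp
      omega
  | succ j ih =>
    obtain ⟨G, hG, hGc⟩ := ih fun i hi => hg i (by omega)
    obtain ⟨f⟩ := hS j
    obtain ⟨h1, h2⟩ := hg (j + 1) le_rfl
    obtain ⟨G', hG', hGc'⟩ := f.exists_lift (hl _ (S j).β_mem) hq2 hu hL h1 G hG
    refine ⟨G', fun φ hφ => (hG' φ hφ).2, ?_⟩
    have h3 : (2 * (S (j + 1)).C.genus + 1) * 2 ^ u ≤ 2 * (q * 2 ^ (j + 1)) * 2 ^ u :=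
      Nat.mul_le_mul_right _ (by omega)
    rw [pow_succ] at h3 ⊢
    nlinarith

theorem sum_pow_le (hq2 : 2 ≤ q) (m : ℕ) : ∑ d ∈ Finset.range (m + 1), q ^ d ≤ 2 * q ^ m := by
  induction m with
  | zero => simp
  | succ m ih =>
    rw [Finset.sum_range_succ, pow_succ]
    nlinarith [pow_pos (show 0 < q by omega) m]

open Polynomial in
theorem card_filter_pow_eq_le [Fintype L] [DecidableEq L] {N : ℕ} (hN : 2 ≤ N) :
    (Finset.univ.filter fun t : L => t ^ N = t).card ≤ N := by
  have h0 : (X ^ N - X : Polynomial L).natDegree = N := by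
    rw [natDegree_sub_eq_left_of_natDegree_lt] <;> simp
    omega
  have h1 : (X ^ N - X : Polynomial L) ≠ 0 := by
    intro h; rw [h] at h0; simp at h0; omega
  calc _ ≤ (X ^ N - X : Polynomial L).roots.toFinset.card := Finset.card_le_card fun t ht => by
        rw [Multiset.mem_toFinset, mem_roots h1]
        simpa [sub_eq_zero] using ht
    _ ≤ _ := (Multiset.toFinset_card_le _).trans ((card_roots' _).trans h0.le)

theorem not_card_bounds {q e j r r' H U : ℕ} (hq4 : 4 ≤ q) (h3 : j + 1 ≤ e) (hrr : r' ≤ r)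
    (hMr : (q * e) ^ 2 ≤ r') (hH : r * r' ≤ H + q * e * (1 + 2 * j * r)) (h1 : H ≤ e * U)
    (hU : U ≤ 2 * r') : False := by
  obtain ⟨M, hM⟩ : ∃ M, M = q * e := ⟨_, rfl⟩
  rw [← hM] at hMr hH
  have hM4 : 4 * e ≤ M := hM ▸ Nat.mul_le_mul_right _ hq4
  have h2 : e * U ≤ e * (2 * r') := Nat.mul_le_mul_left _ hU
  have h4 : 2 * e * r' ≤ 2 * e * r := Nat.mul_le_mul_left _ hrr
  have h5 : M ^ 2 * r ≤ r' * r := Nat.mul_le_mul_right _ hMr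
  have h6 : r' * r ≤ 2 * e * r + (M + 2 * j * M * r) := by linarith
  have h0 : 1 ≤ M ^ 2 := Nat.one_le_pow _ _ (by omega)
  have hr : 1 ≤ r := by omega
  have h7 : M ≤ M * r := Nat.le_mul_of_pos_right _ (by omega)
  have h8 : M ^ 2 * r ≤ (2 * e + M + 2 * j * M) * r := by linarith
  have h9 : M ^ 2 ≤ 2 * e + M + 2 * j * M := Nat.le_of_mul_le_mul_right h8 (by omega)
  have h10 : M * (4 * e) ≤ M * M := Nat.mul_le_mul_left _ hM4
  have h11 : M * (j + 1) ≤ M * e := Nat.mul_le_mul_left _ h3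
  nlinarith

theorem exists_surjective_of_even {S : ℕ → Stage K 2 q l₀} (hq : Fintype.card K = q)
    (hq4 : 4 ≤ q) (hqa : q = 2 ^ a)
    (hl : ∀ β ∈ l₀, β ≠ 0)
    (h0 : ∀ {L : Type} [Field L] [Algebra K L] (t : L), ∃! φ : (S 0).O →ₐ[K] L, φ (S 0).X = t)
    (hg : (S 0).C.genus = 0) (hc : (S 0).cuspDeg = q)
    (hS : ∀ j, Nonempty (Stage.Step (S j) (S (j + 1)))) {n : ℕ}
    (hL : Module.finrank K L = n) (j : ℕ) (hn : 4 * (a + j) ≤ a * n) :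
    ∃ φ : (S j).O →ₐ[K] L, Function.Surjective φ := by
  classical
  have : Finite L := Module.finite_of_finite K
  have := Fintype.ofFinite L
  have ha : 0 < a := by
    rcases Nat.eq_zero_or_pos a with rfl | h
    · simp at hqa; omega
    · exact h
  have hn0 : 0 < n := by
    rcases Nat.eq_zero_or_pos n with rfl | h
    · omega
    · exact h
  obtain ⟨u', hu'⟩ : ∃ u', u' = a * n / 2 := ⟨_, rfl⟩
  obtain ⟨u, hu⟩ : ∃ u, u = a * n - u' := ⟨_, rfl⟩
  have huu : u' ≤ u := by omega
  have hLc : Nat.card L = 2 ^ u * 2 ^ u' := by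
    rw [Module.natCard_eq_pow_finrank (K := K), hL, Nat.card_eq_fintype_card, hq, hqa, ← pow_mul,
      ← pow_add]
    congr 1; omega
  have hMr : (q * 2 ^ j) ^ 2 ≤ 2 ^ u' := by
    rw [hqa, ← pow_add, ← pow_mul]
    exact Nat.pow_le_pow_right (by omega) (by omega)
  have hrr : 2 ^ u' ≤ 2 ^ u := Nat.pow_le_pow_right (by omega) huu
  have hgen : ∀ i ≤ j, (S i).C.genus ^ 2 + 3 * (S i).C.genus + 1 < 2 ^ u ∧
      (S i).C.genus + 1 ≤ q * 2 ^ i := fun i hi => by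
    obtain ⟨h1, h2⟩ := genus_add_cuspDeg_le hg hc hS i
    have h3 : q * 2 ^ i ≤ q * 2 ^ j := Nat.mul_le_mul_left _ (Nat.pow_le_pow_right (by omega) hi)
    refine ⟨lt_of_lt_of_le ?_ (hMr.trans hrr), by omega⟩
    have h4 : (S i).C.genus + 4 ≤ q * 2 ^ j := by omega
    nlinarith
  obtain ⟨H, hH, hHc⟩ := exists_homs_of_even (by omega) hl h0 hS huu hLc j hgen
  by_contra! hno
  let U : Finset L := (Finset.range (n / 2 + 1)).biUnion fun d =>
    if d = 0 then ∅ else Finset.univ.filter fun t : L => t ^ q ^ d = t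
  have hU : ∀ φ ∈ H, φ (S j).X ∈ U := fun φ _ => by
    obtain ⟨d, hd, ⟨k, hk⟩, hdn, h1⟩ := Ev.pow_card_pow_of_not_surjective (F := (S j).F) hq hL hn0
      (hno φ)
    have h2 : 2 ≤ k := by
      by_contra hk'
      interval_cases k <;> omega
    refine Finset.mem_biUnion.2 ⟨d, Finset.mem_range.2 ?_, ?_⟩
    · have : d * 2 ≤ n := hk ▸ Nat.mul_le_mul_left d h2
      omega
    · rw [if_neg hd.ne', Finset.mem_filter]
      exact ⟨Finset.mem_univ _, h1 _ _ (Ev.of_mem (S j).X)⟩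
  have hUc : U.card ≤ 2 * 2 ^ u' := by
    calc U.card ≤ ∑ d ∈ Finset.range (n / 2 + 1), q ^ d := by
          refine Finset.card_biUnion_le.trans (Finset.sum_le_sum fun d _ => ?_)
          split_ifs with hd
          · simp
          · exact card_filter_pow_eq_le ((by omega : 2 ≤ q).trans (Nat.le_self_pow hd q))
      _ ≤ 2 * q ^ (n / 2) := sum_pow_le (by omega) _
      _ ≤ 2 * 2 ^ u' := by
          rw [hqa, ← pow_mul]
          refine Nat.mul_le_mul_left _ (Nat.pow_le_pow_right (by omega) ?_)
          rw [hu', Nat.le_div_iff_mul_le (by omega), mul_assoc]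
          exact Nat.mul_le_mul_left _ (Nat.div_mul_le_self _ _)
  exact not_card_bounds hq4 Nat.lt_two_pow_self hrr hMr hHc
    (card_homs_le (by omega) h0 hS U j H hH hU) hUc

end

namespace Crv

variable {K O F : Type} [Field K] [Fintype K] [CommRing O] [IsDedekindDomain O] [Field F]
  [Algebra K O] [Algebra O F] [Algebra K F] [IsScalarTower K O F] [IsFractionRing O F]
  {L E : Type} [Field L] [Algebra K L] [Module.Finite K L] [Field E] [Algebra K E]

theorem hasRank_of_genus_eq_zero (C : Crv K O F) (hg : C.genus = 0)
    (hE : Module.finrank K E = 2) (φ : O →ₐ[K] L) (hφ : Function.Surjective φ) {B n : ℕ}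
    (ψ : Fin B → (O →ₐ[K] E)) (hψ : ∀ i, Function.Surjective (ψ i))
    (hker : ∀ i j, i ≠ j → RingHom.ker (ψ i) ≠ RingHom.ker (ψ j))
    (hn : Module.finrank K L = n) (hB : n ≤ B) : HasRank K L (3 * n) := by
  have := C.finite_classGroup
  refine C.hasRank (γ := 0) ?_ hE φ hφ (fun i => ψ (Fin.castLE hB i)) (fun i => hψ _)
    (fun i j h => hker _ _ fun h' => h (Fin.castLE_injective hB h'))
    (by rw [hn, hg]; push_cast; omega)
  rw [card_eff_neg (by rw [hg]; norm_num), mul_zero]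
  exact Nat.card_pos

theorem hasRank_of_quadratic (C : Crv K O F) {q M δ i n B : ℕ} (hq : Fintype.card K = q)
    (hq1 : 1 ≤ q) (hg : C.genus + q ≤ M) (hM : M ≤ q * q ^ i)
    (hδ : 2 * q + 2 + δ ≤ (q - 1) * q)
    (hE : Module.finrank K E = 2) (φ : O →ₐ[K] L) (hφ : Function.Surjective φ)
    (ψ : Fin B → (O →ₐ[K] E)) (hψ : ∀ i, Function.Surjective (ψ i))
    (hker : ∀ i j, i ≠ j → RingHom.ker (ψ i) ≠ RingHom.ker (ψ j))
    (hB : (q - 1) * M ≤ 2 * B + δ) (hn : Module.finrank K L = n)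
    (hR : 2 * n + M + 3 * (1 + 2 * i) + δ ≤ (q - 1) * M + q) :
    HasRank K L (3 * (n + (M - q + 3 * (1 + 2 * i)) / 2)) := by
  classical
  have hs : n + (M - q + 3 * (1 + 2 * i)) / 2 ≤ B := by omega
  refine C.hasRank (γ := 1 + 2 * i) ?_ hE φ hφ (fun i => ψ (Fin.castLE hs i)) (fun i => hψ _)
    (fun i j h => hker _ _ fun h' => h (Fin.castLE_injective hs h')) ?_
  · have hinj : Function.Injective fun i => RingHom.ker (ψ i) := fun i j h =>
      by_contra fun h' => hker i j h' h
    have h1 := C.two_mul_card_eff_lt (Finset.univ.image fun i => RingHom.ker (ψ i))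
      (D := 2 * q) (j := i) (fun P hP => by
        obtain ⟨i, -, rfl⟩ := Finset.mem_image.1 hP
        have : Module.Finite K E := Module.finite_of_finrank_pos (by omega)
        exact ⟨C.ker_ne_bot _, RingHom.ker_isPrime _, by rw [codim_ker _ (hψ i), hE]⟩) (by
        rw [Finset.card_image_of_injective _ hinj, Finset.card_univ, Fintype.card_fin,
          Nat.card_eq_fintype_card, hq]
        obtain ⟨k, rfl⟩ := Nat.exists_eq_add_of_le' hq1
        rw [Nat.add_sub_cancel] at hδ hB
        have h2 := Nat.mul_le_mul_left k hg
        linarith) (by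
        rw [Nat.card_eq_fintype_card, hq]
        have : 2 * q * q ^ i = 2 * (q * q ^ i) := by ring
        omega)
    have e : (C.genus : ℤ) - 1 - (1 + 2 * i) = C.genus - 2 - 2 * i := by ring
    rwa [e]
  · rw [hn]
    push_cast
    omega

end Crv

section

variable {K : Type} [Field K] [Fintype K] {p q a : ℕ} [Fact p.Prime] [CharP K p]

theorem exists_finrank_eq_two (K : Type) [Field K] [Finite K] :
    ∃ (E : Type) (_ : Field E) (_ : Algebra K E), Module.finrank K E = 2 := by
  obtain ⟨p, hp⟩ := CharP.exists K
  have : Fact p.Prime := ⟨CharP.char_is_prime K p⟩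
  let _ := ZMod.algebra K p
  exact ⟨FiniteField.Extension K p 2, inferInstance, inferInstance,
    FiniteField.finrank_extension ..⟩

variable {L : Type} [Field L] [Algebra K L]

/-- The complexity bound obtained from interpolation on the stage `j` of the tower. -/
theorem hasRank_tower (hq : Fintype.card K = q) (hq4 : 4 ≤ q) (hqa : q = p ^ a) {n : ℕ}
    (hL : Module.finrank K L = n) (hn : 2 ≤ n) :
    (2 * n + (if p = 2 then 0 else q - 1) ≤ q * (q - 1) → HasRank K L (3 * n)) ∧
    ∀ i j : ℕ, p ^ j ≤ q ^ i → (p = 2 → 4 * (a + j) ≤ a * n) →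
      2 * n + q * p ^ j + 3 * (1 + 2 * i) + (if p = 2 then 0 else q - 1) ≤
        (q - 1) * (q * p ^ j) + q →
      HasRank K L (3 * (n + (q * p ^ j - q + 3 * (1 + 2 * i)) / 2)) := by
  have : Module.Finite K L := Module.finite_of_finrank_pos (by omega)
  have ha : 0 < a := by
    rcases Nat.eq_zero_or_pos a with rfl | h
    · simp at hqa; omega
    · exact h
  obtain ⟨l₀, S, -, hl, hAL, ⟨hg, hc, hpre, hk, h0⟩, hS⟩ :=
    exists_stage_tower (K := K) hq hqa (by omega) ha
  obtain ⟨E, _, _, hE⟩ := exists_finrank_eq_two K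
  have : Module.Finite K E := Module.finite_of_finrank_pos (by omega)
  have hpts := exists_quadratic_points hq (by omega) hqa hAL hl h0 hS hE
  have hqq : q ^ 2 - q = (q - 1) * q := by rw [Nat.sub_mul, sq, one_mul]
  constructor
  · intro hn'
    obtain ⟨φ, hφ⟩ := exists_surjective_base hq (by omega) h0 hL hn
    obtain ⟨s, ψ, h1, h2, h3⟩ := hpts 0
    rw [hqq, mul_comm] at h3
    exact (S 0).C.hasRank_of_genus_eq_zero hg hE φ hφ ψ h1 h2 hL (by
      rw [pow_zero, one_mul, mul_comm (q - 1)] at h3; omega)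
  · intro i j hi hp2 hR
    obtain ⟨φ, hφ⟩ : ∃ φ : (S j).O →ₐ[K] L, Function.Surjective φ := by
      by_cases h : p = 2
      · subst h
        exact exists_surjective_of_even hq hq4 hqa hl h0 hg hc hS hL j (hp2 rfl)
      · have : CharP L p := charP_of_injective_algebraMap (algebraMap K L).injective p
        exact exists_surjective_of_odd hq (by omega) hqa hAL hl hpre hk h0 hS h hL hn j
    obtain ⟨s, ψ, h1, h2, h3⟩ := hpts j
    obtain ⟨h4, h5⟩ := genus_add_cuspDeg_le hg hc hS j
    refine (S j).C.hasRank_of_quadratic hq (by omega) (by omega) (Nat.mul_le_mul_left q hi) ?_ hE φ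
      hφ ψ h1 h2 (by rwa [← mul_assoc, ← hqq]) hL hR
    obtain ⟨k, rfl⟩ := Nat.exists_eq_add_of_le' hq4
    have e : k + 4 - 1 = k + 3 := rfl
    rw [e]
    split_ifs with h
    · nlinarith
    · rcases Nat.eq_zero_or_pos k with rfl | hk'
      · exfalso
        have h6 : 2 ∣ p ^ a := hqa ▸ (by norm_num)
        exact h ((Nat.prime_dvd_prime_iff_eq Nat.prime_two Fact.out).1
          (Nat.prime_two.dvd_of_dvd_pow h6)).symm
      · nlinarith

end

section

/-- An exponent `i` with `p ^ j ≤ q ^ i`, where `q = p ^ a`. -/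
def levelExp (a j : ℕ) : ℕ := if a = 1 then j else (j + 1) / 2

variable {p q a n : ℕ}

theorem pow_le_pow_levelExp (hp : p.Prime) (ha : 0 < a) (hqa : q = p ^ a) (j : ℕ) :
    p ^ j ≤ q ^ levelExp a j := by
  rw [hqa, ← pow_mul, levelExp]
  refine Nat.pow_le_pow_right hp.pos ?_
  split_ifs with h
  · rw [h, one_mul]
  · have : 2 * ((j + 1) / 2) ≤ a * ((j + 1) / 2) := Nat.mul_le_mul_right _ (by omega)
    omega

theorem twelve_mul_le_five_pow (j : ℕ) : 12 * (j + 2) ≤ 5 ^ (j + 2) + 4 := by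
  induction j with
  | zero => norm_num
  | succ j ih => rw [show j + 1 + 2 = (j + 2) + 1 by ring, pow_succ]; omega

theorem four_mul_le_three_pow (j : ℕ) : 4 * (j + 2) + 1 ≤ 3 ^ (j + 2) := by
  induction j with
  | zero => norm_num
  | succ j ih => rw [show j + 1 + 2 = (j + 2) + 1 by ring, pow_succ]; omega

theorem three_mul_le_two_pow (j : ℕ) : 3 * (j + 2) ≤ 2 ^ (j + 2) + 2 := by
  induction j with
  | zero => norm_num
  | succ j ih => rw [show j + 1 + 2 = (j + 2) + 1 by ring, pow_succ]; omega

theorem cases_of_four_le (hp : p.Prime) (ha : 0 < a) (hqa : q = p ^ a) (hq4 : 4 ≤ q) :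
    (p = 2 ∧ 2 ≤ a ∧ (q = 4 ∨ 8 ≤ q)) ∨ (p ≠ 2 ∧ a = 1 ∧ q = p ∧ 5 ≤ p) ∨
      (p ≠ 2 ∧ 2 ≤ a ∧ 3 ≤ p ∧ 3 * p ≤ q) := by
  by_cases h2 : p = 2
  · subst h2
    have ha2 : 2 ≤ a := by
      by_contra h
      obtain rfl : a = 1 := by omega
      omega
    refine Or.inl ⟨rfl, ha2, ?_⟩
    rcases Nat.lt_or_ge a 3 with h | h
    · left; rw [hqa, show a = 2 by omega]; norm_num
    · right; rw [hqa]; exact Nat.pow_le_pow_right (n := 2) (by omega) h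
  · have hp3 : 3 ≤ p := by have := hp.two_le; omega
    rcases Nat.lt_or_ge a 2 with h | h
    · obtain rfl : a = 1 := by omega
      rw [pow_one] at hqa
      refine Or.inr (Or.inl ⟨h2, rfl, hqa, ?_⟩)
      rcases Nat.lt_or_ge p 5 with h5 | h5
      · obtain rfl : p = 4 := by omega
        norm_num at hp
      · exact h5
    · refine Or.inr (Or.inr ⟨h2, h, hp3, ?_⟩)
      calc 3 * p ≤ p * p := Nat.mul_le_mul_right _ hp3
        _ = p ^ 2 := (sq p).symm
        _ ≤ q := hqa ▸ Nat.pow_le_pow_right hp.pos h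

theorem stage_inequality (hp : p.Prime) (ha : 0 < a) (hqa : q = p ^ a) (hq4 : 4 ≤ q) (j : ℕ) :
    3 * p * (1 + 2 * levelExp a (j + 1) : ℤ) + 3 * (q - 3) * (1 + 2 * levelExp a (j + 2) : ℤ) ≤
      q * p ^ (j + 2) + p * (q + 1 - if p = 2 then 0 else q - 1) + q * (q - 3) := by
  have hi1 : a ≠ 1 → 2 * (levelExp a (j + 1) : ℤ) ≤ j + 2 := fun h => by
    rw [levelExp, if_neg h]; omega
  have hi2 : a ≠ 1 → 2 * (levelExp a (j + 2) : ℤ) ≤ j + 3 := fun h => by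
    rw [levelExp, if_neg h]; omega
  have hq4' : (4 : ℤ) ≤ q := by exact_mod_cast hq4
  rcases cases_of_four_le hp ha hqa hq4 with ⟨h, h2, h3⟩ | ⟨h, h2, h3, h4⟩ | ⟨h, h2, h3, h4⟩
  · have hA := hi1 (by omega)
    have hB := hi2 (by omega)
    have hC : (3 : ℤ) * (j + 2) ≤ 2 ^ (j + 2) + 2 := by exact_mod_cast three_mul_le_two_pow j
    rw [if_pos h, h]
    push_cast
    generalize (2 : ℤ) ^ (j + 2) = P at *
    generalize (levelExp a (j + 1) : ℤ) = x at *
    generalize (levelExp a (j + 2) : ℤ) = y at *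
    have h5 : 3 * ((q : ℤ) - 3) * (1 + 2 * y) ≤ 3 * (q - 3) * (j + 4) :=
      mul_le_mul_of_nonneg_left (by linarith) (by linarith)
    have h6 : (q : ℤ) * (3 * (j + 2) - 2) ≤ q * P :=
      mul_le_mul_of_nonneg_left (by linarith) (by linarith)
    have h7 : (0 : ℤ) ≤ (q - 4) * (q - 5) := by
      rcases h3 with h3 | h3
      · rw [h3]; norm_num
      · have : (8 : ℤ) ≤ q := by exact_mod_cast h3
        exact mul_nonneg (by linarith) (by linarith)
    nlinarith
  · have hA : levelExp a (j + 1) = j + 1 := by rw [levelExp, if_pos h2]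
    have hB : levelExp a (j + 2) = j + 2 := by rw [levelExp, if_pos h2]
    have hC : (12 : ℤ) * (j + 2) ≤ p ^ (j + 2) + 4 := by
      have h5 := twelve_mul_le_five_pow j
      have h6 : 5 ^ (j + 2) ≤ p ^ (j + 2) := Nat.pow_le_pow_left h4 _
      exact_mod_cast h5.trans (by omega)
    rw [if_neg h, hA, hB, h3, Nat.cast_sub hp.one_le]
    push_cast
    generalize (p : ℤ) ^ (j + 2) = P at *
    have h5 : (5 : ℤ) ≤ p := by exact_mod_cast h4
    have h6 : (p : ℤ) * (12 * (j + 2) - 4) ≤ p * P :=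
      mul_le_mul_of_nonneg_left (by linarith) (by linarith)
    nlinarith
  · have hA := hi1 (by omega)
    have hB := hi2 (by omega)
    have hC : (4 : ℤ) * (j + 2) + 1 ≤ p ^ (j + 2) := by
      have h5 := four_mul_le_three_pow j
      have h6 : 3 ^ (j + 2) ≤ p ^ (j + 2) := Nat.pow_le_pow_left h3 _
      exact_mod_cast h5.trans (by omega)
    rw [if_neg h, Nat.cast_sub (by omega)]
    push_cast
    generalize (p : ℤ) ^ (j + 2) = P at *
    generalize (levelExp a (j + 1) : ℤ) = x at *
    generalize (levelExp a (j + 2) : ℤ) = y at *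
    have h5 : (3 : ℤ) ≤ p := by exact_mod_cast h3
    have h6 : 3 * (p : ℤ) ≤ q := by exact_mod_cast h4
    have h7 : 3 * ((q : ℤ) - 3) * (1 + 2 * y) ≤ 3 * (q - 3) * (j + 4) :=
      mul_le_mul_of_nonneg_left (by linarith) (by linarith)
    have h8 : (q : ℤ) * (4 * (j + 2) + 1) ≤ q * P :=
      mul_le_mul_of_nonneg_left hC (by linarith)
    have h9 : 3 * (p : ℤ) * (1 + 2 * x) ≤ 3 * p * (j + 3) :=
      mul_le_mul_of_nonneg_left (by linarith) (by linarith)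
    have h10 : 3 * (p : ℤ) * (j + 3) ≤ q * (j + 3) :=
      mul_le_mul_of_nonneg_right h6 (by positivity)
    have h11 : (0 : ℤ) ≤ (q - 9) * q := mul_nonneg (by linarith) (by linarith)
    nlinarith

theorem exists_stage (hp : p.Prime) (ha : 0 < a) (hqa : q = p ^ a) (hq4 : 4 ≤ q)
    (hsmall : q = 4 → 18 ≤ n) :
    2 * n + (if p = 2 then 0 else q - 1) ≤ q * (q - 1) ∨
    ∃ i j : ℕ, p ^ j ≤ q ^ i ∧ (p = 2 → 4 * (a + j) ≤ a * n) ∧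
      2 * n + q * p ^ j + 3 * (1 + 2 * i) + (if p = 2 then 0 else q - 1) ≤
        (q - 1) * (q * p ^ j) + q ∧
      ((q : ℤ) * p ^ j - q + 3 * (1 + 2 * i)) * (q - 3) ≤ 2 * n * p := by
  obtain ⟨δ, hδ⟩ : ∃ δ, δ = if p = 2 then 0 else q - 1 := ⟨_, rfl⟩
  have hδq : δ ≤ q - 1 := by rw [hδ]; split_ifs <;> omega
  by_cases h0 : 2 * n + δ ≤ q * (q - 1)
  · exact Or.inl (hδ ▸ h0)
  right
  push Not at h0
  have hq4' : (4 : ℤ) ≤ q := by exact_mod_cast hq4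
  have hq1 : ((q - 1 : ℕ) : ℤ) = q - 1 := by omega
  let R : ℕ → Prop := fun j => 2 * n + q * p ^ (j + 1) + 3 * (1 + 2 * levelExp a (j + 1)) + δ ≤
    (q - 1) * (q * p ^ (j + 1)) + q
  have hR : ∃ j, R j := by
    refine ⟨n, ?_⟩
    have h1 : n + 1 < p ^ (n + 1) := Nat.lt_pow_self hp.one_lt
    have h2 : levelExp a (n + 1) ≤ n + 1 := by rw [levelExp]; split_ifs <;> omega
    change _ ≤ _
    generalize p ^ (n + 1) = P at *
    obtain ⟨k, rfl⟩ := Nat.exists_eq_add_of_le' hq4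
    rw [show k + 4 - 1 = k + 3 by omega] at *
    nlinarith [Nat.zero_le (k * P), Nat.zero_le (k * k * P)]
  classical
  obtain ⟨j, hj, hmin⟩ : ∃ j, R j ∧ ∀ i < j, ¬ R i :=
    ⟨Nat.find hR, Nat.find_spec hR, fun i hi => Nat.find_min hR hi⟩
  have hp2' : p = 2 → 2 ≤ a ∧ (q = 4 ∨ 8 ≤ q) := fun h => by
    rcases cases_of_four_le hp ha hqa hq4 with ⟨_, h2, h3⟩ | ⟨h', _⟩ | ⟨h', _⟩
    · exact ⟨h2, h3⟩
    · exact absurd h h'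
    · exact absurd h h'
  refine ⟨levelExp a (j + 1), j + 1, pow_le_pow_levelExp hp ha hqa _, fun h => ?_, hδ ▸ hj, ?_⟩
  · obtain ⟨ha2, hq48⟩ := hp2' h
    suffices hn : 4 + 2 * (j + 1) ≤ n by
      have h1 : a * (4 + 2 * (j + 1)) ≤ a * n := Nat.mul_le_mul_left _ hn
      have h2 : 2 * (j + 1) ≤ a * (j + 1) := Nat.mul_le_mul_right _ ha2
      linarith
    rw [if_pos h] at hδ
    rcases j with _ | j
    · rcases hq48 with h4 | h8
      · have := hsmall h4; omega
      · have : 8 * 7 ≤ q * (q - 1) := Nat.mul_le_mul h8 (by omega)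
        omega
    · have h1 := hmin j (by omega)
      have h2 : 2 * levelExp a (j + 1) ≤ j + 2 := by rw [levelExp, if_neg (by omega)]; omega
      have h3 : j + 2 ≤ p ^ (j + 1) := by rw [h]; exact Nat.lt_two_pow_self
      simp only [R, not_le] at h1
      generalize p ^ (j + 1) = P at *
      rcases hq48 with h4 | h8
      · have := hsmall h4
        subst h4
        omega
      · have h4 : 7 * (q * P) ≤ (q - 1) * (q * P) := Nat.mul_le_mul_right _ (by omega)
        have h5 : 8 * P ≤ q * P := Nat.mul_le_mul_right _ h8
        omega
  · have hp2 : (2 : ℤ) ≤ p := by exact_mod_cast hp.two_le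
    rcases j with _ | j
    · have hi : levelExp a 1 = 1 := by rw [levelExp]; split_ifs <;> rfl
      have h1 : ((q : ℤ) * (q - 1) + 1 - δ) * p ≤ 2 * n * p := by
        refine mul_le_mul_of_nonneg_right ?_ (by linarith)
        zify [hq1] at h0
        linarith
      have h2 : (p : ℤ) * δ ≤ p * (q - 1) := mul_le_mul_of_nonneg_left (by omega) (by linarith)
      rw [zero_add, hi]
      push_cast
      nlinarith [sq_nonneg ((q : ℤ) - 6)]
    · have h1 := hmin j (by omega)
      have h2 := stage_inequality hp ha hqa hq4 j
      rw [← hδ] at h2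
      simp only [R, not_le] at h1
      zify at h1
      rw [hq1] at h1
      have h4 : (p : ℤ) ^ (j + 2) = p * p ^ (j + 1) := by ring
      rw [show j + 1 + 1 = j + 2 from rfl, h4]
      rw [h4] at h2
      generalize (p : ℤ) ^ (j + 1) = P at *
      have h5 := mul_le_mul_of_nonneg_left (Int.add_one_le_of_lt h1) (show (0 : ℤ) ≤ p by linarith)
      linarith

end

/-- Let `p` be a prime and `q = p^a ≥ 4` a prime power. Then for every
positive integer `n`, the bilinear complexity of multiplication in `F_{q^n}` over `F_q`
satisfies `μ_q(n) ≤ 3(1 + p/(q-3))·n`: there are `r ≤ 3(1 + p/(q-3))n`, `F_q`-linear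
forms `a₁,…,a_r, b₁,…,b_r` on `F_{q^n}` and elements `c₁,…,c_r ∈ F_{q^n}` with
`x·y = ∑ l, a_l(x) b_l(y) c_l` for all `x, y`. -/
theorem stmt_13
    (p a : ℕ) (hp : p.Prime) (ha : 0 < a) (q : ℕ) (hq : q = p ^ a) (hq4 : 4 ≤ q)
    (n : ℕ) (hn : 0 < n)
    (Fq Fqn : Type) [Field Fq] [Fintype Fq] [Field Fqn] [Algebra Fq Fqn]
    (hcard : Fintype.card Fq = q) (hdeg : Module.finrank Fq Fqn = n) :
    ∃ r : ℕ, (r : ℝ) ≤ 3 * (1 + (p : ℝ) / ((q : ℝ) - 3)) * (n : ℝ) ∧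
      ∃ (A B : Fin r → (Fqn →ₗ[Fq] Fq)) (c : Fin r → Fqn),
        ∀ x y : Fqn, x * y = ∑ l, (A l x * B l y) • c l := by
  change ∃ r : ℕ, _ ∧ HasRank Fq Fqn r
  have : Fact p.Prime := ⟨hp⟩
  have : CharP Fq p := charP_of_card_eq_prime_pow (hcard.trans hq)
  have : Module.Finite Fq Fqn := Module.finite_of_finrank_pos (hdeg ▸ hn)
  have hq4' : (4 : ℝ) ≤ q := by exact_mod_cast hq4
  have hn' : (1 : ℝ) ≤ n := by exact_mod_cast hn
  have hd : (0 : ℝ) < q - 3 := by linarith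
  have hpq : (0 : ℝ) ≤ p / (q - 3) := by positivity
  have hnp : (0 : ℝ) ≤ p / (q - 3) * n := by positivity
  by_cases hsmall : 2 ≤ n ∧ (q = 4 → 18 ≤ n)
  · obtain ⟨hn2, h18⟩ := hsmall
    obtain ⟨h₀, h₁⟩ := hasRank_tower hcard hq4 hq hdeg hn2
    rcases exists_stage hp ha hq hq4 h18 with h | ⟨i, j, hi, hj, hR, hb⟩
    · refine ⟨3 * n, ?_, h₀ h⟩
      push_cast
      linarith
    · refine ⟨_, ?_, h₁ i j hi hj hR⟩
      set s := (q * p ^ j - q + 3 * (1 + 2 * i)) / 2 with hs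
      suffices h : (s : ℝ) ≤ p / (q - 3) * n by
        push_cast
        linarith
      rw [div_mul_eq_mul_div, le_div_iff₀ hd]
      have hM : q ≤ q * p ^ j := Nat.le_mul_of_pos_right _ (pow_pos hp.pos _)
      have hs2 : 2 * (s : ℤ) ≤ (q : ℤ) * p ^ j - q + 3 * (1 + 2 * i) := by
        have h := Nat.mul_div_le (q * p ^ j - q + 3 * (1 + 2 * i)) 2
        rw [← hs] at h
        zify [hM] at h
        exact h
      have hle : 2 * (s : ℤ) * (q - 3) ≤ 2 * n * p :=
        (mul_le_mul_of_nonneg_right hs2 (by omega)).trans hb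
      have hle' : 2 * (s : ℝ) * (q - 3) ≤ 2 * n * p := by exact_mod_cast hle
      linarith
  · refine ⟨_, ?_, hdeg ▸ HasRank.karatsuba (K := Fq) (L := Fqn)⟩
    rcases (show n = 1 ∨ q = 4 ∧ n ≤ 17 by omega) with rfl | ⟨h4, h17⟩
    · norm_num
      linarith
    · have hp2 : (2 : ℝ) ≤ p := by exact_mod_cast hp.two_le
      have hle : n * (n + 1) / 2 ≤ 9 * n := by
        have : n * (n + 1) ≤ n * 18 := Nat.mul_le_mul_left _ (by omega)
        omega
      have hle' : ((n * (n + 1) / 2 : ℕ) : ℝ) ≤ 9 * n := by exact_mod_cast hle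
      refine hle'.trans (mul_le_mul_of_nonneg_right ?_ (by positivity))
      rw [h4]
      norm_num
      linarith
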